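/- As L → ∞, the diagonal sum (2/(πL)²)·Σ_{n>2} A(n)²·g(log N(n)/(2πL))² is asymptotic to σ_L² = (2κ/(πL))·∫₀^∞ g(u)²·e^{πLu} du; that is, the ratio of the two quantities tends to 1. -/

import Mathlib

open MeasureTheory Filter

/-- `N(n) = ((n + √(n²−4))/2)²`, the norm of a hyperbolic class of trace `n`. -/
noncomputable def Nnorm (n : ℕ) : ℝ := (((n : ℝ) + Real.sqrt ((n : ℝ) ^ 2 - 4)) / 2) ^ 2
/-- Value of the integral binary quadratic form `(a,b,c)` at `(x,y)`. -/
def formVal (f : ℤ × ℤ × ℤ) (x y : ℤ) : ℤ := f.1 * x ^ 2 + f.2.1 * x * y + f.2.2 * y ^ 2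

/-- A form `ax² + bxy + cy²` is primitive if `gcd(a,b,c) = 1`. -/
def IsPrimitiveForm (f : ℤ × ℤ × ℤ) : Prop := Int.gcd f.1 (Int.gcd f.2.1 f.2.2) = 1

/-- Discriminant `b² − 4ac` of the form `(a,b,c)`. -/
def formDisc (f : ℤ × ℤ × ℤ) : ℤ := f.2.1 ^ 2 - 4 * f.1 * f.2.2

/-- `SL(2,ℤ)`-equivalence of binary quadratic forms:
`Q'(x,y) = Q(αx + βy, γx + δy)` for some `[[α,β],[γ,δ]] ∈ SL(2,ℤ)`. -/
def formEquiv (f g : ℤ × ℤ × ℤ) : Prop :=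
  ∃ M : Matrix.SpecialLinearGroup (Fin 2) ℤ,
    ∀ x y : ℤ, formVal g x y =
      formVal f (M.1 0 0 * x + M.1 0 1 * y) (M.1 1 0 * x + M.1 1 1 * y)

/-- The class number `h(d)`: the number of `SL(2,ℤ)`-equivalence classes of
primitive integral binary quadratic forms of discriminant `d`. -/
noncomputable def classNumber (d : ℤ) : ℕ :=
  Nat.card (Quot (fun f g : {f : ℤ × ℤ × ℤ // IsPrimitiveForm f ∧ formDisc f = d} =>
    formEquiv f.1 g.1))
/-- `t_d`: the least `t ≥ 1` such that `t² − d u² = 4` has a solution with `u ≥ 1`. -/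
noncomputable def td (d : ℤ) : ℕ :=
  sInf {t : ℕ | 0 < t ∧ ∃ u : ℕ, 0 < u ∧ (t : ℤ) ^ 2 - d * (u : ℤ) ^ 2 = 4}

/-- `u_d`: the positive `u` corresponding to `t_d`. -/
noncomputable def ud (d : ℤ) : ℕ :=
  sInf {u : ℕ | 0 < u ∧ (td d : ℤ) ^ 2 - d * (u : ℤ) ^ 2 = 4}

/-- `ε_d = (t_d + u_d √d)/2`, the fundamental solution of `t² − d u² = 4`. -/
noncomputable def eps (d : ℤ) : ℝ := ((td d : ℝ) + (ud d : ℝ) * Real.sqrt (d : ℝ)) / 2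
/-- `A(n) = Σ h(d)·log(ε_d)/(u·√d)`, summed over pairs `(d,u)` of positive integers with
`d ≡ 0, 1 (mod 4)` and `d·u² = n² − 4`. -/
noncomputable def ampA (n : ℕ) : ℝ :=
  ∑ p ∈ (Finset.range (n ^ 2) ×ˢ Finset.range (n ^ 2)).filter
      (fun p => 0 < p.1 ∧ 0 < p.2 ∧ (p.1 % 4 = 0 ∨ p.1 % 4 = 1) ∧ p.1 * p.2 ^ 2 = n ^ 2 - 4),
    (classNumber (p.1 : ℤ) : ℝ) * Real.log (eps (p.1 : ℤ)) /
      ((p.2 : ℝ) * Real.sqrt (p.1 : ℝ))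
/-- `κ = (1015/864)·∏_{p ≠ 2 prime} (1 + (p⁴ − 2p³ + 1)/(p² − 1)³)`. -/
noncomputable def kappa : ℝ :=
  (1015 / 864) * ∏' p : {p : ℕ // p.Prime ∧ p ≠ 2},
    (1 + ((p.1 : ℝ) ^ 4 - 2 * (p.1 : ℝ) ^ 3 + 1) / ((p.1 : ℝ) ^ 2 - 1) ^ 3)
/-- `σ_L² = (2κ/(πL))·∫₀^∞ g(u)²·e^{πLu} du`. -/
noncomputable def sigmaSq (g : ℝ → ℝ) (L : ℝ) : ℝ :=
  (2 * kappa / (Real.pi * L)) * ∫ u in Set.Ioi (0 : ℝ), g u ^ 2 * Real.exp (Real.pi * L * u)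

section P1

open scoped NumberTheorySymbols

/-- Jacobi symbol restricted to odd moduli. -/
noncomputable def psi (a : ℤ) (q : ℕ) : ℝ := if Odd q then (jacobiSym a q : ℝ) else 0

lemma psi_abs_le (a : ℤ) (q : ℕ) : |psi a q| ≤ 1 := by
  unfold psi
  split_ifs
  · rcases jacobiSym.trichotomy a q with h | h | h <;> simp [h]
  · simp

lemma psi_one (a : ℤ) : psi a 1 = 1 := by simp [psi]

lemma psi_even (a : ℤ) {q : ℕ} (h : ¬ Odd q) : psi a q = 0 := by simp [psi, h]

lemma psi_odd (a : ℤ) {q : ℕ} (h : Odd q) : psi a q = (jacobiSym a q : ℝ) := by simp [psi, h]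

lemma psi_mul_right (a : ℤ) (q r : ℕ) : psi a (q * r) = psi a q * psi a r := by
  unfold psi
  by_cases hq : Odd q <;> by_cases hr : Odd r <;> simp [hq, hr, Nat.odd_mul]
  have : q ≠ 0 := by rintro rfl; simp at hq
  have : r ≠ 0 := by rintro rfl; simp at hr
  rw [jacobiSym.mul_right' a ‹_› ‹_›]; push_cast; rfl

lemma psi_mul_left (a b : ℤ) (q : ℕ) : psi (a * b) q = psi a q * psi b q := by
  unfold psi
  split_ifs
  · rw [jacobiSym.mul_left]; push_cast; rfl
  · simp

lemma psi_congr {a b : ℤ} {q : ℕ} (h : (q : ℤ) ∣ a - b) : psi a q = psi b q := by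
  unfold psi
  have : a % q = b % q := (Int.emod_eq_emod_iff_emod_sub_eq_zero.mpr (Int.emod_eq_zero_of_dvd h))
  rw [jacobiSym.mod_left' this]

lemma psi_periodic (a : ℤ) (q : ℕ) : psi a (4 * a.natAbs + q) = psi a q := by
  unfold psi
  have h1 : Odd (4 * a.natAbs + q) ↔ Odd q := by
    simp only [Nat.odd_iff]; omega
  by_cases h : Odd q
  · rw [if_pos (h1.2 h), if_pos h, jacobiSym.mod_right a (h1.2 h), jacobiSym.mod_right a h]
    simp
  · rw [if_neg (fun h' => h (h1.1 h')), if_neg h]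

lemma psi_zero_right (a : ℤ) : psi a 0 = 0 := by simp [psi]

lemma psi_eq_zero_of_not_coprime {a : ℤ} {q : ℕ} (h : a.gcd q ≠ 1) : psi a q = 0 := by
  unfold psi
  split_ifs with ho
  · have : NeZero q := ⟨by rintro rfl; simp at ho⟩
    rw [jacobiSym.eq_zero_iff_not_coprime.2 h]; simp
  · rfl

lemma psi_sq_of_coprime {a : ℤ} {q : ℕ} (ho : Odd q) (h : a.gcd q = 1) : psi a q ^ 2 = 1 := by
  rw [psi_odd a ho]
  exact_mod_cast jacobiSym.sq_one h

lemma psi_sq_mul {u a : ℤ} {q : ℕ} (h : u.gcd q = 1) : psi (u ^ 2 * a) q = psi a q := by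
  rw [psi_mul_left, sq, psi_mul_left]
  by_cases ho : Odd q
  · have := psi_sq_of_coprime ho h
    rw [← sq, this, one_mul]
  · simp [psi_even _ ho]

lemma exists_odd_val {a : ℕ} (ha : a ≠ 0) (hs : ¬ IsSquare a) :
    ∃ p i m : ℕ, p.Prime ∧ Odd i ∧ ¬ p ∣ m ∧ a = p ^ i * m := by
  by_contra! hcon
  apply hs
  have hev : ∀ p, p.Prime → Even (a.factorization p) := by
    intro p hp
    by_contra ho
    rw [Nat.not_even_iff_odd] at ho
    exact hcon p (a.factorization p) (a / p ^ a.factorization p) hp ho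
      (Nat.not_dvd_ordCompl hp ha) (Nat.ordProj_mul_ordCompl_eq_self a p).symm
  refine ⟨∏ p ∈ a.factorization.support, p ^ (a.factorization p / 2), ?_⟩
  rw [← Finset.prod_mul_distrib]
  conv_lhs => rw [← Nat.prod_factorization_pow_eq_self ha]
  refine Finset.prod_congr rfl fun p hp => ?_
  have hpp := Nat.prime_of_mem_primeFactors (by simpa using hp)
  obtain ⟨k, hk⟩ := hev p hpp
  rw [← pow_add]; congr 1; omega

lemma exists_jacobi_neg {a : ℕ} (ha : a ≠ 0) (hs : ¬ IsSquare a) :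
    ∃ b : ℕ, Odd b ∧ jacobiSym a b = -1 := by
  obtain ⟨p, i, m, hp, hi, hpm, rfl⟩ := exists_odd_val ha hs
  have hm : m ≠ 0 := by rintro rfl; simp at hpm
  have hcop : Nat.Coprime p m := (Nat.Prime.coprime_iff_not_dvd hp).2 hpm
  rcases hp.eq_two_or_odd' with rfl | hpo
  · have hmo : Odd m := by rw [← Nat.not_even_iff_odd]; exact fun h => hpm h.two_dvd
    have hc8 : Nat.Coprime 8 m := by
      have := Nat.Coprime.pow_left 3 hcop; simpa using this
    obtain ⟨q, hq8, hqm⟩ := Nat.chineseRemainder hc8 5 1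
    have hq8' : q % 8 = 5 := hq8
    have hqo : Odd q := by rw [Nat.odd_iff]; omega
    refine ⟨q, hqo, ?_⟩
    push_cast
    rw [jacobiSym.mul_left, jacobiSym.pow_left]
    have h2 : jacobiSym 2 q = -1 := by
      rw [jacobiSym.at_two hqo, ZMod.χ₈_nat_eq_if_mod_eight]; simp [hq8']; omega
    have h3 : jacobiSym m q = 1 := by
      have := jacobiSym.quadratic_reciprocity_one_mod_four' hmo (b := q) (by omega)
      rw [this, jacobiSym.mod_left' (a₂ := 1)]
      · simp
      · have := hqm; unfold Nat.ModEq at this; exact_mod_cast this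
    rw [h2, h3, hi.neg_one_pow]; simp
  · have := Fact.mk hp
    have hp2 : ringChar (ZMod p) ≠ 2 := by
      rw [ZMod.ringChar_zmod_n]; rintro rfl; revert hpo; decide
    obtain ⟨r, hr⟩ := quadraticChar_exists_neg_one hp2
    have hc : Nat.Coprime (4 * m) p := by
      apply Nat.Coprime.mul_left
      · have : Nat.Coprime 2 p := by
          rw [Nat.coprime_comm]; exact (Nat.coprime_two_right.2 hpo)
        have := Nat.Coprime.pow_left 2 this; simpa using this
      · exact hcop.symm
    obtain ⟨q, hq4, hqp⟩ := Nat.chineseRemainder hc 1 r.val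
    have hq4' : q % 4 = 1 := by
      have := Nat.ModEq.of_mul_right m hq4
      exact this
    have hqo : Odd q := by rw [Nat.odd_iff]; omega
    refine ⟨q, hqo, ?_⟩
    push_cast
    rw [jacobiSym.mul_left, jacobiSym.pow_left]
    have h3 : jacobiSym m q = 1 := by
      rw [jacobiSym.mod_right _ hqo]
      have : q % (4 * (m : ℤ).natAbs) = 1 := by
        have := hq4; unfold Nat.ModEq at this
        simp only [Int.natAbs_natCast]; rw [this]; apply Nat.mod_eq_of_lt; omega
      rw [this]; simp
    have h2 : jacobiSym p q = -1 := by
      rw [jacobiSym.quadratic_reciprocity_one_mod_four' hpo hq4']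
      rw [← jacobiSym.legendreSym.to_jacobiSym]
      unfold legendreSym
      have : ((q : ℤ) : ZMod p) = r := by
        have := (ZMod.natCast_eq_natCast_iff _ _ _).2 hqp
        push_cast; rw [this]; simp
      rw [this, hr]
    rw [h2, h3, hi.neg_one_pow]; simp

lemma psi_sum_period {a : ℕ} (ha : a ≠ 0) (hs : ¬ IsSquare a) :
    ∑ q ∈ Finset.range (4 * a), psi a q = 0 := by
  obtain ⟨b, hbo, hb⟩ := exists_jacobi_neg ha hs
  set N := 4 * a with hN
  have : NeZero N := ⟨by omega⟩
  have hmod : ∀ q, psi a (q % N) = psi a q := by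
    intro q
    have hper : Function.Periodic (psi a) N := by
      intro x; rw [add_comm]; have := psi_periodic a x; simpa using this
    exact hper.map_mod_nat q
  have hsum : ∑ q ∈ Finset.range N, psi a q = ∑ x : ZMod N, psi a x.val := by
    refine Finset.sum_bij' (fun q _ => (q : ZMod N)) (fun x _ => x.val) ?_ ?_ ?_ ?_ ?_
    · simp
    · intro x _; simp [ZMod.val_lt]
    · intro q hq; simp at hq; simp [ZMod.val_natCast, Nat.mod_eq_of_lt hq]
    · intro x _; simp
    · intro q hq; simp at hq; simp [ZMod.val_natCast, Nat.mod_eq_of_lt hq]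
  have hcop : Nat.Coprime b N := by
    apply Nat.Coprime.mul_right
    · have : Nat.Coprime b 2 := Nat.coprime_two_right.2 hbo
      have := Nat.Coprime.pow_right 2 this; simpa using this
    · by_contra h
      have : NeZero b := ⟨by rintro rfl; simp at hbo⟩
      have := (jacobiSym.eq_zero_iff_not_coprime (a := a) (b := b)).2 (by
        rw [Int.gcd_natCast_natCast, Nat.gcd_comm]; exact h)
      omega
  let u : (ZMod N)ˣ := ZMod.unitOfCoprime b hcop
  have h2 : ∑ x : ZMod N, psi a x.val = ∑ x : ZMod N, psi a (((u : ZMod N) * x).val) :=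
    (Equiv.sum_comp (Units.mulLeft u) (fun x => psi a x.val)).symm
  have h3 : ∀ x : ZMod N, psi a (((u : ZMod N) * x).val) = - psi a x.val := by
    intro x
    have : (u : ZMod N) = (b : ZMod N) := ZMod.coe_unitOfCoprime b hcop
    rw [this, ZMod.val_mul, hmod, psi_mul_right, ZMod.val_natCast, hmod, psi_odd _ hbo, hb]
    simp
  rw [hsum]
  simp only [h3, Finset.sum_neg_distrib] at h2
  linarith

lemma psi_sum_bound {a : ℕ} (ha : a ≠ 0) (hs : ¬ IsSquare a) (M : ℕ) :
    |∑ q ∈ Finset.range M, psi a q| ≤ 4 * a := by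
  induction M using Nat.strong_induction_on with
  | _ M ih =>
    by_cases h : M < 4 * a
    · calc |∑ q ∈ Finset.range M, psi a q| ≤ ∑ q ∈ Finset.range M, |psi a q| :=
            Finset.abs_sum_le_sum_abs _ _
        _ ≤ ∑ q ∈ Finset.range M, 1 := Finset.sum_le_sum fun q _ => psi_abs_le _ _
        _ = M := by simp
        _ ≤ 4 * a := by exact_mod_cast h.le
    · push Not at h
      obtain ⟨k, rfl⟩ := Nat.exists_eq_add_of_le h
      rw [Finset.sum_range_add, psi_sum_period ha hs, zero_add]
      have : ∀ x, psi a (4 * a + x) = psi a x := fun x => by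
        have := psi_periodic a x; simpa using this
      simp only [this]
      exact ih k (by omega)

end P1

section P2a

/-- partial sums -/
noncomputable def Spsi (a : ℤ) (w : ℕ) : ℝ := ∑ q ∈ Finset.range (w + 1), psi a q

/-- value at 1 of the L function -/
noncomputable def Lval (a : ℤ) : ℝ := ∑' w : ℕ, Spsi a w / (w * (w + 1))

lemma Spsi_succ (a : ℤ) (w : ℕ) : Spsi a (w + 1) = Spsi a w + psi a (w + 1) := by
  unfold Spsi; rw [Finset.sum_range_succ]

lemma Spsi_zero (a : ℤ) : Spsi a 0 = 0 := by simp [Spsi, psi_zero_right]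

lemma psi_abel (a : ℤ) (y : ℕ) : ∑ q ∈ Finset.range (y + 1), psi a q / q =
    Spsi a y / (y + 1) + ∑ w ∈ Finset.range (y + 1), Spsi a w / (w * (w + 1)) := by
  induction y with
  | zero => simp [Spsi_zero]
  | succ y ih =>
    rw [Finset.sum_range_succ, ih, Finset.sum_range_succ _ (y + 1), Spsi_succ]
    push_cast
    field_simp
    ring

lemma Spsi_trivial (a : ℤ) (w : ℕ) : |Spsi a w| ≤ w := by
  induction w with
  | zero => simp [Spsi_zero]
  | succ w ih =>
    rw [Spsi_succ]; push_cast
    exact (abs_add_le _ _).trans (add_le_add ih (psi_abs_le _ _))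

lemma hasSum_tele (y : ℕ) : HasSum (fun w : ℕ => (1 : ℝ) / ((w + y + 1 : ℝ) * (w + y + 2))) (1 / (y + 1)) := by
  have h : ∀ n : ℕ, ∑ w ∈ Finset.range n, (1 : ℝ) / ((w + y + 1 : ℝ) * (w + y + 2)) = 1 / (y + 1) - 1 / (n + y + 1) := by
    intro n
    induction n with
    | zero => simp
    | succ n ih =>
      rw [Finset.sum_range_succ, ih]
      have : (n : ℝ) + y + 1 ≠ 0 := by positivity
      have : (n : ℝ) + y + 2 ≠ 0 := by positivity
      have : (n : ℝ) + 1 + y + 1 ≠ 0 := by positivity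
      push_cast
      field_simp
      ring
  rw [hasSum_iff_tendsto_nat_of_nonneg]
  · simp_rw [h]
    have : Tendsto (fun n : ℕ => (1 : ℝ) / (n + y + 1)) atTop (nhds 0) := by
      have := (tendsto_one_div_add_atTop_nhds_zero_nat (𝕜 := ℝ)).comp (tendsto_add_atTop_nat y)
      refine this.congr fun n => ?_
      simp [Function.comp]
    simpa using tendsto_const_nhds.sub this
  · intro i; positivity

lemma Lval_summable {a : ℤ} {B : ℝ} (hB : ∀ w, |Spsi a w| ≤ B) :
    Summable (fun w : ℕ => Spsi a w / ((w : ℝ) * (w + 1))) := by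
  rw [← summable_nat_add_iff 1]
  refine Summable.of_norm_bounded (g := fun w : ℕ => B * (1 / ((w + (0 : ℕ) + 1 : ℝ) * (w + (0 : ℕ) + 2))))
    ((hasSum_tele 0).summable.mul_left B) ?_
  intro w
  rw [Real.norm_eq_abs, abs_div]
  have : |((w + 1 : ℕ) : ℝ) * ((w + 1 : ℕ) + 1)| = (w + (0 : ℕ) + 1 : ℝ) * (w + (0 : ℕ) + 2) := by
    rw [abs_of_nonneg (by positivity)]; push_cast; ring
  rw [this, mul_one_div]
  gcongr
  exact hB _

lemma Lval_tail {a : ℤ} {B : ℝ} (hB : ∀ w, |Spsi a w| ≤ B) (Z : ℕ) :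
    |Lval a - ∑ w ∈ Finset.range (Z + 1), Spsi a w / (w * (w + 1))| ≤ B / (Z + 1) := by
  have hs := Lval_summable hB
  have h1 := hs.sum_add_tsum_nat_add (Z + 1)
  unfold Lval
  rw [← h1, add_sub_cancel_left]
  have h2 := (hasSum_tele Z).mul_left B
  rw [mul_one_div] at h2
  have := tsum_of_norm_bounded h2 (f := fun i : ℕ => Spsi a (i + (Z + 1)) / (((i + (Z + 1) : ℕ) : ℝ) * ((i + (Z + 1) : ℕ) + 1))) ?_
  · simpa using this
  intro w
  rw [Real.norm_eq_abs, abs_div]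
  have : |((w + (Z + 1) : ℕ) : ℝ) * ((w + (Z + 1) : ℕ) + 1)| = (w + Z + 1 : ℝ) * (w + Z + 2) := by
    rw [abs_of_nonneg (by positivity)]; push_cast; ring
  rw [this, mul_one_div]
  gcongr
  exact hB _

lemma Lval_approx {a : ℤ} {B : ℝ} (hB : ∀ w, |Spsi a w| ≤ B) (y : ℕ) :
    |Lval a - ∑ q ∈ Finset.range (y + 1), psi a q / q| ≤ 2 * B / (y + 1) := by
  have h1 := Lval_tail hB y
  rw [psi_abel]
  have h2 : |Spsi a y / (y + 1)| ≤ B / (y + 1) := by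
    rw [abs_div, abs_of_nonneg (by positivity : (0 : ℝ) ≤ (y : ℝ) + 1)]
    gcongr; exact hB _
  have : Lval a - (Spsi a y / (y + 1) + ∑ w ∈ Finset.range (y + 1), Spsi a w / (w * (w + 1)))
    = (Lval a - ∑ w ∈ Finset.range (y + 1), Spsi a w / (w * (w + 1))) - Spsi a y / (y + 1) := by ring
  rw [this]
  calc _ ≤ _ := abs_sub _ _
    _ ≤ B / (y + 1) + B / (y + 1) := add_le_add h1 h2
    _ = _ := by ring

lemma Spsi_bound {a : ℕ} (ha : a ≠ 0) (hs : ¬ IsSquare a) (w : ℕ) : |Spsi a w| ≤ 4 * a :=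
  psi_sum_bound ha hs (w + 1)

end P2a

section P2b

lemma sum_Ioc_eq_range (F : ℕ → ℝ) (h0 : F 0 = 0) (y : ℕ) :
    ∑ e ∈ Finset.Ioc 0 y, F e = ∑ e ∈ Finset.range (y + 1), F e := by
  induction y with
  | zero => simp [h0]
  | succ y ih => rw [Finset.sum_Ioc_succ_top (by omega), ih, Finset.sum_range_succ _ (y + 1)]

lemma periodic_sum_approx {F : ℕ → ℝ} {W : ℕ} (hW : 0 < W) (hF : Function.Periodic F W) {B : ℝ}
    (hB : ∀ n, |F n| ≤ B) (x : ℕ) :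
    |∑ n ∈ Finset.range x, F n - (x : ℝ) / W * ∑ n ∈ Finset.range W, F n| ≤ 2 * W * B := by
  have hB0 : 0 ≤ B := (abs_nonneg _).trans (hB 0)
  have hWr : (0 : ℝ) < W := by exact_mod_cast hW
  have htriv : ∀ y, |∑ n ∈ Finset.range y, F n| ≤ y * B := fun y =>
    (Finset.abs_sum_le_sum_abs _ _).trans ((Finset.sum_le_sum fun n _ => hB n).trans (by simp))
  induction x using Nat.strong_induction_on with
  | _ x ih =>
    by_cases h : x < W
    · have hx : (x : ℝ) ≤ W := by exact_mod_cast h.le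
      calc _ ≤ |∑ n ∈ Finset.range x, F n| + |(x : ℝ) / W * ∑ n ∈ Finset.range W, F n| := abs_sub _ _
        _ ≤ x * B + (x : ℝ) / W * (W * B) := by
          rw [abs_mul, abs_of_nonneg (by positivity : (0:ℝ) ≤ (x : ℝ) / W)]
          gcongr
          · exact htriv x
          · exact htriv W
        _ = 2 * x * B := by field_simp; ring
        _ ≤ _ := by gcongr
    · push Not at h
      obtain ⟨k, rfl⟩ := Nat.exists_eq_add_of_le h
      rw [Finset.sum_range_add]
      have : ∀ n, F (W + n) = F n := fun n => by rw [add_comm]; exact hF n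
      simp only [this]
      have := ih k (by omega)
      convert this using 2
      push_cast
      field_simp
      ring

open ArithmeticFunction

/-- `psi` as an arithmetic function. -/
noncomputable def fpsi (d : ℤ) : ArithmeticFunction ℝ := ⟨psi d, psi_zero_right d⟩

/-- coprimality indicator -/
noncomputable def fcop (N : ℕ) : ArithmeticFunction ℝ :=
  ⟨fun e => if e ≠ 0 ∧ Nat.Coprime e N then 1 else 0, by simp⟩

lemma fcop_apply (N e : ℕ) : fcop N e = if e ≠ 0 ∧ Nat.Coprime e N then 1 else 0 := rfl

lemma fpsi_apply (d : ℤ) (q : ℕ) : fpsi d q = psi d q := rfl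

lemma hyperbola (f g : ArithmeticFunction ℝ) (K : ℕ) :
    ∑ n ∈ Finset.Ioc 0 (K ^ 2), (f * g) n =
      ∑ q ∈ Finset.Ioc 0 K, f q * ∑ e ∈ Finset.Ioc 0 (K ^ 2 / q), g e +
      ∑ e ∈ Finset.Ioc 0 K, g e * (∑ q ∈ Finset.Ioc 0 (K ^ 2 / e), f q - ∑ q ∈ Finset.Ioc 0 K, f q) := by
  rw [sum_Ioc_mul_eq_sum_prod_filter]
  rw [← Finset.sum_filter_add_sum_filter_not _ (fun x => x.1 ≤ K)]
  congr 1
  · simp_rw [Finset.mul_sum]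
    rw [Finset.sum_sigma']
    refine Finset.sum_bij' (fun x _ => ⟨x.1, x.2⟩) (fun x _ => (x.1, x.2)) ?_ ?_ ?_ ?_ ?_
    · rintro ⟨q, e⟩ h
      simp only [Finset.mem_filter, Finset.mem_product, Finset.mem_Ioc, Finset.mem_sigma] at h ⊢
      refine ⟨⟨h.1.1.1.1, h.2⟩, h.1.1.2.1, ?_⟩
      rw [Nat.le_div_iff_mul_le h.1.1.1.1, mul_comm]; exact h.1.2
    · rintro ⟨q, e⟩ h
      simp only [Finset.mem_filter, Finset.mem_product, Finset.mem_Ioc, Finset.mem_sigma] at h ⊢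
      have h2 := h.2.2
      rw [Nat.le_div_iff_mul_le h.1.1, mul_comm] at h2
      have hq := h.1.1
      have he := h.2.1
      refine ⟨⟨⟨⟨h.1.1, ?_⟩, h.2.1, ?_⟩, h2⟩, h.1.2⟩ <;> nlinarith
    · intros; rfl
    · intros; rfl
    · intros; rfl
  · have : ∀ e ∈ Finset.Ioc 0 K, g e * (∑ q ∈ Finset.Ioc 0 (K ^ 2 / e), f q - ∑ q ∈ Finset.Ioc 0 K, f q)
        = ∑ q ∈ Finset.Ioc K (K ^ 2 / e), g e * f q := by
      intro e he
      simp only [Finset.mem_Ioc] at he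
      have hle : K ≤ K ^ 2 / e := by
        rw [Nat.le_div_iff_mul_le he.1, sq]; exact Nat.mul_le_mul_left _ he.2
      rw [← Finset.mul_sum, ← Finset.sum_Ioc_consecutive f (Nat.zero_le K) hle]; ring
    rw [Finset.sum_congr rfl this, Finset.sum_sigma']
    refine Finset.sum_bij' (fun x _ => ⟨x.2, x.1⟩) (fun x _ => (x.2, x.1)) ?_ ?_ ?_ ?_ ?_
    · rintro ⟨q, e⟩ h
      simp only [Finset.mem_filter, Finset.mem_product, Finset.mem_Ioc, Finset.mem_sigma, not_le] at h ⊢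
      refine ⟨⟨h.1.1.2.1, ?_⟩, h.2, ?_⟩
      · by_contra hc; push Not at hc; nlinarith [h.1.2, h.2]
      · rw [Nat.le_div_iff_mul_le h.1.1.2.1]; exact h.1.2
    · rintro ⟨e, q⟩ h
      simp only [Finset.mem_filter, Finset.mem_product, Finset.mem_Ioc, Finset.mem_sigma, not_le] at h ⊢
      have h2 := h.2.2
      rw [Nat.le_div_iff_mul_le h.1.1] at h2
      have he := h.1.1
      have hq := h.2.1
      refine ⟨⟨⟨⟨by omega, ?_⟩, h.1.1, ?_⟩, h2⟩, h.2.1⟩ <;> nlinarith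
    · intros; rfl
    · intros; rfl
    · rintro ⟨q, e⟩ h; exact mul_comm _ _

lemma fcop_sum (N : ℕ) (hN : 1 < N) (x : ℕ) :
    |∑ e ∈ Finset.Ioc 0 x, fcop N e - (x : ℝ) * (N.totient / N)| ≤ 2 * N + 1 := by
  have h0 : fcop N 0 = 0 := by simp
  have hs : ∀ y, ∑ e ∈ Finset.Ioc 0 y, fcop N e = ∑ e ∈ Finset.range (y + 1), fcop N e := by
    exact fun y => sum_Ioc_eq_range _ h0 y
  have hper : Function.Periodic (fun e => fcop N e) N := by
    intro e
    have : ∀ e, fcop N e = if Nat.Coprime e N then 1 else 0 := by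
      intro e; rw [fcop_apply]
      by_cases he : e = 0
      · subst he; simp; omega
      · simp [he]
    simp [this]
  have hB : ∀ n, |fcop N n| ≤ 1 := by intro n; rw [fcop_apply]; split_ifs <;> simp
  have h1 := periodic_sum_approx (by omega) hper hB (x + 1)
  have htot : ∑ n ∈ Finset.range N, fcop N n = N.totient := by
    simp only [fcop_apply, Finset.sum_boole]
    rw [Nat.totient_eq_card_coprime]
    congr 2; ext e
    simp only [Finset.mem_filter, Finset.mem_range]
    refine and_congr_right fun _ => ⟨fun h => h.2.symm, fun h => ⟨?_, h.symm⟩⟩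
    rintro rfl; simp at h; omega
  rw [htot] at h1
  rw [hs]
  have hle : (N.totient : ℝ) / N ≤ 1 := by
    rw [div_le_one (by positivity)]; exact_mod_cast Nat.totient_le N
  have hge : (0:ℝ) ≤ (N.totient : ℝ) / N := by positivity
  rw [abs_le] at h1 ⊢
  have e1 : ((x + 1 : ℕ) : ℝ) / N * N.totient = x * (N.totient / N) + N.totient / N := by
    push_cast; ring
  rw [e1] at h1
  constructor <;> linarith [h1.1, h1.2]

lemma T_limit {d : ℕ} (hd : d ≠ 0) (hs : ¬ IsSquare d) :
    Tendsto (fun K : ℕ => (∑ n ∈ Finset.Ioc 0 (K ^ 2), (fpsi d * fcop (2 * d)) n) / (K : ℝ) ^ 2)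
      atTop (nhds (((2 * d).totient : ℝ) / (2 * d : ℕ) * Lval d)) := by
  set N := 2 * d with hN
  set ρ : ℝ := (N.totient : ℝ) / N with hρ
  have hρ0 : 0 ≤ ρ := by positivity
  have hρ1 : ρ ≤ 1 := by
    rw [hρ, div_le_one (by positivity)]; exact_mod_cast Nat.totient_le N
  have hN1 : 1 < N := by omega
  have hbd := Spsi_bound hd hs
  have hF : ∀ y, ∑ q ∈ Finset.Ioc 0 y, fpsi d q = Spsi d y := by
    exact fun y => sum_Ioc_eq_range _ (psi_zero_right d) y
  have hF' : ∀ y, ∑ q ∈ Finset.Ioc 0 y, psi d q / q = ∑ q ∈ Finset.range (y + 1), psi d q / q := by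
    exact fun y => sum_Ioc_eq_range (fun q => psi d q / q) (by simp) y
  have hmain : ∀ K : ℕ, |∑ n ∈ Finset.Ioc 0 (K ^ 2), (fpsi d * fcop N) n
      - (K : ℝ) ^ 2 * ρ * ∑ q ∈ Finset.range (K + 1), psi d q / q| ≤ K * (2 * N + 2 + 8 * d) := by
    intro K
    rw [hyperbola, ← hF']
    have h1 : |∑ q ∈ Finset.Ioc 0 K, fpsi d q * ∑ e ∈ Finset.Ioc 0 (K ^ 2 / q), fcop N e -
        (K : ℝ) ^ 2 * ρ * ∑ q ∈ Finset.Ioc 0 K, psi d q / q| ≤ K * (2 * N + 2) := by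
      rw [Finset.mul_sum, ← Finset.sum_sub_distrib]
      refine (Finset.abs_sum_le_sum_abs _ _).trans ?_
      have : ∀ q ∈ Finset.Ioc 0 K, |fpsi d q * ∑ e ∈ Finset.Ioc 0 (K ^ 2 / q), fcop N e -
          (K : ℝ) ^ 2 * ρ * (psi d q / q)| ≤ 2 * N + 2 := by
        intro q hq
        simp only [Finset.mem_Ioc] at hq
        have hq0 : (0 : ℝ) < q := by exact_mod_cast hq.1
        have e1 : fpsi d q * ∑ e ∈ Finset.Ioc 0 (K ^ 2 / q), fcop N e -
          (K : ℝ) ^ 2 * ρ * (psi d q / q) = psi d q * (∑ e ∈ Finset.Ioc 0 (K ^ 2 / q), fcop N e -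
           (K : ℝ) ^ 2 / q * ρ) := by rw [fpsi_apply]; ring
        rw [e1, abs_mul]
        have h2 := fcop_sum N hN1 (K ^ 2 / q)
        have h3 : (((K ^ 2 / q : ℕ) : ℝ)) ≤ (K : ℝ) ^ 2 / q := by
          have := @Nat.cast_div_le ℝ _ _ _ (K ^ 2) q; push_cast at this; exact this
        have h4 : (K : ℝ) ^ 2 / q ≤ ((K ^ 2 / q : ℕ) : ℝ) + 1 := by
          rw [div_le_iff₀ hq0]
          have := Nat.lt_div_mul_add hq.1 (a := K ^ 2)
          have h5 : ((K ^ 2 : ℕ) : ℝ) < ((K ^ 2 / q * q + q : ℕ) : ℝ) := by exact_mod_cast this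
          push_cast at h5; linarith
        have h6 : |∑ e ∈ Finset.Ioc 0 (K ^ 2 / q), fcop N e - (K : ℝ) ^ 2 / q * ρ| ≤ 2 * N + 2 := by
          rw [abs_le] at h2 ⊢
          constructor <;> nlinarith [h2.1, h2.2]
        calc _ ≤ 1 * |∑ e ∈ Finset.Ioc 0 (K ^ 2 / q), fcop N e - (K : ℝ) ^ 2 / q * ρ| := by
              gcongr; exact psi_abs_le _ _
          _ ≤ _ := by rw [one_mul]; exact h6
      refine (Finset.sum_le_sum this).trans ?_
      simp [mul_add]
    have h2 : |∑ e ∈ Finset.Ioc 0 K, fcop N e * (∑ q ∈ Finset.Ioc 0 (K ^ 2 / e), fpsi d q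
        - ∑ q ∈ Finset.Ioc 0 K, fpsi d q)| ≤ K * (8 * d) := by
      refine (Finset.abs_sum_le_sum_abs _ _).trans ?_
      have : ∀ e ∈ Finset.Ioc 0 K, |fcop N e * (∑ q ∈ Finset.Ioc 0 (K ^ 2 / e), fpsi d q
        - ∑ q ∈ Finset.Ioc 0 K, fpsi d q)| ≤ 8 * d := by
        intro e he
        rw [hF, hF, abs_mul]
        have hB : |fcop N e| ≤ 1 := by rw [fcop_apply]; split_ifs <;> simp
        calc _ ≤ 1 * |Spsi d (K ^ 2 / e) - Spsi d K| := by gcongr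
          _ ≤ |Spsi d (K ^ 2 / e)| + |Spsi d K| := by rw [one_mul]; exact abs_sub _ _
          _ ≤ 4 * d + 4 * d := add_le_add (hbd _) (hbd _)
          _ = _ := by ring
      refine (Finset.sum_le_sum this).trans ?_
      simp
    rw [abs_le] at h1 h2 ⊢
    constructor <;> linarith [h1.1, h1.2, h2.1, h2.2]
  have hL : Tendsto (fun K : ℕ => ∑ q ∈ Finset.range (K + 1), psi d q / q) atTop (nhds (Lval d)) := by
    rw [tendsto_iff_norm_sub_tendsto_zero]
    refine squeeze_zero (fun _ => norm_nonneg _) (g := fun K : ℕ => 2 * (4 * d : ℝ) * (1 / ((K : ℝ) + 1))) ?_ ?_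
    · intro K
      rw [norm_sub_rev, Real.norm_eq_abs, mul_one_div]
      exact Lval_approx hbd K
    · simpa using (tendsto_one_div_add_atTop_nhds_zero_nat (𝕜 := ℝ)).const_mul (2 * (4 * d : ℝ))
  have hL2 := hL.const_mul ρ
  refine (tendsto_iff_of_dist ?_).1 hL2
  refine squeeze_zero' (Eventually.of_forall fun _ => dist_nonneg)
    (g := fun K : ℕ => (2 * N + 2 + 8 * d : ℝ) * (1 / (K : ℝ))) ?_ ?_
  · filter_upwards [eventually_gt_atTop 0] with K hK
    have hK0 : (0 : ℝ) < K := by exact_mod_cast hK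
    rw [dist_comm, Real.dist_eq]
    have e : (∑ n ∈ Finset.Ioc 0 (K ^ 2), (fpsi d * fcop N) n) / (K : ℝ) ^ 2 -
      ρ * ∑ q ∈ Finset.range (K + 1), psi d q / q = (∑ n ∈ Finset.Ioc 0 (K ^ 2), (fpsi d * fcop N) n
      - (K : ℝ) ^ 2 * ρ * ∑ q ∈ Finset.range (K + 1), psi d q / q) / (K : ℝ) ^ 2 := by
      field_simp
    rw [e, abs_div, abs_of_pos (by positivity : (0 : ℝ) < (K : ℝ) ^ 2), div_le_iff₀ (by positivity)]
    refine (hmain K).trans (le_of_eq ?_)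
    field_simp
  · simpa using (tendsto_one_div_atTop_nhds_zero_nat (𝕜 := ℝ)).const_mul (2 * N + 2 + 8 * d : ℝ)

end P2b

section P2c

open ArithmeticFunction

/-- number of square roots of `d` modulo `m` -/
noncomputable def rcnt (d : ℕ) (m : ℕ) : ℕ := Nat.card {x : ZMod m // x ^ 2 = (d : ZMod m)}

/-- arithmetic function version of `rcnt`, restricted to `m` coprime to `2d` -/
noncomputable def frc (d : ℕ) : ArithmeticFunction ℝ :=
  ⟨fun m => if m ≠ 0 ∧ Nat.Coprime m (2 * d) then (rcnt d m : ℝ) else 0, by simp⟩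

/-- indicator of squares coprime to `N` -/
noncomputable def fsq (N : ℕ) : ArithmeticFunction ℝ := by
  classical
  exact ⟨fun m => if m ≠ 0 ∧ IsSquare m ∧ Nat.Coprime m N then 1 else 0, by simp⟩

lemma frc_apply (d m : ℕ) : frc d m = if m ≠ 0 ∧ Nat.Coprime m (2 * d) then (rcnt d m : ℝ) else 0 := rfl

open Classical in
lemma fsq_apply (N m : ℕ) : fsq N m = if m ≠ 0 ∧ IsSquare m ∧ Nat.Coprime m N then 1 else 0 := rfl

lemma rcnt_one (d : ℕ) : rcnt d 1 = 1 := by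
  unfold rcnt
  rw [Nat.card_eq_one_iff_unique]
  exact ⟨⟨fun a b => Subtype.ext (Subsingleton.elim _ _)⟩, ⟨0, Subsingleton.elim _ _⟩⟩

lemma rcnt_mul (d m n : ℕ) (h : Nat.Coprime m n) : rcnt d (m * n) = rcnt d m * rcnt d n := by
  unfold rcnt
  rw [← Nat.card_prod]
  let e := ZMod.chineseRemainder h
  refine Nat.card_congr ?_
  refine (Equiv.subtypeEquiv e.toEquiv (q := fun y : ZMod m × ZMod n => y.1 ^ 2 = d ∧ y.2 ^ 2 = d) ?_).trans
    (Equiv.subtypeProdEquivProd (p := fun y : ZMod m => y ^ 2 = d) (q := fun y : ZMod n => y ^ 2 = d))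
  intro x
  rw [← e.injective.eq_iff, map_pow, map_natCast, Prod.ext_iff]
  rfl

lemma isMult_frc (d : ℕ) : (frc d).IsMultiplicative := by
  rw [IsMultiplicative.iff_ne_zero]
  refine ⟨by simp [frc_apply, rcnt_one], ?_⟩
  intro m n hm hn h
  simp only [frc_apply, Nat.coprime_mul_iff_left, rcnt_mul _ _ _ h]
  push_cast
  have hmn : m * n ≠ 0 := mul_ne_zero hm hn
  split_ifs <;> first | tauto | simp

lemma isMult_fcop (N : ℕ) : (fcop N).IsMultiplicative := by
  rw [IsMultiplicative.iff_ne_zero]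
  refine ⟨by simp [fcop_apply], ?_⟩
  intro m n hm hn h
  simp only [fcop_apply, Nat.coprime_mul_iff_left]
  have hmn : m * n ≠ 0 := mul_ne_zero hm hn
  split_ifs <;> first | tauto | simp

lemma isMult_fpsi (d : ℤ) : (fpsi d).IsMultiplicative := by
  rw [IsMultiplicative.iff_ne_zero]
  refine ⟨by simp [fpsi_apply, psi_one], ?_⟩
  intro m n hm hn h
  simp only [fpsi_apply, psi_mul_right]

lemma isSquare_mul_coprime {m n : ℕ} (h : Nat.Coprime m n) : IsSquare (m * n) ↔ IsSquare m ∧ IsSquare n := by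
  constructor
  · rintro ⟨r, hr⟩
    rw [← sq] at hr
    constructor
    · obtain ⟨c, hc⟩ := exists_associated_pow_of_mul_eq_pow (by rw [Nat.isUnit_iff]; exact h) hr
      rw [associated_iff_eq] at hc
      exact ⟨c, by rw [← hc, sq]⟩
    · obtain ⟨c, hc⟩ := exists_associated_pow_of_mul_eq_pow (by rw [Nat.isUnit_iff]; exact h.symm) (by rw [mul_comm]; exact hr : n * m = r ^ 2)
      rw [associated_iff_eq] at hc
      exact ⟨c, by rw [← hc, sq]⟩
  · rintro ⟨h1, h2⟩; exact h1.mul h2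

lemma isMult_fsq (N : ℕ) : (fsq N).IsMultiplicative := by
  rw [IsMultiplicative.iff_ne_zero]
  refine ⟨by simp [fsq_apply], ?_⟩
  intro m n hm hn h
  simp only [fsq_apply, Nat.coprime_mul_iff_left, isSquare_mul_coprime h]
  have hmn : m * n ≠ 0 := mul_ne_zero hm hn
  split_ifs <;> first | tauto | simp

lemma hensel_sq {p : ℕ} (hp : p.Prime) (hp2 : p ≠ 2) {d : ℤ} (hd : ¬ (p : ℤ) ∣ d)
    {x : ℤ} (hx : (p : ℤ) ∣ x ^ 2 - d) (k : ℕ) : ∃ y : ℤ, (p : ℤ) ^ (k + 1) ∣ y ^ 2 - d := by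
  have hpi : Prime (p : ℤ) := Nat.prime_iff_prime_int.1 hp
  have h2 : ¬ (p : ℤ) ∣ 2 := by
    intro h
    have h3 : (p : ℤ) ∣ ((2 : ℕ) : ℤ) := by exact_mod_cast h
    rw [Int.natCast_dvd_natCast] at h3
    exact hp2 ((Nat.prime_dvd_prime_iff_eq hp Nat.prime_two).1 h3)
  induction k with
  | zero => exact ⟨x, by simpa using hx⟩
  | succ k ih =>
    obtain ⟨y, s, hs⟩ := ih
    have hy : ¬ (p : ℤ) ∣ y := by
      intro hy
      apply hd
      have : d = y * y - (p : ℤ) * ((p : ℤ) ^ k * s) := by linear_combination -hs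
      rw [this]
      exact dvd_sub (hy.mul_left y) (dvd_mul_right _ _)
    have hc : IsCoprime (2 * y) (p : ℤ) := by
      rw [isCoprime_comm]
      refine (Prime.coprime_iff_not_dvd hpi).2 fun h => ?_
      rcases hpi.dvd_or_dvd h with h | h
      · exact h2 h
      · exact hy h
    obtain ⟨α, β, hαβ⟩ := hc
    refine ⟨y - (p : ℤ) ^ (k + 1) * (s * α), ?_⟩
    refine ⟨s * β + (p : ℤ) ^ k * (s * α) ^ 2, ?_⟩
    linear_combination hs - s * (p : ℤ) ^ (k + 1) * hαβ

lemma rcnt_prime_pow {d p : ℕ} (hp : p.Prime) (hpd : Nat.Coprime p (2 * d)) (k : ℕ) :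
    (rcnt d (p ^ (k + 1)) : ℝ) = 1 + psi d p := by
  have hp2 : p ≠ 2 := by rintro rfl; simp at hpd; rw [Nat.odd_iff] at hpd; omega
  have hpo : Odd p := hp.odd_of_ne_two hp2
  have hpd' : ¬ (p : ℤ) ∣ d := by
    rw [Int.natCast_dvd_natCast]
    exact (Nat.Prime.coprime_iff_not_dvd hp).1 (Nat.Coprime.coprime_mul_left_right hpd)
  have hpi : Prime (p : ℤ) := Nat.prime_iff_prime_int.1 hp
  have := Fact.mk hp
  have h2' : ¬ (p : ℤ) ∣ 2 := by
    intro h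
    have h3 : (p : ℤ) ∣ ((2 : ℕ) : ℤ) := by exact_mod_cast h
    rw [Int.natCast_dvd_natCast] at h3
    exact hp2 ((Nat.prime_dvd_prime_iff_eq hp Nat.prime_two).1 h3)
  rw [psi_odd _ hpo, ← jacobiSym.legendreSym.to_jacobiSym]
  have hd0 : ((d : ℤ) : ZMod p) ≠ 0 := by
    rw [Ne, ZMod.intCast_zmod_eq_zero_iff_dvd]; exact hpd'
  set P := p ^ (k + 1) with hP
  have hPp : (p : ℤ) ∣ (P : ℤ) := by rw [hP]; push_cast; exact dvd_pow_self _ (by omega)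
  have : NeZero P := ⟨by rw [hP]; exact pow_ne_zero _ hp.ne_zero⟩
  rcases legendreSym.eq_one_or_neg_one p hd0 with h | h
  · rw [h]
    rw [legendreSym.eq_one_iff p hd0] at h
    obtain ⟨x, hx⟩ := h
    obtain ⟨y, hy⟩ := hensel_sq hp hp2 hpd' (x := x.val) (by
      rw [← ZMod.intCast_zmod_eq_zero_iff_dvd]; push_cast; simp; rw [sq, ← hx]; simp) k
    have hyd : ((y : ℤ) : ZMod P) ^ 2 = d := by
      have : (((y ^ 2 - d : ℤ)) : ZMod P) = 0 := by
        rw [ZMod.intCast_zmod_eq_zero_iff_dvd, hP]; push_cast; exact hy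
      push_cast at this
      exact sub_eq_zero.1 this
    have hyp : ¬ (p : ℤ) ∣ y := by
      intro h
      apply hpd'
      have h3 : (p : ℤ) ∣ y ^ 2 - d := (dvd_pow_self _ (by omega)).trans hy
      have : (d : ℤ) = y * y - (y ^ 2 - d) := by ring
      rw [this]; exact dvd_sub (h.mul_left y) h3
    have hset : {x : ZMod P | x ^ 2 = (d : ZMod P)} = {(y : ZMod P), -(y : ZMod P)} := by
      ext z
      simp only [Set.mem_ofPred_eq, Set.mem_insert_iff, Set.mem_singleton_iff]
      constructor
      · intro hz
        obtain ⟨w, rfl⟩ := ZMod.intCast_surjective z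
        have h4 : (P : ℤ) ∣ (w - y) * (w + y) := by
          rw [← ZMod.intCast_zmod_eq_zero_iff_dvd]
          push_cast
          linear_combination hz - hyd
        have h5 : ¬ ((p : ℤ) ∣ w - y ∧ (p : ℤ) ∣ w + y) := by
          rintro ⟨ha, hb⟩
          have : (p : ℤ) ∣ 2 * y := by
            have := dvd_sub hb ha; ring_nf at this; rwa [mul_comm] at this
          rcases hpi.dvd_or_dvd this with h | h
          · exact h2' h
          · exact hyp h
        have h6 : (P : ℤ) ∣ w - y ∨ (P : ℤ) ∣ w + y := by
          by_cases h7 : (p : ℤ) ∣ w - y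
          · left
            have h8 : ¬ (p : ℤ) ∣ w + y := fun h => h5 ⟨h7, h⟩
            have h9 : IsCoprime (P : ℤ) (w + y) := by
              rw [hP]; push_cast
              exact ((Prime.coprime_iff_not_dvd hpi).2 h8).pow_left
            exact h9.dvd_of_dvd_mul_right h4
          · right
            have h9 : IsCoprime (P : ℤ) (w - y) := by
              rw [hP]; push_cast
              exact ((Prime.coprime_iff_not_dvd hpi).2 h7).pow_left
            exact h9.dvd_of_dvd_mul_left h4
        rcases h6 with h6 | h6
        · left; rw [← ZMod.intCast_zmod_eq_zero_iff_dvd] at h6; push_cast at h6; exact sub_eq_zero.1 h6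
        · right; rw [← ZMod.intCast_zmod_eq_zero_iff_dvd] at h6; push_cast at h6
          exact eq_neg_of_add_eq_zero_left h6
      · rintro (rfl | rfl)
        · exact hyd
        · rw [neg_sq]; exact hyd
    have hne : (y : ZMod P) ≠ -(y : ZMod P) := by
      intro h
      have h1 : ((2 * y : ℤ) : ZMod P) = 0 := by push_cast; linear_combination h
      rw [ZMod.intCast_zmod_eq_zero_iff_dvd] at h1
      rcases hpi.dvd_or_dvd (hPp.trans h1) with h | h
      · exact h2' h
      · exact hyp h
    have : rcnt d P = 2 := by
      unfold rcnt
      have : Nat.card {x : ZMod P // x ^ 2 = (d : ZMod P)} = Set.ncard {x : ZMod P | x ^ 2 = (d : ZMod P)} := rfl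
      rw [this, hset, Set.ncard_pair hne]
    rw [this]; norm_num
  · rw [h]
    rw [legendreSym.eq_neg_one_iff] at h
    have : rcnt d P = 0 := by
      unfold rcnt
      rw [Nat.card_eq_zero]; left
      constructor
      rintro ⟨z, hz⟩
      apply h
      obtain ⟨w, rfl⟩ := ZMod.intCast_surjective z
      have h4 : (P : ℤ) ∣ w ^ 2 - d := by
        rw [← ZMod.intCast_zmod_eq_zero_iff_dvd]; push_cast; rw [hz]; simp
      have h5 := hPp.trans h4
      rw [← ZMod.intCast_zmod_eq_zero_iff_dvd] at h5
      push_cast at h5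
      refine ⟨(w : ZMod p), ?_⟩
      push_cast
      linear_combination -h5
    rw [this]; norm_num

lemma mul_prime_pow (f g : ArithmeticFunction ℝ) {p : ℕ} (hp : p.Prime) (k : ℕ) :
    (f * g) (p ^ k) = ∑ i ∈ Finset.range (k + 1), f (p ^ i) * g (p ^ (k - i)) := by
  rw [mul_apply, Nat.sum_divisorsAntidiagonal (fun x y => f x * g y), Nat.sum_divisors_prime_pow hp]
  refine Finset.sum_congr rfl fun i hi => ?_
  rw [Nat.pow_div (by simp at hi; omega) hp.pos]

theorem R_eq_E {d : ℕ} (hd : d ≠ 0) : fsq (2 * d) * frc d = fpsi d * fcop (2 * d) := by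
  rw [IsMultiplicative.eq_iff_eq_on_prime_powers _ ((isMult_fsq _).mul (isMult_frc _)) _
    ((isMult_fpsi _).mul (isMult_fcop _))]
  intro p k hp
  by_cases hc : Nat.Coprime p (2 * d)
  · set χ := psi d p with hχ
    have hpo : Odd p := hp.odd_of_ne_two (by rintro rfl; simp at hc; rw [Nat.odd_iff] at hc; omega)
    have hχ2 : χ ^ 2 = 1 := psi_sq_of_coprime hpo (by
      rw [Int.gcd_natCast_natCast, Nat.gcd_comm]; exact Nat.Coprime.coprime_mul_left_right hc)
    have hpsi : ∀ i, psi d (p ^ i) = χ ^ i := by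
      intro i
      induction i with
      | zero => simp [psi_one]
      | succ i ih => rw [pow_succ, psi_mul_right, ih, pow_succ]
    have hE : ∀ k, (fpsi d * fcop (2 * d)) (p ^ k) = ∑ i ∈ Finset.range (k + 1), χ ^ i := by
      intro k
      rw [mul_prime_pow _ _ hp]
      refine Finset.sum_congr rfl fun i _ => ?_
      rw [fpsi_apply, hpsi, fcop_apply, if_pos ⟨pow_ne_zero _ hp.ne_zero, hc.pow_left _⟩, mul_one]
    have hfrc0 : frc d (p ^ 0) = 1 := by simp
                                         exact (isMult_frc d).1
    have hfrc : ∀ k, frc d (p ^ (k + 1)) = 1 + χ := by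
      intro k
      rw [frc_apply, if_pos ⟨pow_ne_zero _ hp.ne_zero, hc.pow_left _⟩, rcnt_prime_pow hp hc]
    have hsq2 : ∀ i, fsq (2 * d) (p ^ (i + 2)) = fsq (2 * d) (p ^ i) := by
      intro i
      have h1 : IsSquare (p ^ (i + 2)) ↔ IsSquare (p ^ i) := by
        constructor
        · rintro ⟨r, hr⟩
          have : p ∣ r := by
            have : p ∣ r * r := by rw [← hr]; exact dvd_pow_self _ (by omega)
            rcases (Nat.Prime.dvd_mul hp).1 this with h | h <;> exact h
          obtain ⟨s, rfl⟩ := this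
          refine ⟨s, ?_⟩
          have : p ^ 2 * p ^ i = p ^ 2 * (s * s) := by rw [← pow_add, add_comm, hr]; ring
          exact Nat.eq_of_mul_eq_mul_left (pow_pos hp.pos 2) this
        · rintro ⟨r, hr⟩; exact ⟨p * r, by rw [pow_add, hr]; ring⟩
      simp only [fsq_apply, h1, ne_eq, pow_ne_zero _ hp.ne_zero, not_false_eq_true, true_and]
      have h3 : Nat.Coprime (p ^ i) (2 * d) := hc.pow_left _
      have h4 : Nat.Coprime (p ^ (i + 2)) (2 * d) := hc.pow_left _
      split_ifs <;> first | tauto | simp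
    have hsq0 : fsq (2 * d) (p ^ 0) = 1 := by rw [pow_zero]; exact (isMult_fsq _).1
    have hsq1 : fsq (2 * d) (p ^ 1) = 0 := by
      rw [fsq_apply, if_neg]
      rintro ⟨_, h, _⟩
      rw [pow_one] at h
      exact hp.prime.not_isSquare h
    rw [hE]
    induction k using Nat.twoStepInduction with
    | zero => simp; rw [(isMult_fsq _).1, (isMult_frc _).1]; norm_num
    | one =>
      rw [mul_prime_pow _ _ hp, Finset.sum_range_succ, Finset.sum_range_succ, Finset.sum_range_zero]
      have := hfrc 0
      simp only [hsq0, hsq1, zero_add, Nat.sub_zero] at this ⊢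
      rw [this]; simp [Finset.sum_range_succ]
    | more k ih _ =>
      rw [mul_prime_pow _ _ hp] at ih ⊢
      rw [Finset.sum_range_succ', Finset.sum_range_succ']
      rw [Finset.sum_range_succ' _ (k + 1 + 1), Finset.sum_range_succ' _ (k + 1)]
      have e1 : ∑ x ∈ Finset.range (k + 1), fsq (2 * d) (p ^ (x + 1 + 1)) * frc d (p ^ (k + 2 - (x + 1 + 1)))
          = ∑ i ∈ Finset.range (k + 1), χ ^ i := by
        rw [← ih]
        refine Finset.sum_congr rfl fun i _ => ?_
        rw [show i + 1 + 1 = i + 2 by ring, hsq2]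
        congr 3; omega
      have e2 : ∑ x ∈ Finset.range (k + 1), χ ^ (x + 1 + 1) = ∑ x ∈ Finset.range (k + 1), χ ^ x := by
        refine Finset.sum_congr rfl fun i _ => ?_
        rw [show i + 1 + 1 = i + 2 by ring, pow_add, hχ2, mul_one]
      rw [e1, e2, hsq0]
      have := hfrc (k + 1)
      simp only [zero_add, hsq1, Nat.sub_zero] at this ⊢
      rw [this]; ring
  · rcases Nat.eq_zero_or_pos k with rfl | hk
    · simp only [pow_zero]
      rw [((isMult_fsq _).mul (isMult_frc _)).1, ((isMult_fpsi _).mul (isMult_fcop _)).1]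
    · rw [mul_prime_pow _ _ hp, mul_prime_pow _ _ hp, Finset.sum_eq_zero, Finset.sum_eq_zero]
      · intro i hi
        rcases Nat.eq_zero_or_pos i with rfl | hi0
        · rw [fcop_apply, if_neg, mul_zero]
          rintro ⟨_, h⟩
          exact hc (Nat.Coprime.coprime_dvd_left (dvd_pow_self _ (by omega)) h)
        · rw [fpsi_apply]
          have : psi d (p ^ i) = 0 := by
            by_cases ho : Odd (p ^ i)
            · apply psi_eq_zero_of_not_coprime
              intro h
              rw [Int.gcd_natCast_natCast] at h
              apply hc
              have h1 : Nat.Coprime p d := (Nat.Coprime.coprime_dvd_right (dvd_pow_self _ (by omega)) h).symm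
              have h2 : Nat.Coprime p 2 := by
                rw [Nat.coprime_two_right]; exact (Nat.odd_pow_iff (by omega)).1 ho
              exact h2.mul_right h1
            · exact psi_even _ ho
          rw [this, zero_mul]
      · intro i hi
        simp at hi
        rcases Nat.eq_zero_or_pos i with rfl | hi0
        · rw [frc_apply, if_neg, mul_zero]
          rintro ⟨_, h⟩
          exact hc (Nat.Coprime.coprime_dvd_left (dvd_pow_self _ (by omega)) h)
        · rw [fsq_apply, if_neg, zero_mul]
          rintro ⟨_, _, h⟩
          exact hc (Nat.Coprime.coprime_dvd_left (dvd_pow_self _ (by omega)) h)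

end P2c

section P2d

open scoped ENNReal

theorem shifted_lattice (Ω : Set (ℝ × ℝ)) (hm : MeasurableSet Ω) (hb : Bornology.IsBounded Ω)
    (hf : volume (frontier Ω) = 0) (N : ℕ) (hN : 0 < N) (v : ℤ × ℤ) :
    Tendsto (fun K : ℕ => (Set.ncard {w : ℤ × ℤ |
        ((((v.1 + N * w.1 : ℤ) : ℝ) / K, ((v.2 + N * w.2 : ℤ) : ℝ) / K) : ℝ × ℝ) ∈ Ω} : ℝ) / (K : ℝ) ^ 2)
      atTop (nhds ((volume Ω).toReal / (N : ℝ) ^ 2)) := by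
  have hNr : (0 : ℝ) < N := by exact_mod_cast hN
  let A : ℕ → Set (ℤ × ℤ) := fun K => {w : ℤ × ℤ |
        ((((v.1 + N * w.1 : ℤ) : ℝ) / K, ((v.2 + N * w.2 : ℤ) : ℝ) / K) : ℝ × ℝ) ∈ Ω}
  let c : ℕ → ℤ × ℤ → Set (ℝ × ℝ) := fun K w =>
    Set.Ico (((v.1 + N * w.1 : ℤ) : ℝ) / K) (((v.1 + N * w.1 : ℤ) : ℝ) / K + N / K) ×ˢ
    Set.Ico (((v.2 + N * w.2 : ℤ) : ℝ) / K) (((v.2 + N * w.2 : ℤ) : ℝ) / K + N / K)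
  let U : ℕ → Set (ℝ × ℝ) := fun K => ⋃ w ∈ A K, c K w
  have hfloor : ∀ (K : ℕ), 0 < K → ∀ (x : ℝ) (v w : ℤ),
      x ∈ Set.Ico (((v + N * w : ℤ) : ℝ) / K) (((v + N * w : ℤ) : ℝ) / K + N / K) ↔ ⌊(K * x - v) / N⌋ = w := by
    intro K hK x v w
    have hKr : (0 : ℝ) < K := by exact_mod_cast hK
    rw [Int.floor_eq_iff, Set.mem_Ico, ← add_div, div_le_iff₀ hKr, lt_div_iff₀ hKr, le_div_iff₀ hNr, div_lt_iff₀ hNr]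
    push_cast
    constructor <;> rintro ⟨h1, h2⟩ <;> constructor <;> nlinarith
  have hmemc : ∀ (K : ℕ), 0 < K → ∀ (x : ℝ × ℝ) (w : ℤ × ℤ),
      x ∈ c K w ↔ (⌊(K * x.1 - v.1) / N⌋, ⌊(K * x.2 - v.2) / N⌋) = w := by
    intro K hK x w
    simp only [c, Set.mem_prod, hfloor K hK, Prod.ext_iff]
  have hvolc : ∀ K : ℕ, ∀ w, volume (c K w) = ENNReal.ofReal ((N / K : ℝ) ^ 2) := by
    intro K w
    simp only [c, Measure.volume_eq_prod, Measure.prod_prod, Real.volume_Ico, add_sub_cancel_left]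
    rw [← ENNReal.ofReal_mul (by positivity), sq]
  have hmc : ∀ K w, MeasurableSet (c K w) := fun K w => measurableSet_Ico.prod measurableSet_Ico
  have hvolU : ∀ K : ℕ, 0 < K → volume (U K) = (A K).encard * ENNReal.ofReal ((N / K : ℝ) ^ 2) := by
    intro K hK
    simp only [U]
    rw [measure_biUnion (Set.to_countable _) ?_ (fun w _ => hmc K w)]
    · simp_rw [hvolc]; rw [ENNReal.tsum_set_const]
    · intro w _ w' _ hne
      rw [Function.onFun, Set.disjoint_left]
      intro x hx hx'
      rw [hmemc K hK] at hx hx'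
      exact hne (hx.symm.trans hx')
  have hsub1 : ∀ K : ℕ, 0 < K → U K ⊆ Metric.cthickening (N / K) Ω := by
    intro K hK x hx
    simp only [U, Set.mem_iUnion] at hx
    obtain ⟨w, hw, hx⟩ := hx
    refine Metric.mem_cthickening_of_dist_le x _ _ _ hw ?_
    simp only [c, Set.mem_prod, Set.mem_Ico] at hx
    rw [Prod.dist_eq, max_le_iff, Real.dist_eq, Real.dist_eq]
    constructor <;> rw [abs_of_nonneg] <;> linarith
  have hsub2 : ∀ K : ℕ, 0 < K → Ω ⊆ U K ∪ (Metric.cthickening (N / K) Ωᶜ ∩ Ω) := by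
    intro K hK x hx
    set w : ℤ × ℤ := (⌊(K * x.1 - v.1) / N⌋, ⌊(K * x.2 - v.2) / N⌋) with hw
    have hxc : x ∈ c K w := (hmemc K hK x w).2 rfl
    by_cases hA : w ∈ A K
    · left; simp only [U, Set.mem_iUnion]; exact ⟨w, hA, hxc⟩
    · right
      refine ⟨?_, hx⟩
      refine Metric.mem_cthickening_of_dist_le x _ _ _ hA ?_
      simp only [c, Set.mem_prod, Set.mem_Ico] at hxc
      rw [Prod.dist_eq, max_le_iff, Real.dist_eq, Real.dist_eq]
      constructor <;> rw [abs_of_nonneg] <;> linarith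
  have hvolfin : volume Ω ≠ ∞ := hb.measure_lt_top.ne
  have hs : Tendsto (fun K : ℕ => (N / K : ℝ)) atTop (nhds 0) := tendsto_const_div_atTop_nhds_zero_nat _
  have hclos : volume (closure Ω) = volume Ω := by
    apply le_antisymm _ (measure_mono subset_closure)
    have : closure Ω ⊆ Ω ∪ frontier Ω := by
      intro x hx; by_cases h : x ∈ Ω
      · exact Or.inl h
      · exact Or.inr ⟨hx, fun h' => h (interior_subset h')⟩
    refine (measure_mono this).trans ((measure_union_le _ _).trans ?_)
    rw [hf, add_zero]
  have hup : Tendsto (fun K : ℕ => volume (Metric.cthickening (N / K : ℝ) Ω)) atTop (nhds (volume Ω)) := by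
    have := tendsto_measure_cthickening (μ := volume) (s := Ω) ⟨1, one_pos, (hb.cthickening).measure_lt_top.ne⟩
    rw [hclos] at this
    exact this.comp hs
  have hlow : Tendsto (fun K : ℕ => volume (Metric.cthickening (N / K : ℝ) Ωᶜ ∩ Ω)) atTop (nhds 0) := by
    have hfinr : (volume.restrict Ω) (Metric.cthickening 1 Ωᶜ) ≠ ∞ := by
      refine ((measure_mono (Set.subset_univ _)).trans_lt ?_).ne
      rw [Measure.restrict_apply_univ]; exact hvolfin.lt_top
    have := tendsto_measure_cthickening (μ := volume.restrict Ω) (s := Ωᶜ) ⟨1, one_pos, hfinr⟩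
    have h2 : (volume.restrict Ω) (closure Ωᶜ) = 0 := by
      rw [Measure.restrict_apply isClosed_closure.measurableSet]
      refine measure_mono_null ?_ hf
      rintro x ⟨hx, hx'⟩
      refine ⟨subset_closure hx', ?_⟩
      rw [← Set.mem_compl_iff, ← closure_compl]; exact hx
    rw [h2] at this
    have h3 := this.comp hs
    refine h3.congr fun K => ?_
    simp only [Function.comp]
    rw [Measure.restrict_apply Metric.isClosed_cthickening.measurableSet]
  have hU : Tendsto (fun K : ℕ => volume (U K)) atTop (nhds (volume Ω)) := by
    have h1 : Tendsto (fun K : ℕ => volume Ω - volume (Metric.cthickening (N / K : ℝ) Ωᶜ ∩ Ω)) atTop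
        (nhds (volume Ω)) := by
      have := ENNReal.Tendsto.sub (tendsto_const_nhds (x := volume Ω) (f := (atTop : Filter ℕ))) hlow (Or.inl hvolfin)
      simpa using this
    refine tendsto_of_tendsto_of_tendsto_of_le_of_le' h1 hup ?_ ?_
    · filter_upwards [eventually_gt_atTop 0] with K hK
      rw [tsub_le_iff_right]
      exact (measure_mono (hsub2 K hK)).trans (measure_union_le _ _)
    · filter_upwards [eventually_gt_atTop 0] with K hK
      exact measure_mono (hsub1 K hK)
  have hUr := ((ENNReal.tendsto_toReal hvolfin).comp hU).div_const ((N : ℝ) ^ 2)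
  refine hUr.congr' ?_
  filter_upwards [eventually_gt_atTop 0] with K hK
  have hKr : (0 : ℝ) < K := by exact_mod_cast hK
  simp only [Function.comp]
  rw [hvolU K hK, ENNReal.toReal_mul, ENNReal.toReal_ofReal (by positivity)]
  have : ((A K).encard : ℝ≥0∞).toReal = ((A K).ncard : ℝ) := by
    rw [Set.ncard]
    cases h : (A K).encard with
    | top => simp
    | coe n => simp
  rw [this]
  field_simp
  rfl

end P2d

section P2e

open scoped ENNReal

/-- the basic hyperbolic sector, coordinates `(η, ξ)` -/
def Om0 (E : ℝ) : Set (ℝ × ℝ) := {p | 0 < p.1 ∧ p.1 < p.2 ∧ p.2 ≤ E ^ 2 * p.1 ∧ p.1 * p.2 ≤ 1}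

lemma Om0_meas (E : ℝ) : MeasurableSet (Om0 E) := by
  unfold Om0
  refine MeasurableSet.inter (measurableSet_lt measurable_const measurable_fst) ?_
  refine MeasurableSet.inter (measurableSet_lt measurable_fst measurable_snd) ?_
  refine MeasurableSet.inter (measurableSet_le measurable_snd (measurable_fst.const_mul _)) ?_
  exact measurableSet_le (measurable_fst.mul measurable_snd) measurable_const

lemma Om0_bdd {E : ℝ} (hE : 1 < E) : Bornology.IsBounded (Om0 E) := by
  refine (Metric.isBounded_Icc ((0 : ℝ), (0 : ℝ)) (E, E)).subset ?_
  rintro ⟨x, y⟩ ⟨h1, h2, h3, h4⟩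
  simp only at h1 h2 h3 h4
  have hy : y ≤ E := by
    by_contra h; push Not at h
    nlinarith
  simp only [Set.mem_Icc, Prod.mk_le_mk]
  exact ⟨⟨h1.le, by linarith⟩, by linarith, hy⟩

lemma Om0_vol {E : ℝ} (hE : 1 < E) : (volume (Om0 E)).toReal = Real.log E := by
  have hE0 : 0 < E := by linarith
  rw [Measure.volume_eq_prod, Measure.prod_apply (Om0_meas E)]
  have hsl : ∀ x : ℝ, volume (Prod.mk x ⁻¹' Om0 E) =
      (Set.Ioc 0 1).indicator (fun x => ENNReal.ofReal (min (E ^ 2 * x) x⁻¹ - x)) x := by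
    intro x
    by_cases hx : 0 < x
    · have : Prod.mk x ⁻¹' Om0 E = Set.Ioc x (min (E ^ 2 * x) x⁻¹) := by
        ext y
        simp only [Om0, Set.mem_preimage, Set.mem_ofPred_eq, Set.mem_Ioc, le_min_iff, hx, true_and]
        rw [← one_div, le_div_iff₀ hx, mul_comm x y]
      rw [this, Real.volume_Ioc]
      by_cases hx1 : x ≤ 1
      · rw [Set.indicator_of_mem (by exact ⟨hx, hx1⟩)]
      · rw [Set.indicator_of_notMem (by simp; intro _; linarith)]
        rw [ENNReal.ofReal_eq_zero]
        have : x⁻¹ ≤ 1 := inv_le_one_of_one_le₀ (by linarith)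
        have := min_le_right (E ^ 2 * x) x⁻¹
        linarith
    · rw [Set.indicator_of_notMem (by simp; intro h; exact absurd h hx)]
      have : Prod.mk x ⁻¹' Om0 E = ∅ := by
        ext y; simp [Om0, hx]
      rw [this]; simp
  simp_rw [hsl]
  rw [lintegral_indicator measurableSet_Ioc]
  have hEinv : E⁻¹ < 1 := inv_lt_one_of_one_lt₀ hE
  have hEi0 : 0 < E⁻¹ := inv_pos.2 hE0
  have hnn : ∀ x ∈ Set.Ioc (0:ℝ) 1, 0 ≤ min (E ^ 2 * x) x⁻¹ - x := by
    rintro x ⟨h0, h1⟩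
    rw [sub_nonneg, le_min_iff]
    constructor
    · have : 1 ≤ E ^ 2 := by nlinarith
      nlinarith
    · rw [le_inv_comm₀ h0 h0]; exact h1.trans (one_le_inv_iff₀.2 ⟨h0, h1⟩)
  have hle : ∀ x ∈ Set.Ioc (0:ℝ) E⁻¹, min (E ^ 2 * x) x⁻¹ - x = (E ^ 2 - 1) * x := by
    rintro x ⟨h0, h1⟩
    rw [min_eq_left]
    · ring
    · rw [← one_div, le_div_iff₀ h0]
      have : E * x ≤ 1 := by
        calc E * x ≤ E * E⁻¹ := by gcongr
          _ = 1 := by field_simp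
      nlinarith [mul_pos hE0 h0]
  have hge : ∀ x ∈ Set.Ioc (E⁻¹:ℝ) 1, min (E ^ 2 * x) x⁻¹ - x = x⁻¹ - x := by
    rintro x ⟨h0, h1⟩
    have hx0 : 0 < x := by linarith
    rw [min_eq_right]
    rw [← one_div, div_le_iff₀ hx0]
    have : 1 ≤ E * x := by
      calc 1 = E * E⁻¹ := by field_simp
        _ ≤ E * x := by gcongr
    nlinarith [mul_pos hE0 hx0]
  have hi1 : IntervalIntegrable (fun x => (E ^ 2 - 1) * x) volume 0 E⁻¹ := by
    apply Continuous.intervalIntegrable; fun_prop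
  have hi2 : IntervalIntegrable (fun x : ℝ => x⁻¹ - x) volume E⁻¹ 1 := by
    apply ContinuousOn.intervalIntegrable
    apply ContinuousOn.sub _ continuousOn_id
    apply ContinuousOn.inv₀ continuousOn_id
    intro x hx
    rw [Set.uIcc_of_le hEinv.le] at hx
    simp only [id]; linarith [hx.1]
  have hj1 : IntervalIntegrable (fun x => min (E ^ 2 * x) x⁻¹ - x) volume 0 E⁻¹ := by
    refine hi1.congr ?_
    rw [Set.uIoc_of_le hEi0.le]
    intro x hx; exact (hle x hx).symm
  have hj2 : IntervalIntegrable (fun x => min (E ^ 2 * x) x⁻¹ - x) volume E⁻¹ 1 := by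
    refine hi2.congr ?_
    rw [Set.uIoc_of_le hEinv.le]
    intro x hx; exact (hge x hx).symm
  have hj := hj1.trans hj2
  rw [intervalIntegrable_iff_integrableOn_Ioc_of_le zero_le_one] at hj
  rw [← ofReal_integral_eq_lintegral_ofReal hj]
  · rw [ENNReal.toReal_ofReal]
    · rw [← intervalIntegral.integral_of_le zero_le_one, ← intervalIntegral.integral_add_adjacent_intervals hj1 hj2]
      have e1 : ∫ x in (0:ℝ)..E⁻¹, (min (E ^ 2 * x) x⁻¹ - x) = ∫ x in (0:ℝ)..E⁻¹, (E ^ 2 - 1) * x := by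
        rw [intervalIntegral.integral_of_le hEi0.le, intervalIntegral.integral_of_le hEi0.le]
        exact setIntegral_congr_fun measurableSet_Ioc hle
      have e2 : ∫ x in (E⁻¹:ℝ)..1, (min (E ^ 2 * x) x⁻¹ - x) = ∫ x in (E⁻¹:ℝ)..1, (x⁻¹ - x) := by
        rw [intervalIntegral.integral_of_le hEinv.le, intervalIntegral.integral_of_le hEinv.le]
        exact setIntegral_congr_fun measurableSet_Ioc hge
      rw [e1, e2, intervalIntegral.integral_const_mul, integral_id, intervalIntegral.integral_sub, integral_id,
        integral_inv_of_pos hEi0 one_pos]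
      · simp only [one_div, inv_inv]
        field_simp
        ring
      · apply ContinuousOn.intervalIntegrable
        apply ContinuousOn.inv₀ continuousOn_id
        intro x hx
        rw [Set.uIcc_of_le hEinv.le] at hx
        simp only [id]; linarith [hx.1]
      · apply Continuous.intervalIntegrable; fun_prop
    · exact setIntegral_nonneg measurableSet_Ioc hnn
  · exact (ae_restrict_iff' measurableSet_Ioc).2 (Eventually.of_forall hnn)

lemma null_of_slices {s : Set (ℝ × ℝ)} (hs : MeasurableSet s)
    (h : ∀ x y y', (x, y) ∈ s → (x, y') ∈ s → y = y') : volume s = 0 := by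
  rw [Measure.volume_eq_prod, Measure.measure_prod_null hs]
  refine Eventually.of_forall fun x => ?_
  apply Set.Subsingleton.measure_zero
  intro y hy y' hy'
  exact h x y y' hy hy'

lemma Om0_frontier {E : ℝ} : volume (frontier (Om0 E)) = 0 := by
  have hc : closure (Om0 E) ⊆ {p | 0 ≤ p.1 ∧ p.1 ≤ p.2 ∧ p.2 ≤ E ^ 2 * p.1 ∧ p.1 * p.2 ≤ 1} := by
    apply closure_minimal
    · rintro p ⟨h1, h2, h3, h4⟩; exact ⟨h1.le, h2.le, h3, h4⟩
    · refine IsClosed.inter (isClosed_le continuous_const continuous_fst) ?_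
      refine IsClosed.inter (isClosed_le continuous_fst continuous_snd) ?_
      refine IsClosed.inter (isClosed_le continuous_snd (continuous_const.mul continuous_fst)) ?_
      exact isClosed_le (continuous_fst.mul continuous_snd) continuous_const
  have hi : {p : ℝ × ℝ | 0 < p.1 ∧ p.1 < p.2 ∧ p.2 < E ^ 2 * p.1 ∧ p.1 * p.2 < 1} ⊆ interior (Om0 E) := by
    apply interior_maximal
    · rintro p ⟨h1, h2, h3, h4⟩; exact ⟨h1, h2, h3.le, h4.le⟩
    · refine IsOpen.inter (isOpen_lt continuous_const continuous_fst) ?_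
      refine IsOpen.inter (isOpen_lt continuous_fst continuous_snd) ?_
      refine IsOpen.inter (isOpen_lt continuous_snd (continuous_const.mul continuous_fst)) ?_
      exact isOpen_lt (continuous_fst.mul continuous_snd) continuous_const
  have hsub : frontier (Om0 E) ⊆ {p | p.1 = p.2} ∪ ({p | p.2 = E ^ 2 * p.1} ∪ {p | p.1 * p.2 = 1}) := by
    rintro p ⟨h1, h2⟩
    obtain ⟨a1, a2, a3, a4⟩ := hc h1
    by_contra hcon
    simp only [Set.mem_union, Set.mem_ofPred_eq, not_or] at hcon
    obtain ⟨b1, b2, b3⟩ := hcon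
    apply h2
    apply hi
    refine ⟨?_, lt_of_le_of_ne a2 b1, lt_of_le_of_ne a3 b2, lt_of_le_of_ne a4 b3⟩
    refine lt_of_le_of_ne a1 fun h => b1 ?_
    rw [← h] at a2 a3 ⊢
    linarith
  refine measure_mono_null hsub ?_
  rw [measure_union_null_iff, measure_union_null_iff]
  refine ⟨?_, ?_, ?_⟩
  · refine null_of_slices (isClosed_eq continuous_fst continuous_snd).measurableSet ?_
    intro x y y' h h'; exact h.symm.trans h'
  · refine null_of_slices (isClosed_eq continuous_snd (continuous_const.mul continuous_fst)).measurableSet ?_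
    intro x y y' h h'; exact h.trans h'.symm
  · refine null_of_slices (isClosed_eq (continuous_fst.mul continuous_snd) continuous_const).measurableSet ?_
    intro x y y' h h'
    simp only [Set.mem_ofPred_eq] at h h'
    have hx : x ≠ 0 := by rintro rfl; simp at h
    exact mul_left_cancel₀ hx (h.trans h'.symm)

theorem lattice_linear (Ω : Set (ℝ × ℝ)) (hm : MeasurableSet Ω) (hb : Bornology.IsBounded Ω)
    (hf : volume (frontier Ω) = 0) (α β γ δ : ℝ) (hdet : α * δ - β * γ ≠ 0)
    (N : ℕ) (hN : 0 < N) (v : ℤ × ℤ) :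
    Tendsto (fun K : ℕ => (Set.ncard {w : ℤ × ℤ |
        ((α * (((v.1 + N * w.1 : ℤ) : ℝ) / K) + β * (((v.2 + N * w.2 : ℤ) : ℝ) / K),
          γ * (((v.1 + N * w.1 : ℤ) : ℝ) / K) + δ * (((v.2 + N * w.2 : ℤ) : ℝ) / K)) : ℝ × ℝ) ∈ Ω} : ℝ) / (K : ℝ) ^ 2)
      atTop (nhds ((volume Ω).toReal / |α * δ - β * γ| / (N : ℝ) ^ 2)) := by
  let T : ℝ × ℝ →ₗ[ℝ] ℝ × ℝ := Matrix.toLin (Module.Basis.finTwoProd ℝ) (Module.Basis.finTwoProd ℝ) !![α, β; γ, δ]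
  have hTdet : LinearMap.det T = α * δ - β * γ := by
    simp only [T]; rw [LinearMap.det_toLin, Matrix.det_fin_two_of]
  have hTapp : ∀ p : ℝ × ℝ, T p = (α * p.1 + β * p.2, γ * p.1 + δ * p.2) := by
    intro p
    simp only [T]; rw [Matrix.toLin_finTwoProd_apply]
  let e : (ℝ × ℝ) ≃L[ℝ] (ℝ × ℝ) := (LinearEquiv.ofIsUnitDet (f := T) (v := Module.Basis.finTwoProd ℝ) (v' := Module.Basis.finTwoProd ℝ)
    (by
      have : LinearMap.toMatrix (Module.Basis.finTwoProd ℝ) (Module.Basis.finTwoProd ℝ) T = !![α, β; γ, δ] := by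
        simp only [T]; rw [LinearMap.toMatrix_toLin]
      rw [this, Matrix.det_fin_two_of]; exact isUnit_iff_ne_zero.2 hdet)).toContinuousLinearEquiv
  have heT : ∀ p, e p = T p := fun p => rfl
  have hpre : e ⁻¹' Ω = T ⁻¹' Ω := rfl
  have hvol : (volume (T ⁻¹' Ω)).toReal = (volume Ω).toReal / |α * δ - β * γ| := by
    rw [Measure.addHaar_preimage_linearMap volume (by rw [hTdet]; exact hdet), hTdet, ENNReal.toReal_mul,
      ENNReal.toReal_ofReal (abs_nonneg _), abs_inv]
    field_simp
  have hm' : MeasurableSet (T ⁻¹' Ω) := by rw [← hpre]; exact e.continuous.measurable hm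
  have hb' : Bornology.IsBounded (T ⁻¹' Ω) := by
    have : T ⁻¹' Ω = e.symm '' Ω := by rw [← hpre]; exact (e.toEquiv.image_symm_eq_preimage Ω).symm
    rw [this]
    exact e.symm.lipschitz.isBounded_image hb
  have hf' : volume (frontier (T ⁻¹' Ω)) = 0 := by
    have h1 := e.toHomeomorph.preimage_frontier Ω
    have h2 : frontier (e.toHomeomorph ⁻¹' Ω) = T ⁻¹' (frontier Ω) := h1.symm
    refine (congrArg volume h2).trans ?_
    rw [Measure.addHaar_preimage_linearMap volume (by rw [hTdet]; exact hdet), hf, mul_zero]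
  have := shifted_lattice (T ⁻¹' Ω) hm' hb' hf' N hN v
  rw [hvol] at this
  refine this.congr fun K => ?_
  simp only [Set.mem_preimage, hTapp]

end P2e

section P2f

lemma formEquiv_iff (f g : ℤ × ℤ × ℤ) : formEquiv f g ↔ ∃ α β γ δ : ℤ, α * δ - β * γ = 1 ∧
    ∀ x y, formVal g x y = formVal f (α * x + β * y) (γ * x + δ * y) := by
  constructor
  · rintro ⟨M, hM⟩
    refine ⟨M.1 0 0, M.1 0 1, M.1 1 0, M.1 1 1, ?_, hM⟩
    have := M.2
    rwa [Matrix.det_fin_two] at this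
  · rintro ⟨α, β, γ, δ, h, hM⟩
    refine ⟨⟨!![α, β; γ, δ], by rw [Matrix.det_fin_two_of]; exact h⟩, ?_⟩
    simpa using hM

lemma form_ext {f g : ℤ × ℤ × ℤ} (h : ∀ x y, formVal f x y = formVal g x y) : f = g := by
  obtain ⟨a, b, c⟩ := f
  obtain ⟨a', b', c'⟩ := g
  have h1 := h 1 0
  have h2 := h 0 1
  have h3 := h 1 1
  simp [formVal] at h1 h2 h3
  subst h1 h2
  simp; linarith

lemma formEquiv_refl (f : ℤ × ℤ × ℤ) : formEquiv f f :=
  (formEquiv_iff f f).2 ⟨1, 0, 0, 1, by norm_num, by intros; simp⟩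

lemma formEquiv_symm {f g : ℤ × ℤ × ℤ} (h : formEquiv f g) : formEquiv g f := by
  rw [formEquiv_iff] at h ⊢
  obtain ⟨α, β, γ, δ, h, hM⟩ := h
  refine ⟨δ, -β, -γ, α, by linarith, fun x y => ?_⟩
  rw [hM]
  congr 1
  · linear_combination (-x) * h
  · linear_combination (-y) * h

lemma formEquiv_trans {f g k : ℤ × ℤ × ℤ} (h : formEquiv f g) (h' : formEquiv g k) : formEquiv f k := by
  rw [formEquiv_iff] at h h' ⊢
  obtain ⟨α, β, γ, δ, h, hM⟩ := h
  obtain ⟨α', β', γ', δ', h', hM'⟩ := h'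
  refine ⟨α * α' + β * γ', α * β' + β * δ', γ * α' + δ * γ', γ * β' + δ * δ', ?_, fun x y => ?_⟩
  · linear_combination (α'*δ'-β'*γ') * h + h'
  · rw [hM', hM]; congr 1 <;> ring

/-- action of a substitution on a form -/
def actF (f : ℤ × ℤ × ℤ) (α β γ δ : ℤ) : ℤ × ℤ × ℤ :=
  (formVal f α γ, 2 * f.1 * α * β + f.2.1 * (α * δ + β * γ) + 2 * f.2.2 * γ * δ, formVal f β δ)

lemma formVal_act (f : ℤ × ℤ × ℤ) (α β γ δ x y : ℤ) :
    formVal (actF f α β γ δ) x y = formVal f (α * x + β * y) (γ * x + δ * y) := by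
  simp only [formVal, actF]; ring

lemma formDisc_act (f : ℤ × ℤ × ℤ) {α β γ δ : ℤ} (h : α * δ - β * γ = 1) :
    formDisc (actF f α β γ δ) = formDisc f := by
  have : formDisc (actF f α β γ δ) = formDisc f * (α * δ - β * γ) ^ 2 := by
    simp only [formVal, actF, formDisc]; ring
  rw [this, h]; ring

lemma formEquiv_act (f : ℤ × ℤ × ℤ) {α β γ δ : ℤ} (h : α * δ - β * γ = 1) :
    formEquiv f (actF f α β γ δ) :=
  (formEquiv_iff _ _).2 ⟨α, β, γ, δ, h, fun x y => formVal_act f α β γ δ x y⟩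

lemma prim_iff (f : ℤ × ℤ × ℤ) : IsPrimitiveForm f ↔
    ∀ p : ℕ, p.Prime → ¬ ((p : ℤ) ∣ f.1 ∧ (p : ℤ) ∣ f.2.1 ∧ (p : ℤ) ∣ f.2.2) := by
  unfold IsPrimitiveForm
  constructor
  · intro h p hp ⟨h1, h2, h3⟩
    have h4 : (p : ℤ) ∣ ((Int.gcd f.2.1 f.2.2 : ℕ) : ℤ) := Int.dvd_coe_gcd h2 h3
    have h5 : (p : ℤ) ∣ ((Int.gcd f.1 (Int.gcd f.2.1 f.2.2) : ℕ) : ℤ) := Int.dvd_coe_gcd h1 h4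
    rw [h] at h5
    exact hp.one_lt.ne' (Nat.dvd_one.1 (by exact_mod_cast h5))
  · intro h
    by_contra hc
    obtain ⟨p, hp, hd⟩ := Nat.exists_prime_and_dvd hc
    have hd' : (p : ℤ) ∣ ((Int.gcd f.1 (Int.gcd f.2.1 f.2.2) : ℕ) : ℤ) := by exact_mod_cast hd
    have h6 := hd'.trans (Int.gcd_dvd_right _ _)
    exact h p hp ⟨hd'.trans (Int.gcd_dvd_left _ _), h6.trans (Int.gcd_dvd_left _ _), h6.trans (Int.gcd_dvd_right _ _)⟩

lemma prim_of_equiv {f g : ℤ × ℤ × ℤ} (h : formEquiv f g) (hf : IsPrimitiveForm f) : IsPrimitiveForm g := by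
  rw [prim_iff] at hf ⊢
  rintro p hp ⟨h1, h2, h3⟩
  have hall : ∀ x y, (p : ℤ) ∣ formVal g x y := by
    intro x y; unfold formVal
    exact dvd_add (dvd_add (h1.mul_right _) ((h2.mul_right _).mul_right _)) (h3.mul_right _)
  have h' := formEquiv_symm h
  rw [formEquiv_iff] at h'
  obtain ⟨α, β, γ, δ, _, hM⟩ := h'
  have hall' : ∀ x y, (p : ℤ) ∣ formVal f x y := fun x y => by rw [hM]; exact hall _ _
  apply hf p hp
  have e1 := hall' 1 0
  have e2 := hall' 0 1
  have e3 := hall' 1 1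
  simp [formVal] at e1 e2 e3
  refine ⟨e1, ?_, e2⟩
  have : f.2.1 = f.1 + f.2.1 + f.2.2 - f.1 - f.2.2 := by ring
  rw [this]
  exact dvd_sub (dvd_sub e3 e1) e2

lemma disc_of_equiv {f g : ℤ × ℤ × ℤ} (h : formEquiv f g) : formDisc g = formDisc f := by
  rw [formEquiv_iff] at h
  obtain ⟨α, β, γ, δ, h, hM⟩ := h
  have : g = actF f α β γ δ := form_ext fun x y => by rw [hM, formVal_act]
  rw [this, formDisc_act f h]

lemma exists_coprime_value (f : ℤ × ℤ × ℤ) (hf : IsPrimitiveForm f) {N : ℕ} (hN : N ≠ 0) :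
    ∃ x y : ℤ, IsCoprime x y ∧ IsCoprime (formVal f x y) (N : ℤ) := by
  classical
  rw [prim_iff] at hf
  let X : Finset ℕ := N.primeFactors.filter (fun p => (p : ℤ) ∣ f.1 ∧ ¬ (p : ℤ) ∣ f.2.2)
  let Y : Finset ℕ := N.primeFactors.filter (fun p => ¬ (p : ℤ) ∣ f.1)
  have hXp : ∀ p ∈ X, p.Prime := fun p hp => Nat.prime_of_mem_primeFactors (Finset.mem_filter.1 hp).1
  have hYp : ∀ p ∈ Y, p.Prime := fun p hp => Nat.prime_of_mem_primeFactors (Finset.mem_filter.1 hp).1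
  have key : ∀ (S : Finset ℕ), (∀ p ∈ S, p.Prime) → ∀ p : ℕ, p.Prime → ((p : ℤ) ∣ ((∏ q ∈ S, q : ℕ) : ℤ) ↔ p ∈ S) := by
    intro S hS p hp
    rw [Int.natCast_dvd_natCast]
    constructor
    · intro h
      rw [Prime.dvd_finsetProd_iff hp.prime] at h
      obtain ⟨q, hq, hd⟩ := h
      rwa [(Nat.prime_dvd_prime_iff_eq hp (hS q hq)).1 hd]
    · intro h; exact Finset.dvd_prod_of_mem _ h
  set x : ℤ := ((∏ q ∈ X, q : ℕ) : ℤ) with hx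
  set y : ℤ := ((∏ q ∈ Y, q : ℕ) : ℤ) with hy
  have hxd : ∀ p : ℕ, p.Prime → ((p : ℤ) ∣ x ↔ p ∈ X) := key X hXp
  have hyd : ∀ p : ℕ, p.Prime → ((p : ℤ) ∣ y ↔ p ∈ Y) := key Y hYp
  refine ⟨x, y, ?_, ?_⟩
  · rw [Int.isCoprime_iff_gcd_eq_one]
    by_contra hc
    obtain ⟨p, hp, hd⟩ := Nat.exists_prime_and_dvd hc
    have hd' : (p : ℤ) ∣ ((Int.gcd x y : ℕ) : ℤ) := by exact_mod_cast hd
    have h1 := (hxd p hp).1 (hd'.trans (Int.gcd_dvd_left _ _))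
    have h2 := (hyd p hp).1 (hd'.trans (Int.gcd_dvd_right _ _))
    exact (Finset.mem_filter.1 h2).2 (Finset.mem_filter.1 h1).2.1
  · rw [Int.isCoprime_iff_gcd_eq_one]
    by_contra hc
    obtain ⟨p, hp, hd⟩ := Nat.exists_prime_and_dvd hc
    have hd' : (p : ℤ) ∣ ((Int.gcd (formVal f x y) N : ℕ) : ℤ) := by exact_mod_cast hd
    have hv := (hd'.trans (Int.gcd_dvd_left _ _))
    have hpN : p ∈ N.primeFactors := by
      rw [Nat.mem_primeFactors]
      refine ⟨hp, ?_, hN⟩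
      have := (hd'.trans (Int.gcd_dvd_right _ _))
      exact_mod_cast this
    have hpi : Prime (p : ℤ) := Nat.prime_iff_prime_int.1 hp
    have hx' := hxd p hp
    have hy' := hyd p hp
    simp only [X, Y, Finset.mem_filter, hpN, true_and] at hx' hy'
    unfold formVal at hv
    by_cases ha : (p : ℤ) ∣ f.1
    · by_cases hcc : (p : ℤ) ∣ f.2.2
      · have hxn : ¬ (p : ℤ) ∣ x := by rw [hx']; tauto
        have hyn : ¬ (p : ℤ) ∣ y := by rw [hy']; tauto
        have hb : ¬ (p : ℤ) ∣ f.2.1 := fun hb => hf p hp ⟨ha, hb, hcc⟩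
        have : (p : ℤ) ∣ f.2.1 * x * y := by
          have e : f.2.1 * x * y = (f.1 * x ^ 2 + f.2.1 * x * y + f.2.2 * y ^ 2) - f.1 * x ^ 2 - f.2.2 * y ^ 2 := by ring
          rw [e]; exact dvd_sub (dvd_sub hv (ha.mul_right _)) (hcc.mul_right _)
        rcases hpi.dvd_or_dvd this with h | h
        · rcases hpi.dvd_or_dvd h with h | h
          · exact hb h
          · exact hxn h
        · exact hyn h
      · have hxn : (p : ℤ) ∣ x := by rw [hx']; tauto
        have hyn : ¬ (p : ℤ) ∣ y := by rw [hy']; tauto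
        have : (p : ℤ) ∣ f.2.2 * y ^ 2 := by
          have e : f.2.2 * y ^ 2 = (f.1 * x ^ 2 + f.2.1 * x * y + f.2.2 * y ^ 2) - f.1 * x ^ 2 - x * (f.2.1 * y) := by ring
          rw [e]; exact dvd_sub (dvd_sub hv (ha.mul_right _)) (hxn.mul_right _)
        rcases hpi.dvd_or_dvd this with h | h
        · exact hcc h
        · exact hyn (hpi.dvd_of_dvd_pow h)
    · have hxn : ¬ (p : ℤ) ∣ x := by rw [hx']; tauto
      have hyn : (p : ℤ) ∣ y := by rw [hy']; tauto
      have : (p : ℤ) ∣ f.1 * x ^ 2 := by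
        have e : f.1 * x ^ 2 = (f.1 * x ^ 2 + f.2.1 * x * y + f.2.2 * y ^ 2) - y * (f.2.1 * x) - y * (f.2.2 * y) := by ring
        rw [e]; exact dvd_sub (dvd_sub hv (hyn.mul_right _)) (hyn.mul_right _)
      rcases hpi.dvd_or_dvd this with h | h
      · exact ha h
      · exact hxn (hpi.dvd_of_dvd_pow h)

lemma exists_good_rep (f : ℤ × ℤ × ℤ) (hf : IsPrimitiveForm f) {N : ℕ} (hN : N ≠ 0) :
    ∃ g, formEquiv f g ∧ IsCoprime g.1 (N : ℤ) := by
  obtain ⟨x, y, ⟨s, t, hst⟩, hc⟩ := exists_coprime_value f hf hN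
  exact ⟨actF f x (-t) y s, formEquiv_act f (by linarith), hc⟩

/-- the class parameter -/
def Bpar (f : ℤ × ℤ × ℤ) (v : ℤ × ℤ) : ℤ :=
  (actF f v.1 (-Int.gcdB v.1 v.2) v.2 (Int.gcdA v.1 v.2)).2.1

lemma bez {v : ℤ × ℤ} (h : Int.gcd v.1 v.2 = 1) :
    v.1 * Int.gcdA v.1 v.2 - (-Int.gcdB v.1 v.2) * v.2 = 1 := by
  have := Int.gcd_eq_gcd_ab v.1 v.2
  rw [h] at this; push_cast at this; linarith

lemma Bpar_sq {f : ℤ × ℤ × ℤ} {v : ℤ × ℤ} (h : Int.gcd v.1 v.2 = 1) :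
    ∃ C, Bpar f v ^ 2 - 4 * formVal f v.1 v.2 * C = formDisc f ∧
      actF f v.1 (-Int.gcdB v.1 v.2) v.2 (Int.gcdA v.1 v.2) = (formVal f v.1 v.2, Bpar f v, C) :=
  ⟨(actF f v.1 (-Int.gcdB v.1 v.2) v.2 (Int.gcdA v.1 v.2)).2.2, formDisc_act f (bez h), rfl⟩

lemma Bpar_inj {f f' : ℤ × ℤ × ℤ} (hd : formDisc f = formDisc f') {v v' : ℤ × ℤ}
    (h : Int.gcd v.1 v.2 = 1) (h' : Int.gcd v'.1 v'.2 = 1) {m : ℤ} (hm : Odd m)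
    (hv : formVal f v.1 v.2 = m) (hv' : formVal f' v'.1 v'.2 = m) (hB : m ∣ Bpar f' v' - Bpar f v) :
    ∃ α β γ δ : ℤ, α * δ - β * γ = 1 ∧ (∀ x y, formVal f' x y = formVal f (α * x + β * y) (γ * x + δ * y)) ∧
      v.1 = α * v'.1 + β * v'.2 ∧ v.2 = γ * v'.1 + δ * v'.2 := by
  obtain ⟨C, hC, hact⟩ := Bpar_sq (f := f) h
  obtain ⟨C', hC', hact'⟩ := Bpar_sq (f := f') h'
  rw [hv] at hC hact
  rw [hv'] at hC' hact'
  set B := Bpar f v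
  set B' := Bpar f' v'
  have hm0 : m ≠ 0 := by rintro rfl; simp at hm
  have hpar : (2 : ℤ) ∣ B' - B := by
    have h4 : (2 : ℤ) ∣ B' ^ 2 - B ^ 2 := ⟨2 * m * (C' - C), by linear_combination hC' - hC - hd⟩
    rw [← even_iff_two_dvd] at h4 ⊢
    rw [Int.even_sub, Int.even_pow' two_ne_zero, Int.even_pow' two_ne_zero] at h4
    rw [Int.even_sub]; exact h4
  have h2m : IsCoprime (2 : ℤ) m := by
    obtain ⟨k, hk⟩ := hm
    exact ⟨-k, 1, by rw [hk]; ring⟩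
  obtain ⟨k, hk⟩ := h2m.mul_dvd hpar hB
  have hB' : B' = B + 2 * m * k := by linarith
  have hCC : C' = m * k ^ 2 + B * k + C := by
    have : 4 * m * C' = 4 * m * (m * k ^ 2 + B * k + C) := by
      rw [hB'] at hC'
      linear_combination -hC' + hC + hd
    exact mul_left_cancel₀ (by simpa using hm0) this
  have hT : ∀ x y, formVal (m, B', C') x y = formVal (m, B, C) (x + k * y) y := by
    intro x y; simp only [formVal]; rw [hB', hCC]; ring
  set z := -Int.gcdB v.1 v.2
  set w := Int.gcdA v.1 v.2
  set z' := -Int.gcdB v'.1 v'.2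
  set w' := Int.gcdA v'.1 v'.2
  have hb : v.1 * w - z * v.2 = 1 := bez h
  have hb' : v'.1 * w' - z' * v'.2 = 1 := bez h'
  have hf' : ∀ x y, formVal f' x y = formVal (m, B', C') (w' * x - z' * y) (- v'.2 * x + v'.1 * y) := by
    intro x y
    rw [← hact', formVal_act]
    congr 1
    · linear_combination (-x) * hb'
    · linear_combination (-y) * hb'
  refine ⟨v.1 * (w' - k * v'.2) - z * v'.2, v.1 * (-z' + k * v'.1) + z * v'.1,
    v.2 * (w' - k * v'.2) - w * v'.2, v.2 * (-z' + k * v'.1) + w * v'.1, ?_, ?_, ?_, ?_⟩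
  · linear_combination (v'.1*w'-z'*v'.2) * hb + hb'
  · intro x y
    rw [hf', hT, ← hact, formVal_act]
    congr 1 <;> ring
  · linear_combination (-v.1) * hb'
  · linear_combination (-v.2) * hb'

lemma aut_struct {f : ℤ × ℤ × ℤ} (hf : IsPrimitiveForm f) (ha : f.1 ≠ 0) {α β γ δ : ℤ}
    (hdet : α * δ - β * γ = 1)
    (hA : ∀ x y, formVal f x y = formVal f (α * x + β * y) (γ * x + δ * y)) :
    ∃ t u : ℤ, t ^ 2 - formDisc f * u ^ 2 = 4 ∧ 2 * α = t - f.2.1 * u ∧ β = - f.2.2 * u ∧ γ = f.1 * u ∧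
      2 * δ = t + f.2.1 * u := by
  obtain ⟨a, b, c⟩ := f
  simp only at ha ⊢
  have e1 := hA 1 0
  have e2 := hA 0 1
  have e3 := hA 1 1
  simp only [formVal] at e1 e2 e3
  have g1 : a * α ^ 2 + b * α * γ + c * γ ^ 2 = a := by linear_combination -e1
  have g2 : 2 * a * α * β + b * (α * δ + β * γ) + 2 * c * γ * δ = b := by linear_combination e1 + e2 - e3
  have k1 : a * (δ - α) = b * γ := by
    have : 2 * (a * (δ - α) - b * γ) = 0 := by
      linear_combination (-2 * δ) * g1 + γ * g2 + (2 * a * α + b * γ) * hdet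
    linarith
  have k2 : a * β = - c * γ := by
    have : 2 * (a * β + c * γ) = 0 := by
      linear_combination (-2 * β) * g1 + α * g2 - (b * α + 2 * c * γ) * hdet
    linarith
  have hdvd : a ∣ γ := by
    have h1 := Int.gcd_eq_gcd_ab a (Int.gcd b c)
    have h2 := Int.gcd_eq_gcd_ab b c
    unfold IsPrimitiveForm at hf
    simp only at hf
    rw [hf] at h1
    rw [h2] at h1
    push_cast at h1
    rw [← h2] at h1
    generalize a.gcdA (b.gcd c : ℤ) = r at h1
    generalize a.gcdB (b.gcd c : ℤ) = s at h1
    refine ⟨r * γ + s * (δ - α) * b.gcdA c - s * β * b.gcdB c, ?_⟩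
    rw [h2] at h1
    linear_combination γ * h1 - s * b.gcdA c * k1 + s * b.gcdB c * k2
  obtain ⟨u, rfl⟩ := hdvd
  have hδ : δ - α = b * u := mul_left_cancel₀ ha (by linear_combination k1)
  have hβ : β = -c * u := mul_left_cancel₀ ha (by linear_combination k2)
  refine ⟨α + δ, u, ?_, by linarith, hβ, rfl, by linarith⟩
  simp only [formDisc]
  subst hβ
  linear_combination 4 * hdet + (δ - α + b * u) * hδ

end P2f

section P2g

/-- The Pell equation is solvable. -/
def PellOK (d : ℕ) : Prop := ∃ t u : ℕ, 0 < t ∧ 0 < u ∧ (t : ℤ) ^ 2 - (d : ℤ) * (u : ℤ) ^ 2 = 4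

lemma td_spec {d : ℕ} (h : PellOK d) : 0 < td d ∧ ∃ u : ℕ, 0 < u ∧ (td d : ℤ) ^ 2 - d * (u : ℤ) ^ 2 = 4 := by
  obtain ⟨t, u, h1, h2, h3⟩ := h
  exact Nat.sInf_mem (s := {t : ℕ | 0 < t ∧ ∃ u : ℕ, 0 < u ∧ (t : ℤ) ^ 2 - d * (u : ℤ) ^ 2 = 4}) ⟨t, h1, u, h2, h3⟩

lemma td_min {d : ℕ} {t u : ℕ} (h1 : 0 < t) (h2 : 0 < u) (h3 : (t : ℤ) ^ 2 - (d : ℤ) * (u : ℤ) ^ 2 = 4) :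
    td d ≤ t :=
  Nat.sInf_le (s := {t : ℕ | 0 < t ∧ ∃ u : ℕ, 0 < u ∧ (t : ℤ) ^ 2 - d * (u : ℤ) ^ 2 = 4}) ⟨h1, u, h2, h3⟩

lemma ud_spec {d : ℕ} (h : PellOK d) : 0 < ud d ∧ (td d : ℤ) ^ 2 - d * (ud d : ℤ) ^ 2 = 4 := by
  obtain ⟨_, u, h2, h3⟩ := td_spec h
  exact Nat.sInf_mem (s := {u : ℕ | 0 < u ∧ (td d : ℤ) ^ 2 - d * (u : ℤ) ^ 2 = 4}) ⟨u, h2, h3⟩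

lemma pell_real {d : ℕ} {t u : ℤ} (h : t ^ 2 - (d : ℤ) * u ^ 2 = 4) :
    ((t + u * Real.sqrt d) / 2) * ((t - u * Real.sqrt d) / 2) = (1 : ℝ) := by
  have h' : (t : ℝ) ^ 2 - d * (u : ℝ) ^ 2 = 4 := by exact_mod_cast h
  have hs : Real.sqrt d ^ 2 = d := Real.sq_sqrt (by positivity)
  linear_combination (1 / 4) * h' - (1/4) * u ^ 2 * hs

lemma eps_eq (d : ℕ) : eps d = (((td d : ℤ) : ℝ) + ((ud d : ℤ) : ℝ) * Real.sqrt d) / 2 := by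
  simp [eps]

lemma eps_gt_one {d : ℕ} (hd : d ≠ 0) (h : PellOK d) : 1 < eps d := by
  have h1 := (ud_spec h).1
  have h2 := (ud_spec h).2
  have h3 := (td_spec h).1
  have hd1 : 1 ≤ d := Nat.one_le_iff_ne_zero.2 hd
  have : 2 < (td d : ℤ) := by
    have : (0 : ℤ) < d * (ud d : ℤ) ^ 2 := by positivity
    nlinarith
  have h4 : (2 : ℝ) < td d := by exact_mod_cast this
  have : 0 ≤ (ud d : ℝ) * Real.sqrt d := by positivity
  rw [eps_eq]; push_cast; linarith

lemma pell_parity {d t u : ℤ} (h : t ^ 2 - d * u ^ 2 = 4) : Even (t - d * u) := by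
  have h1 : Even (t ^ 2 - d * u ^ 2) := by rw [h]; decide
  simp only [Int.even_sub, Int.even_mul, Int.even_pow' two_ne_zero] at h1 ⊢
  exact h1

lemma pell_mul {d : ℕ} {t u t' u' : ℤ} (h : t ^ 2 - (d : ℤ) * u ^ 2 = 4) (h' : t' ^ 2 - (d : ℤ) * u' ^ 2 = 4) :
    ∃ s w : ℤ, s ^ 2 - (d : ℤ) * w ^ 2 = 4 ∧
      ((s + w * Real.sqrt d) / 2 : ℝ) = ((t + u * Real.sqrt d) / 2) * ((t' + u' * Real.sqrt d) / 2) := by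
  have hp := pell_parity h
  have hp' := pell_parity h'
  obtain ⟨s, hs⟩ : Even (t * t' + d * u * u') := by
    simp only [Int.even_sub, Int.even_add, Int.even_mul] at hp hp' ⊢; tauto
  obtain ⟨w, hw⟩ : Even (t * u' + u * t') := by
    simp only [Int.even_sub, Int.even_add, Int.even_mul] at hp hp' ⊢; tauto
  refine ⟨s, w, ?_, ?_⟩
  · have : 4 * (s ^ 2 - (d : ℤ) * w ^ 2) = 16 := by
      linear_combination (t' ^ 2 - (d : ℤ) * u' ^ 2) * h + 4 * h' - (t * t' + d * u * u' + 2 * s) * hs + d * (t * u' + u * t' + 2 * w) * hw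
    linarith
  · have hs' : (t * t' + d * u * u' : ℝ) = s + s := by exact_mod_cast hs
    have hw' : (t * u' + u * t' : ℝ) = w + w := by exact_mod_cast hw
    have hq : Real.sqrt d ^ 2 = d := Real.sq_sqrt (by positivity)
    linear_combination (-1/4) * hs' - (1/4) * Real.sqrt d * hw' - (1/4) * u * u' * hq

lemma pell_zpow {d : ℕ} (hd : d ≠ 0) (h : PellOK d) (k : ℤ) :
    ∃ t u : ℤ, t ^ 2 - (d : ℤ) * u ^ 2 = 4 ∧ ((t + u * Real.sqrt d) / 2 : ℝ) = eps d ^ k := by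
  have hN : ∀ k : ℕ, ∃ t u : ℤ, t ^ 2 - (d : ℤ) * u ^ 2 = 4 ∧ ((t + u * Real.sqrt d) / 2 : ℝ) = eps d ^ k := by
    intro k
    induction k with
    | zero => exact ⟨2, 0, by norm_num, by norm_num⟩
    | succ k ih =>
      obtain ⟨t, u, h1, h2⟩ := ih
      obtain ⟨s, w, h3, h4⟩ := pell_mul h1 (ud_spec h).2
      exact ⟨s, w, h3, by rw [h4, h2, ← eps_eq, pow_succ]⟩
  rcases Int.eq_nat_or_neg k with ⟨n, rfl | rfl⟩
  · simpa using hN n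
  · obtain ⟨t, u, h1, h2⟩ := hN n
    refine ⟨t, -u, by simpa using h1, ?_⟩
    have := pell_real h1
    rw [zpow_neg, zpow_natCast, ← h2]
    have h0 : ((t + u * Real.sqrt d) / 2 : ℝ) ≠ 0 := left_ne_zero_of_mul_eq_one this
    apply eq_inv_of_mul_eq_one_left; push_cast; linear_combination this

lemma pell_small {d : ℕ} (hd : d ≠ 0) (h : PellOK d) {t u : ℤ} (ht : t ^ 2 - (d : ℤ) * u ^ 2 = 4)
    (h1 : (eps d)⁻¹ < (t + u * Real.sqrt d) / 2) (h2 : (t + u * Real.sqrt d) / 2 < eps d) : t = 2 ∧ u = 0 := by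
  have hr := pell_real ht
  have he := eps_gt_one hd h
  have hre := pell_real (ud_spec h).2
  rw [← eps_eq] at hre
  set l := (t + u * Real.sqrt d) / 2 with hl
  set l' := (t - u * Real.sqrt d) / 2 with hl'
  set e := eps d with hedef
  set e' := (((td d : ℤ) : ℝ) - ((ud d : ℤ) : ℝ) * Real.sqrt d) / 2 with he'
  have hepos : 0 < e := by linarith
  have hee : e⁻¹ = e' := inv_eq_of_mul_eq_one_right hre
  have hlpos : 0 < l := lt_trans (inv_pos.2 hepos) h1
  have hll : 0 < l' := by by_contra hc; nlinarith
  have hlt : l * e > 1 := by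
    have := mul_lt_mul_of_pos_right h1 hepos
    rwa [inv_mul_cancel₀ hepos.ne'] at this
  have hlt2 : l + l' < e + e' := by
    have e1 : 0 < (e - l) * (l * e - 1) := mul_pos (by linarith) (by linarith)
    have e3 : (e - l) * (l * e - 1) * (l' * e') = e + e' - l - l' := by
      linear_combination (e-l)*(e*e')*hr + (e-l)*hre - l' * hre + e' * hr
    have e4 : 0 < e' := by rw [← hee]; positivity
    have : 0 < (e - l) * (l * e - 1) * (l' * e') := by positivity
    linarith
  have htt : (t : ℝ) < td d := by
    have a1 : (t : ℝ) = l + l' := by rw [hl, hl']; ring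
    have a2 : (td d : ℝ) = e + e' := by rw [hedef, eps_eq, he']; push_cast; ring
    rw [a1, a2]; exact hlt2
  have htpos : (0 : ℝ) < t := by
    have a1 : (t : ℝ) = l + l' := by rw [hl, hl']; ring
    rw [a1]; positivity
  have htp : 0 < t := by exact_mod_cast htpos
  have hu : u = 0 := by
    by_contra hu
    have := @td_min d t.natAbs u.natAbs (by omega) (by omega) (by
      rw [Int.natCast_natAbs, Int.natCast_natAbs, sq_abs, sq_abs]; exact ht)
    have h5 : (t : ℤ) < td d := by exact_mod_cast htt
    omega
  subst hu
  refine ⟨?_, rfl⟩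
  have : (t - 2) * (t + 2) = 0 := by linear_combination ht
  rcases mul_eq_zero.1 this with h | h <;> omega

noncomputable def xi (d : ℕ) (f : ℤ × ℤ × ℤ) (v : ℤ × ℤ) : ℝ :=
  2 * f.1 * v.1 + (f.2.1 + Real.sqrt d) * v.2
noncomputable def et (d : ℕ) (f : ℤ × ℤ × ℤ) (v : ℤ × ℤ) : ℝ :=
  (1 / 2) * v.1 + ((f.2.1 - Real.sqrt d) / (4 * f.1)) * v.2

lemma xi_et {d : ℕ} {f : ℤ × ℤ × ℤ} (ha : f.1 ≠ 0) (hd : formDisc f = d) (v : ℤ × ℤ) :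
    xi d f v * et d f v = formVal f v.1 v.2 := by
  have ha' : (f.1 : ℝ) ≠ 0 := by exact_mod_cast ha
  have hq : Real.sqrt d ^ 2 = d := Real.sq_sqrt (by positivity)
  have hd' : (f.2.1 : ℝ) ^ 2 - 4 * f.1 * f.2.2 = d := by
    have : ((formDisc f : ℤ) : ℝ) = d := by rw [hd]; norm_cast
    rw [← this, formDisc]; push_cast; ring
  simp only [xi, et, formVal]; push_cast
  field_simp
  linear_combination 2 * v.2 ^ 2 * hd' - 2 * v.2 ^ 2 * hq

/-- the fundamental cone -/
def cone (d : ℕ) (f : ℤ × ℤ × ℤ) (v : ℤ × ℤ) : Prop :=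
  0 < et d f v ∧ et d f v < xi d f v ∧ xi d f v ≤ eps d ^ 2 * et d f v

lemma xi_aut {d : ℕ} {f : ℤ × ℤ × ℤ} (hd : formDisc f = d) {α β γ δ t u : ℤ}
    (h1 : 2 * α = t - f.2.1 * u) (h2 : β = - f.2.2 * u) (h3 : γ = f.1 * u) (h4 : 2 * δ = t + f.2.1 * u)
    (v : ℤ × ℤ) : xi d f (α * v.1 + β * v.2, γ * v.1 + δ * v.2) = (t + u * Real.sqrt d) / 2 * xi d f v := by
  have hq : Real.sqrt d ^ 2 = d := Real.sq_sqrt (by positivity)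
  have hd' : (f.2.1 : ℝ) ^ 2 - 4 * f.1 * f.2.2 = d := by
    have : ((formDisc f : ℤ) : ℝ) = d := by rw [hd]; norm_cast
    rw [← this, formDisc]; push_cast; ring
  have h1' : (2 * α : ℝ) = t - f.2.1 * u := by exact_mod_cast h1
  have h4' : (2 * δ : ℝ) = t + f.2.1 * u := by exact_mod_cast h4
  subst h2 h3
  simp only [xi]; push_cast
  linear_combination (f.1 * v.1 : ℝ) * h1' + ((f.2.1 + Real.sqrt d) * v.2 / 2 : ℝ) * h4' + (u * v.2 / 2 : ℝ) * hd' - (u * v.2 / 2 : ℝ) * hq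

lemma et_aut {d : ℕ} {f : ℤ × ℤ × ℤ} (ha : f.1 ≠ 0) (hd : formDisc f = d) {α β γ δ t u : ℤ}
    (h1 : 2 * α = t - f.2.1 * u) (h2 : β = - f.2.2 * u) (h3 : γ = f.1 * u) (h4 : 2 * δ = t + f.2.1 * u)
    (v : ℤ × ℤ) : et d f (α * v.1 + β * v.2, γ * v.1 + δ * v.2) = (t - u * Real.sqrt d) / 2 * et d f v := by
  have ha' : (f.1 : ℝ) ≠ 0 := by exact_mod_cast ha
  have hq : Real.sqrt d ^ 2 = d := Real.sq_sqrt (by positivity)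
  have hd' : (f.2.1 : ℝ) ^ 2 - 4 * f.1 * f.2.2 = d := by
    have : ((formDisc f : ℤ) : ℝ) = d := by rw [hd]; norm_cast
    rw [← this, formDisc]; push_cast; ring
  have h1' : (2 * α : ℝ) = t - f.2.1 * u := by exact_mod_cast h1
  have h4' : (2 * δ : ℝ) = t + f.2.1 * u := by exact_mod_cast h4
  subst h2 h3
  simp only [et]; push_cast
  field_simp
  linear_combination (4 * f.1 * v.1 : ℝ) * h1' + (2 * (f.2.1 - Real.sqrt d) * v.2 : ℝ) * h4' + (2 * u * v.2 : ℝ) * hd' - (2 * u * v.2 : ℝ) * hq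

lemma aut_of_pell {d : ℕ} {f : ℤ × ℤ × ℤ} (hd : formDisc f = d) {t u : ℤ} (h : t ^ 2 - (d : ℤ) * u ^ 2 = 4) :
    ∃ α δ : ℤ, 2 * α = t - f.2.1 * u ∧ 2 * δ = t + f.2.1 * u ∧ α * δ - (- f.2.2 * u) * (f.1 * u) = 1 ∧
      ∀ x y, formVal f (α * x + (- f.2.2 * u) * y) ((f.1 * u) * x + δ * y) = formVal f x y := by
  have hp := pell_parity h
  have hb : Even (f.2.1 ^ 2 - d) := ⟨2 * f.1 * f.2.2, by rw [← hd, formDisc]; ring⟩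
  obtain ⟨α, hα⟩ : Even (t - f.2.1 * u) := by
    simp only [Int.even_sub, Int.even_mul, Int.even_pow' two_ne_zero] at hp hb ⊢; tauto
  obtain ⟨δ, hδ⟩ : Even (t + f.2.1 * u) := by
    simp only [Int.even_sub, Int.even_add, Int.even_mul, Int.even_pow' two_ne_zero] at hp hb ⊢; tauto
  have hdet : α * δ - (- f.2.2 * u) * (f.1 * u) = 1 := by
    rw [← hd, formDisc] at h
    have : 4 * (α * δ - (- f.2.2 * u) * (f.1 * u)) = 4 := by
      linear_combination h - (2 * δ) * hα - (t - f.2.1 * u) * hδ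
    linarith
  refine ⟨α, δ, by linarith, by linarith, hdet, fun x y => ?_⟩
  obtain ⟨a, b, c⟩ := f
  simp only [formVal, formDisc] at *
  have hδ' : δ = α + b * u := by linarith
  subst hδ'
  linear_combination (a * x ^ 2 + b * x * y + c * y ^ 2) * hdet

lemma cone_unique {d : ℕ} (hd0 : d ≠ 0) (hP : PellOK d) {f : ℤ × ℤ × ℤ} (hf : IsPrimitiveForm f) (ha : f.1 ≠ 0)
    (hd : formDisc f = d) {α β γ δ : ℤ} (hdet : α * δ - β * γ = 1)
    (hA : ∀ x y, formVal f x y = formVal f (α * x + β * y) (γ * x + δ * y)) {v v' : ℤ × ℤ}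
    (h1 : v.1 = α * v'.1 + β * v'.2) (h2 : v.2 = γ * v'.1 + δ * v'.2) (hv : cone d f v) (hv' : cone d f v') :
    v = v' := by
  obtain ⟨t, u, hp, e1, e2, e3, e4⟩ := aut_struct hf ha hdet hA
  rw [hd] at hp
  have hvv : v = (α * v'.1 + β * v'.2, γ * v'.1 + δ * v'.2) := Prod.ext h1 h2
  have hx := xi_aut hd e1 e2 e3 e4 v'
  have hy := et_aut ha hd e1 e2 e3 e4 v'
  rw [← hvv] at hx hy
  have hr := pell_real hp
  have he := eps_gt_one hd0 hP
  obtain ⟨a1, a2, a3⟩ := hv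
  obtain ⟨b1, b2, b3⟩ := hv'
  set l := (t + u * Real.sqrt d) / 2 with hl
  set l' := (t - u * Real.sqrt d) / 2 with hl'
  set e := eps d
  have hx0 : 0 < xi d f v := a1.trans a2
  have hx0' : 0 < xi d f v' := b1.trans b2
  have hlpos : 0 < l := by by_contra hc; nlinarith
  have hlpos' : 0 < l' := by by_contra hc; nlinarith
  have hepos : 0 < e := by linarith
  rw [hx, hy] at a2 a3
  -- l' η < l ξ ≤ ...
  have k1 : l < e := by
    by_contra hc
    push Not at hc
    -- l ξ' ≤ e² l' η', η' < ξ' so l η' < e² l' η'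
    have : l * et d f v' < e ^ 2 * l' * et d f v' := by nlinarith
    have : l < e ^ 2 * l' := lt_of_mul_lt_mul_right this b1.le
    have h3 : l * l < e ^ 2 := by nlinarith
    nlinarith
  have k2 : e⁻¹ < l := by
    rw [inv_lt_iff_one_lt_mul₀ hepos]
    by_contra hc
    push Not at hc
    have : l' * et d f v' < l * e ^ 2 * et d f v' := by nlinarith
    have : l' < l * e ^ 2 := lt_of_mul_lt_mul_right this b1.le
    have h3 : 1 < (l * e) ^ 2 := by nlinarith
    have h4 : 0 < l * e := by positivity
    nlinarith
  obtain ⟨rfl, rfl⟩ := pell_small hd0 hP hp k2 k1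
  have : α = 1 := by linarith
  have : δ = 1 := by linarith
  subst_vars
  apply Prod.ext
  · rw [h1]; ring
  · rw [h2]; ring

lemma cone_exists {d : ℕ} (hd0 : d ≠ 0) (hP : PellOK d) {f : ℤ × ℤ × ℤ} (ha : f.1 ≠ 0)
    (hd : formDisc f = d) (v : ℤ × ℤ) (hv : 0 < formVal f v.1 v.2) :
    ∃ α β γ δ : ℤ, α * δ - β * γ = 1 ∧ (∀ x y, formVal f (α * x + β * y) (γ * x + δ * y) = formVal f x y) ∧
      cone d f (α * v.1 + β * v.2, γ * v.1 + δ * v.2) := by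
  have hxe := xi_et ha hd v
  have hpos : (0 : ℝ) < xi d f v * et d f v := by rw [hxe]; exact_mod_cast hv
  have he := eps_gt_one hd0 hP
  have hepos : 0 < eps d := by linarith
  have hratio : 0 < xi d f v / et d f v := by
    rcases pos_and_pos_or_neg_and_neg_of_mul_pos hpos with ⟨h1, h2⟩ | ⟨h1, h2⟩
    · exact div_pos h1 h2
    · exact div_pos_of_neg_of_neg h1 h2
  obtain ⟨n, hn1, hn2⟩ := exists_mem_Ioc_zpow hratio (show 1 < eps d ^ 2 by nlinarith)
  obtain ⟨t, u, hp, htu⟩ := pell_zpow hd0 hP (-n)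
  have hbar : ((t - u * Real.sqrt d) / 2 : ℝ) = eps d ^ n := by
    have := pell_real hp
    rw [htu, zpow_neg, inv_mul_eq_one₀ (by positivity)] at this
    exact this.symm
  -- choose the sign
  obtain ⟨s, hs, hs1, hs2⟩ : ∃ s : ℤ, s ^ 2 = 1 ∧ 0 < s * xi d f v ∧ 0 < s * et d f v := by
    rcases pos_and_pos_or_neg_and_neg_of_mul_pos hpos with ⟨h1, h2⟩ | ⟨h1, h2⟩
    · exact ⟨1, by norm_num, by simpa using h1, by simpa using h2⟩
    · exact ⟨-1, by norm_num, by simpa using h1, by simpa using h2⟩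
  have hp' : (s * t) ^ 2 - (d : ℤ) * (s * u) ^ 2 = 4 := by linear_combination s ^ 2 * hp + 4 * hs
  obtain ⟨α, δ, e1, e4, hdet, hA⟩ := aut_of_pell hd hp'
  refine ⟨α, _, _, δ, hdet, hA, ?_⟩
  have hx := xi_aut hd e1 rfl rfl e4 v
  have hy := et_aut ha hd e1 rfl rfl e4 v
  unfold cone
  rw [hx, hy]
  have q1 : (((s * t : ℤ) : ℝ) + ((s * u : ℤ) : ℝ) * Real.sqrt d) / 2 * xi d f v = eps d ^ (-n) * (s * xi d f v) := by
    rw [← htu]; push_cast; ring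
  have q2 : (((s * t : ℤ) : ℝ) - ((s * u : ℤ) : ℝ) * Real.sqrt d) / 2 * et d f v = eps d ^ n * (s * et d f v) := by
    rw [← hbar]; push_cast; ring
  rw [q1, q2]
  have hne : et d f v ≠ 0 := by rintro h; rw [h] at hpos; simp at hpos
  have hsne : (s : ℝ) ≠ 0 := by rintro h; rw [h] at hs1; simp at hs1
  have hr : xi d f v / et d f v = (s * xi d f v) / (s * et d f v) := by field_simp
  rw [hr] at hn1 hn2
  rw [lt_div_iff₀ hs2] at hn1
  rw [div_le_iff₀ hs2] at hn2
  have hz : (eps d ^ 2) ^ n = eps d ^ n * eps d ^ n := by rw [pow_two, mul_zpow]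
  have hz0 : 0 < eps d ^ n := by positivity
  have hz1 : eps d ^ (-n) * eps d ^ n = 1 := by rw [← zpow_add₀ hepos.ne']; simp
  have hz2 : 0 < eps d ^ (-n) := by positivity
  refine ⟨by positivity, ?_, ?_⟩
  · rw [hz] at hn1
    have := mul_lt_mul_of_pos_left hn1 hz2
    calc _ = (eps d ^ (-n) * eps d ^ n) * eps d ^ n * (s * et d f v) := by rw [hz1]; ring
      _ < _ := by linarith
  · rw [zpow_add₀ (by positivity), zpow_one, hz] at hn2
    have := mul_le_mul_of_nonneg_left hn2 hz2.le
    calc _ ≤ _ := this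
      _ = (eps d ^ (-n) * eps d ^ n) * eps d ^ 2 * (eps d ^ n * (s * et d f v)) := by ring
      _ = _ := by rw [hz1]; ring

end P2g

section P2h

/-- forms -/
abbrev PF (d : ℕ) := {f : ℤ × ℤ × ℤ // IsPrimitiveForm f ∧ formDisc f = (d : ℤ)}
/-- classes -/
abbrev Cl (d : ℕ) := Quot (fun f g : PF d => formEquiv f.1 g.1)

lemma Cl_exact {d : ℕ} {f g : PF d} (h : (Quot.mk _ f : Cl d) = Quot.mk _ g) : formEquiv f.1 g.1 := by
  have he : Equivalence (fun f g : PF d => formEquiv f.1 g.1) :=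
    ⟨fun f => formEquiv_refl _, fun h => formEquiv_symm h, fun h h' => formEquiv_trans h h'⟩
  exact he.eqvGen_iff.1 (Quot.eqvGen_exact h)

lemma exists_rep {d : ℕ} (hd : d ≠ 0) : ∃ rep : Cl d → ℤ × ℤ × ℤ, (∀ q, IsPrimitiveForm (rep q)) ∧
    (∀ q, formDisc (rep q) = d) ∧ (∀ q, IsCoprime (rep q).1 ((2 * d : ℕ) : ℤ)) ∧
    (∀ f : PF d, formEquiv (rep (Quot.mk _ f)) f.1) ∧ (∀ q q', formEquiv (rep q) (rep q') → q = q') := by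
  have key : ∀ q : Cl d, ∃ g : PF d, Quot.mk _ g = q ∧ IsCoprime g.1.1 ((2 * d : ℕ) : ℤ) := by
    intro q
    induction q using Quot.ind with
    | mk f =>
      obtain ⟨g, h1, h2⟩ := exists_good_rep f.1 f.2.1 (N := 2 * d) (by omega)
      refine ⟨⟨g, prim_of_equiv h1 f.2.1, by rw [disc_of_equiv h1, f.2.2]⟩, ?_, h2⟩
      exact Quot.sound (formEquiv_symm h1)
  choose r hr1 hr2 using key
  refine ⟨fun q => (r q).1, fun q => (r q).2.1, fun q => (r q).2.2, hr2, fun f => Cl_exact (hr1 _), fun q q' h => ?_⟩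
  rw [← hr1 q, ← hr1 q']
  exact Quot.sound h

lemma Bpar_eq {f : ℤ × ℤ × ℤ} {v : ℤ × ℤ} (h : Int.gcd v.1 v.2 = 1) {z w : ℤ} (hb : v.1 * w - z * v.2 = 1) :
    formVal f v.1 v.2 ∣ (actF f v.1 z v.2 w).2.1 - Bpar f v := by
  have hb' := bez h
  set z' := -Int.gcdB v.1 v.2 with hz
  set w' := Int.gcdA v.1 v.2 with hw
  have e1 : z - z' = (w' * (z - z') - z' * (w - w')) * v.1 := by linear_combination (-(z-z')) * hb' + z' * hb - z' * hb'
  have e2 : w - w' = (w' * (z - z') - z' * (w - w')) * v.2 := by linear_combination (-(w-w')) * hb' + w' * hb - w' * hb'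
  refine ⟨2 * (w' * (z - z') - z' * (w - w')), ?_⟩
  set k := (w' * (z - z') - z' * (w - w'))
  have hz1 : z = z' + k * v.1 := by linarith
  have hw1 : w = w' + k * v.2 := by linarith
  rw [Bpar, ← hz, ← hw, hz1, hw1]
  simp only [actF, formVal]; ring

/-- primitive representations in the cone -/
def Vp (d : ℕ) (f : ℤ × ℤ × ℤ) (m : ℕ) : Set (ℤ × ℤ) :=
  {v | Int.gcd v.1 v.2 = 1 ∧ cone d f v ∧ formVal f v.1 v.2 = m}

lemma gcd_of_det {x y z w : ℤ} (h : x * w - z * y = 1) : Int.gcd x y = 1 := by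
  rw [← Int.isCoprime_iff_gcd_eq_one]
  exact ⟨w, -z, by linarith⟩

lemma Bpar_aut {f : ℤ × ℤ × ℤ} {v : ℤ × ℤ} (h : Int.gcd v.1 v.2 = 1) {α β γ δ : ℤ} (hdet : α * δ - β * γ = 1)
    (hA : ∀ x y, formVal f (α * x + β * y) (γ * x + δ * y) = formVal f x y) :
    Int.gcd (α * v.1 + β * v.2) (γ * v.1 + δ * v.2) = 1 ∧
    formVal f v.1 v.2 ∣ Bpar f v - Bpar f (α * v.1 + β * v.2, γ * v.1 + δ * v.2) := by
  have hb := bez h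
  set z' := -Int.gcdB v.1 v.2 with hz
  set w' := Int.gcdA v.1 v.2 with hw
  have hb2 : (α * v.1 + β * v.2) * (γ * z' + δ * w') - (α * z' + β * w') * (γ * v.1 + δ * v.2) = 1 := by
    linear_combination (v.1 * w' - z' * v.2) * hdet + hb
  have hg := gcd_of_det hb2
  refine ⟨hg, ?_⟩
  have := Bpar_eq (f := f) (v := (α * v.1 + β * v.2, γ * v.1 + δ * v.2)) hg hb2
  simp only [hA] at this
  have e : actF f (α * v.1 + β * v.2) (α * z' + β * w') (γ * v.1 + δ * v.2) (γ * z' + δ * w') = actF f v.1 z' v.2 w' := by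
    apply form_ext
    intro x y
    rw [formVal_act, formVal_act, ← hA (v.1 * x + z' * y)]
    congr 1 <;> ring
  rw [e] at this
  exact this

lemma lift_sq {d m : ℕ} (hd4 : d % 4 = 0 ∨ d % 4 = 1) (hm : Nat.Coprime m (2 * d)) (x : ZMod m) (hx : x ^ 2 = (d : ZMod m)) :
    ∃ B C : ℤ, B ^ 2 - 4 * m * C = d ∧ (B : ZMod m) = x := by
  obtain ⟨B0, rfl⟩ := ZMod.intCast_surjective x
  have hmo : Odd (m : ℤ) := by
    have := Nat.Coprime.coprime_mul_right_right hm
    rw [Nat.coprime_two_right] at this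
    exact_mod_cast this
  -- fix parity
  obtain ⟨B, hB, hpar⟩ : ∃ B : ℤ, ((B : ZMod m) = B0) ∧ Even (B - d) := by
    by_cases h : Even (B0 - d)
    · exact ⟨B0, rfl, h⟩
    · refine ⟨B0 + m, by simp, ?_⟩
      rw [Int.not_even_iff_odd] at h
      have : B0 + m - d = (B0 - d) + m := by ring
      rw [this]; exact h.add_odd hmo
  have h1 : (m : ℤ) ∣ B ^ 2 - d := by
    rw [← ZMod.intCast_zmod_eq_zero_iff_dvd]
    push_cast; rw [hB, hx]; simp
  have h4 : (4 : ℤ) ∣ B ^ 2 - d := by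
    rcases hpar with ⟨k, hk⟩
    have hBk : B = d + 2 * k := by linarith
    have : (4 : ℤ) ∣ (d : ℤ) ^ 2 - d := by
      have : (d : ℤ) % 4 = 0 ∨ (d : ℤ) % 4 = 1 := by omega
      rcases this with h | h
      · obtain ⟨j, hj⟩ := Int.dvd_of_emod_eq_zero h
        rw [hj]; exact ⟨4 * j ^ 2 - j, by ring⟩
      · obtain ⟨j, hj⟩ : ∃ j, (d : ℤ) = 4 * j + 1 := ⟨d / 4, by omega⟩
        rw [hj]; exact ⟨4 * j ^ 2 + j, by ring⟩
    obtain ⟨j, hj⟩ := this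
    exact ⟨j + d * k + k ^ 2, by rw [hBk]; linear_combination hj⟩
  have hcop : IsCoprime (4 : ℤ) m := by
    have : IsCoprime ((2 : ℤ) ^ 2) m := by
      apply IsCoprime.pow_left
      obtain ⟨k, hk⟩ := hmo
      exact ⟨-k, 1, by rw [hk]; ring⟩
    simpa using this
  obtain ⟨C, hC⟩ := hcop.mul_dvd h4 h1
  exact ⟨B, C, by linarith, hB⟩

variable {d : ℕ} {rep : Cl d → ℤ × ℤ × ℤ}

lemma rep_ne (hd : d ≠ 0) (r3 : ∀ q, IsCoprime (rep q).1 ((2 * d : ℕ) : ℤ)) (q : Cl d) : (rep q).1 ≠ 0 := by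
  intro h
  have := r3 q
  rw [h, isCoprime_zero_left, Int.isUnit_iff] at this
  omega

/-- the parametrization map -/
def PhiB (r2 : ∀ q, formDisc (rep q) = d) (m : ℕ) (p : Σ q : Cl d, Vp d (rep q) m) : {x : ZMod m // x ^ 2 = (d : ZMod m)} :=
  ⟨(Bpar (rep p.1) p.2.1 : ℤ), by
    obtain ⟨C, hC, -⟩ := Bpar_sq (f := rep p.1) p.2.2.1
    rw [p.2.2.2.2, r2] at hC
    have : ((Bpar (rep p.1) p.2.1 ^ 2 - 4 * (m : ℤ) * C : ℤ) : ZMod m) = ((d : ℤ) : ZMod m) := by rw [hC]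
    push_cast at this
    simpa using this⟩

lemma PhiB_bij (hd : d ≠ 0) (hP : PellOK d) (hd4 : d % 4 = 0 ∨ d % 4 = 1) (r1 : ∀ q, IsPrimitiveForm (rep q))
    (r2 : ∀ q, formDisc (rep q) = d) (r3 : ∀ q, IsCoprime (rep q).1 ((2 * d : ℕ) : ℤ)) (r4 : ∀ f : PF d, formEquiv (rep (Quot.mk _ f)) f.1) (r5 : ∀ q q', formEquiv (rep q) (rep q') → q = q') {m : ℕ} (hm0 : m ≠ 0) (hm : Nat.Coprime m (2 * d)) : Function.Bijective (PhiB r2 m) := by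
  have hmo : Odd (m : ℤ) := by
    have := Nat.Coprime.coprime_mul_right_right hm
    rw [Nat.coprime_two_right] at this
    exact_mod_cast this
  have hrn := rep_ne hd r3
  constructor
  · rintro ⟨q, v, hv1, hv2, hv3⟩ ⟨q', v', hv1', hv2', hv3'⟩ h
    have h' : ((Bpar (rep q') v' : ℤ) : ZMod m) = (Bpar (rep q) v : ℤ) := (congrArg Subtype.val h).symm
    rw [← sub_eq_zero, ← Int.cast_sub, ZMod.intCast_zmod_eq_zero_iff_dvd] at h'
    obtain ⟨α, β, γ, δ, hdet, hA, h1, h2⟩ := Bpar_inj ((r2 q).trans (r2 q').symm) hv1 hv1' hmo hv3 hv3' h'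
    have hq : q = q' := r5 q q' ((formEquiv_iff _ _).2 ⟨α, β, γ, δ, hdet, hA⟩)
    subst hq
    have := cone_unique hd hP (r1 q) (hrn q) (r2 q) hdet hA h1 h2 hv2 hv2'
    subst this
    rfl
  · rintro ⟨x, hx⟩
    obtain ⟨B, C, hBC, hBx⟩ := lift_sq hd4 hm x hx
    have hprim : IsPrimitiveForm ((m : ℤ), B, C) := by
      rw [prim_iff]
      rintro p hp ⟨h1, h2, h3⟩
      simp only at h1 h2 h3
      have hpd : (p : ℤ) ∣ d := by
        rw [← hBC, pow_two]
        exact dvd_sub (h2.mul_right _) (h3.mul_left _)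
      have a1 : p ∣ m := by exact_mod_cast h1
      have a2 : p ∣ d := by exact_mod_cast hpd
      have := Nat.dvd_gcd a1 (a2.mul_left 2)
      rw [hm] at this
      exact hp.one_lt.ne' (Nat.dvd_one.1 this)
    let f : PF d := ⟨((m : ℤ), B, C), hprim, hBC⟩
    set q : Cl d := Quot.mk _ f
    have he := r4 f
    rw [formEquiv_iff] at he
    obtain ⟨α, β, γ, δ, hdet, hM⟩ := he
    have hact : ((m : ℤ), B, C) = actF (rep q) α β γ δ := form_ext fun x y => by rw [formVal_act]; exact hM x y
    have hg : Int.gcd α γ = 1 := gcd_of_det hdet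
    have hval : formVal (rep q) α γ = m := (congrArg Prod.fst hact).symm
    have hBB := Bpar_eq (f := rep q) (v := (α, γ)) hg hdet
    simp only at hBB
    rw [← hact, hval] at hBB
    simp only at hBB
    obtain ⟨α', β', γ', δ', hdet', hA', hcone⟩ := cone_exists hd hP (hrn q) (r2 q) (α, γ) (by
      simp only; rw [hval]; exact_mod_cast Nat.pos_of_ne_zero hm0)
    obtain ⟨hg2, hB2⟩ := Bpar_aut (f := rep q) (v := (α, γ)) hg hdet' hA'
    refine ⟨⟨q, ⟨(α' * α + β' * γ, γ' * α + δ' * γ), hg2, hcone, ?_⟩⟩, ?_⟩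
    · simp only; rw [hA', hval]
    · apply Subtype.ext
      simp only [PhiB]
      rw [← hBx, eq_comm, ← sub_eq_zero, ← Int.cast_sub, ZMod.intCast_zmod_eq_zero_iff_dvd]
      simp only [hval] at hB2
      have := dvd_add hBB hB2
      simpa using this

lemma Vp_finite (hd : d ≠ 0) (hP : PellOK d) (hd4 : d % 4 = 0 ∨ d % 4 = 1) (r1 : ∀ q, IsPrimitiveForm (rep q))
    (r2 : ∀ q, formDisc (rep q) = d) (r3 : ∀ q, IsCoprime (rep q).1 ((2 * d : ℕ) : ℤ)) (r4 : ∀ f : PF d, formEquiv (rep (Quot.mk _ f)) f.1) (r5 : ∀ q q', formEquiv (rep q) (rep q') → q = q') {m : ℕ} (hm0 : m ≠ 0) (hm : Nat.Coprime m (2 * d)) (q : Cl d) : (Vp d (rep q) m).Finite := by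
  have hb := PhiB_bij hd hP hd4 r1 r2 r3 r4 r5 hm0 hm
  haveI : NeZero m := ⟨hm0⟩
  haveI : Finite (Σ q : Cl d, Vp d (rep q) m) := Finite.of_injective _ hb.1
  have : Finite (Vp d (rep q) m) := Finite.of_injective (fun v => (⟨q, v⟩ : Σ q : Cl d, Vp d (rep q) m)) (by
    intro a b h; simpa using h)
  exact this

lemma Vp_sum_le (hd : d ≠ 0) (hP : PellOK d) (hd4 : d % 4 = 0 ∨ d % 4 = 1) (r1 : ∀ q, IsPrimitiveForm (rep q))
    (r2 : ∀ q, formDisc (rep q) = d) (r3 : ∀ q, IsCoprime (rep q).1 ((2 * d : ℕ) : ℤ)) (r4 : ∀ f : PF d, formEquiv (rep (Quot.mk _ f)) f.1) (r5 : ∀ q q', formEquiv (rep q) (rep q') → q = q') {m : ℕ} (hm0 : m ≠ 0) (hm : Nat.Coprime m (2 * d)) (s : Finset (Cl d)) :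
    ∑ q ∈ s, (Vp d (rep q) m).ncard ≤ rcnt d m := by
  have hb := PhiB_bij hd hP hd4 r1 r2 r3 r4 r5 hm0 hm
  haveI : NeZero m := ⟨hm0⟩
  haveI : Finite (Σ q : Cl d, Vp d (rep q) m) := Finite.of_injective _ hb.1
  haveI : ∀ q, Finite (Vp d (rep q) m) := fun q => Vp_finite hd hP hd4 r1 r2 r3 r4 r5 hm0 hm q
  have h1 : Nat.card (Σ q : Cl d, Vp d (rep q) m) = rcnt d m := Nat.card_eq_of_bijective _ hb
  have h2 : Nat.card (Σ q : s, Vp d (rep q) m) = ∑ q ∈ s, (Vp d (rep q) m).ncard := by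
    rw [Nat.card_sigma, ← Finset.sum_coe_sort s]
    rfl
  rw [← h2, ← h1]
  exact Nat.card_le_card_of_injective (fun p => (⟨p.1.1, p.2⟩ : Σ q : Cl d, Vp d (rep q) m)) (by
    rintro ⟨⟨q, hq⟩, v⟩ ⟨⟨q', hq'⟩, v'⟩ h
    simp only [Sigma.mk.injEq] at h
    obtain ⟨rfl, h⟩ := h
    simp at h
    subst h; rfl)

lemma Vp_sum_eq (hd : d ≠ 0) (hP : PellOK d) (hd4 : d % 4 = 0 ∨ d % 4 = 1) (r1 : ∀ q, IsPrimitiveForm (rep q))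
    (r2 : ∀ q, formDisc (rep q) = d) (r3 : ∀ q, IsCoprime (rep q).1 ((2 * d : ℕ) : ℤ)) (r4 : ∀ f : PF d, formEquiv (rep (Quot.mk _ f)) f.1) (r5 : ∀ q q', formEquiv (rep q) (rep q') → q = q') [Fintype (Cl d)] {m : ℕ} (hm0 : m ≠ 0) (hm : Nat.Coprime m (2 * d)) :
    ∑ q : Cl d, (Vp d (rep q) m).ncard = rcnt d m := by
  have hb := PhiB_bij hd hP hd4 r1 r2 r3 r4 r5 hm0 hm
  haveI : ∀ q, Finite (Vp d (rep q) m) := fun q => Vp_finite hd hP hd4 r1 r2 r3 r4 r5 hm0 hm q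
  have h1 : Nat.card (Σ q : Cl d, Vp d (rep q) m) = rcnt d m := Nat.card_eq_of_bijective _ hb
  rw [← h1, Nat.card_sigma]
  rfl

end P2h

section P2i

/-- representations in the cone -/
def Vall (d : ℕ) (f : ℤ × ℤ × ℤ) (m : ℕ) : Set (ℤ × ℤ) :=
  {v | cone d f v ∧ formVal f v.1 v.2 = m}

def Cnt (d : ℕ) (f : ℤ × ℤ × ℤ) (K : ℕ) : Set (ℤ × ℤ) :=
  {v | cone d f v ∧ formVal f v.1 v.2 ≤ (K : ℤ) ^ 2 ∧ Int.gcd (formVal f v.1 v.2) ((2 * d : ℕ) : ℤ) = 1}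

lemma cone_smul {d : ℕ} {f : ℤ × ℤ × ℤ} {e : ℕ} (he : e ≠ 0) (v : ℤ × ℤ) :
    cone d f (e * v.1, e * v.2) ↔ cone d f v := by
  have h1 : xi d f (e * v.1, e * v.2) = e * xi d f v := by simp only [xi]; push_cast; ring
  have h2 : et d f (e * v.1, e * v.2) = e * et d f v := by simp only [et]; push_cast; ring
  have he' : (0 : ℝ) < e := by positivity
  unfold cone
  rw [h1, h2, mul_pos_iff_of_pos_left he', mul_lt_mul_iff_right₀ he',
    show eps d ^ 2 * (e * et d f v) = e * (eps d ^ 2 * et d f v) by ring, mul_le_mul_iff_right₀ he']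

lemma formVal_smul (f : ℤ × ℤ × ℤ) (e x y : ℤ) : formVal f (e * x) (e * y) = e ^ 2 * formVal f x y := by
  simp only [formVal]; ring

lemma Vall_card {d : ℕ} {f : ℤ × ℤ × ℤ} (hfin : ∀ m : ℕ, m ≠ 0 → Nat.Coprime m (2 * d) → (Vp d f m).Finite)
    {m : ℕ} (hm0 : m ≠ 0) (hm : Nat.Coprime m (2 * d)) :
    (Vall d f m).Finite ∧ (Vall d f m).ncard = ∑ x ∈ m.divisorsAntidiagonal with IsSquare x.1, (Vp d f x.2).ncard := by
  classical
  have hdiv : ∀ x ∈ m.divisorsAntidiagonal, x.2 ≠ 0 ∧ Nat.Coprime x.2 (2 * d) ∧ x.1 ≠ 0 := by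
    intro x hx
    rw [Nat.mem_divisorsAntidiagonal] at hx
    have hx2 : x.2 ∣ m := ⟨x.1, by rw [← hx.1]; ring⟩
    refine ⟨?_, Nat.Coprime.coprime_dvd_left hx2 hm, ?_⟩
    · intro h; rw [h] at hx; simp at hx; exact hm0 hx.1.symm
    · intro h; rw [h] at hx; simp at hx; exact hm0 hx.1.symm
  have hdecomp : ∀ v ∈ Vall d f m, ∃ e : ℕ, e = Int.gcd v.1 v.2 ∧ e ≠ 0 ∧ e ^ 2 * (m / e ^ 2) = m ∧ ∃ w ∈ Vp d f (m / e ^ 2), v = (e * w.1, e * w.2) := by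
    rintro v ⟨hc, hv⟩
    set e := Int.gcd v.1 v.2 with he
    have he0 : e ≠ 0 := by
      intro h
      rw [he, Int.gcd_eq_zero_iff] at h
      rw [h.1, h.2] at hv
      simp [formVal] at hv; exact hm0 (by exact_mod_cast hv.symm)
    obtain ⟨w1, hw1⟩ := Int.gcd_dvd_left v.1 v.2
    obtain ⟨w2, hw2⟩ := Int.gcd_dvd_right v.1 v.2
    rw [← he] at hw1 hw2
    have hvv : v = (e * w1, e * w2) := Prod.ext hw1 hw2
    have hval : (e : ℤ) ^ 2 * formVal f w1 w2 = m := by rw [← formVal_smul, ← hw1, ← hw2, hv]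
    have hdvd : e ^ 2 ∣ m := by
      have : ((e ^ 2 : ℕ) : ℤ) ∣ (m : ℤ) := ⟨formVal f w1 w2, by rw [← hval]; push_cast; ring⟩
      exact_mod_cast this
    have hmul := Nat.mul_div_cancel' hdvd
    refine ⟨e, rfl, he0, hmul, (w1, w2), ⟨?_, ?_, ?_⟩, hvv⟩
    · have : e * Int.gcd w1 w2 = e * 1 := by
        rw [mul_one]; conv_rhs => rw [he, hw1, hw2, Int.gcd_mul_left]
        simp
      exact Nat.eq_of_mul_eq_mul_left (Nat.pos_of_ne_zero he0) this
    · rw [hvv] at hc; exact (cone_smul he0 (w1, w2)).1 hc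
    · have h2 : (e : ℤ) ^ 2 * formVal f w1 w2 = (e : ℤ) ^ 2 * ((m / e ^ 2 : ℕ) : ℤ) := by
        rw [hval]; exact_mod_cast hmul.symm
      exact mul_left_cancel₀ (by positivity) h2
  have hback : ∀ e j : ℕ, e ≠ 0 → e ^ 2 * j = m → ∀ w ∈ Vp d f j, ((e * w.1, e * w.2) : ℤ × ℤ) ∈ Vall d f m ∧ Int.gcd (e * w.1) (e * w.2) = e := by
    rintro e j he hej w ⟨h1, h2, h3⟩
    refine ⟨⟨(cone_smul he w).2 h2, ?_⟩, ?_⟩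
    · simp only; rw [formVal_smul, h3]; exact_mod_cast hej
    · rw [Int.gcd_mul_left, h1]; simp
  have hfinV : (Vall d f m).Finite := by
    apply Set.Finite.subset (Set.Finite.biUnion (Finset.finite_toSet (m.divisorsAntidiagonal))
      (t := fun x => (fun w : ℤ × ℤ => (((Nat.sqrt x.1 : ℕ) : ℤ) * w.1, ((Nat.sqrt x.1 : ℕ) : ℤ) * w.2)) '' (Vp d f x.2)) (fun x hx => by
        apply Set.Finite.image
        have := hdiv x hx
        exact hfin _ this.1 this.2.1))
    intro v hv
    obtain ⟨e, _, he0, hmul, w, hw, hvv⟩ := hdecomp v hv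
    rw [Set.mem_iUnion₂]
    refine ⟨(e ^ 2, m / e ^ 2), ?_, w, hw, ?_⟩
    · rw [Finset.mem_coe, Nat.mem_divisorsAntidiagonal]; exact ⟨hmul, hm0⟩
    · simp only [Nat.sqrt_eq']; exact hvv.symm
  refine ⟨hfinV, ?_⟩
  rw [Set.ncard_eq_toFinset_card _ hfinV]
  rw [Finset.card_eq_sum_card_fiberwise (f := fun v : ℤ × ℤ => ((Int.gcd v.1 v.2) ^ 2, m / (Int.gcd v.1 v.2) ^ 2))
    (t := m.divisorsAntidiagonal.filter (fun x => IsSquare x.1))]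
  · apply Finset.sum_congr rfl
    rintro ⟨i, j⟩ hx
    rw [Finset.mem_filter] at hx
    obtain ⟨hx, ⟨e, he⟩⟩ := hx
    simp only at he
    have hdx := hdiv _ hx
    simp only at hdx
    rw [Nat.mem_divisorsAntidiagonal] at hx
    simp only at hx
    have he0 : e ≠ 0 := by rintro rfl; simp at he; exact hdx.2.2 he
    have hie : i = e ^ 2 := by rw [he]; ring
    have hej : e ^ 2 * j = m := by rw [← hie]; exact hx.1
    rw [← Set.ncard_coe_finset]
    have himg : (↑(hfinV.toFinset.filter (fun v : ℤ × ℤ => ((Int.gcd v.1 v.2) ^ 2, m / (Int.gcd v.1 v.2) ^ 2) = (i, j))) : Set (ℤ × ℤ))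
        = (fun w : ℤ × ℤ => ((e * w.1, e * w.2) : ℤ × ℤ)) '' (Vp d f j) := by
      ext v
      simp only [Finset.coe_filter, Set.Finite.mem_toFinset, Set.mem_ofPred_eq, Set.mem_image, Prod.mk.injEq]
      constructor
      · rintro ⟨hv, h1, h2⟩
        obtain ⟨e', he', he0', hmul, w, hw, hvv⟩ := hdecomp v hv
        rw [← he'] at h1 h2
        have : e' = e := by rw [hie] at h1; exact Nat.pow_left_injective two_ne_zero h1
        subst this
        rw [h2] at hw
        exact ⟨w, hw, hvv.symm⟩
      · rintro ⟨w, hw, rfl⟩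
        have := hback e j he0 hej w hw
        refine ⟨this.1, ?_, ?_⟩
        · rw [this.2, hie]
        · rw [this.2, ← hej]; exact Nat.mul_div_cancel_left _ (by positivity)
    rw [himg, Set.ncard_image_of_injective]
    intro a b hab
    simp only [Prod.mk.injEq] at hab
    have : (e : ℤ) ≠ 0 := by exact_mod_cast he0
    exact Prod.ext (mul_left_cancel₀ this hab.1) (mul_left_cancel₀ this hab.2)
  · intro v hv
    simp only [Set.Finite.coe_toFinset] at hv
    obtain ⟨e', he', he0', hmul, w, hw, hvv⟩ := hdecomp v hv
    simp only [Finset.coe_filter, Nat.mem_divisorsAntidiagonal, Set.mem_ofPred_eq]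
    rw [← he']
    exact ⟨⟨hmul, hm0⟩, ⟨e', by ring⟩⟩

lemma cone_pos {d : ℕ} {f : ℤ × ℤ × ℤ} (ha : f.1 ≠ 0) (hd : formDisc f = d) {v : ℤ × ℤ} (h : cone d f v) :
    0 < formVal f v.1 v.2 := by
  have := xi_et ha hd v
  have h2 : 0 < xi d f v * et d f v := mul_pos (h.1.trans h.2.1) h.1
  rw [this] at h2
  exact_mod_cast h2

lemma Cnt_card {d : ℕ} {f : ℤ × ℤ × ℤ} (ha : f.1 ≠ 0) (hd : formDisc f = d)
    (hfin : ∀ m : ℕ, m ≠ 0 → Nat.Coprime m (2 * d) → (Vp d f m).Finite) (K : ℕ) :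
    (Cnt d f K).Finite ∧ (Cnt d f K).ncard = ∑ m ∈ Finset.Ioc 0 (K ^ 2) with Nat.Coprime m (2 * d), (Vall d f m).ncard := by
  classical
  have hmem : ∀ v, v ∈ Cnt d f K ↔ ∃ m ∈ (Finset.Ioc 0 (K ^ 2)).filter (fun m => Nat.Coprime m (2 * d)), v ∈ Vall d f m := by
    intro v
    constructor
    · rintro ⟨h1, h2, h3⟩
      have hp := cone_pos ha hd h1
      obtain ⟨m, hm⟩ := Int.eq_ofNat_of_zero_le hp.le
      refine ⟨m, ?_, h1, hm⟩
      rw [hm] at h2 h3 hp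
      rw [Finset.mem_filter, Finset.mem_Ioc]
      refine ⟨⟨by exact_mod_cast hp, by exact_mod_cast h2⟩, ?_⟩
      rwa [Int.gcd_natCast_natCast] at h3
    · rintro ⟨m, hm, h1, h2⟩
      rw [Finset.mem_filter, Finset.mem_Ioc] at hm
      refine ⟨h1, ?_, ?_⟩
      · rw [h2]; exact_mod_cast hm.1.2
      · rw [h2, Int.gcd_natCast_natCast]; exact hm.2
  have hfinV : ∀ m ∈ (Finset.Ioc 0 (K ^ 2)).filter (fun m => Nat.Coprime m (2 * d)), (Vall d f m).Finite := by
    intro m hm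
    rw [Finset.mem_filter, Finset.mem_Ioc] at hm
    exact (Vall_card hfin (by omega) hm.2).1
  have hfinC : (Cnt d f K).Finite := by
    apply Set.Finite.subset (Set.Finite.biUnion (Finset.finite_toSet _) hfinV)
    intro v hv
    rw [hmem] at hv
    rw [Set.mem_iUnion₂]
    simpa using hv
  refine ⟨hfinC, ?_⟩
  rw [Set.ncard_eq_toFinset_card _ hfinC, Finset.card_eq_sum_card_fiberwise (f := fun v => (formVal f v.1 v.2).toNat)
    (t := (Finset.Ioc 0 (K ^ 2)).filter (fun m => Nat.Coprime m (2 * d)))]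
  · apply Finset.sum_congr rfl
    intro m hm
    rw [← Set.ncard_coe_finset]
    congr 1
    ext v
    simp only [Finset.coe_filter, Set.Finite.mem_toFinset, Set.mem_ofPred_eq]
    constructor
    · rintro ⟨h1, h2⟩
      exact ⟨h1.1, by have := cone_pos ha hd h1.1; omega⟩
    · intro h
      exact ⟨(hmem v).2 ⟨m, hm, h⟩, by rw [h.2]; simp⟩
  · intro v hv
    simp only [Set.Finite.coe_toFinset] at hv
    rw [hmem] at hv
    obtain ⟨m, hm, h⟩ := hv
    simp only [h.2, Int.toNat_natCast]
    exact hm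

lemma E_apply {d m : ℕ} (hm0 : m ≠ 0) (hm : Nat.Coprime m (2 * d)) :
    (fsq (2 * d) * frc d) m = ((∑ x ∈ m.divisorsAntidiagonal with IsSquare x.1, rcnt d x.2 : ℕ) : ℝ) := by
  classical
  rw [ArithmeticFunction.mul_apply, Finset.sum_filter]
  push_cast
  apply Finset.sum_congr rfl
  intro x hx
  rw [Nat.mem_divisorsAntidiagonal] at hx
  have hx1 : x.1 ∣ m := ⟨x.2, hx.1.symm⟩
  have hx2 : x.2 ∣ m := ⟨x.1, by rw [← hx.1]; ring⟩
  have c1 := Nat.Coprime.coprime_dvd_left hx1 hm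
  have c2 := Nat.Coprime.coprime_dvd_left hx2 hm
  have n1 : x.1 ≠ 0 := fun h => hm0 (by rw [← hx.1, h]; simp)
  have n2 : x.2 ≠ 0 := fun h => hm0 (by rw [← hx.1, h]; simp)
  rw [fsq_apply, frc_apply, if_pos (⟨n2, c2⟩ : x.2 ≠ 0 ∧ _)]
  by_cases h : IsSquare x.1
  · rw [if_pos h, if_pos ⟨n1, h, c1⟩, one_mul]
  · rw [if_neg h, if_neg (fun hh => h hh.2.1), zero_mul]

lemma E_nonneg (d m : ℕ) : 0 ≤ (fsq (2 * d) * frc d) m := by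
  classical
  rw [ArithmeticFunction.mul_apply]
  apply Finset.sum_nonneg
  intro x _
  rw [fsq_apply, frc_apply]
  split_ifs <;> simp

lemma E_zero {d m : ℕ} (hm : ¬ Nat.Coprime m (2 * d)) : (fsq (2 * d) * frc d) m = 0 := by
  classical
  rw [ArithmeticFunction.mul_apply]
  apply Finset.sum_eq_zero
  intro x hx
  rw [Nat.mem_divisorsAntidiagonal] at hx
  rw [fsq_apply, frc_apply]
  by_cases h1 : Nat.Coprime x.1 (2 * d)
  · rw [if_neg (c := x.2 ≠ 0 ∧ _), mul_zero]
    rintro ⟨_, h2⟩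
    exact hm (hx.1 ▸ Nat.Coprime.mul_left h1 h2)
  · rw [if_neg, zero_mul]; tauto

variable {d : ℕ} {rep : Cl d → ℤ × ℤ × ℤ}

lemma Cnt_sum_le (hd : d ≠ 0) (hP : PellOK d) (hd4 : d % 4 = 0 ∨ d % 4 = 1) (r1 : ∀ q, IsPrimitiveForm (rep q))
    (r2 : ∀ q, formDisc (rep q) = d) (r3 : ∀ q, IsCoprime (rep q).1 ((2 * d : ℕ) : ℤ)) (r4 : ∀ f : PF d, formEquiv (rep (Quot.mk _ f)) f.1) (r5 : ∀ q q', formEquiv (rep q) (rep q') → q = q') (s : Finset (Cl d)) (K : ℕ) :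
    ∑ q ∈ s, ((Cnt d (rep q) K).ncard : ℝ) ≤ ∑ m ∈ Finset.Ioc 0 (K ^ 2), (fsq (2 * d) * frc d) m := by
  have hfin : ∀ q, ∀ m : ℕ, m ≠ 0 → Nat.Coprime m (2 * d) → (Vp d (rep q) m).Finite :=
    fun q m h1 h2 => Vp_finite hd hP hd4 r1 r2 r3 r4 r5 h1 h2 q
  have h1 : ∑ m ∈ Finset.Ioc 0 (K ^ 2), (fsq (2 * d) * frc d) m = ∑ m ∈ Finset.Ioc 0 (K ^ 2) with Nat.Coprime m (2 * d), (fsq (2 * d) * frc d) m := by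
    rw [Finset.sum_filter]
    apply Finset.sum_congr rfl
    intro m _
    split_ifs with h
    · rfl
    · exact E_zero h
  rw [h1]
  simp_rw [fun q => (Cnt_card (rep_ne hd r3 q) (r2 q) (hfin q) K).2]
  push_cast
  rw [Finset.sum_comm]
  apply Finset.sum_le_sum
  intro m hm
  rw [Finset.mem_filter, Finset.mem_Ioc] at hm
  have hm0 : m ≠ 0 := by omega
  rw [E_apply hm0 hm.2]
  simp_rw [(Vall_card (hfin _) hm0 hm.2).2]
  norm_cast
  rw [Finset.sum_comm]
  apply Finset.sum_le_sum
  intro x hx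
  rw [Finset.mem_filter, Nat.mem_divisorsAntidiagonal] at hx
  have hx2 : x.2 ∣ m := ⟨x.1, by rw [← hx.1.1]; ring⟩
  exact Vp_sum_le hd hP hd4 r1 r2 r3 r4 r5 (fun h => hm0 (by rw [← hx.1.1, h]; simp)) (Nat.Coprime.coprime_dvd_left hx2 hm.2) s

lemma Cnt_sum_eq (hd : d ≠ 0) (hP : PellOK d) (hd4 : d % 4 = 0 ∨ d % 4 = 1) (r1 : ∀ q, IsPrimitiveForm (rep q))
    (r2 : ∀ q, formDisc (rep q) = d) (r3 : ∀ q, IsCoprime (rep q).1 ((2 * d : ℕ) : ℤ)) (r4 : ∀ f : PF d, formEquiv (rep (Quot.mk _ f)) f.1) (r5 : ∀ q q', formEquiv (rep q) (rep q') → q = q') [Fintype (Cl d)] (K : ℕ) :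
    ∑ q : Cl d, ((Cnt d (rep q) K).ncard : ℝ) = ∑ m ∈ Finset.Ioc 0 (K ^ 2), (fsq (2 * d) * frc d) m := by
  have hfin : ∀ q, ∀ m : ℕ, m ≠ 0 → Nat.Coprime m (2 * d) → (Vp d (rep q) m).Finite :=
    fun q m h1 h2 => Vp_finite hd hP hd4 r1 r2 r3 r4 r5 h1 h2 q
  have h1 : ∑ m ∈ Finset.Ioc 0 (K ^ 2), (fsq (2 * d) * frc d) m = ∑ m ∈ Finset.Ioc 0 (K ^ 2) with Nat.Coprime m (2 * d), (fsq (2 * d) * frc d) m := by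
    rw [Finset.sum_filter]
    apply Finset.sum_congr rfl
    intro m _
    split_ifs with h
    · rfl
    · exact E_zero h
  rw [h1]
  simp_rw [fun q => (Cnt_card (rep_ne hd r3 q) (r2 q) (hfin q) K).2]
  push_cast
  rw [Finset.sum_comm]
  apply Finset.sum_congr rfl
  intro m hm
  rw [Finset.mem_filter, Finset.mem_Ioc] at hm
  have hm0 : m ≠ 0 := by omega
  rw [E_apply hm0 hm.2]
  simp_rw [(Vall_card (hfin _) hm0 hm.2).2]
  norm_cast
  rw [Finset.sum_comm]
  apply Finset.sum_congr rfl
  intro x hx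
  rw [Finset.mem_filter, Nat.mem_divisorsAntidiagonal] at hx
  have hx2 : x.2 ∣ m := ⟨x.1, by rw [← hx.1.1]; ring⟩
  exact Vp_sum_eq hd hP hd4 r1 r2 r3 r4 r5 (fun h => hm0 (by rw [← hx.1.1, h]; simp)) (Nat.Coprime.coprime_dvd_left hx2 hm.2)

end P2i

section P2j

/-- residues giving values coprime to `2d` -/
def good (d : ℕ) (f : ℤ × ℤ × ℤ) : Finset (ℕ × ℕ) :=
  (Finset.range (2 * d) ×ˢ Finset.range (2 * d)).filter
    (fun v => Int.gcd (formVal f v.1 v.2) ((2 * d : ℕ) : ℤ) = 1)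

lemma gcd_shift (f : ℤ × ℤ × ℤ) (N : ℕ) (x y z w : ℤ) :
    Int.gcd (formVal f (x + N * z) (y + N * w)) N = Int.gcd (formVal f x y) N := by
  have : formVal f (x + N * z) (y + N * w) = formVal f x y + N * (f.1 * (2 * x * z + N * z ^ 2) + f.2.1 * (x * w + y * z + N * z * w) + f.2.2 * (2 * y * w + N * w ^ 2)) := by
    simp only [formVal]; ring
  rw [this]; exact Int.gcd_add_mul_left_left _ _ _

lemma mem_Om0_iff {d : ℕ} {f : ℤ × ℤ × ℤ} (ha : f.1 ≠ 0) (hd : formDisc f = d) {K : ℕ} (hK : 0 < K) (v : ℤ × ℤ) :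
    ((1 / 2 * ((v.1 : ℝ) / K) + ((f.2.1 - Real.sqrt d) / (4 * f.1)) * ((v.2 : ℝ) / K),
      2 * f.1 * ((v.1 : ℝ) / K) + (f.2.1 + Real.sqrt d) * ((v.2 : ℝ) / K)) : ℝ × ℝ) ∈ Om0 (eps d) ↔
    cone d f v ∧ formVal f v.1 v.2 ≤ (K : ℤ) ^ 2 := by
  have hK' : (0 : ℝ) < K := by exact_mod_cast hK
  have e1 : (1 / 2 * ((v.1 : ℝ) / K) + ((f.2.1 - Real.sqrt d) / (4 * f.1)) * ((v.2 : ℝ) / K)) = et d f v / K := by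
    simp only [et]; ring
  have e2 : 2 * f.1 * ((v.1 : ℝ) / K) + (f.2.1 + Real.sqrt d) * ((v.2 : ℝ) / K) = xi d f v / K := by
    simp only [xi]; ring
  rw [e1, e2]
  simp only [Om0, Set.mem_ofPred_eq, cone]
  have e3 : et d f v / K * (xi d f v / K) = formVal f v.1 v.2 / (K : ℝ) ^ 2 := by
    rw [← xi_et ha hd v]; field_simp
  rw [e3, div_pos_iff_of_pos_right hK', div_lt_div_iff_of_pos_right hK', ← mul_div_assoc,
    div_le_div_iff_of_pos_right hK', div_le_one (by positivity)]
  have : ((formVal f v.1 v.2 : ℝ) ≤ (K : ℝ) ^ 2) ↔ formVal f v.1 v.2 ≤ (K : ℤ) ^ 2 := by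
    exact_mod_cast Iff.rfl
  rw [this]; tauto

lemma Cnt_limit {d : ℕ} (hd0 : d ≠ 0) (hP : PellOK d) {f : ℤ × ℤ × ℤ} (ha : f.1 ≠ 0) (hd : formDisc f = d)
    (hfin : ∀ K, (Cnt d f K).Finite) :
    Tendsto (fun K : ℕ => ((Cnt d f K).ncard : ℝ) / (K : ℝ) ^ 2) atTop
      (nhds ((good d f).card * (Real.log (eps d) / Real.sqrt d / ((2 * d : ℕ) : ℝ) ^ 2))) := by
  classical
  have he := eps_gt_one hd0 hP
  have hsq : 0 < Real.sqrt d := Real.sqrt_pos.2 (by exact_mod_cast Nat.pos_of_ne_zero hd0)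
  have ha' : (f.1 : ℝ) ≠ 0 := by exact_mod_cast ha
  have hdet : (1 / 2 : ℝ) * (f.2.1 + Real.sqrt d) - ((f.2.1 - Real.sqrt d) / (4 * f.1)) * (2 * f.1) = Real.sqrt d := by
    field_simp; ring
  have hN : 0 < 2 * d := by omega
  have hlim := fun v0 : ℕ × ℕ => lattice_linear (Om0 (eps d)) (Om0_meas _) (Om0_bdd he) Om0_frontier (1 / 2 : ℝ)
    ((f.2.1 - Real.sqrt d) / (4 * f.1)) (2 * f.1) (f.2.1 + Real.sqrt d) (by rw [hdet]; exact hsq.ne') (2 * d) hN ((v0.1 : ℤ), (v0.2 : ℤ))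
  rw [hdet, Om0_vol he, abs_of_pos hsq] at hlim
  have hsum := tendsto_finsetSum (good d f) (fun v0 _ => hlim v0)
  rw [Finset.sum_const, nsmul_eq_mul] at hsum
  refine hsum.congr' ?_
  filter_upwards [eventually_gt_atTop 0] with K hK
  rw [← Finset.sum_div]
  congr 1
  rw [← Nat.cast_sum]
  congr 1
  rw [Set.ncard_eq_toFinset_card _ (hfin K)]
  have hNz : ((2 * d : ℕ) : ℤ) ≠ 0 := by exact_mod_cast hN.ne'
  have hNp : (0 : ℤ) < ((2 * d : ℕ) : ℤ) := by exact_mod_cast hN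
  rw [Finset.card_eq_sum_card_fiberwise (f := fun v : ℤ × ℤ => ((v.1 % ((2 * d : ℕ) : ℤ)).toNat, (v.2 % ((2 * d : ℕ) : ℤ)).toNat)) (t := good d f)]
  · apply Finset.sum_congr rfl
    rintro ⟨x0, y0⟩ hv0
    rw [← Set.ncard_coe_finset]
    simp only [mem_Om0_iff ha hd hK (((x0 : ℤ) + _ * _, (y0 : ℤ) + _ * _) : ℤ × ℤ)]
    have : Function.Injective (fun w : ℤ × ℤ => (((x0 : ℤ) + ((2 * d : ℕ) : ℤ) * w.1, (y0 : ℤ) + ((2 * d : ℕ) : ℤ) * w.2) : ℤ × ℤ)) := by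
      intro a b hab
      simp only [Prod.mk.injEq, add_right_inj] at hab
      exact Prod.ext (mul_left_cancel₀ hNz hab.1) (mul_left_cancel₀ hNz hab.2)
    rw [← Set.ncard_image_of_injective _ this]
    congr 1
    simp only [good, Finset.mem_filter, Finset.mem_product, Finset.mem_range] at hv0
    ext ⟨x, y⟩
    simp only [Finset.coe_filter, Set.Finite.mem_toFinset, Set.mem_ofPred_eq, Set.mem_image, Prod.mk.injEq, Prod.exists]
    constructor
    · rintro ⟨z, w, h1, rfl, rfl⟩
      refine ⟨⟨h1.1, h1.2, ?_⟩, ?_, ?_⟩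
      · simp only; rw [gcd_shift]; exact hv0.2
      · rw [Int.add_mul_emod_self_left, Int.emod_eq_of_lt (by positivity) (by exact_mod_cast hv0.1.1)]; simp
      · rw [Int.add_mul_emod_self_left, Int.emod_eq_of_lt (by positivity) (by exact_mod_cast hv0.1.2)]; simp
    · rintro ⟨h1, h2, h3⟩
      have e1 := Int.emod_add_mul_ediv x ((2 * d : ℕ) : ℤ)
      have e2 := Int.emod_add_mul_ediv y ((2 * d : ℕ) : ℤ)
      have p1 := Int.emod_nonneg x hNz
      have p2 := Int.emod_nonneg y hNz
      have q1 : x % ((2 * d : ℕ) : ℤ) = x0 := by omega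
      have q2 : y % ((2 * d : ℕ) : ℤ) = y0 := by omega
      rw [q1] at e1
      rw [q2] at e2
      refine ⟨x / ((2 * d : ℕ) : ℤ), y / ((2 * d : ℕ) : ℤ), ?_, e1, e2⟩
      rw [e1, e2]
      exact ⟨h1.1, h1.2.1⟩
  · rintro ⟨x, y⟩ hv
    simp only [Set.Finite.coe_toFinset] at hv
    have p1 := Int.emod_nonneg x hNz
    have p2 := Int.emod_nonneg y hNz
    have l1 := Int.emod_lt_of_pos x hNp
    have l2 := Int.emod_lt_of_pos y hNp
    simp only [good, Finset.coe_filter, Finset.mem_product, Finset.mem_range, Set.mem_ofPred_eq]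
    refine ⟨⟨by omega, by omega⟩, ?_⟩
    rw [Int.toNat_of_nonneg p1, Int.toNat_of_nonneg p2]
    rw [← gcd_shift f (2 * d) _ _ (x / ((2 * d : ℕ) : ℤ)) (y / ((2 * d : ℕ) : ℤ)), Int.emod_add_mul_ediv, Int.emod_add_mul_ediv]
    exact hv.2.2

end P2j

section P2k

lemma card_affine {d : ℕ} (hd : d ≠ 0) {α : ℤ} (h : IsCoprime α (d : ℤ)) (β : ℤ) :
    ∑ x ∈ Finset.range d, (if Int.gcd (α * x + β) d = 1 then 1 else 0) = d.totient := by
  classical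
  haveI : NeZero d := ⟨hd⟩
  have hu : IsUnit ((α : ℤ) : ZMod d) := by
    obtain ⟨r, s, hrs⟩ := h
    have : ((r * α + s * d : ℤ) : ZMod d) = 1 := by rw [hrs]; simp
    push_cast at this; simp at this
    exact IsUnit.of_mul_eq_one_right _ this
  have key : ∀ z : ℤ, Int.gcd z d = 1 ↔ IsUnit (z : ZMod d) := by
    intro z
    rw [← Int.isCoprime_iff_gcd_eq_one]
    constructor
    · rintro ⟨r, s, hrs⟩
      have : ((r * z + s * d : ℤ) : ZMod d) = 1 := by rw [hrs]; simp
      push_cast at this; simp at this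
      exact IsUnit.of_mul_eq_one_right _ this
    · intro hz
      obtain ⟨y, hy⟩ := hz.exists_right_inv
      obtain ⟨y, rfl⟩ := ZMod.intCast_surjective y
      have : ((z * y - 1 : ℤ) : ZMod d) = 0 := by push_cast; rw [hy]; ring
      rw [ZMod.intCast_zmod_eq_zero_iff_dvd] at this
      obtain ⟨k, hk⟩ := this
      exact ⟨y, -k, by linarith⟩
  have h1 : ∑ x ∈ Finset.range d, (if Int.gcd (α * x + β) d = 1 then 1 else 0)
      = ∑ x : ZMod d, if IsUnit ((α : ZMod d) * x + β) then 1 else 0 := by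
    symm
    refine Finset.sum_bij' (fun x _ => x.val) (fun n _ => (n : ZMod d)) ?_ ?_ ?_ ?_ ?_
    · intro x _; exact Finset.mem_range.2 (ZMod.val_lt x)
    · intro n _; exact Finset.mem_univ _
    · intro x _; simp
    · intro n hn; exact ZMod.val_cast_of_lt (Finset.mem_range.1 hn)
    · intro x _
      have := key (α * (x.val : ℤ) + β)
      push_cast at this; simp only [ZMod.natCast_val, ZMod.cast_id', id_eq] at this
      simp only [← this]
      congr 3
      simp
  rw [h1]
  have h2 : ∑ x : ZMod d, (if IsUnit ((α : ZMod d) * x + β) then 1 else 0) = ∑ x : ZMod d, if IsUnit x then 1 else 0 := by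
    apply Fintype.sum_bijective (fun x : ZMod d => (α : ZMod d) * x + β)
    · exact (AddGroup.addRight_bijective (β : ZMod d)).comp (hu.unit.mulLeft_bijective)
    · intro x; rfl
  rw [h2, Finset.sum_boole, ← ZMod.card_units_eq_totient, ← Finset.card_univ]
  simp only [Nat.cast_id]
  symm
  refine Finset.card_bij (fun u _ => (u : ZMod d)) ?_ ?_ ?_
  · intro u _; simp
  · intro u _ v _ huv; exact Units.ext huv
  · intro x hx; simp at hx; exact ⟨hx.unit, Finset.mem_univ _, rfl⟩

lemma sum_range_two_mul {M : Type*} [AddCommMonoid M] (F : ℕ → M) (n : ℕ) :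
    ∑ x ∈ Finset.range (2 * n), F x = ∑ x ∈ Finset.range n, (F (2 * x) + F (2 * x + 1)) := by
  induction n with
  | zero => simp
  | succ n ih => rw [Nat.mul_succ, Finset.sum_range_succ, Finset.sum_range_succ, ih, Finset.sum_range_succ, add_assoc]

lemma gcd_eq_one_iff_prime (z : ℤ) (n : ℕ) : Int.gcd z n = 1 ↔ ∀ p : ℕ, p.Prime → p ∣ n → ¬ (p : ℤ) ∣ z := by
  constructor
  · intro h p hp hpn hpz
    have : (p : ℤ) ∣ (Int.gcd z n : ℕ) := Int.dvd_coe_gcd hpz (by exact_mod_cast hpn)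
    rw [h] at this
    exact hp.one_lt.ne' (Nat.dvd_one.1 (by exact_mod_cast this))
  · intro h
    by_contra hc
    obtain ⟨p, hp, hd⟩ := Nat.exists_prime_and_dvd hc
    have hd' : (p : ℤ) ∣ ((Int.gcd z n : ℕ) : ℤ) := by exact_mod_cast hd
    have h2 := hd'.trans (Int.gcd_dvd_right _ _)
    exact h p hp (by exact_mod_cast h2) (hd'.trans (Int.gcd_dvd_left _ _))

lemma good_card_sum (d : ℕ) (f : ℤ × ℤ × ℤ) : (good d f).card =
    ∑ y ∈ Finset.range (2 * d), ∑ x ∈ Finset.range (2 * d), if Int.gcd (formVal f x y) ((2 * d : ℕ) : ℤ) = 1 then 1 else 0 := by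
  rw [good, Finset.card_filter, Finset.sum_product_right]

lemma good_even {d : ℕ} (hd0 : d ≠ 0) (hd4 : d % 4 = 0) {f : ℤ × ℤ × ℤ} (hd : formDisc f = d)
    (hc : IsCoprime f.1 ((2 * d : ℕ) : ℤ)) : (good d f).card = (2 * d) * (2 * d.totient) := by
  rw [good_card_sum]
  obtain ⟨a, b, c⟩ := f
  simp only [formDisc] at hd hc
  obtain ⟨e, rfl⟩ : ∃ e, d = 4 * e := ⟨d / 4, by omega⟩
  obtain ⟨k, rfl⟩ : ∃ k, b = 2 * k := by
    have : Even (b ^ 2) := ⟨2 * e + 2 * a * c, by push_cast at hd; linarith⟩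
    rw [Int.even_pow' two_ne_zero] at this
    obtain ⟨k, hk⟩ := this; exact ⟨k, by linarith⟩
  have hd' : k ^ 2 - a * c = e := by push_cast at hd; linarith
  have hca : IsCoprime a ((4 * e : ℕ) : ℤ) := by
    apply IsCoprime.of_isCoprime_of_dvd_right hc; exact ⟨2, by push_cast; ring⟩
  have key : ∀ x y : ℕ, Int.gcd (formVal (a, 2 * k, c) x y) ((2 * (4 * e) : ℕ) : ℤ) = 1 ↔ Int.gcd (a * x + (k + e) * y) ((4 * e : ℕ) : ℤ) = 1 := by
    intro x y
    rw [gcd_eq_one_iff_prime, gcd_eq_one_iff_prime]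
    apply forall_congr'; intro p
    apply forall_congr'; intro hp
    have hpp : Prime (p : ℤ) := Nat.prime_iff_prime_int.1 hp
    have hdiv : p ∣ 2 * (4 * e) ↔ p ∣ 4 * e := by
      constructor
      · intro h
        rcases hp.dvd_mul.1 h with h | h
        · exact h.trans ⟨2 * e, by ring⟩
        · exact h
      · intro h; exact h.mul_left _
    rw [hdiv]
    apply imp_congr_right; intro hpe
    rw [not_iff_not]
    have hpa : ¬ (p : ℤ) ∣ a := by
      intro h
      have hu := hca.isUnit_of_dvd' h (by exact_mod_cast hpe)
      exact hpp.not_isUnit hu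
    have hdiff : (p : ℤ) ∣ (a * x + (k + e) * y) ^ 2 - a * formVal (a, 2 * k, c) x y := by
      have e1 : (a * x + (k + e) * y) ^ 2 - a * formVal (a, 2 * k, c) x y = e * (2 * y * (a * x + k * y)) + e * (e + 1) * y ^ 2 := by
        simp only [formVal]; linear_combination (y : ℤ) ^ 2 * hd'
      rw [e1]
      by_cases h2 : p = 2
      · subst h2
        apply dvd_add
        · exact ⟨e * (y * (a * x + k * y)), by push_cast; ring⟩
        · have := Int.even_mul_succ_self (e : ℤ)
          exact (even_iff_two_dvd.1 this).mul_right _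
      · have : (p : ℤ) ∣ e := by
          have : p ∣ e := by
            rcases hp.dvd_mul.1 hpe with h | h
            · exact absurd ((Nat.prime_dvd_prime_iff_eq hp Nat.prime_two).1 (hp.dvd_of_dvd_pow (n := 2) (by simpa using h))) h2
            · exact h
          exact_mod_cast this
        exact dvd_add (this.mul_right _) ((this.mul_right _).mul_right _)
    constructor
    · intro h
      have : (p : ℤ) ∣ (a * x + (k + e) * y) ^ 2 := by
        have := dvd_add hdiff (h.mul_left a); simpa using this
      exact hpp.dvd_of_dvd_pow this
    · intro h
      have h2 : (p : ℤ) ∣ a * formVal (a, 2 * k, c) x y := by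
        have := dvd_sub (dvd_pow h two_ne_zero) hdiff; simpa using this
      exact (hpp.dvd_or_dvd h2).resolve_left hpa
  simp only [key]
  rw [Finset.sum_congr rfl (g := fun _ => 2 * (4 * e).totient)]
  · simp
  · intro y _
    rw [two_mul (4 * e), Finset.sum_range_add, two_mul]
    congr 1
    · exact card_affine hd0 hca _
    · rw [← card_affine hd0 hca ((k + e) * y)]
      apply Finset.sum_congr rfl
      intro x _
      have : a * ((4 * e + x : ℕ) : ℤ) + (k + e) * y = (a * x + (k + e) * y) + a * ((4 * e : ℕ) : ℤ) := by push_cast; ring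
      rw [this, Int.gcd_add_mul_right_left]

lemma good_odd {d : ℕ} (hd0 : d ≠ 0) (hd4 : d % 4 = 1) {f : ℤ × ℤ × ℤ} (hd : formDisc f = d)
    (hc : IsCoprime f.1 ((2 * d : ℕ) : ℤ)) :
    (good d f).card = d * ((if d % 8 = 1 then 1 else 3) * d.totient) := by
  rw [good_card_sum]
  obtain ⟨a, b, c⟩ := f
  simp only [formDisc] at hd hc
  have hb : b % 2 = 1 := by
    have : Odd (b ^ 2) := by
      have : b ^ 2 = d + 4 * (a * c) := by linarith
      rw [this, Int.odd_iff]; omega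
    rw [Int.odd_pow' two_ne_zero, Int.odd_iff] at this; exact this
  have ha : a % 2 = 1 := by
    have := IsCoprime.of_isCoprime_of_dvd_right hc (show (2 : ℤ) ∣ _ from ⟨d, by push_cast; ring⟩)
    rw [Int.isCoprime_iff_gcd_eq_one] at this
    by_contra h
    have h2 : (2 : ℤ) ∣ a := by omega
    have : (2 : ℤ) ∣ (Int.gcd a 2 : ℕ) := Int.dvd_coe_gcd h2 (dvd_refl _)
    omega
  have hcpar : c % 2 = if d % 8 = 1 then 0 else 1 := by
    obtain ⟨j, hj⟩ : ∃ j, b = 2 * j + 1 := ⟨b / 2, by omega⟩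
    obtain ⟨i, hi⟩ : ∃ i, a = 2 * i + 1 := ⟨a / 2, by omega⟩
    obtain ⟨l, hl⟩ := Int.even_mul_succ_self j
    have h8 : (8 : ℤ) * l + 1 - 8 * (i * c) - 4 * c = d := by
      rw [hj, hi] at hd; linear_combination hd - 4 * hl
    split_ifs with h <;> omega
  have hca : IsCoprime a (d : ℤ) := IsCoprime.of_isCoprime_of_dvd_right hc ⟨2, by push_cast; ring⟩
  have hc2 : IsCoprime (2 : ℤ) (d : ℤ) := by
    obtain ⟨j, hj⟩ : ∃ j : ℤ, (d : ℤ) = 2 * j + 1 := ⟨d / 2, by omega⟩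
    exact ⟨-j, 1, by rw [hj]; ring⟩
  have h2a := hc2.mul_left hca
  have h4a := hc2.mul_left h2a
  have key : ∀ x y : ℕ, Int.gcd (formVal (a, b, c) x y) ((2 * d : ℕ) : ℤ) = 1 ↔
      (¬ (2 : ℤ) ∣ formVal (a, b, c) x y) ∧ Int.gcd (2 * a * x + b * y) (d : ℤ) = 1 := by
    intro x y
    rw [gcd_eq_one_iff_prime, gcd_eq_one_iff_prime]
    have hp2 : ∀ p : ℕ, p.Prime → p ∣ d → ((p : ℤ) ∣ formVal (a, b, c) x y ↔ (p : ℤ) ∣ 2 * a * x + b * y) := by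
      intro p hp hpd
      have hpp : Prime (p : ℤ) := Nat.prime_iff_prime_int.1 hp
      have hpz : (p : ℤ) ∣ (d : ℤ) := by exact_mod_cast hpd
      have e1 : (2 * a * x + b * y) ^ 2 - 2 * (2 * a) * formVal (a, b, c) x y = d * y ^ 2 := by
        simp only [formVal]; linear_combination (y : ℤ) ^ 2 * hd
      have hdiff : (p : ℤ) ∣ (2 * a * x + b * y) ^ 2 - 2 * (2 * a) * formVal (a, b, c) x y := by
        rw [e1]; exact hpz.mul_right _
      constructor
      · intro h
        have : (p : ℤ) ∣ (2 * a * x + b * y) ^ 2 := by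
          have := dvd_add hdiff (h.mul_left (2 * (2 * a))); simpa using this
        exact hpp.dvd_of_dvd_pow this
      · intro h
        have h2 : (p : ℤ) ∣ 2 * (2 * a) * formVal (a, b, c) x y := by
          have := dvd_sub (dvd_pow h two_ne_zero) hdiff; simpa using this
        refine (hpp.dvd_or_dvd h2).resolve_left (fun h' => hpp.not_isUnit (h4a.isUnit_of_dvd' h' hpz))
    constructor
    · intro h
      refine ⟨by simpa using h 2 Nat.prime_two ⟨d, rfl⟩, fun p hp hpd => ?_⟩
      rw [← hp2 p hp hpd]; exact h p hp (hpd.mul_left _)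
    · rintro ⟨h1, h2⟩ p hp hpd
      rcases hp.dvd_mul.1 hpd with h | h
      · rw [(Nat.prime_dvd_prime_iff_eq hp Nat.prime_two).1 h]; exact_mod_cast h1
      · rw [hp2 p hp h]; exact h2 p hp h
  have hpar : ∀ x y : ℤ, (2 : ℤ) ∣ formVal (a, b, c) x y ↔ (x * (1 + y) + c * y) % 2 = 0 := by
    intro x y
    obtain ⟨j, hj⟩ : ∃ j, b = 2 * j + 1 := ⟨b / 2, by omega⟩
    obtain ⟨i, hi⟩ : ∃ i, a = 2 * i + 1 := ⟨a / 2, by omega⟩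
    obtain ⟨l, hl⟩ := Int.even_mul_pred_self x
    obtain ⟨l', hl'⟩ := Int.even_mul_pred_self y
    have : formVal (a, b, c) x y = (x * (1 + y) + c * y) + 2 * (i * x ^ 2 + l + j * x * y + c * l') := by
      simp only [formVal]; rw [hj, hi]; linear_combination hl + c * hl'
    rw [this]; omega
  -- values for each residue class
  have c00 : ∀ x y : ℕ, (2 : ℤ) ∣ formVal (a, b, c) (2 * x : ℕ) (2 * y : ℕ) := by
    intro x y; rw [hpar]; push_cast
    rw [show (2 * (x : ℤ) * (1 + 2 * y) + c * (2 * y)) = 2 * (x * (1 + 2 * y) + c * y) by ring]; omega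
  have c10 : ∀ x y : ℕ, ¬ (2 : ℤ) ∣ formVal (a, b, c) (2 * x + 1 : ℕ) (2 * y : ℕ) := by
    intro x y; rw [hpar]; push_cast
    rw [show ((2 * (x : ℤ) + 1) * (1 + 2 * y) + c * (2 * y)) = 2 * (x * (1 + 2 * y) + c * y + y) + 1 by ring]; omega
  have c01 : ∀ (x y : ℕ), (2 : ℤ) ∣ formVal (a, b, c) x (2 * y + 1 : ℕ) ↔ d % 8 = 1 := by
    intro x y; rw [hpar]; push_cast
    rw [show ((x : ℤ) * (1 + (2 * y + 1)) + c * (2 * y + 1)) = 2 * (x * (1 + y) + c * y) + c by ring]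
    generalize (x * (1 + y) + c * y : ℤ) = Z; split_ifs at hcpar with h <;> constructor <;> intro h2 <;> first | exact h | (exfalso; omega) | omega
  simp only [key]
  rw [sum_range_two_mul]
  rw [Finset.sum_congr rfl (g := fun _ => (if d % 8 = 1 then 1 else 3) * d.totient)]
  · simp
  · intro y _
    have s1 : ∑ x ∈ Finset.range (2 * d), (if (¬ (2 : ℤ) ∣ formVal (a, b, c) x (2 * y : ℕ)) ∧ Int.gcd (2 * a * x + b * (2 * y : ℕ)) (d : ℤ) = 1 then 1 else 0) = d.totient := by
      rw [sum_range_two_mul, ← card_affine hd0 h4a (2 * a + b * (2 * y : ℕ))]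
      apply Finset.sum_congr rfl
      intro x _
      rw [if_neg (fun h => h.1 (c00 x y)), zero_add]
      have : (2 * a * ((2 * x + 1 : ℕ) : ℤ) + b * (2 * y : ℕ)) = (2 * (2 * a) * x + (2 * a + b * (2 * y : ℕ))) := by push_cast; ring
      rw [this]
      have := c10 x y
      simp only [this, not_false_eq_true, true_and]
    have s2 : ∑ x ∈ Finset.range (2 * d), (if (¬ (2 : ℤ) ∣ formVal (a, b, c) x (2 * y + 1 : ℕ)) ∧ Int.gcd (2 * a * x + b * (2 * y + 1 : ℕ)) (d : ℤ) = 1 then 1 else 0) = (if d % 8 = 1 then 0 else 2) * d.totient := by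
      simp only [c01]
      split_ifs with h
      · rw [Finset.sum_congr rfl (g := fun _ => 0)]
        · simp
        · intro x _; rw [if_neg]; tauto
      · rw [Finset.sum_congr rfl (g := fun x : ℕ => if Int.gcd (2 * a * x + b * (2 * y + 1 : ℕ)) (d : ℤ) = 1 then 1 else 0)]
        swap
        · intro x _; congr 1; simp [h]
        rw [two_mul d, Finset.sum_range_add, two_mul d.totient]
        congr 1
        · exact card_affine hd0 h2a _
        · rw [← card_affine hd0 h2a (b * (2 * y + 1 : ℕ))]
          apply Finset.sum_congr rfl
          intro x _
          have : 2 * a * ((d + x : ℕ) : ℤ) + b * (2 * y + 1 : ℕ) = (2 * a * x + b * (2 * y + 1 : ℕ)) + 2 * a * (d : ℤ) := by push_cast; ring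
          rw [this, Int.gcd_add_mul_right_left]
    rw [s1, s2]
    split_ifs <;> ring

end P2k

section P2l

/-- the constant c(d) -/
noncomputable def cdisc (d : ℕ) : ℝ :=
  if d % 4 = 0 then 1 else if d % 8 = 1 then 2 else if d % 8 = 5 then 2 / 3 else 0

theorem CNF {d : ℕ} (hd : d ≠ 0) (hs : ¬ IsSquare d) (hP : PellOK d) (hd4 : d % 4 = 0 ∨ d % 4 = 1) :
    (classNumber (d : ℤ) : ℝ) * Real.log (eps d) / Real.sqrt d = cdisc d * Lval d := by
  classical
  obtain ⟨rep, r1, r2, r3, r4, r5⟩ := exists_rep hd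
  have hfin : ∀ q, ∀ m : ℕ, m ≠ 0 → Nat.Coprime m (2 * d) → (Vp d (rep q) m).Finite :=
    fun q m h1 h2 => Vp_finite hd hP hd4 r1 r2 r3 r4 r5 h1 h2 q
  have hdpos : (0 : ℝ) < d := by exact_mod_cast Nat.pos_of_ne_zero hd
  have hφ : (0 : ℝ) < d.totient := by exact_mod_cast Nat.totient_pos.2 (Nat.pos_of_ne_zero hd)
  have hlog : 0 < Real.log (eps d) := Real.log_pos (eps_gt_one hd hP)
  have hsq : 0 < Real.sqrt d := Real.sqrt_pos.2 hdpos
  have hT := T_limit hd hs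
  rw [← R_eq_E hd] at hT
  have hc0 : 0 < cdisc d := by
    unfold cdisc; split_ifs <;> first | (norm_num; done) | omega
  have hgood : ∀ q, ((good d (rep q)).card : ℝ) = 4 * (d : ℝ) ^ 2 * (((2 * d).totient : ℝ) / (2 * d : ℕ)) / cdisc d := by
    intro q
    rcases hd4 with h | h
    · have h2 : (2 * d).totient = 2 * d.totient :=
        Nat.totient_mul_of_prime_of_dvd Nat.prime_two (by omega)
      rw [good_even hd h (r2 q) (r3 q), h2]
      simp only [cdisc, h, if_true]
      push_cast; field_simp; ring
    · have h2 : (2 * d).totient = d.totient := by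
        rw [Nat.totient_mul_of_prime_of_not_dvd Nat.prime_two (by omega)]; simp
      rw [good_odd hd h (r2 q) (r3 q), h2]
      have h0 : ¬ d % 4 = 0 := by omega
      rcases (by omega : d % 8 = 1 ∨ d % 8 = 5) with h8 | h8
      · simp only [cdisc, h8, if_true, h0, if_false]
        push_cast; field_simp; ring
      · have h81 : ¬ d % 8 = 1 := by omega
        simp only [cdisc, h81, h8, if_true, h0, if_false]
        push_cast; field_simp; norm_num
  set Γ : ℝ := 4 * (d : ℝ) ^ 2 * (((2 * d).totient : ℝ) / (2 * d : ℕ)) / cdisc d with hΓ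
  set ρ : ℝ := Real.log (eps d) / Real.sqrt d / ((2 * d : ℕ) : ℝ) ^ 2 with hρ
  have hφ2 : (0 : ℝ) < ((2 * d).totient : ℝ) := by
    exact_mod_cast Nat.totient_pos.2 (by omega)
  have hΓ0 : 0 < Γ := by
    rw [hΓ]; push_cast; positivity
  have hρ0 : 0 < ρ := by rw [hρ]; push_cast; positivity
  have hlim : ∀ q, Tendsto (fun K : ℕ => ((Cnt d (rep q) K).ncard : ℝ) / (K : ℝ) ^ 2) atTop (nhds (Γ * ρ)) := by
    intro q
    have := Cnt_limit hd hP (rep_ne hd r3 q) (r2 q) (fun K => (Cnt_card (rep_ne hd r3 q) (r2 q) (hfin q) K).1)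
    rwa [hgood q] at this
  set M : ℝ := ((2 * d).totient : ℝ) / (2 * d : ℕ) * Lval d with hM
  have hbd : ∀ s : Finset (Cl d), (s.card : ℝ) * (Γ * ρ) ≤ M := by
    intro s
    have h1 : Tendsto (fun K : ℕ => ∑ q ∈ s, ((Cnt d (rep q) K).ncard : ℝ) / (K : ℝ) ^ 2) atTop (nhds (∑ q ∈ s, Γ * ρ)) :=
      tendsto_finsetSum _ fun q _ => hlim q
    rw [Finset.sum_const, nsmul_eq_mul] at h1
    refine le_of_tendsto_of_tendsto' h1 hT fun K => ?_
    rw [← Finset.sum_div]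
    exact div_le_div_of_nonneg_right (Cnt_sum_le hd hP hd4 r1 r2 r3 r4 r5 s K) (by positivity)
  have hfinCl : Finite (Cl d) := by
    by_contra hinf
    rw [not_finite_iff_infinite] at hinf
    obtain ⟨n, hn⟩ := exists_nat_gt (M / (Γ * ρ))
    obtain ⟨s, hs⟩ := Infinite.exists_subset_card_eq (Cl d) n
    have := hbd s
    rw [hs] at this
    rw [div_lt_iff₀ (by positivity)] at hn
    linarith
  haveI := Fintype.ofFinite (Cl d)
  have hE : (Fintype.card (Cl d) : ℝ) * (Γ * ρ) = M := by
    have h1 : Tendsto (fun K : ℕ => ∑ q : Cl d, ((Cnt d (rep q) K).ncard : ℝ) / (K : ℝ) ^ 2) atTop (nhds (∑ q : Cl d, Γ * ρ)) :=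
      tendsto_finsetSum _ fun q _ => hlim q
    rw [Finset.sum_const, nsmul_eq_mul, Finset.card_univ] at h1
    refine tendsto_nhds_unique h1 (hT.congr fun K => ?_)
    rw [← Finset.sum_div, Cnt_sum_eq hd hP hd4 r1 r2 r3 r4 r5 K]
  have hcl : classNumber (d : ℤ) = Fintype.card (Cl d) := by
    have : classNumber (d : ℤ) = Nat.card (Cl d) := rfl
    rw [this, Nat.card_eq_fintype_card]
  rw [hcl]
  rw [hM, hΓ, hρ] at hE
  push_cast at hE
  field_simp at hE
  field_simp
  linarith

end P2l

section P3

/-- truncated 2-adic factor -/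
noncomputable def Ytr : ℕ → ℕ → ℝ
  | 0, _ => 0
  | (J + 1), D => if D % 4 = 0 then 1 + Ytr J (D / 4) / 2 else if D % 8 = 1 then 2 else if D % 8 = 5 then 2 / 3 else 0

/-- odd part sum -/
noncomputable def Aodd (n : ℕ) : ℝ :=
  ∑ v ∈ Finset.range (n + 1) with Odd v ∧ v ^ 2 ∣ n ^ 2 - 4, Lval ((n ^ 2 - 4) / v ^ 2 : ℕ) / v

lemma Ytr_nonneg (J D : ℕ) : 0 ≤ Ytr J D ∧ Ytr J D ≤ 2 := by
  induction J generalizing D with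
  | zero => simp [Ytr]
  | succ J ih =>
    rw [Ytr]
    have := ih (D / 4)
    split_ifs <;> constructor <;> linarith

lemma Ytr_diff (J k D : ℕ) : |Ytr (J + k) D - Ytr J D| ≤ 2 / 2 ^ J := by
  induction J generalizing D with
  | zero =>
    have := Ytr_nonneg k D
    simp [Ytr, abs_le]; constructor <;> linarith
  | succ J ih =>
    rw [show J + 1 + k = (J + k) + 1 by ring, Ytr, Ytr]
    have := ih (D / 4)
    split_ifs
    · rw [show 1 + Ytr (J + k) (D / 4) / 2 - (1 + Ytr J (D / 4) / 2) = (Ytr (J + k) (D / 4) - Ytr J (D / 4)) / 2 by ring, abs_div, abs_two, pow_succ, ← div_div]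
      linarith
    all_goals (rw [sub_self, abs_zero]; positivity)

lemma Ytr_eq_sum (J D : ℕ) : Ytr J D = ∑ a ∈ Finset.range J, if 4 ^ a ∣ D then cdisc (D / 4 ^ a) / 2 ^ a else 0 := by
  induction J generalizing D with
  | zero => simp [Ytr]
  | succ J ih =>
    rw [Finset.sum_range_succ']
    simp only [pow_zero, one_dvd, if_true, Nat.div_one, div_one]
    by_cases h4 : D % 4 = 0
    · rw [Ytr, if_pos h4, ih, Finset.sum_div]
      have : cdisc D = 1 := by simp [cdisc, h4]
      rw [this, add_comm]
      congr 1
      apply Finset.sum_congr rfl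
      intro a _
      obtain ⟨e, rfl⟩ := Nat.dvd_of_mod_eq_zero h4
      have e1 : (4 ^ (a + 1) ∣ 4 * e) ↔ 4 ^ a ∣ e := by
        rw [pow_succ, mul_comm]; exact mul_dvd_mul_iff_left (by norm_num)
      have e2 : 4 * e / 4 ^ (a + 1) = e / 4 ^ a := by
        rw [pow_succ, mul_comm (4 ^ a)]; exact Nat.mul_div_mul_left _ _ (by norm_num)
      rw [Nat.mul_div_cancel_left e (by norm_num)]
      simp only [e1, e2]
      split_ifs
      · rw [pow_succ, div_div]
      · simp
    · rw [Ytr, if_neg h4, Finset.sum_eq_zero]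
      · simp [cdisc, h4]
      · intro a _
        rw [if_neg]
        intro h
        exact h4 (Nat.mod_eq_zero_of_dvd (dvd_trans (dvd_pow_self 4 (by omega)) h))

lemma not_isSquare_D {n : ℕ} (hn : 3 ≤ n) : ¬ IsSquare (n ^ 2 - 4) := by
  rintro ⟨r, hr⟩
  have h4 : 4 ≤ n ^ 2 := by nlinarith
  have h1 : r * r + 4 = n ^ 2 := by omega
  have h2 : r < n := by nlinarith
  have h3 : r * r ≤ (n - 1) * (n - 1) := Nat.mul_self_le_mul_self (by omega)
  obtain ⟨m, rfl⟩ : ∃ m, n = m + 1 := ⟨n - 1, by omega⟩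
  simp at h3
  nlinarith

lemma psi_sq_mul_odd {a e q : ℕ} : psi ((4 ^ a * e : ℕ) : ℤ) q = psi (e : ℤ) q := by
  by_cases h : Odd q
  · have : ((4 ^ a * e : ℕ) : ℤ) = ((2 ^ a : ℕ) : ℤ) ^ 2 * (e : ℤ) := by
      push_cast; rw [show (4 : ℤ) = 2 ^ 2 by norm_num, ← pow_mul, ← pow_mul, mul_comm 2 a]
    rw [this]
    apply psi_sq_mul
    rw [Int.gcd_natCast_natCast]
    exact Nat.Coprime.pow_left _ (Nat.coprime_two_left.2 h)
  · rw [psi_even, psi_even] <;> exact h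

lemma cdisc_odd_sq {v e : ℕ} (hv : Odd v) : cdisc (v ^ 2 * e) = cdisc e := by
  have h8 : v ^ 2 % 8 = 1 := by
    obtain ⟨k, rfl⟩ := hv
    have : (2 * k + 1) ^ 2 = 4 * (k * (k + 1)) + 1 := by ring
    obtain ⟨j, hj⟩ := Nat.even_mul_succ_self k
    have hj' : k * (k + 1) = j + j := hj
    rw [this, hj']; omega
  have h : (v ^ 2 * e) % 8 = e % 8 := by rw [Nat.mul_mod, h8]; simp
  have h' : (v ^ 2 * e) % 4 = e % 4 := by omega
  simp only [cdisc, h, h']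

theorem ampA_eq {n : ℕ} (hn : 3 ≤ n) {J : ℕ} (hJ : n ≤ J) : ampA n = Ytr J (n ^ 2 - 4) * Aodd n := by
  classical
  set D := n ^ 2 - 4 with hD
  have h9 : 9 ≤ n ^ 2 := by nlinarith
  have hD0 : D ≠ 0 := by omega
  have hsq := not_isSquare_D hn
  rw [← hD] at hsq
  have hule : ∀ u, u ^ 2 ∣ D → u < n := by
    intro u h
    have := Nat.le_of_dvd (by omega) h
    by_contra h'
    have : n ^ 2 ≤ u ^ 2 := Nat.pow_le_pow_left (by omega) 2
    omega
  -- step 1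
  have s1 : ampA n = ∑ u ∈ Finset.range (n + 1) with u ^ 2 ∣ D, cdisc (D / u ^ 2) * Lval (D / u ^ 2 : ℕ) / u := by
    have s0 : ∑ u ∈ Finset.range (n + 1) with u ^ 2 ∣ D, cdisc (D / u ^ 2) * Lval (D / u ^ 2 : ℕ) / u
      = ∑ u ∈ Finset.range (n + 1) with (u ^ 2 ∣ D ∧ ((D / u ^ 2) % 4 = 0 ∨ (D / u ^ 2) % 4 = 1)), cdisc (D / u ^ 2) * Lval (D / u ^ 2 : ℕ) / u := by
      symm
      apply Finset.sum_subset
      · intro u hu; simp at hu ⊢; tauto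
      · intro u hu hu'
        simp only [Finset.mem_filter] at hu hu'
        have : cdisc (D / u ^ 2) = 0 := by
          unfold cdisc
          have : ¬ ((D / u ^ 2) % 4 = 0 ∨ (D / u ^ 2) % 4 = 1) := by tauto
          split_ifs <;> first | omega | rfl
        rw [this]; simp
    rw [s0, ampA]
    refine Finset.sum_bij' (fun p _ => p.2) (fun u _ => (D / u ^ 2, u)) ?_ ?_ ?_ ?_ ?_
    · rintro ⟨d, u⟩ h
      simp only [Finset.mem_filter, Finset.mem_product, Finset.mem_range] at h ⊢
      have hd : u ^ 2 ∣ D := ⟨d, by rw [hD, ← h.2.2.2.2]; ring⟩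
      have : D / u ^ 2 = d := by
        rw [hD, ← h.2.2.2.2]; exact Nat.mul_div_cancel _ (pow_pos h.2.2.1 2)
      rw [this]
      exact ⟨by have := hule u hd; omega, hd, h.2.2.2.1⟩
    · intro u h
      simp only [Finset.mem_filter, Finset.mem_product, Finset.mem_range] at h ⊢
      obtain ⟨e, he⟩ := h.2.1
      have hu0 : 0 < u := Nat.pos_of_ne_zero (by rintro rfl; simp at he; omega)
      have he0 : 0 < e := Nat.pos_of_ne_zero (by rintro rfl; simp at he; omega)
      have : D / u ^ 2 = e := by rw [he]; exact Nat.mul_div_cancel_left _ (pow_pos hu0 2)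
      rw [this] at h ⊢
      refine ⟨⟨?_, ?_⟩, he0, hu0, h.2.2, by rw [← hD, he]; ring⟩
      · have : e ≤ D := Nat.le_of_dvd (by omega) ⟨u ^ 2, by rw [he]; ring⟩
        omega
      · have := hule u h.2.1; nlinarith
    · rintro ⟨d, u⟩ h
      simp only [Finset.mem_filter, Finset.mem_product, Finset.mem_range] at h ⊢
      have : D / u ^ 2 = d := by
        rw [hD, ← h.2.2.2.2]; exact Nat.mul_div_cancel _ (pow_pos h.2.2.1 2)
      rw [this]
    · intro u h; rfl
    · rintro ⟨d, u⟩ h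
      simp only [Finset.mem_filter, Finset.mem_product, Finset.mem_range] at h ⊢
      have : D / u ^ 2 = d := by
        rw [hD, ← h.2.2.2.2]; exact Nat.mul_div_cancel _ (pow_pos h.2.2.1 2)
      rw [this]
      have hds : ¬ IsSquare d := by
        rintro ⟨r, hr⟩
        exact hsq ⟨r * u, by rw [hD, ← h.2.2.2.2, hr]; ring⟩
      have hP : PellOK d := ⟨n, u, by omega, h.2.2.1, by
        have : d * u ^ 2 + 4 = n ^ 2 := by rw [h.2.2.2.2]; omega
        zify at this; linarith⟩
      rw [← CNF (by omega) hds hP h.2.2.2.1]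
      have : (u : ℝ) ≠ 0 := by have := h.2.2.1; positivity
      field_simp
  rw [s1, Ytr_eq_sum, ← Finset.sum_filter, Aodd, Finset.sum_mul_sum, ← Finset.sum_product']
  have hJD : ∀ a, 4 ^ a ∣ D → a < J := by
    intro a h
    have : (2 ^ a) ^ 2 ∣ D := by rw [← pow_mul, mul_comm, pow_mul]; exact h
    have := hule _ this
    have := Nat.lt_two_pow_self (n := a)
    omega
  symm
  have pair : ∀ a v, Odd v → 4 ^ a ∣ D → v ^ 2 ∣ D → (2 ^ a * v) ^ 2 ∣ D := by
    intro a v hv h1 h2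
    have : (2 ^ a * v) ^ 2 = 4 ^ a * v ^ 2 := by
      rw [mul_pow, ← pow_mul, mul_comm a 2, pow_mul]; norm_num
    rw [this]
    apply Nat.Coprime.mul_dvd_of_dvd_of_dvd _ h1 h2
    apply Nat.Coprime.pow
    rw [show 4 = 2 ^ 2 by norm_num]
    exact Nat.Coprime.pow_left _ (Nat.coprime_two_left.2 hv)
  refine Finset.sum_bij (fun p _ => 2 ^ p.1 * p.2) ?_ ?_ ?_ ?_
  · rintro ⟨a, v⟩ h
    simp only [Finset.mem_filter, Finset.mem_product, Finset.mem_range] at h ⊢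
    have := pair a v h.2.2.1 h.1.2 h.2.2.2
    exact ⟨by have := hule _ this; omega, this⟩
  · rintro ⟨a, v⟩ h ⟨b, w⟩ h' he
    simp only [Finset.mem_filter, Finset.mem_product, Finset.mem_range] at h h' he
    have hv := h.2.2.1
    have hw := h'.2.2.1
    have key : ∀ {a b v w : ℕ}, Odd w → 2 ^ a * v = 2 ^ b * w → a ≤ b := by
      intro a b v w hw he
      by_contra hab
      push Not at hab
      obtain ⟨c, rfl⟩ : ∃ c, a = b + (c + 1) := ⟨a - b - 1, by omega⟩
      rw [pow_add, mul_assoc] at he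
      have := Nat.eq_of_mul_eq_mul_left (by positivity) he
      rw [← this, pow_succ] at hw
      rw [Nat.odd_mul, Nat.odd_mul] at hw
      exact absurd hw.1.2 (by decide)
    have : a = b := le_antisymm (key hw he) (key hv he.symm)
    subst this
    have := Nat.eq_of_mul_eq_mul_left (by positivity) he
    rw [this]
  · intro u h
    simp only [Finset.mem_filter, Finset.mem_range] at h
    have hu0 : u ≠ 0 := by rintro rfl; have := h.2; simp at this; omega
    obtain ⟨a, v, hv, he⟩ := Nat.exists_eq_two_pow_mul_odd hu0
    refine ⟨(a, v), ?_, he.symm⟩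
    simp only [Finset.mem_filter, Finset.mem_product, Finset.mem_range]
    have h4 : 4 ^ a * v ^ 2 ∣ D := by
      have : (2 ^ a * v) ^ 2 = 4 ^ a * v ^ 2 := by
        rw [mul_pow, ← pow_mul, mul_comm a 2, pow_mul]; norm_num
      rw [← this, ← he]; exact h.2
    have h5 := dvd_trans (Dvd.intro_left _ rfl) h4
    exact ⟨⟨hJD a (dvd_trans (Dvd.intro _ rfl) h4), dvd_trans (Dvd.intro _ rfl) h4⟩, by have := hule v h5; omega, hv, h5⟩
  · rintro ⟨a, v⟩ h
    simp only [Finset.mem_filter, Finset.mem_product, Finset.mem_range] at h ⊢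
    obtain ⟨e, he⟩ := pair a v h.2.2.1 h.1.2 h.2.2.2
    have hv0 : 0 < v := h.2.2.1.pos
    have h4 : (2 ^ a * v) ^ 2 = 4 ^ a * v ^ 2 := by
      rw [mul_pow, ← pow_mul, mul_comm a 2, pow_mul]; norm_num
    have e1 : D / (2 ^ a * v) ^ 2 = e := by rw [he]; exact Nat.mul_div_cancel_left _ (by positivity)
    have e2 : D / 4 ^ a = v ^ 2 * e := by
      rw [he, h4, mul_assoc]; exact Nat.mul_div_cancel_left _ (by positivity)
    have e3 : D / v ^ 2 = 4 ^ a * e := by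
      rw [he, h4, mul_comm (4 ^ a), mul_assoc]; exact Nat.mul_div_cancel_left _ (by positivity)
    rw [e1, e2, e3, cdisc_odd_sq h.2.2.1]
    have : Lval ((4 ^ a * e : ℕ) : ℤ) = Lval (e : ℤ) := by
      unfold Lval Spsi; simp_rw [psi_sq_mul_odd]
    rw [this]
    push_cast
    have : (v : ℝ) ≠ 0 := by positivity
    field_simp

end P3

section P4a

lemma pow_le_two_pow (N : ℕ) : ∃ K : ℕ, 1 ≤ K ∧ ∀ e : ℕ, (e + 1) ^ N ≤ K * 2 ^ e := by
  have h := tendsto_pow_const_div_const_pow_of_one_lt N (one_lt_two (α := ℝ))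
  obtain ⟨B, hB⟩ := h.bddAbove_range
  obtain ⟨K, hK⟩ := exists_nat_ge (2 * max B 1)
  refine ⟨K, ?_, fun e => ?_⟩
  · have : (1 : ℝ) ≤ K := by have := le_max_right B 1; linarith
    exact_mod_cast this
  · have h1 : ((e + 1 : ℕ) : ℝ) ^ N / 2 ^ (e + 1) ≤ B := hB ⟨e + 1, rfl⟩
    rw [div_le_iff₀ (by positivity)] at h1
    have h2 : ((e + 1 : ℕ) : ℝ) ^ N ≤ K * 2 ^ e := by
      calc ((e + 1 : ℕ) : ℝ) ^ N ≤ B * 2 ^ (e + 1) := h1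
        _ = (2 * B) * 2 ^ e := by ring
        _ ≤ K * 2 ^ e := by
          apply mul_le_mul_of_nonneg_right _ (by positivity)
          have := le_max_left B 1; linarith
    exact_mod_cast h2

theorem divisor_bound (N : ℕ) : ∃ C : ℕ, 1 ≤ C ∧ ∀ m : ℕ, m ≠ 0 → m.divisors.card ^ N ≤ C * m := by
  classical
  obtain ⟨K, hK1, hK⟩ := pow_le_two_pow N
  refine ⟨K ^ (2 ^ N), Nat.one_le_pow _ _ hK1, fun m hm => ?_⟩
  rw [Nat.card_divisors hm, ← Finset.prod_pow]
  have h1 : ∏ p ∈ m.primeFactors, (m.factorization p + 1) ^ N ≤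
      ∏ p ∈ m.primeFactors, (if p < 2 ^ N then K else 1) * p ^ (m.factorization p) := by
    apply Finset.prod_le_prod' 
    intro p hp
    have hp' := Nat.prime_of_mem_primeFactors hp
    split_ifs with h
    · exact (hK _).trans (Nat.mul_le_mul_left _ (Nat.pow_le_pow_left hp'.two_le _))
    · push Not at h
      rw [one_mul]
      calc (m.factorization p + 1) ^ N ≤ (2 ^ (m.factorization p)) ^ N :=
            Nat.pow_le_pow_left (Nat.lt_two_pow_self) N
        _ = (2 ^ N) ^ (m.factorization p) := by rw [← pow_mul, ← pow_mul, mul_comm]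
        _ ≤ _ := Nat.pow_le_pow_left h _
  refine h1.trans ?_
  rw [Finset.prod_mul_distrib]
  have h2 : ∏ p ∈ m.primeFactors, p ^ (m.factorization p) = m := Nat.prod_factorization_pow_eq_self hm
  rw [h2]
  apply Nat.mul_le_mul_right
  rw [← Finset.prod_filter, Finset.prod_const]
  apply Nat.pow_le_pow_right hK1
  calc _ ≤ (Finset.range (2 ^ N)).card := Finset.card_le_card (by
        intro p hp; simp at hp ⊢; exact hp.2)
    _ = _ := Finset.card_range _

lemma double_of_square {a b : ℕ} (ha : 3 ≤ a) (hab : a < b) (h : IsSquare ((a ^ 2 - 4) * (b ^ 2 - 4))) : 2 * a ≤ b := by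
  obtain ⟨s, hs⟩ := h
  have h1 : 4 ≤ a ^ 2 := by nlinarith
  have h2 : 4 ≤ b ^ 2 := by nlinarith
  have hs' : ((a : ℤ) ^ 2 - 4) * ((b : ℤ) ^ 2 - 4) = s * s := by
    have := congrArg (Nat.cast : ℕ → ℤ) hs
    rw [Nat.cast_mul, Nat.cast_sub h1, Nat.cast_sub h2] at this
    push_cast at this; exact this
  have hlt : (s : ℤ) < a * b := by
    by_contra hc
    push Not at hc
    have : ((a : ℤ) * b) * (a * b) ≤ s * s := mul_self_le_mul_self (by positivity) hc
    have ha' : (3 : ℤ) ≤ a := by exact_mod_cast ha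
    have hb' : (3 : ℤ) ≤ b := by exact_mod_cast (by omega : 3 ≤ b)
    nlinarith
  have hpar : ∃ m : ℤ, (a : ℤ) * b - s = 2 * m := by
    have he : Even ((s : ℤ) * s - (a * b) * (a * b)) := ⟨2 * (4 - (a : ℤ) ^ 2 - (b : ℤ) ^ 2), by linear_combination -hs'⟩
    have : Even ((a : ℤ) * b - s) := by
      rw [Int.even_sub, Int.even_mul, Int.even_mul] at he
      rw [Int.even_sub]
      tauto
    obtain ⟨m, hm⟩ := this
    exact ⟨m, by linarith⟩
  obtain ⟨m, hm⟩ := hpar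
  have hm1 : 1 ≤ m := by omega
  have ha' : (3 : ℤ) ≤ a := by exact_mod_cast ha
  have hb' : (a : ℤ) + 1 ≤ b := by exact_mod_cast hab
  have hseq : (s : ℤ) = a * b - 2 * m := by linarith
  have heq : m ^ 2 - m * (a * b) + a ^ 2 + b ^ 2 = 4 := by
    rw [hseq] at hs'
    nlinarith
  have hs0 : (0 : ℤ) ≤ s := by positivity
  have hm3 : 3 ≤ m := by
    by_contra hc
    have : m = 1 ∨ m = 2 := by omega
    rcases this with rfl | rfl
    · nlinarith
    · nlinarith [sq_nonneg ((b : ℤ) - a - 1)]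
  by_contra hc
  push Not at hc
  have hc' : (b : ℤ) + 1 ≤ 2 * a := by exact_mod_cast hc
  have hsle : (s : ℤ) ≤ a * b - 6 := by linarith
  have : (s : ℤ) * s ≤ (a * b - 6) * (a * b - 6) := mul_self_le_mul_self hs0 hsle
  nlinarith [mul_nonneg (by linarith : (0 : ℤ) ≤ b - a) (by linarith : (0 : ℤ) ≤ 2 * a - b)]

theorem mult_bound {X : ℕ} (S : Finset ℕ) (hS : ∀ n ∈ S, 3 ≤ n ∧ n ≤ X) (a : ℕ) (ha : 3 ≤ a) :
    (S.filter fun n => IsSquare ((a ^ 2 - 4) * (n ^ 2 - 4))).card ≤ Nat.log 2 X + 1 := by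
  rw [← Finset.card_range (Nat.log 2 X + 1)]
  have hpos : ∀ {n : ℕ}, 3 ≤ n → n ^ 2 - 4 ≠ 0 := by
    intro n hn; have : 9 ≤ n ^ 2 := by nlinarith
    omega
  have hsq : ∀ {x y z : ℕ}, x ≠ 0 → IsSquare (x * y) → IsSquare (x * z) → IsSquare (y * z) := by
    intro x y z hx ⟨r, hr⟩ ⟨s, hs⟩
    have h1 : x ^ 2 ∣ (r * s) ^ 2 := ⟨y * z, by nlinarith⟩
    rw [Nat.pow_dvd_pow_iff (by norm_num)] at h1
    obtain ⟨k, hk⟩ := h1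
    refine ⟨k, ?_⟩
    have : x ^ 2 * (y * z) = x ^ 2 * (k * k) := by
      calc x ^ 2 * (y * z) = (x * y) * (x * z) := by ring
        _ = (r * s) * (r * s) := by rw [hr, hs]; ring
        _ = _ := by rw [hk]; ring
    exact Nat.eq_of_mul_eq_mul_left (by positivity) this
  have key : ∀ b c : ℕ, 3 ≤ b → b < c → IsSquare ((a ^ 2 - 4) * (b ^ 2 - 4)) → IsSquare ((a ^ 2 - 4) * (c ^ 2 - 4)) →
      Nat.log 2 b ≠ Nat.log 2 c := by
    intro b c hb hbc h1 h2 he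
    have h3 := double_of_square hb hbc (hsq (hpos ha) h1 h2)
    have h4 := Nat.log_mono_right (b := 2) h3
    rw [mul_comm, Nat.log_mul_base (by norm_num) (by omega)] at h4
    omega
  refine Finset.card_le_card_of_injOn (fun n => Nat.log 2 n) ?_ ?_
  · intro n hn
    simp only [Finset.coe_filter, Set.mem_ofPred_eq] at hn
    have := Nat.log_mono_right (b := 2) (hS n hn.1).2
    simp; omega
  · intro b hb c hc he
    simp only [Finset.coe_filter, Set.mem_ofPred_eq] at hb hc
    rcases lt_trichotomy b c with h | h | h
    · exact absurd he (key b c (hS b hb.1).1 h hb.2 hc.2)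
    · exact h
    · exact absurd he.symm (key c b (hS c hc.1).1 h hc.2 hb.2)

end P4a

section P4b

lemma psi_prod {ι : Type*} (a : ℤ) (s : Finset ι) (f : ι → ℕ) : psi a (∏ i ∈ s, f i) = ∏ i ∈ s, psi a (f i) := by
  classical
  induction s using Finset.induction_on with
  | empty => simp [psi_one]
  | insert i s hi ih => rw [Finset.prod_insert hi, Finset.prod_insert hi, psi_mul_right, ih]

lemma Spsi_eq_Ioc (a : ℤ) (w : ℕ) : Spsi a w = ∑ q ∈ Finset.Ioc 0 w, psi a q := by
  rw [sum_Ioc_eq_range _ (psi_zero_right a)]; rfl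

/-- coefficient count -/
noncomputable def cntc (k w m : ℕ) : ℕ :=
  ((Fintype.piFinset (fun _ : Fin k => Finset.Ioc 0 w)).filter fun x => ∏ i, x i = m).card

lemma cntc_le (k w m : ℕ) (hm : m ≠ 0) : cntc k w m ≤ m.divisors.card ^ k := by
  classical
  have : (m.divisors.card) ^ k = (Fintype.piFinset (fun _ : Fin k => m.divisors)).card := by simp
  rw [this, cntc]
  apply Finset.card_le_card
  intro x hx
  simp only [Finset.mem_filter, Fintype.mem_piFinset] at hx ⊢
  intro i
  rw [Nat.mem_divisors]
  exact ⟨hx.2 ▸ Finset.dvd_prod_of_mem _ (Finset.mem_univ i), hm⟩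

lemma tupleprod_mem (k w : ℕ) (x : Fin k → ℕ) (hx : x ∈ Fintype.piFinset (fun _ : Fin k => Finset.Ioc 0 w)) :
    ∏ i, x i ∈ Finset.Ioc 0 (w ^ k) := by
  simp only [Fintype.mem_piFinset, Finset.mem_Ioc] at hx ⊢
  refine ⟨Finset.prod_pos fun i _ => (hx i).1, ?_⟩
  calc ∏ i, x i ≤ ∏ i : Fin k, w := Finset.prod_le_prod' fun i _ => (hx i).2
    _ = w ^ k := by simp

lemma cntc_sum (k w : ℕ) : ∑ m ∈ Finset.Ioc 0 (w ^ k), cntc k w m = w ^ k := by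
  classical
  have := Finset.card_eq_sum_card_fiberwise (f := fun x : Fin k → ℕ => ∏ i, x i)
    (s := Fintype.piFinset (fun _ : Fin k => Finset.Ioc 0 w)) (t := Finset.Ioc 0 (w ^ k)) (fun x hx => tupleprod_mem k w x hx)
  rw [Fintype.card_piFinset] at this
  simp at this
  exact this.symm

lemma Spsi_pow (a : ℤ) (k w : ℕ) : Spsi a w ^ k = ∑ m ∈ Finset.Ioc 0 (w ^ k), (cntc k w m : ℝ) * psi a m := by
  classical
  have h1 : Spsi a w ^ k = ∏ i : Fin k, ∑ q ∈ Finset.Ioc 0 w, psi a q := by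
    rw [Spsi_eq_Ioc]; simp
  rw [h1, Finset.prod_univ_sum]
  rw [← Finset.sum_fiberwise_of_maps_to (t := Finset.Ioc 0 (w ^ k)) (g := fun x : Fin k → ℕ => ∏ i, x i) (fun x hx => tupleprod_mem k w x hx)]
  apply Finset.sum_congr rfl
  intro m _
  rw [cntc, ← nsmul_eq_mul]
  rw [← Finset.sum_const]
  apply Finset.sum_congr rfl
  intro x hx
  rw [Finset.mem_filter] at hx
  rw [← hx.2, psi_prod]

theorem moment_bound {ι : Type*} (S : Finset ι) (d : ι → ℕ) {Y μ k w : ℕ} {A : ℝ} (hd0 : ∀ i ∈ S, d i ≠ 0) (hdY : ∀ i ∈ S, d i ≤ Y)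
    (hμ : ∀ i ∈ S, (S.filter fun j => IsSquare (d i * d j)).card ≤ μ)
    (hA : ∀ m : ℕ, 0 < m → m ≤ w ^ k → ((m.divisors.card : ℝ)) ^ k ≤ A) :
    ∑ i ∈ S, (Spsi (d i) w) ^ (2 * k) ≤ A * (w : ℝ) ^ k * ((w : ℝ) ^ k * μ + 4 * (Y : ℝ) ^ 2 * S.card) := by
  classical
  set b : ι → ℝ := fun i => Spsi (d i) w ^ k with hb
  set M := w ^ k with hM
  set c : ℕ → ℝ := fun m => (cntc k w m : ℝ) with hc
  set T := ∑ i ∈ S, b i ^ 2 with hT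
  have hTe : ∑ i ∈ S, (Spsi (d i) w) ^ (2 * k) = T := by
    rw [hT]; apply Finset.sum_congr rfl; intro i _; rw [hb, mul_comm, pow_mul]
  rw [hTe]
  set R : ℝ := ((w : ℝ) ^ k * μ + 4 * (Y : ℝ) ^ 2 * S.card) with hR
  have hR0 : 0 ≤ R := by positivity
  have hT0 : 0 ≤ T := Finset.sum_nonneg fun i _ => sq_nonneg _
  have hA0 : 0 ≤ A * (w : ℝ) ^ k := by
    rcases Nat.eq_zero_or_pos (w ^ k) with h | h
    · rw [← Nat.cast_pow, h]; simp
    · have := hA 1 one_pos h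
      simp at this
      have : 0 ≤ A := by linarith
      positivity
  have hc2 : ∑ m ∈ Finset.Ioc 0 M, c m ^ 2 ≤ A * (w : ℝ) ^ k := by
    have : ((w : ℝ) ^ k) = ∑ m ∈ Finset.Ioc 0 M, c m := by
      have := cntc_sum k w; simp only [hc, hM]; exact_mod_cast this.symm
    rw [this, Finset.mul_sum]
    apply Finset.sum_le_sum
    intro m hm
    rw [Finset.mem_Ioc] at hm
    rw [sq]
    apply mul_le_mul_of_nonneg_right _ (by simp [hc])
    refine le_trans ?_ (hA m hm.1 hm.2)
    simp only [hc]; exact_mod_cast cntc_le k w m (by omega)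
  have h1 : T = ∑ m ∈ Finset.Ioc 0 M, c m * ∑ i ∈ S, b i * psi (d i) m := by
    simp_rw [Finset.mul_sum]
    rw [Finset.sum_comm, hT]
    apply Finset.sum_congr rfl
    intro i _
    rw [sq]
    nth_rw 2 [hb]
    simp only
    rw [Spsi_pow, Finset.mul_sum]
    apply Finset.sum_congr rfl
    intro m _; ring
  have hK : ∀ i ∈ S, ∀ j ∈ S, |∑ m ∈ Finset.Ioc 0 M, psi (d i) m * psi (d j) m| ≤
      if IsSquare (d i * d j) then (w : ℝ) ^ k else 4 * (Y : ℝ) ^ 2 := by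
    intro i hi j hj
    have e : ∑ m ∈ Finset.Ioc 0 M, psi (d i) m * psi (d j) m = Spsi ((d i * d j : ℕ) : ℤ) M := by
      rw [Spsi_eq_Ioc]
      apply Finset.sum_congr rfl
      intro m _
      rw [← psi_mul_left]; push_cast; rfl
    rw [e]
    split_ifs with h
    · have := Spsi_trivial ((d i * d j : ℕ) : ℤ) M
      rw [hM] at this ⊢; push_cast at this ⊢; exact this
    · refine (psi_sum_bound (mul_ne_zero (hd0 i hi) (hd0 j hj)) h (M + 1)).trans ?_
      have : ((d i * d j : ℕ) : ℝ) ≤ (Y : ℝ) ^ 2 := by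
        rw [sq]; exact_mod_cast Nat.mul_le_mul (hdY i hi) (hdY j hj)
      linarith
  set KK : ι → ι → ℝ := fun i j => if IsSquare (d i * d j) then (w : ℝ) ^ k else 4 * (Y : ℝ) ^ 2 with hKK
  have hKsymm : ∀ i j, KK i j = KK j i := by intro i j; simp only [hKK, mul_comm]
  have hKnn : ∀ i j, 0 ≤ KK i j := by intro i j; simp only [hKK]; split_ifs <;> positivity
  have hKrow : ∀ i ∈ S, ∑ j ∈ S, KK i j ≤ R := by
    intro i hi
    simp only [hKK]
    rw [Finset.sum_ite, Finset.sum_const, Finset.sum_const, nsmul_eq_mul, nsmul_eq_mul, hR]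
    apply add_le_add
    · rw [mul_comm]
      apply mul_le_mul_of_nonneg_left _ (by positivity)
      exact_mod_cast hμ i hi
    · rw [mul_comm]
      apply mul_le_mul_of_nonneg_left _ (by positivity)
      exact_mod_cast Finset.card_filter_le _ _
  have h2 : ∑ m ∈ Finset.Ioc 0 M, (∑ i ∈ S, b i * psi (d i) m) ^ 2 ≤ T * R := by
    have e : ∑ m ∈ Finset.Ioc 0 M, (∑ i ∈ S, b i * psi (d i) m) ^ 2 =
        ∑ i ∈ S, ∑ j ∈ S, b i * b j * ∑ m ∈ Finset.Ioc 0 M, psi (d i) m * psi (d j) m := by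
      simp_rw [sq, Finset.sum_mul_sum, Finset.mul_sum]
      rw [Finset.sum_comm]
      apply Finset.sum_congr rfl
      intro i _
      rw [Finset.sum_comm]
      apply Finset.sum_congr rfl
      intro j _
      apply Finset.sum_congr rfl
      intro m _; ring
    rw [e]
    have h3 : ∑ i ∈ S, ∑ j ∈ S, b i * b j * ∑ m ∈ Finset.Ioc 0 M, psi (d i) m * psi (d j) m ≤
        ∑ i ∈ S, ∑ j ∈ S, ((b i ^ 2) * KK i j + (b j ^ 2) * KK i j) / 2 := by
      apply Finset.sum_le_sum; intro i hi
      apply Finset.sum_le_sum; intro j hj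
      have h4 := hK i hi j hj
      have h5 : |b i * b j| ≤ (b i ^ 2 + b j ^ 2) / 2 := by
        rw [abs_le]; constructor <;> nlinarith [sq_nonneg (b i + b j), sq_nonneg (b i - b j)]
      calc _ ≤ |b i * b j * ∑ m ∈ Finset.Ioc 0 M, psi (d i) m * psi (d j) m| := le_abs_self _
        _ ≤ (b i ^ 2 + b j ^ 2) / 2 * KK i j := by
          rw [abs_mul]; exact mul_le_mul h5 h4 (abs_nonneg _) (by positivity)
        _ = _ := by ring
    refine h3.trans ?_
    have h6 : ∑ i ∈ S, ∑ j ∈ S, (b i ^ 2) * KK i j ≤ T * R := by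
      rw [hT, Finset.sum_mul]
      apply Finset.sum_le_sum; intro i hi
      rw [← Finset.mul_sum]
      exact mul_le_mul_of_nonneg_left (hKrow i hi) (sq_nonneg _)
    have h7 : ∑ i ∈ S, ∑ j ∈ S, (b j ^ 2) * KK i j ≤ T * R := by
      rw [Finset.sum_comm]
      simp_rw [fun i j => hKsymm i j] at h6 ⊢
      refine le_trans (le_of_eq ?_) h6
      apply Finset.sum_congr rfl; intro i _; apply Finset.sum_congr rfl; intro j _; rw [hKsymm]
    simp_rw [← Finset.sum_div, Finset.sum_add_distrib]
    linarith
  have h8 : T ^ 2 ≤ (A * (w : ℝ) ^ k) * (T * R) := by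
    calc T ^ 2 ≤ (∑ m ∈ Finset.Ioc 0 M, c m ^ 2) * ∑ m ∈ Finset.Ioc 0 M, (∑ i ∈ S, b i * psi (d i) m) ^ 2 := by
          nth_rw 1 [h1]; exact Finset.sum_mul_sq_le_sq_mul_sq _ _ _
      _ ≤ _ := mul_le_mul hc2 h2 (Finset.sum_nonneg fun _ _ => sq_nonneg _) hA0
  rcases hT0.eq_or_lt with h | h
  · rw [← h]; exact mul_nonneg hA0 hR0
  · nlinarith

end P4b

section P4c

set_option exponentiation.threshold 400

lemma log_bound (t : ℕ) : Nat.log 2 (t ^ 2000) ≤ 2000 * t := by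
  have h : t ^ 2000 ≤ 2 ^ (2000 * t) := by
    rw [mul_comm, pow_mul]; exact Nat.pow_le_pow_left (Nat.lt_two_pow_self).le _
  calc Nat.log 2 (t ^ 2000) ≤ Nat.log 2 (2 ^ (2000 * t)) := Nat.log_mono_right h
    _ = _ := Nat.log_pow (by norm_num) _

lemma split_pow {T x : ℝ} (hT : 0 < T) (hx : 0 ≤ x) : x ≤ 1 / T + T ^ 49 * x ^ 50 := by
  by_cases h : x ≤ 1 / T
  · have : 0 ≤ T ^ 49 * x ^ 50 := by positivity
    linarith
  · push Not at h
    have h1 : 1 ≤ T * x := by rw [div_lt_iff₀ hT] at h; linarith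
    have h2 : 1 ≤ (T * x) ^ 49 := one_le_pow₀ h1
    have h3 : T ^ 49 * x ^ 50 = x * (T * x) ^ 49 := by ring
    have : 0 < 1 / T := by positivity
    rw [h3]; nlinarith

/-- the set of n -/
def Nset (X u : ℕ) : Finset ℕ := (Finset.Icc 3 X).filter fun n => u ^ 2 ∣ n ^ 2 - 4

theorem LV : ∃ C : ℝ, 0 < C ∧ ∀ t u w : ℕ, 1 ≤ t → 1 ≤ u → t ^ 400 ≤ w → w ≤ t ^ 6000 →
    ∑ n ∈ Nset (t ^ 2000) u, |Spsi ((n ^ 2 - 4) / u ^ 2 : ℕ) w| ≤ C * w * (t : ℝ) ^ 1990 := by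
  obtain ⟨C0, hC1, hC0⟩ := divisor_bound 7500
  have hC1' : (1 : ℝ) ≤ C0 := by exact_mod_cast hC1
  refine ⟨1 + 2005 * C0, by linarith, fun t u w ht hu hw1 hw2 => ?_⟩
  have ht' : (1 : ℝ) ≤ t := by exact_mod_cast ht
  have ht0 : (0 : ℝ) < t := by linarith
  have hw0 : 0 < w := lt_of_lt_of_le (by positivity) hw1
  have hw0' : (0 : ℝ) < w := by exact_mod_cast hw0
  set S := Nset (t ^ 2000) u with hS
  have hmem : ∀ n ∈ S, 3 ≤ n ∧ n ≤ t ^ 2000 ∧ u ^ 2 ∣ n ^ 2 - 4 := by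
    intro n hn
    simp only [hS, Nset, Finset.mem_filter, Finset.mem_Icc] at hn
    exact ⟨hn.1.1, hn.1.2, hn.2⟩
  have hcard : (S.card : ℝ) ≤ (t : ℝ) ^ 2000 := by
    have : S.card ≤ t ^ 2000 := by
      calc S.card ≤ (Finset.Icc 3 (t ^ 2000)).card := Finset.card_filter_le _ _
        _ ≤ t ^ 2000 := by rw [Nat.card_Icc]; omega
    exact_mod_cast this
  have hmom := moment_bound S (fun n => (n ^ 2 - 4) / u ^ 2) (Y := t ^ 4000) (μ := Nat.log 2 (t ^ 2000) + 1) (k := 25) (w := w)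
    (A := C0 * (t : ℝ) ^ 500) ?_ ?_ ?_ ?_
  rotate_left
  · intro n hn
    obtain ⟨h3, _, e, he⟩ := hmem n hn
    have h9 : 9 ≤ n ^ 2 := by nlinarith
    rw [he, Nat.mul_div_cancel_left _ (by positivity)]
    rintro rfl
    omega
  · intro n hn
    obtain ⟨h3, hX, _⟩ := hmem n hn
    calc (n ^ 2 - 4) / u ^ 2 ≤ n ^ 2 - 4 := Nat.div_le_self _ _
      _ ≤ n ^ 2 := Nat.sub_le _ _
      _ ≤ (t ^ 2000) ^ 2 := Nat.pow_le_pow_left hX 2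
      _ = t ^ 4000 := by rw [← pow_mul]
  · intro n hn
    obtain ⟨h3, hX, e, he⟩ := hmem n hn
    refine le_trans (Finset.card_le_card ?_) (mult_bound (X := t ^ 2000) S (fun m hm => ⟨(hmem m hm).1, (hmem m hm).2.1⟩) n h3)
    intro m hm
    rw [Finset.mem_filter] at hm ⊢
    refine ⟨hm.1, ?_⟩
    obtain ⟨_, _, e', he'⟩ := hmem m hm.1
    have h := hm.2
    rw [he, he', Nat.mul_div_cancel_left _ (by positivity), Nat.mul_div_cancel_left _ (by positivity)] at h
    obtain ⟨r, hr⟩ := h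
    exact ⟨u ^ 2 * r, by rw [he, he']; linear_combination u ^ 4 * hr⟩
  · intro m hm0 hm
    have h1 := hC0 m (by omega)
    have h2 : (m.divisors.card ^ 25) ^ 300 ≤ (C0 * t ^ 500) ^ 300 := by
      calc (m.divisors.card ^ 25) ^ 300 = m.divisors.card ^ 7500 := by rw [← pow_mul]
        _ ≤ C0 * m := h1
        _ ≤ C0 * (t ^ 6000) ^ 25 := Nat.mul_le_mul_left _ (hm.trans (Nat.pow_le_pow_left hw2 _))
        _ = C0 * (t ^ 500) ^ 300 := by rw [← pow_mul, ← pow_mul]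
        _ ≤ C0 ^ 300 * (t ^ 500) ^ 300 := Nat.mul_le_mul_right _ (Nat.le_self_pow (by norm_num) _)
        _ = _ := by rw [mul_pow]
    have h3 := (Nat.pow_le_pow_iff_left (by norm_num)).1 h2
    exact_mod_cast h3
  have hμ : ((Nat.log 2 (t ^ 2000) + 1 : ℕ) : ℝ) ≤ 2001 * t := by
    have := log_bound t
    have : ((Nat.log 2 (t ^ 2000) : ℕ) : ℝ) ≤ 2000 * t := by exact_mod_cast this
    push_cast; linarith
  have hw25 : (t : ℝ) ^ 10000 ≤ (w : ℝ) ^ 25 := by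
    have : (t ^ 400) ^ 25 ≤ w ^ 25 := Nat.pow_le_pow_left hw1 25
    rw [← pow_mul] at this
    exact_mod_cast this
  have hsum : ∑ n ∈ S, (|Spsi ((n ^ 2 - 4) / u ^ 2 : ℕ) w| / w) ^ 50 ≤ 2005 * C0 * (t : ℝ) ^ 501 := by
    have e : ∑ n ∈ S, (|Spsi ((n ^ 2 - 4) / u ^ 2 : ℕ) w| / w) ^ 50 = (∑ n ∈ S, Spsi ((n ^ 2 - 4) / u ^ 2 : ℕ) w ^ (2 * 25)) / (w : ℝ) ^ 50 := by
      rw [Finset.sum_div]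
      apply Finset.sum_congr rfl
      intro n _
      rw [div_pow, Even.pow_abs (by decide)]
    rw [e, div_le_iff₀ (by positivity)]
    refine hmom.trans ?_
    have h4 : (w : ℝ) ^ 25 * ((Nat.log 2 (t ^ 2000) + 1 : ℕ) : ℝ) + 4 * ((t ^ 4000 : ℕ) : ℝ) ^ 2 * S.card ≤ (w : ℝ) ^ 25 * (2005 * t) := by
      have h5 : ((t ^ 4000 : ℕ) : ℝ) ^ 2 * S.card ≤ (w : ℝ) ^ 25 := by
        calc ((t ^ 4000 : ℕ) : ℝ) ^ 2 * S.card ≤ ((t ^ 4000 : ℕ) : ℝ) ^ 2 * (t : ℝ) ^ 2000 := by gcongr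
          _ = (t : ℝ) ^ 10000 := by push_cast; rw [← pow_mul, ← pow_add]
          _ ≤ _ := hw25
      have h6 : (w : ℝ) ^ 25 * ((Nat.log 2 (t ^ 2000) + 1 : ℕ) : ℝ) ≤ (w : ℝ) ^ 25 * (2001 * t) := by gcongr
      have h7 : (w : ℝ) ^ 25 * 1 ≤ (w : ℝ) ^ 25 * t := by gcongr
      linarith
    calc _ ≤ C0 * (t : ℝ) ^ 500 * (w : ℝ) ^ 25 * ((w : ℝ) ^ 25 * (2005 * t)) := by gcongr
      _ = _ := by ring
  have hfin : ∑ n ∈ S, |Spsi ((n ^ 2 - 4) / u ^ 2 : ℕ) w| / w ≤ (1 + 2005 * C0) * (t : ℝ) ^ 1990 := by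
    calc ∑ n ∈ S, |Spsi ((n ^ 2 - 4) / u ^ 2 : ℕ) w| / w ≤
        ∑ n ∈ S, (1 / (t : ℝ) ^ 10 + ((t : ℝ) ^ 10) ^ 49 * (|Spsi ((n ^ 2 - 4) / u ^ 2 : ℕ) w| / w) ^ 50) :=
          Finset.sum_le_sum fun n _ => split_pow (by positivity) (by positivity)
      _ = S.card * (1 / (t : ℝ) ^ 10) + ((t : ℝ) ^ 10) ^ 49 * ∑ n ∈ S, (|Spsi ((n ^ 2 - 4) / u ^ 2 : ℕ) w| / w) ^ 50 := by
          rw [Finset.sum_add_distrib, Finset.sum_const, nsmul_eq_mul, ← Finset.mul_sum]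
      _ ≤ (t : ℝ) ^ 2000 * (1 / (t : ℝ) ^ 10) + ((t : ℝ) ^ 10) ^ 49 * (2005 * C0 * (t : ℝ) ^ 501) := by gcongr
      _ = (t : ℝ) ^ 1990 + 2005 * C0 * (t : ℝ) ^ 991 := by
          have e1 : (t : ℝ) ^ 2000 = (t : ℝ) ^ 1990 * (t : ℝ) ^ 10 := by rw [← pow_add]
          have e2 : (t : ℝ) ^ 991 = (t : ℝ) ^ 490 * (t : ℝ) ^ 501 := by rw [← pow_add]
          rw [e1, e2, ← pow_mul]
          have : (t : ℝ) ^ 10 ≠ 0 := by positivity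
          generalize (t : ℝ) ^ 10 = T at *
          field_simp
          ring
      _ ≤ (t : ℝ) ^ 1990 + 2005 * C0 * (t : ℝ) ^ 1990 := by
          gcongr
          norm_num
      _ = _ := by ring
  rw [← Finset.sum_div, div_le_iff₀ hw0'] at hfin
  linarith

end P4c

section P4d

set_option exponentiation.threshold 400

lemma harm_bound {t Z : ℕ} (ht : 1 ≤ t) (hZ : Z ≤ t ^ 6000) : ∑ q ∈ Finset.range (Z + 1), (1 : ℝ) / q ≤ 6001 * t := by
  have ht' : (1 : ℝ) ≤ t := by exact_mod_cast ht
  have h1 : ∑ q ∈ Finset.range (Z + 1), (1 : ℝ) / q = (harmonic Z : ℝ) := by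
    rw [Finset.sum_range_succ', harmonic]; push_cast; simp
  rw [h1]
  refine (harmonic_le_one_add_log Z).trans ?_
  have h2 : Real.log Z ≤ 6000 * t := by
    rcases Nat.eq_zero_or_pos Z with rfl | hp
    · simp
    · calc Real.log Z ≤ Real.log ((t : ℝ) ^ 6000) := Real.log_le_log (by exact_mod_cast hp) (by exact_mod_cast hZ)
        _ = 6000 * Real.log t := by rw [Real.log_pow]; norm_num
        _ ≤ 6000 * t := by
          have := Real.log_le_sub_one_of_pos (by linarith : (0 : ℝ) < t)
          linarith
  linarith

lemma psi_harm {t y : ℕ} (ht : 1 ≤ t) (hy : y ≤ t ^ 6000) (a : ℤ) : |∑ q ∈ Finset.range (y + 1), psi a q / q| ≤ 6001 * t := by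
  refine (Finset.abs_sum_le_sum_abs _ _).trans ((Finset.sum_le_sum fun q _ => ?_).trans (harm_bound ht hy))
  rw [abs_div, Nat.abs_cast]
  exact div_le_div_of_nonneg_right (psi_abs_le _ _) (by positivity)

lemma tail_bound {a : ℕ} (ha : a ≠ 0) (hs : ¬ IsSquare a) {y Z : ℕ} (hyZ : y ≤ Z) :
    |Lval a - ∑ q ∈ Finset.range (y + 1), psi a q / q| ≤
      |Spsi a y| / (y + 1) + ∑ w ∈ Finset.Ioc y Z, |Spsi a w| / (w * (w + 1)) + 4 * a / (Z + 1) := by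
  have hB : ∀ w, |Spsi a w| ≤ 4 * a := fun w => psi_sum_bound ha hs (w + 1)
  have h1 := Lval_tail hB Z
  rw [psi_abel]
  have h2 : ∑ w ∈ Finset.range (Z + 1), Spsi a w / (w * (w + 1)) = ∑ w ∈ Finset.range (y + 1), Spsi a w / (w * (w + 1))
      + ∑ w ∈ Finset.Ioc y Z, Spsi a w / (w * (w + 1)) := by
    rw [← Finset.sum_range_add_sum_Ico _ (by omega : y + 1 ≤ Z + 1)]
    have hIJ : Finset.Ico (y + 1) (Z + 1) = Finset.Ioc y Z := by
      ext w; rw [Finset.mem_Ico, Finset.mem_Ioc]; omega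
    rw [hIJ]
  rw [h2] at h1
  set P := ∑ w ∈ Finset.range (y + 1), Spsi a w / (w * (w + 1))
  have h3 : |∑ w ∈ Finset.Ioc y Z, Spsi a w / (w * (w + 1))| ≤ ∑ w ∈ Finset.Ioc y Z, |Spsi a w| / (w * (w + 1)) := by
    refine (Finset.abs_sum_le_sum_abs _ _).trans (le_of_eq (Finset.sum_congr rfl fun w _ => ?_))
    rw [abs_div, abs_of_nonneg (by positivity : (0 : ℝ) ≤ (w : ℝ) * (w + 1))]
  set Q := ∑ w ∈ Finset.Ioc y Z, Spsi a w / (w * (w + 1))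
  have h4 : |Spsi a y| / (y + 1) = |Spsi a y / (y + 1)| := by
    rw [abs_div, abs_of_nonneg (by positivity : (0 : ℝ) ≤ (y : ℝ) + 1)]
  rw [h4]
  set R := Spsi a y / ((y : ℝ) + 1)
  calc |Lval a - (R + P)| = |(Lval a - (P + Q)) + Q - R| := by ring_nf
    _ ≤ |Lval a - (P + Q)| + |Q| + |R| := by
      refine (abs_sub _ _).trans ?_
      have := abs_add_le (Lval a - (P + Q)) Q
      linarith
    _ ≤ _ := by linarith

lemma D_props {X u n : ℕ} (hu : 1 ≤ u) (hn : n ∈ Nset X u) : (n ^ 2 - 4) / u ^ 2 ≠ 0 ∧ ¬ IsSquare ((n ^ 2 - 4) / u ^ 2) ∧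
    (n ^ 2 - 4) / u ^ 2 ≤ X ^ 2 := by
  simp only [Nset, Finset.mem_filter, Finset.mem_Icc] at hn
  obtain ⟨⟨h3, hX⟩, e, he⟩ := hn
  have h9 : 9 ≤ n ^ 2 := by nlinarith
  have hsq := not_isSquare_D h3
  have : (n ^ 2 - 4) / u ^ 2 = e := by rw [he, Nat.mul_div_cancel_left _ (by positivity)]
  refine ⟨?_, ?_, ?_⟩
  · rw [this]; rintro rfl; omega
  · rw [this]; rintro ⟨r, rfl⟩; exact hsq ⟨u * r, by rw [he]; ring⟩
  · exact (Nat.div_le_self _ _).trans ((Nat.sub_le _ _).trans (Nat.pow_le_pow_left hX 2))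

theorem tail_sum : ∃ C : ℝ, 0 < C ∧ ∀ t u : ℕ, 1 ≤ t → 1 ≤ u → u ≤ t ^ 20 →
    ∑ n ∈ Nset (t ^ 2000) u, |Lval ((n ^ 2 - 4) / u ^ 2 : ℕ) - ∑ q ∈ Finset.range (t ^ 440 / u ^ 2 + 1), psi ((n ^ 2 - 4) / u ^ 2 : ℕ) q / q| ≤
      C * (t : ℝ) ^ 1991 := by
  obtain ⟨C, hC, hLV⟩ := LV
  refine ⟨6002 * C + 4, by positivity, fun t u ht hu hut => ?_⟩
  have ht' : (1 : ℝ) ≤ t := by exact_mod_cast ht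
  set y := t ^ 440 / u ^ 2 with hy
  set Z := t ^ 6000 with hZ
  have hy1 : t ^ 400 ≤ y := by
    rw [hy, Nat.le_div_iff_mul_le (by positivity)]
    calc t ^ 400 * u ^ 2 ≤ t ^ 400 * (t ^ 20) ^ 2 := Nat.mul_le_mul_left _ (Nat.pow_le_pow_left hut 2)
      _ = t ^ 440 := by rw [← pow_mul, ← pow_add]
  have hyZ : y ≤ Z := (Nat.div_le_self _ _).trans (Nat.pow_le_pow_right ht (by norm_num))
  set S := Nset (t ^ 2000) u with hS
  have hcard : (S.card : ℝ) ≤ (t : ℝ) ^ 2000 := by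
    have : S.card ≤ t ^ 2000 := by
      calc S.card ≤ (Finset.Icc 3 (t ^ 2000)).card := Finset.card_filter_le _ _
        _ ≤ t ^ 2000 := by rw [Nat.card_Icc]; omega
    exact_mod_cast this
  refine (Finset.sum_le_sum fun n hn => tail_bound (D_props hu hn).1 (D_props hu hn).2.1 hyZ).trans ?_
  rw [Finset.sum_add_distrib, Finset.sum_add_distrib, Finset.sum_comm]
  have hb1 : ∑ n ∈ S, |Spsi ((n ^ 2 - 4) / u ^ 2 : ℕ) y| / ((y : ℝ) + 1) ≤ C * (t : ℝ) ^ 1990 := by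
    rw [← Finset.sum_div, div_le_iff₀ (by positivity)]
    refine (hLV t u y ht hu hy1 hyZ).trans ?_
    have : 0 ≤ C * (t : ℝ) ^ 1990 := by positivity
    linarith
  have hb2 : ∑ w ∈ Finset.Ioc y Z, ∑ n ∈ S, |Spsi ((n ^ 2 - 4) / u ^ 2 : ℕ) w| / ((w : ℝ) * (w + 1)) ≤ C * (t : ℝ) ^ 1990 * (6001 * t) := by
    have h1 : ∀ w ∈ Finset.Ioc y Z, ∑ n ∈ S, |Spsi ((n ^ 2 - 4) / u ^ 2 : ℕ) w| / ((w : ℝ) * (w + 1)) ≤ C * (t : ℝ) ^ 1990 * (1 / w) := by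
      intro w hw
      rw [Finset.mem_Ioc] at hw
      have hw0 : (0 : ℝ) < w := by exact_mod_cast (by omega : 0 < w)
      rw [← Finset.sum_div, div_le_iff₀ (by positivity)]
      refine (hLV t u w ht hu (hy1.trans hw.1.le) hw.2).trans ?_
      have : 0 ≤ C * (t : ℝ) ^ 1990 := by positivity
      have e : C * (t : ℝ) ^ 1990 * (1 / w) * (w * (w + 1)) = C * (t : ℝ) ^ 1990 * (w + 1) := by field_simp
      rw [e]; linarith
    refine (Finset.sum_le_sum h1).trans ?_
    rw [← Finset.mul_sum]
    apply mul_le_mul_of_nonneg_left _ (by positivity)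
    refine le_trans ?_ (harm_bound ht (le_refl Z))
    apply Finset.sum_le_sum_of_subset_of_nonneg
    · intro w hw; rw [Finset.mem_Ioc] at hw; rw [Finset.mem_range]; omega
    · intro i _ _; positivity
  have hb3 : ∑ n ∈ S, 4 * (((n ^ 2 - 4) / u ^ 2 : ℕ) : ℝ) / ((Z : ℝ) + 1) ≤ 4 := by
    have : ∀ n ∈ S, 4 * (((n ^ 2 - 4) / u ^ 2 : ℕ) : ℝ) / ((Z : ℝ) + 1) ≤ 4 / (t : ℝ) ^ 2000 := by
      intro n hn
      have h1 := (D_props hu hn).2.2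
      have h2 : (((n ^ 2 - 4) / u ^ 2 : ℕ) : ℝ) ≤ (t : ℝ) ^ 4000 := by
        rw [← pow_mul] at h1; exact_mod_cast h1
      rw [div_le_div_iff₀ (by positivity) (by positivity), hZ]
      have e : (t : ℝ) ^ 4000 * (t : ℝ) ^ 2000 = ((t ^ 6000 : ℕ) : ℝ) := by push_cast; rw [← pow_add]
      have : (((n ^ 2 - 4) / u ^ 2 : ℕ) : ℝ) * (t : ℝ) ^ 2000 ≤ ((t ^ 6000 : ℕ) : ℝ) := by
        rw [← e]; gcongr
      linarith
    refine (Finset.sum_le_sum this).trans ?_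
    rw [Finset.sum_const, nsmul_eq_mul, mul_div_assoc', div_le_iff₀ (by positivity)]
    linarith
  have e : (t : ℝ) ^ 1991 = (t : ℝ) ^ 1990 * t := by rw [← pow_succ]
  have h5 : (1 : ℝ) ≤ (t : ℝ) ^ 1991 := one_le_pow₀ ht'
  have h6 : (t : ℝ) ^ 1990 ≤ (t : ℝ) ^ 1991 := pow_le_pow_right₀ ht' (by norm_num)
  have h7 : C * (t : ℝ) ^ 1990 ≤ C * (t : ℝ) ^ 1991 := by gcongr
  have h8 : C * (t : ℝ) ^ 1990 * (6001 * t) = 6001 * C * (t : ℝ) ^ 1991 := by rw [e]; ring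
  rw [h8] at hb2
  linarith

/-- the truncated sum -/
noncomputable def Pz (z n : ℕ) : ℝ :=
  ∑ v ∈ Finset.range (n + 1) with Odd v ∧ v ^ 2 ∣ n ^ 2 - 4,
    (∑ q ∈ Finset.range (z / v ^ 2 + 1), psi ((n ^ 2 - 4) / v ^ 2 : ℕ) q / q) / v

theorem L1_approx : ∃ C : ℝ, 0 < C ∧ ∀ t : ℕ, 1 ≤ t →
    ∑ n ∈ Finset.Icc 3 (t ^ 2000), |Aodd n ^ 2 - Pz (t ^ 440) n ^ 2| ≤ C * (t : ℝ) ^ 1994 := by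
  classical
  obtain ⟨C, hC, hT⟩ := tail_sum
  obtain ⟨C0, hC1, hC0⟩ := divisor_bound 4000
  have hC1' : (1 : ℝ) ≤ C0 := by exact_mod_cast hC1
  refine ⟨24020 * C0 * (6001 * C + 12010 * C0), by positivity, fun t ht => ?_⟩
  have ht' : (1 : ℝ) ≤ t := by exact_mod_cast ht
  have ht0 : (0 : ℝ) < t := by linarith
  set X := t ^ 2000 with hX
  set V : ℕ → Finset ℕ := fun n => (Finset.range (n + 1)).filter (fun v => Odd v ∧ v ^ 2 ∣ n ^ 2 - 4) with hV
  set l : ℕ → ℕ → ℝ := fun n v => Lval ((n ^ 2 - 4) / v ^ 2 : ℕ) with hl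
  set p : ℕ → ℕ → ℝ := fun n v => ∑ q ∈ Finset.range (t ^ 440 / v ^ 2 + 1), psi ((n ^ 2 - 4) / v ^ 2 : ℕ) q / q with hp
  have hA : ∀ n, Aodd n = ∑ v ∈ V n, l n v / v := fun n => rfl
  have hPz : ∀ n, Pz (t ^ 440) n = ∑ v ∈ V n, p n v / v := fun n => rfl
  have hVpos : ∀ n, ∀ v ∈ V n, 1 ≤ v := by
    intro n v hv; rw [hV, Finset.mem_filter] at hv; exact hv.2.1.pos
  have hVcard : ∀ n ∈ Finset.Icc 3 X, ((V n).card : ℝ) ≤ C0 * t := by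
    intro n hn
    rw [Finset.mem_Icc] at hn
    have h9 : 9 ≤ n ^ 2 := by nlinarith
    have h1 : (V n).card ≤ (n ^ 2 - 4).divisors.card := by
      apply Finset.card_le_card
      intro v hv
      rw [hV, Finset.mem_filter] at hv
      rw [Nat.mem_divisors]
      exact ⟨dvd_trans (dvd_pow_self v two_ne_zero) hv.2.2, by omega⟩
    have h2 : (n ^ 2 - 4).divisors.card ^ 4000 ≤ (C0 * t) ^ 4000 := by
      calc _ ≤ C0 * (n ^ 2 - 4) := hC0 _ (by omega)
        _ ≤ C0 * (t ^ 4000) := by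
          apply Nat.mul_le_mul_left
          calc n ^ 2 - 4 ≤ n ^ 2 := Nat.sub_le _ _
            _ ≤ (t ^ 2000) ^ 2 := Nat.pow_le_pow_left hn.2 2
            _ = t ^ 4000 := by rw [← pow_mul]
        _ ≤ C0 ^ 4000 * t ^ 4000 := Nat.mul_le_mul_right _ (Nat.le_self_pow (by norm_num) _)
        _ = _ := by rw [mul_pow]
    have h3 := (Nat.pow_le_pow_iff_left (by norm_num)).1 h2
    exact_mod_cast h1.trans h3
  have hmemN : ∀ n ∈ Finset.Icc 3 X, ∀ v ∈ V n, n ∈ Nset X v := by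
    intro n hn v hv
    rw [hV, Finset.mem_filter] at hv
    exact Finset.mem_filter.2 ⟨hn, hv.2.2⟩
  have hpb : ∀ n v, |p n v| ≤ 6001 * t := by
    intro n v
    exact psi_harm ht ((Nat.div_le_self _ _).trans (Nat.pow_le_pow_right ht (by norm_num))) _
  have hlb : ∀ n ∈ Finset.Icc 3 X, ∀ v ∈ V n, |l n v| ≤ 6009 * t := by
    intro n hn v hv
    obtain ⟨a1, a2, a3⟩ := D_props (hVpos n v hv) (hmemN n hn v hv)
    have h1 := Lval_approx (fun w => psi_sum_bound a1 a2 (w + 1)) (t ^ 4000)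
    have h2 := psi_harm ht (Nat.pow_le_pow_right ht (by norm_num) : t ^ 4000 ≤ t ^ 6000) (((n ^ 2 - 4) / v ^ 2 : ℕ) : ℤ)
    have h3 : 2 * (4 * (((n ^ 2 - 4) / v ^ 2 : ℕ) : ℝ)) / (((t ^ 4000 : ℕ) : ℝ) + 1) ≤ 8 := by
      rw [div_le_iff₀ (by positivity)]
      have : (((n ^ 2 - 4) / v ^ 2 : ℕ) : ℝ) ≤ ((t ^ 4000 : ℕ) : ℝ) := by
        rw [hX, ← pow_mul] at a3; exact_mod_cast a3
      linarith
    have h4 := abs_sub_abs_le_abs_sub (l n v) (∑ q ∈ Finset.range (t ^ 4000 + 1), psi (((n ^ 2 - 4) / v ^ 2 : ℕ) : ℤ) q / q)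
    linarith
  have hdivle : ∀ x : ℝ, ∀ v : ℕ, 1 ≤ v → |x / v| ≤ |x| := by
    intro x v hv
    rw [abs_div, Nat.abs_cast]
    exact div_le_self (abs_nonneg _) (by exact_mod_cast hv)
  have hAb : ∀ n ∈ Finset.Icc 3 X, |Aodd n| ≤ 6009 * C0 * t ^ 2 := by
    intro n hn
    rw [hA]
    refine (Finset.abs_sum_le_sum_abs _ _).trans ?_
    calc ∑ v ∈ V n, |l n v / v| ≤ ∑ v ∈ V n, 6009 * (t : ℝ) :=
          Finset.sum_le_sum fun v hv => (hdivle _ _ (hVpos n v hv)).trans (hlb n hn v hv)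
      _ = (V n).card * (6009 * t) := by rw [Finset.sum_const, nsmul_eq_mul]
      _ ≤ (C0 * t) * (6009 * t) := by gcongr; exact hVcard n hn
      _ = _ := by ring
  have hPb : ∀ n ∈ Finset.Icc 3 X, |Pz (t ^ 440) n| ≤ 6009 * C0 * t ^ 2 := by
    intro n hn
    rw [hPz]
    refine (Finset.abs_sum_le_sum_abs _ _).trans ?_
    calc ∑ v ∈ V n, |p n v / v| ≤ ∑ v ∈ V n, 6009 * (t : ℝ) :=
          Finset.sum_le_sum fun v hv => (hdivle _ _ (hVpos n v hv)).trans ((hpb n v).trans (by linarith))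
      _ = (V n).card * (6009 * t) := by rw [Finset.sum_const, nsmul_eq_mul]
      _ ≤ (C0 * t) * (6009 * t) := by gcongr; exact hVcard n hn
      _ = _ := by ring
  have hdiff : ∑ n ∈ Finset.Icc 3 X, |Aodd n - Pz (t ^ 440) n| ≤ (6001 * C + 12010 * C0) * (t : ℝ) ^ 1992 := by
    have h1 : ∀ n ∈ Finset.Icc 3 X, |Aodd n - Pz (t ^ 440) n| ≤
        ∑ v ∈ V n with v ≤ t ^ 20, |l n v - p n v| / v + 12010 * C0 * (t : ℝ) ^ 2 / (t : ℝ) ^ 20 := by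
      intro n hn
      rw [hA, hPz, ← Finset.sum_sub_distrib]
      refine (Finset.abs_sum_le_sum_abs _ _).trans ?_
      have e : ∀ v, |l n v / v - p n v / v| = |l n v - p n v| / v := by
        intro v; rw [← sub_div, abs_div, Nat.abs_cast]
      simp_rw [e]
      rw [← Finset.sum_filter_add_sum_filter_not (V n) (fun v => v ≤ t ^ 20)]
      apply add_le_add_right
      calc ∑ v ∈ V n with ¬ v ≤ t ^ 20, |l n v - p n v| / v ≤ ∑ v ∈ V n with ¬ v ≤ t ^ 20, 12010 * (t : ℝ) / (t : ℝ) ^ 20 := by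
            apply Finset.sum_le_sum
            intro v hv
            rw [Finset.mem_filter] at hv
            have h2 : (t : ℝ) ^ 20 ≤ v := by exact_mod_cast (not_le.1 hv.2).le
            have h3 : |l n v - p n v| ≤ 12010 * t := by
              have := abs_sub (l n v) (p n v)
              have := hlb n hn v hv.1
              have := hpb n v
              linarith
            exact div_le_div₀ (by positivity) h3 (by positivity) h2
        _ = ((V n).filter (fun v => ¬ v ≤ t ^ 20)).card * (12010 * (t : ℝ) / (t : ℝ) ^ 20) := by rw [Finset.sum_const, nsmul_eq_mul]
        _ ≤ (C0 * t) * (12010 * (t : ℝ) / (t : ℝ) ^ 20) := by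
            gcongr
            exact le_trans (by exact_mod_cast Finset.card_filter_le _ _) (hVcard n hn)
        _ = _ := by ring
    refine (Finset.sum_le_sum h1).trans ?_
    rw [Finset.sum_add_distrib, Finset.sum_const, nsmul_eq_mul]
    have h2 : ∑ n ∈ Finset.Icc 3 X, ∑ v ∈ V n with v ≤ t ^ 20, |l n v - p n v| / v ≤ C * (t : ℝ) ^ 1991 * (6001 * t) := by
      calc _ ≤ ∑ v ∈ Finset.Ioc 0 (t ^ 20), ∑ n ∈ Nset X v, |l n v - p n v| / v := by
            rw [Finset.sum_comm' (t' := Finset.Ioc 0 (t ^ 20))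
              (s' := fun v => (Finset.Icc 3 X).filter (fun n => v ∈ V n))]
            · apply Finset.sum_le_sum
              intro v hv
              apply Finset.sum_le_sum_of_subset_of_nonneg
              · intro n hn
                simp only [Finset.mem_filter, V] at hn
                simp only [Nset, Finset.mem_filter]
                exact ⟨hn.1, hn.2.2.2⟩
              · intro i _ _; positivity
            · intro n v
              simp only [Finset.mem_filter, Finset.mem_Ioc]
              constructor
              · rintro ⟨h1, h2, h3⟩
                refine ⟨⟨h1, h2⟩, ?_, h3⟩
                simp only [V, Finset.mem_filter] at h2
                exact h2.2.1.pos
              · rintro ⟨⟨h1, h2⟩, h3, h4⟩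
                exact ⟨h1, h2, h4⟩
        _ ≤ ∑ v ∈ Finset.Ioc 0 (t ^ 20), C * (t : ℝ) ^ 1991 * (1 / v) := by
            apply Finset.sum_le_sum
            intro v hv
            rw [Finset.mem_Ioc] at hv
            rw [← Finset.sum_div, mul_one_div]
            exact div_le_div_of_nonneg_right (hT t v ht hv.1 hv.2) (by positivity)
        _ ≤ _ := by
            rw [← Finset.mul_sum]
            apply mul_le_mul_of_nonneg_left _ (by positivity)
            refine le_trans ?_ (harm_bound ht (Nat.pow_le_pow_right ht (by norm_num) : t ^ 20 ≤ t ^ 6000))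
            apply Finset.sum_le_sum_of_subset_of_nonneg
            · intro w hw; rw [Finset.mem_Ioc] at hw; rw [Finset.mem_range]; omega
            · intro i _ _; positivity
    have h3 : ((Finset.Icc 3 X).card : ℝ) * (12010 * C0 * (t : ℝ) ^ 2 / (t : ℝ) ^ 20) ≤ 12010 * C0 * (t : ℝ) ^ 1992 := by
      have hc : ((Finset.Icc 3 X).card : ℝ) ≤ (t : ℝ) ^ 2000 := by
        have : (Finset.Icc 3 X).card ≤ t ^ 2000 := by rw [Nat.card_Icc]; omega
        exact_mod_cast this
      calc _ ≤ (t : ℝ) ^ 2000 * (12010 * C0 * (t : ℝ) ^ 2 / (t : ℝ) ^ 20) := by gcongr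
        _ = 12010 * C0 * (t : ℝ) ^ 1982 := by
          have e1 : (t : ℝ) ^ 2000 * (t : ℝ) ^ 2 = (t : ℝ) ^ 1982 * (t : ℝ) ^ 20 := by rw [← pow_add, ← pow_add]
          rw [mul_div_assoc', div_eq_iff (by positivity)]
          linear_combination 12010 * (C0 : ℝ) * e1
        _ ≤ _ := by gcongr <;> norm_num
    have e : (t : ℝ) ^ 1992 = (t : ℝ) ^ 1991 * t := by rw [← pow_succ]
    have h8 : C * (t : ℝ) ^ 1991 * (6001 * t) = 6001 * C * (t : ℝ) ^ 1992 := by rw [e]; ring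
    rw [h8] at h2
    linarith
  calc ∑ n ∈ Finset.Icc 3 X, |Aodd n ^ 2 - Pz (t ^ 440) n ^ 2| ≤ ∑ n ∈ Finset.Icc 3 X, |Aodd n - Pz (t ^ 440) n| * (24020 * C0 * (t : ℝ) ^ 2) := by
        apply Finset.sum_le_sum
        intro n hn
        rw [sq_sub_sq, abs_mul, mul_comm]
        apply mul_le_mul_of_nonneg_left _ (abs_nonneg _)
        have h1 := abs_add_le (Aodd n) (Pz (t ^ 440) n)
        have h2 := hAb n hn
        have h3 := hPb n hn
        have h4 : 0 ≤ C0 * (t : ℝ) ^ 2 := by positivity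
        linarith
    _ ≤ (6001 * C + 12010 * C0) * (t : ℝ) ^ 1992 * (24020 * C0 * (t : ℝ) ^ 2) := by
        rw [← Finset.sum_mul]
        gcongr
    _ = _ := by
        have e : (t : ℝ) ^ 1994 = (t : ℝ) ^ 1992 * (t : ℝ) ^ 2 := by rw [← pow_add]
        rw [e]; ring

end P4d

section P5a

/-- periodicity of functions on the integers -/
def PerZ (F : ℤ → ℝ) (W : ℕ) : Prop := ∀ a b : ℤ, (W : ℤ) ∣ a - b → F a = F b

/-- mean value over a period -/
noncomputable def Em (W : ℕ) (F : ℤ → ℝ) : ℝ := (∑ n ∈ Finset.range W, F (n : ℤ)) / W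

lemma PerZ.mono {F : ℤ → ℝ} {V W : ℕ} (h : PerZ F V) (hVW : V ∣ W) : PerZ F W := fun a b hab =>
  h a b ((Int.natCast_dvd_natCast.2 hVW).trans hab)

lemma PerZ.mul {F H : ℤ → ℝ} {W : ℕ} (h : PerZ F W) (h' : PerZ H W) : PerZ (fun x => F x * H x) W := fun a b hab => by
  simp only [h a b hab, h' a b hab]

lemma PerZ.add {F H : ℤ → ℝ} {W : ℕ} (h : PerZ F W) (h' : PerZ H W) : PerZ (fun x => F x + H x) W := fun a b hab => by
  simp only [h a b hab, h' a b hab]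

lemma PerZ.comp {F : ℤ → ℝ} {W : ℕ} (h : PerZ F W) (f : ℝ → ℝ) : PerZ (fun x => f (F x)) W := fun a b hab => by
  simp only [h a b hab]

lemma PerZ.sq4 {F : ℤ → ℝ} {W : ℕ} (h : PerZ F W) : PerZ (fun x => F (x ^ 2 - 4)) W := fun a b hab => by
  apply h
  have : a ^ 2 - 4 - (b ^ 2 - 4) = (a - b) * (a + b) := by ring
  rw [this]; exact Dvd.dvd.mul_right hab _

lemma PerZ.scale {F : ℤ → ℝ} {p V : ℕ} (h : PerZ F (p * V)) : PerZ (fun x => F (p * x)) V := fun a b hab => by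
  apply h
  rw [← mul_sub]; push_cast; exact mul_dvd_mul_left _ hab

lemma Em_congr {W : ℕ} {F H : ℤ → ℝ} (h : ∀ x, F x = H x) : Em W F = Em W H := by
  have : F = H := funext h
  rw [this]

lemma Em_add (W : ℕ) (F H : ℤ → ℝ) : Em W (fun x => F x + H x) = Em W F + Em W H := by
  unfold Em; rw [Finset.sum_add_distrib, add_div]

lemma Em_mul_left (W : ℕ) (c : ℝ) (F : ℤ → ℝ) : Em W (fun x => c * F x) = c * Em W F := by
  unfold Em; rw [← Finset.mul_sum, mul_div_assoc]

lemma Em_const {W : ℕ} (hW : 0 < W) (c : ℝ) : Em W (fun _ => c) = c := by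
  unfold Em; rw [Finset.sum_const, Finset.card_range, nsmul_eq_mul]
  have : (W : ℝ) ≠ 0 := by positivity
  field_simp

lemma Em_sum {ι : Type*} (W : ℕ) (s : Finset ι) (F : ι → ℤ → ℝ) :
    Em W (fun x => ∑ i ∈ s, F i x) = ∑ i ∈ s, Em W (F i) := by
  unfold Em; rw [Finset.sum_comm, Finset.sum_div]

lemma Em_mono {W : ℕ} {F H : ℤ → ℝ} (h : ∀ x, F x ≤ H x) : Em W F ≤ Em W H := by
  unfold Em
  exact div_le_div_of_nonneg_right (Finset.sum_le_sum fun n _ => h n) (by positivity)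

lemma Em_abs_le (W : ℕ) (F : ℤ → ℝ) : |Em W F| ≤ Em W (fun x => |F x|) := by
  unfold Em
  rw [abs_div, Nat.abs_cast]
  exact div_le_div_of_nonneg_right (Finset.abs_sum_le_sum_abs _ _) (by positivity)

lemma Em_reindex {W : ℕ} (hW : 0 < W) {F : ℤ → ℝ} (hF : PerZ F W) {σ : ℤ → ℤ}
    (hσ : ∀ a b, (W : ℤ) ∣ σ a - σ b → (W : ℤ) ∣ a - b) : Em W (fun x => F (σ x)) = Em W F := by
  unfold Em
  congr 1
  have hW' : (W : ℤ) ≠ 0 := by exact_mod_cast hW.ne'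
  have hWp : (0 : ℤ) < W := by exact_mod_cast hW
  set τ : ℕ → ℕ := fun n => (σ n % W).toNat with hτ
  have hτc : ∀ n : ℕ, ((τ n : ℕ) : ℤ) = σ n % W := fun n => Int.toNat_of_nonneg (Int.emod_nonneg _ hW')
  have hmaps : ∀ n ∈ Finset.range W, τ n ∈ Finset.range W := by
    intro n _
    rw [Finset.mem_range]
    have := Int.emod_lt_of_pos (σ n) hWp
    rw [← hτc] at this
    exact_mod_cast this
  have hinj : Set.InjOn τ (Finset.range W) := by
    intro a ha b hb hab
    have h1 : σ a % W = σ b % W := by rw [← hτc, ← hτc, hab]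
    have h2 := hσ a b (Int.emod_eq_emod_iff_emod_sub_eq_zero.1 h1 |> Int.dvd_of_emod_eq_zero)
    rw [Finset.coe_range, Set.mem_Iio] at ha hb
    have h3 := Int.eq_zero_of_abs_lt_dvd h2 (by rw [abs_lt]; constructor <;> omega)
    omega
  have hF' : ∀ n : ℕ, F (σ n) = F (τ n : ℕ) := by
    intro n
    apply hF
    rw [hτc]
    exact Int.dvd_self_sub_emod
  rw [Finset.sum_congr rfl fun n _ => hF' n]
  have himg : (Finset.range W).image τ = Finset.range W := by
    apply Finset.eq_of_subset_of_card_le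
    · intro y hy
      obtain ⟨n, hn, rfl⟩ := Finset.mem_image.1 hy
      exact hmaps n hn
    · rw [Finset.card_image_of_injOn hinj]
  conv_rhs => rw [← himg]
  rw [Finset.sum_image hinj]

lemma Em_shift {W : ℕ} (hW : 0 < W) {F : ℤ → ℝ} (hF : PerZ F W) (c : ℤ) : Em W (fun x => F (x + c)) = Em W F :=
  Em_reindex hW hF (σ := fun x => x + c) (fun a b h => by simpa using h)

lemma sum_split (F : ℤ → ℝ) (p V : ℕ) : ∑ n ∈ Finset.range (p * V), F n =
    ∑ a ∈ Finset.range p, ∑ k ∈ Finset.range V, F (a + p * k) := by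
  induction V with
  | zero => simp
  | succ V ih =>
    rw [Nat.mul_succ, Finset.sum_range_add, ih, ← Finset.sum_add_distrib]
    apply Finset.sum_congr rfl
    intro a _
    rw [Finset.sum_range_succ]
    congr 2
    push_cast; ring

lemma Em_split (F : ℤ → ℝ) (p V : ℕ) : Em (p * V) F = (∑ a ∈ Finset.range p, Em V (fun k => F (a + p * k))) / p := by
  unfold Em
  rw [sum_split, ← Finset.sum_div, div_div]
  push_cast
  rw [mul_comm (p : ℝ)]

lemma Em_period {F : ℤ → ℝ} {V : ℕ} (hF : PerZ F V) {k : ℕ} (hk : 0 < k) : Em (V * k) F = Em V F := by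
  unfold Em
  rw [sum_split]
  have h : ∀ a ∈ Finset.range V, ∑ j ∈ Finset.range k, F ((a : ℤ) + V * (j : ℤ)) = k * F a := by
    intro a _
    rw [Finset.sum_congr rfl (fun (j : ℕ) _ => hF (a + V * (j : ℤ)) a (by simp)), Finset.sum_const, Finset.card_range, nsmul_eq_mul]
  rw [Finset.sum_congr rfl h, ← Finset.mul_sum]
  push_cast
  have : (k : ℝ) ≠ 0 := by positivity
  rw [mul_comm (V : ℝ), mul_div_mul_left _ _ this]

lemma Em_dvd {F : ℤ → ℝ} {V W : ℕ} (hF : PerZ F V) (hVW : V ∣ W) (hW : 0 < W) : Em W F = Em V F := by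
  obtain ⟨k, rfl⟩ := hVW
  exact Em_period hF (Nat.pos_of_mul_pos_left hW |> fun h => by
    rcases Nat.eq_zero_or_pos k with rfl | h'
    · simp at hW
    · exact h')

lemma Em_crt {F H : ℤ → ℝ} {a b : ℕ} (ha : 0 < a) (hb : 0 < b) (hab : Nat.Coprime a b) (hF : PerZ F a) (hH : PerZ H b) :
    Em (a * b) (fun x => F x * H x) = Em a F * Em b H := by
  rw [Em_split]
  have h : ∀ i ∈ Finset.range a, Em b (fun k => F (i + a * k) * H (i + a * k)) = F i * Em b H := by
    intro i _
    rw [Em_congr (H := fun k => F i * H (i + a * k)) (fun x => by rw [hF (i + a * x) i (by simp)]), Em_mul_left]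
    congr 1
    apply Em_reindex hb hH (σ := fun k => (i : ℤ) + a * k)
    intro x y hxy
    have e : (i : ℤ) + a * x - (i + a * y) = a * (x - y) := by ring
    rw [e] at hxy
    have hc : IsCoprime (b : ℤ) (a : ℤ) := Nat.isCoprime_iff_coprime.2 hab.symm
    exact hc.dvd_of_dvd_mul_left hxy
  rw [Finset.sum_congr rfl h, ← Finset.sum_mul, Em, Em]
  ring

/-- the quadratic substitution `k ↦ k (p k + c)` preserves means modulo powers of `p` -/
lemma Em_quad {p m : ℕ} (hp : p.Prime) {c : ℤ} (hc : ¬ (p : ℤ) ∣ c) {F : ℤ → ℝ} (hF : PerZ F (p ^ m)) :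
    Em (p ^ m) (fun k => F (k * (p * k + c))) = Em (p ^ m) F := by
  apply Em_reindex (pow_pos hp.pos m) hF (σ := fun k => k * (p * k + c))
  intro x y hxy
  have e : x * (p * x + c) - y * (p * y + c) = (x - y) * (p * (x + y) + c) := by ring
  rw [e] at hxy
  push_cast at hxy ⊢
  have hc' : IsCoprime (p : ℤ) (p * (x + y) + c) := by
    rw [(Nat.prime_iff_prime_int.1 hp).coprime_iff_not_dvd]
    intro h
    exact hc ((dvd_add_right (Dvd.intro _ rfl)).1 h)
  exact (hc'.pow_left).dvd_of_dvd_mul_right hxy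

end P5a

section P5b

open Classical in
/-- the `u`-term in `lam` -/
noncomputable def lamT (q : ℕ) (D : ℤ) (u : ℕ) : ℝ :=
  if u ^ 2 ∣ q ∧ (u : ℤ) ^ 2 ∣ D then u * psi (D / (u : ℤ) ^ 2) (q / u ^ 2) else 0

open Classical in
/-- coefficients of the (odd part of the) Zagier L-series -/
noncomputable def lam (q : ℕ) (D : ℤ) : ℝ := if Odd q then ∑ u ∈ q.divisors, lamT q D u else 0

lemma lam_one (D : ℤ) : lam 1 D = 1 := by
  simp [lam, lamT, psi_one]

lemma lam_even {q : ℕ} (h : ¬ Odd q) (D : ℤ) : lam q D = 0 := by simp [lam, h]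

lemma lamT_per (q : ℕ) {D E : ℤ} (h : (q : ℤ) ∣ D - E) (u : ℕ) (hu : u ≠ 0) : lamT q D u = lamT q E u := by
  unfold lamT
  by_cases hq : u ^ 2 ∣ q
  · have huq : (u : ℤ) ^ 2 ∣ q := by exact_mod_cast hq
    have h1 : (u : ℤ) ^ 2 ∣ D ↔ (u : ℤ) ^ 2 ∣ E := by
      rw [← dvd_iff_dvd_of_dvd_sub (huq.trans h)]
    by_cases hD : (u : ℤ) ^ 2 ∣ D
    · rw [if_pos ⟨hq, hD⟩, if_pos ⟨hq, h1.1 hD⟩]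
      congr 1
      apply psi_congr
      obtain ⟨a, rfl⟩ := hD
      obtain ⟨b, rfl⟩ := h1.1 ⟨a, rfl⟩
      obtain ⟨c, rfl⟩ := hq
      have hu2 : (u : ℤ) ^ 2 ≠ 0 := by positivity
      rw [Int.mul_ediv_cancel_left _ hu2, Int.mul_ediv_cancel_left _ hu2, Nat.mul_div_cancel_left _ (by positivity)]
      push_cast at h
      rw [← mul_sub] at h
      exact (mul_dvd_mul_iff_left hu2).1 h
    · rw [if_neg (by tauto), if_neg (by tauto)]
  · rw [if_neg (by tauto), if_neg (by tauto)]

lemma lam_per (q : ℕ) : PerZ (lam q) q := by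
  intro D E h
  unfold lam
  split_ifs
  · exact Finset.sum_congr rfl fun u hu => lamT_per q h u (Nat.pos_of_mem_divisors hu).ne'
  · rfl

lemma lam_bound (q : ℕ) (D : ℤ) : |lam q D| ≤ q := by
  unfold lam
  split_ifs with ho
  swap
  · simp
  have hq : q ≠ 0 := by rintro rfl; simp at ho
  have h1 : ∑ u ∈ q.divisors, lamT q D u = ∑ u ∈ q.divisors with u ^ 2 ∣ q, lamT q D u := by
    rw [Finset.sum_filter]
    apply Finset.sum_congr rfl
    intro u _
    split_ifs with h
    · rfl
    · unfold lamT; rw [if_neg (by tauto)]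
  rw [h1]
  refine (Finset.abs_sum_le_sum_abs _ _).trans ?_
  calc _ ≤ ∑ u ∈ q.divisors with u ^ 2 ∣ q, (Nat.sqrt q : ℝ) := by
        apply Finset.sum_le_sum
        intro u hu
        rw [Finset.mem_filter] at hu
        have hus : u ≤ Nat.sqrt q := Nat.le_sqrt'.2 (Nat.le_of_dvd (by omega) hu.2)
        have hus' : (u : ℝ) ≤ Nat.sqrt q := by exact_mod_cast hus
        unfold lamT
        split_ifs
        · rw [abs_mul, Nat.abs_cast]
          calc (u : ℝ) * _ ≤ u * 1 := by
                apply mul_le_mul_of_nonneg_left (psi_abs_le _ _) (by positivity)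
            _ ≤ _ := by linarith
        · simp
    _ = ((q.divisors.filter (fun u => u ^ 2 ∣ q)).card : ℝ) * Nat.sqrt q := by rw [Finset.sum_const, nsmul_eq_mul]
    _ ≤ (Nat.sqrt q : ℝ) * Nat.sqrt q := by
        apply mul_le_mul_of_nonneg_right _ (by positivity)
        have : (q.divisors.filter (fun u => u ^ 2 ∣ q)) ⊆ Finset.Ioc 0 (Nat.sqrt q) := by
          intro u hu
          rw [Finset.mem_filter] at hu
          rw [Finset.mem_Ioc]
          exact ⟨Nat.pos_of_mem_divisors hu.1, Nat.le_sqrt'.2 (Nat.le_of_dvd (by omega) hu.2)⟩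
        have := Finset.card_le_card this
        simp only [Nat.card_Ioc, Nat.sub_zero] at this
        exact_mod_cast this
    _ ≤ q := by exact_mod_cast Nat.sqrt_le q

lemma sum_divisors_coprime {m n : ℕ} (hmn : m.Coprime n) (f : ℕ → ℝ) :
    ∑ d ∈ (m * n).divisors, f d = ∑ a ∈ m.divisors, ∑ b ∈ n.divisors, f (a * b) := by
  have : (m * n).divisors = (m.divisors ×ˢ n.divisors).image (fun p : ℕ × ℕ => p.1 * p.2) := by
    rw [← Finset.mul_def, Nat.divisors_mul]
  rw [this, Finset.sum_image hmn.mul_injOn_divisors, Finset.sum_product]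

lemma lamT_mul {q r a b : ℕ} (hqr : q.Coprime r) (ha : a ∣ q) (hb : b ∣ r) (ha0 : a ≠ 0) (hb0 : b ≠ 0) (D : ℤ) :
    lamT (q * r) D (a * b) = lamT q D a * lamT r D b := by
  unfold lamT
  have hab : a.Coprime b := (hqr.coprime_dvd_left ha).coprime_dvd_right hb
  have har : a.Coprime r := hqr.coprime_dvd_left ha
  have hbq : b.Coprime q := (hqr.symm).coprime_dvd_left hb
  have c1 : (a * b) ^ 2 ∣ q * r ↔ a ^ 2 ∣ q ∧ b ^ 2 ∣ r := by
    rw [mul_pow]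
    constructor
    · intro h
      exact ⟨(har.pow_left 2).dvd_of_dvd_mul_right ((Dvd.intro _ rfl).trans h),
        (hbq.pow_left 2).dvd_of_dvd_mul_left ((Dvd.intro_left _ rfl).trans h)⟩
    · rintro ⟨h1, h2⟩; exact mul_dvd_mul h1 h2
  have hcop : IsCoprime ((a : ℤ) ^ 2) ((b : ℤ) ^ 2) := (Nat.isCoprime_iff_coprime.2 hab).pow
  have c2 : ((a * b : ℕ) : ℤ) ^ 2 ∣ D ↔ (a : ℤ) ^ 2 ∣ D ∧ (b : ℤ) ^ 2 ∣ D := by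
    push_cast
    rw [mul_pow]
    constructor
    · intro h; exact ⟨(Dvd.intro _ rfl).trans h, (Dvd.intro_left _ rfl).trans h⟩
    · rintro ⟨h1, h2⟩; exact hcop.mul_dvd h1 h2
  simp only [c1, c2]
  by_cases h1 : a ^ 2 ∣ q ∧ (a : ℤ) ^ 2 ∣ D
  swap
  · rw [if_neg h1, if_neg (by tauto), zero_mul]
  by_cases h2 : b ^ 2 ∣ r ∧ (b : ℤ) ^ 2 ∣ D
  swap
  · rw [if_neg h2, if_neg (by tauto), mul_zero]
  rw [if_pos h1, if_pos h2, if_pos ⟨⟨h1.1, h2.1⟩, h1.2, h2.2⟩]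
  obtain ⟨E, hE⟩ := hcop.mul_dvd h1.2 h2.2
  obtain ⟨⟨c, rfl⟩, -⟩ := h1
  obtain ⟨⟨d, rfl⟩, -⟩ := h2
  subst hE
  have ha2 : (a : ℤ) ^ 2 ≠ 0 := by positivity
  have hb2 : (b : ℤ) ^ 2 ≠ 0 := by positivity
  have e1 : (a : ℤ) ^ 2 * (b : ℤ) ^ 2 * E / ((a * b : ℕ) : ℤ) ^ 2 = E := by
    push_cast; rw [mul_pow]; exact Int.mul_ediv_cancel_left _ (by positivity)
  have e2 : (a : ℤ) ^ 2 * (b : ℤ) ^ 2 * E / (a : ℤ) ^ 2 = (b : ℤ) ^ 2 * E := by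
    rw [mul_assoc]; exact Int.mul_ediv_cancel_left _ (by positivity)
  have e3 : (a : ℤ) ^ 2 * (b : ℤ) ^ 2 * E / (b : ℤ) ^ 2 = (a : ℤ) ^ 2 * E := by
    rw [mul_comm ((a : ℤ) ^ 2), mul_assoc]; exact Int.mul_ediv_cancel_left _ (by positivity)
  have e4 : a ^ 2 * c * (b ^ 2 * d) / (a * b) ^ 2 = c * d := by
    have : a ^ 2 * c * (b ^ 2 * d) = (a * b) ^ 2 * (c * d) := by ring
    rw [this, Nat.mul_div_cancel_left _ (by positivity)]
  rw [e1, e2, e3, e4, Nat.mul_div_cancel_left _ (by positivity), Nat.mul_div_cancel_left _ (by positivity), psi_mul_right,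
    psi_sq_mul (by rw [Int.gcd_natCast_natCast]; exact hbq.coprime_dvd_right (Dvd.intro_left _ rfl)),
    psi_sq_mul (by rw [Int.gcd_natCast_natCast]; exact har.coprime_dvd_right (Dvd.intro_left _ rfl))]
  push_cast; ring

lemma lam_mul {q r : ℕ} (hqr : q.Coprime r) (D : ℤ) : lam (q * r) D = lam q D * lam r D := by
  by_cases hq : Odd q
  swap
  · rw [lam_even hq, lam_even (by rw [Nat.odd_mul]; tauto), zero_mul]
  by_cases hr : Odd r
  swap
  · rw [lam_even hr, lam_even (by rw [Nat.odd_mul]; tauto), mul_zero]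
  have hqr' : Odd (q * r) := hq.mul hr
  simp only [lam, hq, hr, hqr', if_true]
  rw [sum_divisors_coprime hqr, Finset.sum_mul_sum]
  apply Finset.sum_congr rfl
  intro a ha
  apply Finset.sum_congr rfl
  intro b hb
  exact lamT_mul hqr (Nat.dvd_of_mem_divisors ha) (Nat.dvd_of_mem_divisors hb)
    (Nat.pos_of_mem_divisors ha).ne' (Nat.pos_of_mem_divisors hb).ne' D

section pp
variable {p : ℕ}

lemma lam_pp (hp : p.Prime) (h2 : p ≠ 2) (i : ℕ) (D : ℤ) : lam (p ^ i) D = ∑ k ∈ Finset.range (i + 1), lamT (p ^ i) D (p ^ k) := by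
  have ho : Odd (p ^ i) := (hp.odd_of_ne_two h2).pow
  rw [lam, if_pos ho, Nat.sum_divisors_prime_pow hp]

lemma lam_pp_nsq (hp : p.Prime) (h2 : p ≠ 2) (i : ℕ) {D : ℤ} (hD : ¬ (p : ℤ) ^ 2 ∣ D) : lam (p ^ i) D = psi D p ^ i := by
  rw [lam_pp hp h2, Finset.sum_range_succ', Finset.sum_eq_zero]
  · simp [lamT]
    induction i with
    | zero => simp [psi_one]
    | succ i ih => rw [pow_succ, psi_mul_right, ih, pow_succ]
  · intro k _
    unfold lamT
    rw [if_neg]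
    rintro ⟨-, h⟩
    apply hD
    refine dvd_trans ?_ h
    push_cast
    exact pow_dvd_pow_of_dvd (dvd_pow_self _ (by omega)) 2

lemma lam_pp_sq (hp : p.Prime) (h2 : p ≠ 2) (i : ℕ) (D : ℤ) : lam (p ^ (i + 2)) (p ^ 2 * D) = p * lam (p ^ i) D := by
  have hp0 := hp.pos
  have hpi : (p : ℤ) ^ 2 ≠ 0 := by positivity
  rw [lam_pp hp h2, lam_pp hp h2, Finset.sum_range_succ', Finset.sum_range_succ]
  have h0 : lamT (p ^ (i + 2)) (p ^ 2 * D) (p ^ 0) = 0 := by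
    simp only [lamT, pow_zero, one_pow, one_dvd, Nat.cast_one, and_self, if_true, one_mul, Int.ediv_one, Nat.div_one]
    apply psi_eq_zero_of_not_coprime
    intro h
    have h3 : p ∣ Int.gcd ((p : ℤ) ^ 2 * D) ((p ^ (i + 2) : ℕ) : ℤ) := by
      apply Int.dvd_gcd
      · exact Dvd.dvd.mul_right (dvd_pow_self _ (by norm_num)) _
      · push_cast; exact dvd_pow_self _ (by omega)
    rw [h] at h3
    exact hp.one_lt.ne' (Nat.dvd_one.1 h3)
  have hl : lamT (p ^ (i + 2)) (p ^ 2 * D) (p ^ (i + 1 + 1)) = 0 := by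
    unfold lamT
    rw [if_neg]
    rintro ⟨h, -⟩
    rw [← pow_mul, Nat.pow_dvd_pow_iff_le_right hp.one_lt] at h
    omega
  rw [h0, hl, add_zero, add_zero, Finset.mul_sum]
  apply Finset.sum_congr rfl
  intro k _
  have c1 : (p ^ (k + 1)) ^ 2 ∣ p ^ (i + 2) ↔ (p ^ k) ^ 2 ∣ p ^ i := by
    rw [pow_succ p k, mul_pow, pow_add]
    exact Nat.mul_dvd_mul_iff_right (by positivity)
  have c2 : ((p ^ (k + 1) : ℕ) : ℤ) ^ 2 ∣ p ^ 2 * D ↔ ((p ^ k : ℕ) : ℤ) ^ 2 ∣ D := by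
    push_cast
    rw [pow_succ (p : ℤ) k, mul_pow, mul_comm]
    exact mul_dvd_mul_iff_left hpi
  unfold lamT
  simp only [c1, c2]
  split_ifs with h
  · have e1 : (p : ℤ) ^ 2 * D / ((p ^ (k + 1) : ℕ) : ℤ) ^ 2 = D / ((p ^ k : ℕ) : ℤ) ^ 2 := by
      push_cast
      rw [pow_succ (p : ℤ) k, mul_pow, mul_comm (((p : ℤ) ^ k) ^ 2)]
      exact Int.mul_ediv_mul_of_pos _ _ (by positivity)
    have e2 : p ^ (i + 2) / (p ^ (k + 1)) ^ 2 = p ^ i / (p ^ k) ^ 2 := by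
      rw [pow_add p i 2, pow_succ p k, mul_pow]
      exact Nat.mul_div_mul_right _ _ (by positivity)
    rw [e1, e2]; push_cast; ring
  · simp

lemma lam_p_sq (hp : p.Prime) (h2 : p ≠ 2) (D : ℤ) : lam p (p ^ 2 * D) = 0 := by
  have h := lam_pp hp h2 1 (p ^ 2 * D)
  rw [pow_one] at h
  rw [h, Finset.sum_range_succ, Finset.sum_range_one]
  have h1 : lamT p (p ^ 2 * D) (p ^ 1) = 0 := by
    unfold lamT
    rw [if_neg]
    rintro ⟨h, -⟩
    rw [pow_one] at h
    have := Nat.le_of_dvd hp.pos h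
    nlinarith [hp.one_lt]
  rw [h1]
  simp only [lamT, pow_zero, one_pow, one_dvd, Nat.cast_one, and_self, if_true, one_mul, Int.ediv_one, Nat.div_one, add_zero]
  apply psi_eq_zero_of_not_coprime
  intro h
  have h3 : p ∣ Int.gcd ((p : ℤ) ^ 2 * D) (p : ℤ) := by
    apply Int.dvd_gcd
    · exact Dvd.dvd.mul_right (dvd_pow_self _ (by norm_num)) _
    · exact dvd_rfl
  rw [h] at h3
  exact hp.one_lt.ne' (Nat.dvd_one.1 h3)

end pp

lemma Pz_eq {z n : ℕ} (hn : 3 ≤ n) : Pz z n = ∑ q ∈ Finset.range (z + 1), lam q ((n : ℤ) ^ 2 - 4) / q := by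
  set D : ℕ := n ^ 2 - 4 with hD
  have hn9 : 9 ≤ n ^ 2 := by nlinarith
  have hDc : ((n : ℤ) ^ 2 - 4) = (D : ℤ) := by
    rw [hD]; push_cast [Nat.cast_sub (by omega : 4 ≤ n ^ 2)]; rfl
  rw [hDc]
  set N := n + z + 1
  have hL : Pz z n = ∑ u ∈ Finset.range N with Odd u ∧ u ^ 2 ∣ D,
      (∑ q ∈ Finset.range (z / u ^ 2 + 1), psi ((D / u ^ 2 : ℕ) : ℤ) q / q) / u := by
    unfold Pz
    apply Finset.sum_congr _ (fun _ _ => rfl)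
    ext u
    simp only [Finset.mem_filter, Finset.mem_range]
    constructor
    · rintro ⟨h1, h2⟩; exact ⟨by omega, h2⟩
    · rintro ⟨h1, h2, h3⟩
      refine ⟨?_, h2, h3⟩
      have := Nat.le_of_dvd (by omega) h3
      nlinarith
  have hR : ∀ q ∈ Finset.range (z + 1), lam q (D : ℤ) / q = ∑ u ∈ Finset.range N with Odd u ∧ u ^ 2 ∣ D,
      if u ^ 2 ∣ q then u * psi ((D / u ^ 2 : ℕ) : ℤ) (q / u ^ 2) / q else 0 := by
    intro q hq
    rw [Finset.mem_range] at hq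
    by_cases ho : Odd q
    · have hq0 : q ≠ 0 := by rintro rfl; simp at ho
      rw [lam, if_pos ho, Finset.sum_div, Finset.sum_filter]
      apply Finset.sum_subset_zero_on_sdiff
      · intro u hu
        rw [Finset.mem_range]
        have := Nat.divisor_le hu
        omega
      · intro u hu
        rw [Finset.mem_sdiff, Nat.mem_divisors] at hu
        split_ifs with h1 h2
        · exact absurd ⟨(dvd_pow_self u (by norm_num)).trans h2, hq0⟩ hu.2
        · rfl
        · rfl
      · intro u hu
        have hou : Odd u := ho.of_dvd_nat (Nat.dvd_of_mem_divisors hu)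
        have hc : (u : ℤ) ^ 2 ∣ (D : ℤ) ↔ u ^ 2 ∣ D := by exact_mod_cast Int.natCast_dvd_natCast
        unfold lamT
        simp only [hc]
        push_cast
        by_cases h1 : u ^ 2 ∣ D <;> by_cases h2 : u ^ 2 ∣ q <;> simp [h1, h2, hou]
    · rw [lam_even ho, zero_div, Finset.sum_eq_zero]
      intro u hu
      rw [Finset.mem_filter] at hu
      split_ifs with h
      · rw [psi_even, mul_zero, zero_div]
        obtain ⟨c, rfl⟩ := h
        have := hu.2.1.pos
        rw [Nat.mul_div_cancel_left _ (by positivity)]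
        intro hc
        exact ho ((hu.2.1.pow).mul hc)
      · rfl
  rw [hL, Finset.sum_congr rfl hR, Finset.sum_comm]
  apply Finset.sum_congr rfl
  intro u hu
  rw [Finset.mem_filter] at hu
  have hu0 : 0 < u := hu.2.1.pos
  have hu2 : 0 < u ^ 2 := by positivity
  rw [← Finset.sum_filter, Finset.sum_div]
  symm
  refine Finset.sum_nbij' (fun q => q / u ^ 2) (fun q => u ^ 2 * q) ?_ ?_ ?_ ?_ ?_
  · intro q hq
    rw [Finset.mem_filter, Finset.mem_range] at hq
    rw [Finset.mem_range]
    exact Nat.lt_succ_of_le (Nat.div_le_div_right (by omega))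
  · intro q hq
    rw [Finset.mem_range] at hq
    rw [Finset.mem_filter, Finset.mem_range]
    refine ⟨?_, Dvd.intro _ rfl⟩
    have : q ≤ z / u ^ 2 := by omega
    have := (Nat.le_div_iff_mul_le hu2).1 this
    nlinarith
  · intro q hq
    rw [Finset.mem_filter] at hq
    exact Nat.mul_div_cancel' hq.2
  · intro q _
    exact Nat.mul_div_cancel_left _ hu2
  · intro q hq
    rw [Finset.mem_filter] at hq
    obtain ⟨c, rfl⟩ := hq.2
    rw [Nat.mul_div_cancel_left _ hu2]
    push_cast
    have : (u : ℝ) ≠ 0 := by positivity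
    rcases Nat.eq_zero_or_pos c with rfl | hc
    · simp
    · have : (c : ℝ) ≠ 0 := by positivity
      field_simp

end P5b

section P5c

lemma sum_range_zmod {p : ℕ} [NeZero p] (f : ZMod p → ℝ) : ∑ a ∈ Finset.range p, f (a : ZMod p) = ∑ x : ZMod p, f x := by
  refine Finset.sum_nbij' (fun a => (a : ZMod p)) (fun x => x.val) ?_ ?_ ?_ ?_ ?_
  · intro a _; exact Finset.mem_univ _
  · intro x _; rw [Finset.mem_range]; exact ZMod.val_lt x
  · intro a ha; rw [Finset.mem_range] at ha; exact ZMod.val_cast_of_lt ha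
  · intro x _; exact ZMod.natCast_zmod_val x
  · intro a _; rfl

variable {p : ℕ}

lemma psi_eq_qc (hp : p.Prime) (h2 : p ≠ 2) [Fact p.Prime] (a : ℤ) : psi a p = (quadraticChar (ZMod p) (a : ZMod p) : ℤ) := by
  rw [psi_odd _ (hp.odd_of_ne_two h2), ← jacobiSym.legendreSym.to_jacobiSym]
  rfl

lemma psi_sum_zero (hp : p.Prime) (h2 : p ≠ 2) : ∑ a ∈ Finset.range p, psi (a : ℤ) p = 0 := by
  haveI := Fact.mk hp
  simp_rw [psi_eq_qc hp h2]
  have h := sum_range_zmod (p := p) (fun x => ((quadraticChar (ZMod p) x : ℤ) : ℝ))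
  push_cast at h ⊢
  rw [h]
  have := quadraticChar_sum_zero (F := ZMod p) (by rw [ZMod.ringChar_zmod_n]; exact h2)
  exact_mod_cast this

lemma psi_sum_q (hp : p.Prime) (h2 : p ≠ 2) : ∑ a ∈ Finset.range p, psi ((a : ℤ) ^ 2 - 4) p = -1 := by
  haveI := Fact.mk hp
  simp_rw [psi_eq_qc hp h2]
  have h := sum_range_zmod (p := p) (fun x => ((quadraticChar (ZMod p) (x ^ 2 - 4) : ℤ) : ℝ))
  push_cast at h ⊢
  rw [h]
  have hc : ringChar (ZMod p) ≠ 2 := by rw [ZMod.ringChar_zmod_n]; exact h2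
  have hj := jacobiSum_nontrivial_inv (quadraticChar_ne_one hc)
  rw [(quadraticChar_isQuadratic (ZMod p)).inv, jacobiSum] at hj
  have h20 : (2 : ZMod p) ≠ 0 := Ring.two_ne_zero hc
  have h40 : (4 : ZMod p) ≠ 0 := by
    have : (4 : ZMod p) = 2 * 2 := by norm_num
    rw [this]; exact mul_ne_zero h20 h20
  set χ := quadraticChar (ZMod p)
  have hneg : χ (-1) * χ (-1) = 1 := by rw [← map_mul]; norm_num
  have key : ∑ x : ZMod p, χ (x ^ 2 - 4) = -1 := by
    have e : ∑ x : ZMod p, χ (x ^ 2 - 4) = ∑ x : ZMod p, χ ((4 * x - 2) ^ 2 - 4) := by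
      symm
      apply Fintype.sum_equiv ((Equiv.mulLeft₀ (4 : ZMod p) h40).trans (Equiv.subRight 2))
      intro x; rfl
    have e2 : ∀ x : ZMod p, χ ((4 * x - 2) ^ 2 - 4) = χ (-1) * (χ x * χ (1 - x)) := by
      intro x
      have : (4 * x - 2) ^ 2 - 4 = 4 ^ 2 * (-1 * (x * (1 - x))) := by ring
      rw [this, map_mul, quadraticChar_sq_one' h40, one_mul, map_mul, map_mul]
    rw [e, Finset.sum_congr rfl fun x _ => e2 x, ← Finset.mul_sum, hj]
    rw [mul_neg, hneg]
  exact_mod_cast key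

lemma psi_unit (hp : p.Prime) (h2 : p ≠ 2) {a : ℤ} (h : ¬ (p : ℤ) ∣ a) : psi a p = 1 ∨ psi a p = -1 := by
  have : psi a p ^ 2 = 1 := by
    apply psi_sq_of_coprime (hp.odd_of_ne_two h2)
    have := (Nat.prime_iff_prime_int.1 hp).coprime_iff_not_dvd.2 h
    exact Int.isCoprime_iff_gcd_eq_one.1 this.symm
  have h3 : (psi a p - 1) * (psi a p + 1) = 0 := by linear_combination this
  rcases mul_eq_zero.1 h3 with h | h
  · left; linarith
  · right; linarith

lemma psi_div (hp : p.Prime) {a : ℤ} (h : (p : ℤ) ∣ a) : psi a p = 0 := by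
  apply psi_eq_zero_of_not_coprime
  intro hg
  have : p ∣ a.gcd p := Int.dvd_gcd h dvd_rfl
  rw [hg] at this
  exact hp.one_lt.ne' (Nat.dvd_one.1 this)

lemma h_psi (hp : p.Prime) (h2 : p ≠ 2) {a : ℤ} (ha : ¬ (p : ℤ) ∣ a) (h : ℝ → ℝ) :
    h (psi a p) = (h 1 + h (-1)) / 2 + psi a p * ((h 1 - h (-1)) / 2) := by
  rcases psi_unit hp h2 ha with e | e <;> rw [e] <;> ring

lemma sum_unit1 (hp : p.Prime) (h2 : p ≠ 2) (h : ℝ → ℝ) :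
    ∑ a ∈ (Finset.range p).erase 0, h (psi (a : ℤ) p) = ((p : ℝ) - 1) / 2 * (h 1 + h (-1)) := by
  have e : ∀ a ∈ (Finset.range p).erase 0, h (psi (a : ℤ) p) = (h 1 + h (-1)) / 2 + psi (a : ℤ) p * ((h 1 - h (-1)) / 2) := by
    intro a ha
    rw [Finset.mem_erase, Finset.mem_range] at ha
    apply h_psi hp h2
    rw [Int.natCast_dvd_natCast]
    exact Nat.not_dvd_of_pos_of_lt (by omega) ha.2
  rw [Finset.sum_congr rfl e, Finset.sum_add_distrib, ← Finset.sum_mul, Finset.sum_const,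
    Finset.card_erase_of_mem (Finset.mem_range.2 hp.pos), Finset.card_range]
  have := psi_sum_zero hp h2
  rw [← Finset.add_sum_erase _ _ (Finset.mem_range.2 hp.pos)] at this
  rw [psi_div hp (by simp), zero_add] at this
  rw [this, nsmul_eq_mul, Nat.cast_sub hp.one_le]
  push_cast; ring

/-- residues `a` mod `p` with `a² ≠ 4` -/
def Sq4 (p : ℕ) : Finset ℕ := ((Finset.range p).erase 2).erase (p - 2)

lemma Sq4_unit (hp : p.Prime) (h2 : p ≠ 2) {a : ℕ} (ha : a ∈ Sq4 p) : ¬ (p : ℤ) ∣ (a : ℤ) ^ 2 - 4 := by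
  have hp3 : 3 ≤ p := by have := hp.two_le; omega
  rw [Sq4, Finset.mem_erase, Finset.mem_erase, Finset.mem_range] at ha
  intro h
  have e : (a : ℤ) ^ 2 - 4 = (a - 2) * (a + 2) := by ring
  rw [e] at h
  rcases (Nat.prime_iff_prime_int.1 hp).dvd_or_dvd h with h | h
  · have := Int.eq_zero_of_abs_lt_dvd h (by rw [abs_lt]; constructor <;> omega)
    omega
  · obtain ⟨c, hc⟩ := h
    have hc1 : 0 < c := by
      by_contra hcc
      push Not at hcc
      nlinarith
    have hc2 : c < 2 := by
      by_contra hcc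
      push Not at hcc
      nlinarith
    have : c = 1 := by omega
    subst this
    omega

lemma sum_Sq4 (hp : p.Prime) (h2 : p ≠ 2) (f : ℕ → ℝ) : ∑ a ∈ Finset.range p, f a = ∑ a ∈ Sq4 p, f a + f 2 + f (p - 2) := by
  have hp3 : 3 ≤ p := by have := hp.two_le; omega
  rw [Sq4, ← Finset.sum_erase_add _ _ (Finset.mem_range.2 (by omega : 2 < p)),
    ← Finset.sum_erase_add ((Finset.range p).erase 2) _ (Finset.mem_erase.2 ⟨?_, Finset.mem_range.2 (by omega : p - 2 < p)⟩)]
  · ring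
  · intro h
    have : p = 4 := by omega
    subst this
    norm_num at hp

lemma sum_unit2 (hp : p.Prime) (h2 : p ≠ 2) (h : ℝ → ℝ) :
    ∑ a ∈ Sq4 p, h (psi ((a : ℤ) ^ 2 - 4) p) = ((p : ℝ) - 3) / 2 * h 1 + ((p : ℝ) - 1) / 2 * h (-1) := by
  have hp3 : 3 ≤ p := by have := hp.two_le; omega
  rw [Finset.sum_congr rfl fun a ha => h_psi hp h2 (Sq4_unit hp h2 ha) h, Finset.sum_add_distrib, ← Finset.sum_mul]
  have e1 := psi_sum_q hp h2
  rw [sum_Sq4 hp h2] at e1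
  rw [psi_div hp (by norm_num : (p : ℤ) ∣ ((2 : ℕ) : ℤ) ^ 2 - 4), psi_div hp (a := ((p - 2 : ℕ) : ℤ) ^ 2 - 4)] at e1
  swap
  · rw [Nat.cast_sub (by omega)]; exact ⟨p - 4, by push_cast; ring⟩
  have e2 := sum_Sq4 hp h2 (fun _ => (h 1 + h (-1)) / 2)
  rw [Finset.sum_const, Finset.card_range, nsmul_eq_mul] at e2
  have e3 : ∑ a ∈ Sq4 p, (h 1 + h (-1)) / 2 = (p - 2) * ((h 1 + h (-1)) / 2) := by linarith
  have e4 : ∑ a ∈ Sq4 p, psi ((a : ℤ) ^ 2 - 4) p = -1 := by linarith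
  rw [e3, e4]
  ring

end P5c

section P5d

variable {p : ℕ}

/-- local truncated Euler factor -/
noncomputable def GK (p K : ℕ) (D : ℤ) : ℝ := ∑ i ∈ Finset.range (K + 1), lam (p ^ i) D / (p : ℝ) ^ i

/-- absolute version without constant term -/
noncomputable def HK (p K : ℕ) (D : ℤ) : ℝ := ∑ i ∈ Finset.range K, |lam (p ^ (i + 1)) D| / (p : ℝ) ^ (i + 1)

/-- value at units -/
noncomputable def gunit (p K : ℕ) (s : ℝ) : ℝ := ∑ i ∈ Finset.range (K + 1), (s / p) ^ i

lemma sq_cases (D : ℤ) (p : ℕ) : (∃ E, D = p ^ 2 * E) ∨ ¬ (p : ℤ) ^ 2 ∣ D := by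
  by_cases h : (p : ℤ) ^ 2 ∣ D
  · left; exact h
  · right; exact h

lemma GK_nsq (hp : p.Prime) (h2 : p ≠ 2) (K : ℕ) {D : ℤ} (hD : ¬ (p : ℤ) ^ 2 ∣ D) : GK p K D = gunit p K (psi D p) := by
  unfold GK gunit
  apply Finset.sum_congr rfl
  intro i _
  rw [lam_pp_nsq hp h2 i hD, div_pow]

lemma gunit_zero (K : ℕ) : gunit p K 0 = 1 := by
  unfold gunit
  rw [Finset.sum_range_succ']
  simp

lemma GK_sq (hp : p.Prime) (h2 : p ≠ 2) (K : ℕ) (D : ℤ) : GK p (K + 2) (p ^ 2 * D) = 1 + GK p K D / p := by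
  have hp0 : (p : ℝ) ≠ 0 := by exact_mod_cast hp.ne_zero
  unfold GK
  rw [show K + 2 + 1 = K + 1 + 1 + 1 by ring, Finset.sum_range_succ', Finset.sum_range_succ']
  simp only [pow_zero, lam_one, zero_add, pow_one, lam_p_sq hp h2, zero_div, add_zero, div_one]
  rw [add_comm, Finset.sum_div]
  congr 1
  apply Finset.sum_congr rfl
  intro i _
  rw [show i + 1 + 1 = i + 2 by ring, lam_pp_sq hp h2]
  field_simp
  ring

lemma HK_sq (hp : p.Prime) (h2 : p ≠ 2) (K : ℕ) (D : ℤ) : HK p (K + 2) (p ^ 2 * D) = (1 + HK p K D) / p := by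
  have hp0 : (p : ℝ) ≠ 0 := by exact_mod_cast hp.ne_zero
  unfold HK
  rw [Finset.sum_range_succ']
  simp only [zero_add, pow_one, lam_p_sq hp h2, abs_zero, zero_div, add_zero]
  rw [Finset.sum_range_succ', add_comm, add_div, Finset.sum_div]
  congr 1
  · have := lam_pp_sq hp h2 0 D
    simp only [zero_add] at this ⊢
    norm_num
    rw [this, pow_zero, lam_one, mul_one, Nat.abs_cast]
    field_simp
  · apply Finset.sum_congr rfl
    intro i _
    rw [show i + 1 + 1 + 1 = (i + 1) + 2 by ring, lam_pp_sq hp h2, abs_mul, Nat.abs_cast]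
    field_simp
    ring

lemma geomp_le (hp : p.Prime) (K : ℕ) : ∑ i ∈ Finset.range K, (1 / (p : ℝ)) ^ i ≤ 2 := by
  have hp2 : (2 : ℝ) ≤ p := by exact_mod_cast hp.two_le
  have h1 : (1 / (p : ℝ)) ≤ 1 / 2 := by gcongr
  calc ∑ i ∈ Finset.range K, (1 / (p : ℝ)) ^ i ≤ ∑ i ∈ Finset.range K, (1 / (2 : ℝ)) ^ i := by gcongr
    _ ≤ 2 := sum_geometric_two_le K

lemma lam_nsq_abs (hp : p.Prime) (h2 : p ≠ 2) (i : ℕ) {D : ℤ} (hD : ¬ (p : ℤ) ^ 2 ∣ D) : |lam (p ^ i) D| ≤ 1 := by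
  rw [lam_pp_nsq hp h2 i hD, abs_pow]
  exact pow_le_one₀ (abs_nonneg _) (psi_abs_le _ _)

lemma HK_bound (hp : p.Prime) (h2 : p ≠ 2) (K : ℕ) : ∀ D : ℤ, HK p K D ≤ 2 / p := by
  have hp2 : (2 : ℝ) ≤ p := by exact_mod_cast hp.two_le
  have hnsq : ∀ K : ℕ, ∀ D : ℤ, ¬ (p : ℤ) ^ 2 ∣ D → HK p K D ≤ 2 / p := by
    intro K D hD
    unfold HK
    calc _ ≤ ∑ i ∈ Finset.range K, (1 / (p : ℝ)) ^ i * (1 / p) := by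
          apply Finset.sum_le_sum
          intro i _
          rw [← pow_succ, one_div_pow]
          gcongr
          exact lam_nsq_abs hp h2 _ hD
      _ ≤ 2 * (1 / p) := by
          rw [← Finset.sum_mul]
          exact mul_le_mul_of_nonneg_right (geomp_le hp K) (by positivity)
      _ = _ := by ring
  induction K using Nat.strong_induction_on with
  | _ K ih =>
    intro D
    rcases sq_cases D p with ⟨E, rfl⟩ | h
    swap
    · exact hnsq K D h
    match K, ih with
    | 0, _ => simp [HK]; positivity
    | 1, _ => simp [HK, lam_p_sq hp h2]; positivity
    | K + 2, ih =>
      rw [HK_sq hp h2]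
      have := ih K (by omega) E
      have h3 : 2 / (p : ℝ) ≤ 1 := by rw [div_le_one (by linarith)]; exact hp2
      gcongr
      linarith

lemma lam_abs_nonneg_sum (K : ℕ) (D : ℤ) : 0 ≤ HK p K D := by
  unfold HK; positivity

/-- the tail starting from the square term -/
lemma tail2_bound (hp : p.Prime) (h2 : p ≠ 2) (K : ℕ) (D : ℤ) :
    ∑ i ∈ Finset.range K, |lam (p ^ (i + 2)) D| / (p : ℝ) ^ (i + 2) ≤ 2 / (p : ℝ) ^ 2 + if (p : ℤ) ∣ D then 2 / (p : ℝ) else 0 := by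
  have hp2 : (2 : ℝ) ≤ p := by exact_mod_cast hp.two_le
  rcases sq_cases D p with ⟨E, rfl⟩ | hD
  · rw [if_pos (Dvd.dvd.mul_right (dvd_pow_self _ (by norm_num)) _)]
    have := HK_bound hp h2 (K + 1) (p ^ 2 * E)
    unfold HK at this
    rw [Finset.sum_range_succ'] at this
    have h0 : 0 ≤ |lam (p ^ (0 + 1)) (p ^ 2 * E)| / (p : ℝ) ^ (0 + 1) := by positivity
    have h1 : 0 ≤ 2 / (p : ℝ) ^ 2 := by positivity
    linarith
  · have : ∑ i ∈ Finset.range K, |lam (p ^ (i + 2)) D| / (p : ℝ) ^ (i + 2) ≤ 2 / (p : ℝ) ^ 2 := by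
      calc _ ≤ ∑ i ∈ Finset.range K, (1 / (p : ℝ)) ^ i * (1 / (p : ℝ) ^ 2) := by
            apply Finset.sum_le_sum
            intro i _
            rw [one_div_pow, one_div_mul_one_div, ← pow_add]
            gcongr
            exact lam_nsq_abs hp h2 _ hD
        _ ≤ 2 * (1 / (p : ℝ) ^ 2) := by
            rw [← Finset.sum_mul]
            exact mul_le_mul_of_nonneg_right (geomp_le hp K) (by positivity)
        _ = _ := by ring
    split_ifs
    · have : 0 ≤ 2 / (p : ℝ) := by positivity
      linarith
    · linarith

lemma GK_bound (hp : p.Prime) (h2 : p ≠ 2) (K : ℕ) (D : ℤ) : |GK p K D| ≤ 2 := by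
  have hp2 : (2 : ℝ) ≤ p := by exact_mod_cast hp.two_le
  have h3 : 2 / (p : ℝ) ≤ 1 := by rw [div_le_one (by linarith)]; exact hp2
  have h4 := HK_bound hp h2 K D
  have : |GK p K D| ≤ 1 + HK p K D := by
    unfold GK HK
    rw [Finset.sum_range_succ', add_comm]
    simp only [pow_zero, lam_one, div_one]
    refine (abs_add_le _ _).trans ?_
    rw [abs_one]
    gcongr
    refine (Finset.abs_sum_le_sum_abs _ _).trans (le_of_eq ?_)
    apply Finset.sum_congr rfl
    intro i _
    rw [abs_div, abs_pow, Nat.abs_cast]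
  linarith

lemma GK_diff (hp : p.Prime) (h2 : p ≠ 2) (j : ℕ) : ∀ D : ℤ, |GK p (2 * j + 2) D - GK p (2 * j) D| ≤ 4 / (p : ℝ) ^ j := by
  have hp2 : (2 : ℝ) ≤ p := by exact_mod_cast hp.two_le
  induction j with
  | zero =>
    intro D
    refine (abs_sub _ _).trans ?_
    have := GK_bound hp h2 (2 * 0 + 2) D
    have := GK_bound hp h2 (2 * 0) D
    norm_num at *; linarith
  | succ j ih =>
    intro D
    rcases sq_cases D p with ⟨E, rfl⟩ | hD
    · rw [show 2 * (j + 1) = 2 * j + 2 by ring, GK_sq hp h2, GK_sq hp h2]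
      have := ih E
      rw [show 1 + GK p (2 * j + 2) E / p - (1 + GK p (2 * j) E / p) = (GK p (2 * j + 2) E - GK p (2 * j) E) / p by ring,
        abs_div, Nat.abs_cast, pow_succ, ← div_div]
      gcongr
    · have e : GK p (2 * (j + 1) + 2) D - GK p (2 * (j + 1)) D = lam (p ^ (2 * j + 3)) D / (p : ℝ) ^ (2 * j + 3)
          + lam (p ^ (2 * j + 4)) D / (p : ℝ) ^ (2 * j + 4) := by
        unfold GK
        rw [show 2 * (j + 1) + 2 + 1 = 2 * j + 3 + 1 + 1 by ring, Finset.sum_range_succ, Finset.sum_range_succ]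
        rw [show 2 * (j + 1) + 1 = 2 * j + 3 by ring]
        ring
      have hb : ∀ i, j + 1 ≤ i → |lam (p ^ i) D / (p : ℝ) ^ i| ≤ 1 / (p : ℝ) ^ (j + 1) := by
        intro i hi
        rw [abs_div, abs_pow, Nat.abs_cast]
        apply div_le_div₀ zero_le_one (lam_nsq_abs hp h2 i hD) (by positivity)
        exact pow_le_pow_right₀ (by linarith) hi
      rw [e]
      refine (abs_add_le _ _).trans ?_
      have h1 := hb (2 * j + 3) (by omega)
      have h2 := hb (2 * j + 4) (by omega)
      have h3 : (4 : ℝ) / (p : ℝ) ^ (j + 1) = 4 * (1 / (p : ℝ) ^ (j + 1)) := by ring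
      have h4 : 0 ≤ 1 / (p : ℝ) ^ (j + 1) := by positivity
      rw [h3]; linarith

lemma GK_per (p K : ℕ) : PerZ (GK p K) (p ^ K) := by
  intro a b hab
  unfold GK
  apply Finset.sum_congr rfl
  intro i hi
  rw [Finset.mem_range] at hi
  rw [((lam_per (p ^ i)).mono (pow_dvd_pow p (by omega : i ≤ K))) a b hab]

end P5d

section P5e

variable {p : ℕ}

lemma loc_R (hp : p.Prime) (h2 : p ≠ 2) (j : ℕ) (φ : ℝ → ℝ) :
    Em (p ^ (2 * j + 1)) (fun k => φ (GK p (2 * j + 2) (p * k))) =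
      ((p - 1) * φ 1 + Em (p ^ (2 * j)) (fun l => φ (1 + GK p (2 * j) l / p))) / p := by
  have hpp : 0 < p ^ (2 * j) := pow_pos hp.pos _
  rw [pow_succ', Em_split, ← Finset.sum_erase_add _ _ (Finset.mem_range.2 hp.pos)]
  congr 2
  · have : ∀ a ∈ (Finset.range p).erase 0, Em (p ^ (2 * j)) (fun k => φ (GK p (2 * j + 2) (p * (a + p * k)))) = φ 1 := by
      intro a ha
      rw [Finset.mem_erase, Finset.mem_range] at ha
      rw [← Em_const hpp (φ 1)]
      apply Em_congr
      intro k
      rw [GK_nsq hp h2, psi_div hp (Dvd.intro _ rfl), gunit_zero]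
      rw [pow_two]
      intro h
      have h3 := (mul_dvd_mul_iff_left (by exact_mod_cast hp.ne_zero : (p : ℤ) ≠ 0)).1 h
      rw [dvd_add_left (Dvd.intro _ rfl), Int.natCast_dvd_natCast] at h3
      exact Nat.not_dvd_of_pos_of_lt (by omega) ha.2 h3
    rw [Finset.sum_congr rfl this, Finset.sum_const, Finset.card_erase_of_mem (Finset.mem_range.2 hp.pos), Finset.card_range,
      nsmul_eq_mul, Nat.cast_sub hp.one_le]
    simp
  · apply Em_congr
    intro k
    rw [← GK_sq hp h2]
    congr 2
    push_cast; ring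

lemma loc_U (hp : p.Prime) (h2 : p ≠ 2) (j : ℕ) (φ : ℝ → ℝ) :
    Em (p ^ (2 * j + 2)) (fun D => φ (GK p (2 * j + 2) D)) =
      (((p : ℝ) - 1) / 2 * (φ (gunit p (2 * j + 2) 1) + φ (gunit p (2 * j + 2) (-1)))
        + Em (p ^ (2 * j + 1)) (fun k => φ (GK p (2 * j + 2) (p * k)))) / p := by
  have hpp : 0 < p ^ (2 * j + 1) := pow_pos hp.pos _
  rw [show 2 * j + 2 = 2 * j + 1 + 1 by ring, pow_succ' p, Em_split, ← Finset.sum_erase_add _ _ (Finset.mem_range.2 hp.pos)]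
  congr 2
  · rw [← sum_unit1 hp h2 (fun s => φ (gunit p (2 * j + 1 + 1) s))]
    apply Finset.sum_congr rfl
    intro a ha
    rw [Finset.mem_erase, Finset.mem_range] at ha
    rw [← Em_const hpp (φ (gunit p (2 * j + 1 + 1) (psi (a : ℤ) p)))]
    apply Em_congr
    intro k
    rw [GK_nsq hp h2, psi_congr (a := a + p * k) (b := a) (by simp)]
    intro h
    have h3 : (p : ℤ) ∣ a + p * k := (dvd_pow_self _ (by norm_num)).trans h
    rw [dvd_add_left (Dvd.intro _ rfl), Int.natCast_dvd_natCast] at h3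
    exact Nat.not_dvd_of_pos_of_lt (by omega) ha.2 h3
  · apply Em_congr
    intro k
    congr 2
    push_cast; ring

lemma loc_V (hp : p.Prime) (h2 : p ≠ 2) (j : ℕ) (φ : ℝ → ℝ) :
    Em (p ^ (2 * j + 2)) (fun n => φ (GK p (2 * j + 2) (n ^ 2 - 4))) =
      (((p : ℝ) - 3) / 2 * φ (gunit p (2 * j + 2) 1) + ((p : ℝ) - 1) / 2 * φ (gunit p (2 * j + 2) (-1))
        + 2 * Em (p ^ (2 * j + 1)) (fun k => φ (GK p (2 * j + 2) (p * k)))) / p := by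
  have hpp : 0 < p ^ (2 * j + 1) := pow_pos hp.pos _
  have hp3 : 3 ≤ p := by have := hp.two_le; omega
  have hper : PerZ (fun k => φ (GK p (2 * j + 2) (p * k))) (p ^ (2 * j + 1)) := by
    have : PerZ (fun D => φ (GK p (2 * j + 2) D)) (p * p ^ (2 * j + 1)) := by
      rw [← pow_succ']; exact (GK_per p _).comp φ
    exact this.scale
  have h4 : ¬ (p : ℤ) ∣ 4 := by
    intro h
    have h' : p ∣ 2 ^ 2 := by exact_mod_cast h
    have := (Nat.prime_dvd_prime_iff_eq hp Nat.prime_two).1 (hp.dvd_of_dvd_pow h')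
    exact h2 this
  have h4' : ¬ (p : ℤ) ∣ -4 := by rwa [dvd_neg]
  have e1 := Em_quad hp h4 hper
  have e2 := Em_quad hp h4' hper
  have hper2 : PerZ (fun k : ℤ => φ (GK p (2 * j + 2) (p * (k * (p * k + -4))))) (p ^ (2 * j + 1)) := by
    intro a b hab
    apply hper
    have : a * (p * a + -4) - b * (p * b + -4) = (a - b) * (p * (a + b) - 4) := by ring
    rw [this]
    exact Dvd.dvd.mul_right hab _
  have e3 := Em_shift hpp hper2 1
  rw [e2] at e3
  conv_lhs => rw [show 2 * j + 2 = 2 * j + 1 + 1 by ring, pow_succ' p, Em_split, sum_Sq4 hp h2]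
  congr 1
  have f1 : Em (p ^ (2 * j + 1)) (fun k => φ (GK p (2 * j + 1 + 1) ((((2 : ℕ) : ℤ) + p * k) ^ 2 - 4))) =
      Em (p ^ (2 * j + 1)) (fun k => φ (GK p (2 * j + 2) (p * k))) := by
    rw [← e1]
    apply Em_congr
    intro k
    congr 2
    push_cast; ring
  have f2 : Em (p ^ (2 * j + 1)) (fun k => φ (GK p (2 * j + 1 + 1) ((((p - 2 : ℕ) : ℤ) + p * k) ^ 2 - 4))) =
      Em (p ^ (2 * j + 1)) (fun k => φ (GK p (2 * j + 2) (p * k))) := by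
    rw [← e3]
    apply Em_congr
    intro k
    congr 2
    rw [Nat.cast_sub (by omega)]
    push_cast; ring
  have f3 : ∑ a ∈ Sq4 p, Em (p ^ (2 * j + 1)) (fun k => φ (GK p (2 * j + 1 + 1) (((a : ℤ) + p * k) ^ 2 - 4))) =
      ((p : ℝ) - 3) / 2 * φ (gunit p (2 * j + 2) 1) + ((p : ℝ) - 1) / 2 * φ (gunit p (2 * j + 2) (-1)) := by
    rw [← sum_unit2 hp h2 (fun s => φ (gunit p (2 * j + 2) s))]
    apply Finset.sum_congr rfl
    intro a ha
    rw [← Em_const hpp (φ (gunit p (2 * j + 2) (psi ((a : ℤ) ^ 2 - 4) p)))]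
    apply Em_congr
    intro k
    have hd : (p : ℤ) ∣ ((a : ℤ) + p * k) ^ 2 - 4 - ((a : ℤ) ^ 2 - 4) := ⟨2 * a * k + p * k ^ 2, by ring⟩
    rw [GK_nsq hp h2, psi_congr hd]
    intro h
    have h3 : (p : ℤ) ∣ ((a : ℤ) + p * k) ^ 2 - 4 := (dvd_pow_self _ (by norm_num)).trans h
    apply Sq4_unit hp h2 ha
    have := dvd_sub h3 hd
    rwa [sub_sub_cancel] at this
  rw [f1, f2, f3]
  ring

lemma rec_limit {m c : ℕ → ℝ} {r c' : ℝ} (hr : r ≠ 1) (hm : ∀ j, m (j + 1) = c j + r * m j) (hc : Tendsto c atTop (nhds c'))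
    (hd : Tendsto (fun j => m (j + 1) - m j) atTop (nhds 0)) : Tendsto m atTop (nhds (c' / (1 - r))) := by
  have hr' : 1 - r ≠ 0 := sub_ne_zero.2 (Ne.symm hr)
  have e : ∀ j, m j = (c j - (m (j + 1) - m j)) / (1 - r) := by
    intro j
    rw [eq_div_iff hr']
    linear_combination hm j
  have := (hc.sub hd).div_const (1 - r)
  rw [sub_zero] at this
  exact this.congr (fun j => (e j).symm)

lemma gunit_lim (hp : p.Prime) {s : ℝ} (hs : |s| = 1) : Tendsto (fun j => gunit p (2 * j + 2) s) atTop (nhds (1 / (1 - s / p))) := by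
  have hp2 : (2 : ℝ) ≤ p := by exact_mod_cast hp.two_le
  have : HasSum (fun i => (s / p) ^ i) (1 - s / p)⁻¹ := by
    apply hasSum_geometric_of_abs_lt_one
    rw [abs_div, hs, Nat.abs_cast, div_lt_one (by linarith)]
    linarith
  rw [one_div]
  exact this.tendsto_sum_nat.comp (tendsto_atTop_mono (fun j => by omega : ∀ j, j ≤ 2 * j + 2 + 1) tendsto_id)

lemma Em_diff_bound {W : ℕ} (hW : 0 < W) {F H : ℤ → ℝ} {B : ℝ} (h : ∀ x, |F x - H x| ≤ B) : |Em W F - Em W H| ≤ B := by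
  have e : Em W F - Em W H = Em W (fun x => F x - H x) := by
    unfold Em; rw [Finset.sum_sub_distrib, sub_div]
  rw [e]
  refine (Em_abs_le _ _).trans ((Em_mono h).trans_eq (Em_const hW B))

theorem local_limit (hp : p.Prime) (h2 : p ≠ 2) :
    Tendsto (fun j => Em (p ^ (2 * j)) (fun n => GK p (2 * j) (n ^ 2 - 4) ^ 2)) atTop
      (nhds (1 + ((p : ℝ) ^ 4 - 2 * (p : ℝ) ^ 3 + 1) / ((p : ℝ) ^ 2 - 1) ^ 3)) := by
  have hp3 : (3 : ℝ) ≤ p := by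
    have : 3 ≤ p := by have := hp.two_le; omega
    exact_mod_cast this
  have hp0 : (p : ℝ) ≠ 0 := by linarith
  set m1 : ℕ → ℝ := fun j => Em (p ^ (2 * j)) (GK p (2 * j)) with hm1
  set m2 : ℕ → ℝ := fun j => Em (p ^ (2 * j)) (fun D => GK p (2 * j) D ^ 2) with hm2
  set gp : ℕ → ℝ := fun j => gunit p (2 * j + 2) 1
  set gm : ℕ → ℝ := fun j => gunit p (2 * j + 2) (-1)
  have hgp : Tendsto gp atTop (nhds (1 / (1 - 1 / p))) := gunit_lim hp (by simp)
  have hgm : Tendsto gm atTop (nhds (1 / (1 - -1 / p))) := gunit_lim hp (by simp)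
  have hpj : ∀ j, 0 < p ^ (2 * j) := fun j => pow_pos hp.pos _
  have hR1 : ∀ j, Em (p ^ (2 * j + 1)) (fun k => GK p (2 * j + 2) (p * k)) = ((p - 1) + (1 + m1 j / p)) / p := by
    intro j
    have := loc_R hp h2 j (fun x => x)
    rw [this, Em_add, Em_const (hpj j), Em_congr (H := fun x => (1 / p) * GK p (2 * j) x) (fun x => by ring), Em_mul_left]
    ring
  have hR2 : ∀ j, Em (p ^ (2 * j + 1)) (fun k => GK p (2 * j + 2) (p * k) ^ 2) =
      ((p - 1) + (1 + 2 * m1 j / p + m2 j / p ^ 2)) / p := by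
    intro j
    have := loc_R hp h2 j (fun x => x ^ 2)
    rw [this, Em_congr (H := fun l => 1 + ((2 / p) * GK p (2 * j) l + (1 / p ^ 2) * GK p (2 * j) l ^ 2)) (fun x => by ring),
      Em_add, Em_const (hpj j), Em_add, Em_mul_left, Em_mul_left]
    ring
  have hU1 : ∀ j, m1 (j + 1) = (((p : ℝ) - 1) / 2 * (gp j + gm j) + 1) / p + (1 / p ^ 3) * m1 j := by
    intro j
    have := loc_U hp h2 j (fun x => x)
    rw [hR1] at this
    simp only [hm1]
    rw [show 2 * (j + 1) = 2 * j + 2 by ring]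
    refine this.trans ?_
    simp only [gp, gm]
    field_simp
    ring
  have hU2 : ∀ j, m2 (j + 1) = (((p : ℝ) - 1) / 2 * (gp j ^ 2 + gm j ^ 2) + 1 + 2 * m1 j / p ^ 2) / p + (1 / p ^ 4) * m2 j := by
    intro j
    have := loc_U hp h2 j (fun x => x ^ 2)
    rw [hR2] at this
    simp only [hm2]
    rw [show 2 * (j + 1) = 2 * j + 2 by ring]
    refine this.trans ?_
    simp only [gp, gm]
    field_simp
    ring
  have hz : Tendsto (fun j : ℕ => 16 / (p : ℝ) ^ j) atTop (nhds 0) := by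
    have := tendsto_pow_atTop_nhds_zero_of_lt_one (r := 1 / (p : ℝ)) (by positivity)
      (by rw [div_lt_one (by linarith)]; linarith)
    have := this.const_mul 16
    rw [mul_zero] at this
    refine this.congr fun j => ?_
    rw [one_div_pow]; ring
  have hlift1 : ∀ j, m1 j = Em (p ^ (2 * j + 2)) (GK p (2 * j)) := fun j =>
    (Em_dvd (GK_per p (2 * j)) (pow_dvd_pow p (by omega)) (pow_pos hp.pos _)).symm
  have hlift2 : ∀ j, m2 j = Em (p ^ (2 * j + 2)) (fun D => GK p (2 * j) D ^ 2) := fun j =>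
    (Em_dvd ((GK_per p (2 * j)).comp (fun x => x ^ 2)) (pow_dvd_pow p (by omega)) (pow_pos hp.pos _)).symm
  have hd1 : Tendsto (fun j => m1 (j + 1) - m1 j) atTop (nhds 0) := by
    apply squeeze_zero_norm _ hz
    intro j
    rw [Real.norm_eq_abs, hlift1 j]
    simp only [hm1]
    apply Em_diff_bound (pow_pos hp.pos _)
    intro D
    refine (GK_diff hp h2 j D).trans ?_
    gcongr; norm_num
  have hd2 : Tendsto (fun j => m2 (j + 1) - m2 j) atTop (nhds 0) := by
    apply squeeze_zero_norm _ hz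
    intro j
    rw [Real.norm_eq_abs, hlift2 j]
    simp only [hm2]
    apply Em_diff_bound (pow_pos hp.pos _)
    intro D
    have h3 := GK_diff hp h2 j D
    rw [show 2 * (j + 1) = 2 * j + 2 by ring, sq_sub_sq, abs_mul]
    have h4 : |GK p (2 * j + 2) D + GK p (2 * j) D| ≤ 4 := by
      refine (abs_add_le _ _).trans ?_
      have := GK_bound hp h2 (2 * j + 2) D
      have := GK_bound hp h2 (2 * j) D
      linarith
    calc _ ≤ 4 * (4 / (p : ℝ) ^ j) := mul_le_mul h4 h3 (abs_nonneg _) (by norm_num)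
      _ = _ := by ring
  have hp31 : (p : ℝ) ^ 3 ≠ 1 := by
    have : (1 : ℝ) < (p : ℝ) ^ 3 := one_lt_pow₀ (by linarith) (by norm_num)
    exact this.ne'
  have hp41 : (p : ℝ) ^ 4 ≠ 1 := by
    have : (1 : ℝ) < (p : ℝ) ^ 4 := one_lt_pow₀ (by linarith) (by norm_num)
    exact this.ne'
  have hl1 := rec_limit (r := 1 / (p : ℝ) ^ 3) (by rw [ne_eq, div_eq_one_iff_eq (by positivity)]; exact hp31.symm) hU1
    (((((hgp.add hgm).const_mul (((p : ℝ) - 1) / 2)).add_const 1).div_const (p : ℝ))) hd1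
  have hl2 := rec_limit (r := 1 / (p : ℝ) ^ 4) (by rw [ne_eq, div_eq_one_iff_eq (by positivity)]; exact hp41.symm) hU2
    ((((((hgp.pow 2).add (hgm.pow 2)).const_mul (((p : ℝ) - 1) / 2)).add_const 1).add
      ((hl1.const_mul 2).div_const ((p : ℝ) ^ 2))).div_const (p : ℝ)) hd2
  rw [← tendsto_add_atTop_iff_nat 1]
  have hV : ∀ j, Em (p ^ (2 * (j + 1))) (fun n => GK p (2 * (j + 1)) (n ^ 2 - 4) ^ 2) =
      (((p : ℝ) - 3) / 2 * gp j ^ 2 + ((p : ℝ) - 1) / 2 * gm j ^ 2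
        + 2 * (((p - 1) + (1 + 2 * m1 j / p + m2 j / p ^ 2)) / p)) / p := by
    intro j
    have := loc_V hp h2 j (fun x => x ^ 2)
    rw [hR2] at this
    exact this
  rw [funext hV]
  have hfin := ((((hgp.pow 2).const_mul (((p : ℝ) - 3) / 2)).add ((hgm.pow 2).const_mul (((p : ℝ) - 1) / 2))).add
    (((((((hl1.const_mul 2).div_const (p : ℝ)).const_add 1).add (hl2.div_const ((p : ℝ) ^ 2))).const_add ((p : ℝ) - 1)).div_const
      (p : ℝ)).const_mul 2)).div_const (p : ℝ)
  convert hfin using 2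
  have n1 : (p : ℝ) - 1 ≠ 0 := by linarith
  have n2 : (p : ℝ) + 1 ≠ 0 := by linarith
  have n3 : (p : ℝ) ^ 3 - 1 ≠ 0 := sub_ne_zero.2 hp31
  have n4 : (p : ℝ) ^ 4 - 1 ≠ 0 := sub_ne_zero.2 hp41
  have n5 : (p : ℝ) ^ 2 - 1 ≠ 0 := by
    have : (p : ℝ) ^ 2 - 1 = (p - 1) * (p + 1) := by ring
    rw [this]; exact mul_ne_zero n1 n2
  have n6 : (1 : ℝ) - 1 / p = (p - 1) / p := by field_simp
  have n7 : (1 : ℝ) - -1 / p = (p + 1) / p := by field_simp; ring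
  have n8 : (1 : ℝ) - 1 / p ^ 3 = (p ^ 3 - 1) / p ^ 3 := by field_simp
  have n9 : (1 : ℝ) - 1 / p ^ 4 = (p ^ 4 - 1) / p ^ 4 := by field_simp
  rw [n6, n7, n8, n9]
  field_simp
  ring

end P5e

section P5f

/-- correlations of the coefficients `lam` -/
noncomputable def Bm (q r : ℕ) : ℝ := Em (q * r) (fun n => lam q (n ^ 2 - 4) * lam r (n ^ 2 - 4))

lemma lam2_per {q r W : ℕ} (hq : q ∣ W) (hr : r ∣ W) : PerZ (fun n => lam q (n ^ 2 - 4) * lam r (n ^ 2 - 4)) W :=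
  PerZ.mul ((lam_per q).mono hq).sq4 ((lam_per r).mono hr).sq4

lemma Bm_eq {q r W : ℕ} (hq : q ∣ W) (hr : r ∣ W) (hW : 0 < W) :
    Em W (fun n => lam q (n ^ 2 - 4) * lam r (n ^ 2 - 4)) = Bm q r := by
  have hq0 : 0 < q := Nat.pos_of_dvd_of_pos hq hW
  have hr0 : 0 < r := Nat.pos_of_dvd_of_pos hr hW
  unfold Bm
  rw [← Em_dvd (lam2_per hq hr) (Dvd.intro (q * r) rfl) (by positivity),
    ← Em_dvd (W := W * (q * r)) (lam2_per (Dvd.intro r rfl) (Dvd.intro_left q rfl)) (Dvd.intro_left W rfl) (by positivity)]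

lemma Bm_comm (q r : ℕ) : Bm q r = Bm r q := by
  unfold Bm
  rw [mul_comm q r]
  exact Em_congr fun x => mul_comm _ _

lemma Bm_one : Bm 1 1 = 1 := by
  unfold Bm
  simp_rw [lam_one]
  simp [Em]

lemma Bm_zero_left (r : ℕ) : Bm 0 r = 0 := by simp [Bm, Em]

lemma Bm_even_left {q : ℕ} (r : ℕ) (h : ¬ Odd q) : Bm q r = 0 := by
  unfold Bm
  simp_rw [lam_even h, zero_mul]
  simp [Em]

lemma Bm_even_right (q : ℕ) {r : ℕ} (h : ¬ Odd r) : Bm q r = 0 := by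
  rw [Bm_comm, Bm_even_left q h]

lemma Bm_mul {q q' r r' : ℕ} (h : (q * q').Coprime (r * r')) (hq : 0 < q * q') (hr : 0 < r * r') :
    Bm (q * r) (q' * r') = Bm q q' * Bm r r' := by
  unfold Bm
  rw [← Em_crt hq hr h (lam2_per (Dvd.intro _ rfl) (Dvd.intro_left _ rfl)) (lam2_per (Dvd.intro _ rfl) (Dvd.intro_left _ rfl)),
    show q * r * (q' * r') = q * q' * (r * r') by ring]
  apply Em_congr
  intro x
  rw [lam_mul (Nat.Coprime.coprime_mul_right (Nat.Coprime.coprime_mul_right_right h)),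
    lam_mul (Nat.Coprime.coprime_mul_left (Nat.Coprime.coprime_mul_left_right h))]
  ring

variable {p : ℕ}

lemma Bm_one_p (hp : p.Prime) (h2 : p ≠ 2) : |Bm 1 p| = 1 / p := by
  have h : ∀ D : ℤ, lam p D = psi D p := by
    intro D
    rcases sq_cases D p with ⟨E, rfl⟩ | hD
    · rw [lam_p_sq hp h2, psi_div hp]
      exact Dvd.dvd.mul_right (dvd_pow_self _ (by norm_num)) _
    · have := lam_pp_nsq hp h2 1 hD
      rwa [pow_one, pow_one] at this
  unfold Bm
  simp_rw [lam_one, one_mul, h]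
  unfold Em
  rw [psi_sum_q hp h2, abs_div]
  simp

lemma Em_ind (hp : p.Prime) (h2 : p ≠ 2) {W : ℕ} (hW : 0 < W) (hpW : p ∣ W) (c : ℝ) :
    Em W (fun n => if (p : ℤ) ∣ n ^ 2 - 4 then c else 0) = 2 / p * c := by
  have hper : PerZ (fun D : ℤ => if (p : ℤ) ∣ D then c else 0) p := by
    intro a b hab
    have : (p : ℤ) ∣ a ↔ (p : ℤ) ∣ b := by
      constructor
      · intro h; simpa using dvd_sub h hab
      · intro h; simpa using dvd_add hab h
    simp only [this]
  have := hp.two_le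
  rw [Em_dvd hper.sq4 hpW hW]
  unfold Em
  rw [sum_Sq4 hp h2 (fun a => if (p : ℤ) ∣ (a : ℤ) ^ 2 - 4 then c else 0), Finset.sum_eq_zero, if_pos, if_pos]
  · ring
  · have : (((p - 2 : ℕ) : ℤ)) = p - 2 := by rw [Nat.cast_sub this]; rfl
    rw [this]
    exact ⟨p - 4, by ring⟩
  · norm_num
  · intro a ha
    rw [if_neg (Sq4_unit hp h2 ha)]

lemma Em_HK_sq (hp : p.Prime) (h2 : p ≠ 2) (K : ℕ) {W : ℕ} (hW : 0 < W) : Em W (fun n => HK p K (n ^ 2 - 4) ^ 2) ≤ 4 / (p : ℝ) ^ 2 := by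
  rw [← Em_const hW (4 / (p : ℝ) ^ 2)]
  apply Em_mono
  intro x
  have h1 := HK_bound hp h2 K (x ^ 2 - 4)
  have h0 := lam_abs_nonneg_sum (p := p) K (x ^ 2 - 4)
  calc _ ≤ (2 / (p : ℝ)) ^ 2 := by gcongr
    _ = _ := by ring

lemma Bm_abs_div (hp : p.Prime) {K i j : ℕ} (hi : i ≤ K) (hj : j ≤ K) : |Bm (p ^ i) (p ^ j)| / (p : ℝ) ^ (i + j) ≤
    Em (p ^ K) (fun n => (|lam (p ^ i) (n ^ 2 - 4)| / (p : ℝ) ^ i) * (|lam (p ^ j) (n ^ 2 - 4)| / (p : ℝ) ^ j)) := by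
  have hW : 0 < p ^ K := pow_pos hp.pos _
  have hp0 : 0 < (p : ℝ) := by exact_mod_cast hp.pos
  rw [← Bm_eq (pow_dvd_pow p hi) (pow_dvd_pow p hj) hW]
  have e : ∀ n : ℤ, (|lam (p ^ i) (n ^ 2 - 4)| / (p : ℝ) ^ i) * (|lam (p ^ j) (n ^ 2 - 4)| / (p : ℝ) ^ j) =
      ((p : ℝ) ^ (i + j))⁻¹ * |lam (p ^ i) (n ^ 2 - 4) * lam (p ^ j) (n ^ 2 - 4)| := by
    intro n; rw [abs_mul, pow_add]; field_simp
  simp_rw [e]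
  rw [Em_mul_left, div_eq_inv_mul]
  gcongr
  exact Em_abs_le _ _

lemma row_bound (hp : p.Prime) (h2 : p ≠ 2) (K : ℕ) :
    ∑ j ∈ Finset.range (K + 1), |Bm (p ^ 0) (p ^ (j + 1))| / (p : ℝ) ^ (0 + (j + 1)) ≤ 7 / (p : ℝ) ^ 2 := by
  have hp0 : 0 < (p : ℝ) := by exact_mod_cast hp.pos
  have hW : 0 < p ^ (K + 2) := pow_pos hp.pos _
  rw [Finset.sum_range_succ']
  have h1 : |Bm (p ^ 0) (p ^ (0 + 1))| / (p : ℝ) ^ (0 + (0 + 1)) = 1 / (p : ℝ) ^ 2 := by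
    simp only [pow_zero, zero_add, pow_one]
    rw [Bm_one_p hp h2]; field_simp
  have h3 : ∑ j ∈ Finset.range K, |Bm (p ^ 0) (p ^ (j + 1 + 1))| / (p : ℝ) ^ (0 + (j + 1 + 1)) ≤ 6 / (p : ℝ) ^ 2 := by
    calc _ ≤ ∑ j ∈ Finset.range K, Em (p ^ (K + 2)) (fun n => |lam (p ^ (j + 2)) (n ^ 2 - 4)| / (p : ℝ) ^ (j + 2)) := by
          apply Finset.sum_le_sum
          intro j hj
          rw [Finset.mem_range] at hj
          refine (Bm_abs_div hp (K := K + 2) (by omega) (by omega)).trans (le_of_eq ?_)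
          apply Em_congr
          intro x
          rw [pow_zero, pow_zero, lam_one]; simp
      _ = Em (p ^ (K + 2)) (fun n => ∑ j ∈ Finset.range K, |lam (p ^ (j + 2)) (n ^ 2 - 4)| / (p : ℝ) ^ (j + 2)) := (Em_sum _ _ _).symm
      _ ≤ Em (p ^ (K + 2)) (fun n => 2 / (p : ℝ) ^ 2 + if (p : ℤ) ∣ n ^ 2 - 4 then 2 / (p : ℝ) else 0) :=
          Em_mono fun x => tail2_bound hp h2 K _
      _ = 6 / (p : ℝ) ^ 2 := by
          rw [Em_add, Em_const hW, Em_ind hp h2 hW (dvd_pow_self _ (by omega))]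
          field_simp; norm_num
  rw [h1]
  have : 7 / (p : ℝ) ^ 2 = 6 / (p : ℝ) ^ 2 + 1 / (p : ℝ) ^ 2 := by ring
  linarith

lemma local_box_bound (hp : p.Prime) (h2 : p ≠ 2) (K : ℕ) :
    ∑ i ∈ Finset.range (K + 2), ∑ j ∈ Finset.range (K + 2), |Bm (p ^ i) (p ^ j)| / (p : ℝ) ^ (i + j) ≤ 1 + 18 / (p : ℝ) ^ 2 := by
  have hp0 : 0 < (p : ℝ) := by exact_mod_cast hp.pos
  have hW : 0 < p ^ (K + 1) := pow_pos hp.pos _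
  rw [Finset.sum_range_succ']
  have hA : ∑ j ∈ Finset.range (K + 2), |Bm (p ^ 0) (p ^ j)| / (p : ℝ) ^ (0 + j) ≤ 7 / (p : ℝ) ^ 2 + 1 := by
    rw [Finset.sum_range_succ']
    have := row_bound hp h2 K
    simp only [pow_zero, Bm_one] at this ⊢
    simp at this ⊢
    linarith
  have hB : ∑ i ∈ Finset.range (K + 1), ∑ j ∈ Finset.range (K + 2), |Bm (p ^ (i + 1)) (p ^ j)| / (p : ℝ) ^ (i + 1 + j) ≤ 11 / (p : ℝ) ^ 2 := by
    simp_rw [Finset.sum_range_succ' _ (K + 1)]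
    rw [Finset.sum_add_distrib]
    have h1 : ∑ i ∈ Finset.range (K + 1), |Bm (p ^ (i + 1)) (p ^ 0)| / (p : ℝ) ^ (i + 1 + 0) ≤ 7 / (p : ℝ) ^ 2 := by
      refine le_of_eq_of_le (Finset.sum_congr rfl fun i _ => ?_) (row_bound hp h2 K)
      rw [Bm_comm, zero_add, add_zero]
    have h3 : ∑ i ∈ Finset.range (K + 1), ∑ j ∈ Finset.range (K + 1), |Bm (p ^ (i + 1)) (p ^ (j + 1))| / (p : ℝ) ^ (i + 1 + (j + 1)) ≤ 4 / (p : ℝ) ^ 2 := by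
      refine le_trans ?_ (Em_HK_sq hp h2 (K + 1) hW)
      calc _ ≤ ∑ i ∈ Finset.range (K + 1), ∑ j ∈ Finset.range (K + 1), Em (p ^ (K + 1)) (fun n => (|lam (p ^ (i + 1)) (n ^ 2 - 4)| / (p : ℝ) ^ (i + 1)) * (|lam (p ^ (j + 1)) (n ^ 2 - 4)| / (p : ℝ) ^ (j + 1))) := by
            apply Finset.sum_le_sum
            intro i hi
            apply Finset.sum_le_sum
            intro j hj
            rw [Finset.mem_range] at hi hj
            exact Bm_abs_div hp (by omega) (by omega)
        _ = _ := by
            simp_rw [← Em_sum]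
            apply Em_congr
            intro x
            rw [HK, ← Finset.sum_mul_sum]; exact (sq _).symm
    have : 11 / (p : ℝ) ^ 2 = 7 / (p : ℝ) ^ 2 + 4 / (p : ℝ) ^ 2 := by ring
    linarith
  have : 18 / (p : ℝ) ^ 2 = 7 / (p : ℝ) ^ 2 + 11 / (p : ℝ) ^ 2 := by ring
  linarith

end P5f

section P5g

lemma pair_limit {b : ℕ × ℕ → ℝ} {wt : ℕ × ℕ → ℕ} {S Fib : ℕ → Finset (ℕ × ℕ)}
    (hsub : ∀ z, ∀ x ∈ S z, x ∈ Fib (wt x)) (heq : ∀ m z, m ≤ z → ∀ x ∈ Fib m, x ∈ S z ∧ wt x = m)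
    (hs : Summable fun m => ∑ x ∈ Fib m, |b x|) :
    Tendsto (fun z => ∑ x ∈ S z, b x) atTop (nhds (∑' m, ∑ x ∈ Fib m, b x)) := by
  have key : ∀ z, ∑ x ∈ S z, b x = ∑' m, ∑ x ∈ S z with wt x = m, b x := by
    intro z
    rw [tsum_eq_sum (s := (S z).image wt), Finset.sum_fiberwise_of_maps_to]
    · intro i hi; exact Finset.mem_image_of_mem _ hi
    · intro m hm
      apply Finset.sum_eq_zero
      intro x hx
      rw [Finset.mem_filter] at hx
      exact absurd (Finset.mem_image.2 ⟨x, hx.1, hx.2⟩) hm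
  simp_rw [key]
  apply tendsto_tsum_of_dominated_convergence hs
  · intro m
    apply tendsto_const_nhds.congr'
    filter_upwards [eventually_ge_atTop m] with z hz
    congr 1
    ext x
    rw [Finset.mem_filter]
    constructor
    · intro hx; exact heq m z hz x hx
    · rintro ⟨h1, rfl⟩; exact hsub z x h1
  · filter_upwards with z
    intro m
    rw [Real.norm_eq_abs]
    refine (Finset.abs_sum_le_sum_abs _ _).trans ?_
    apply Finset.sum_le_sum_of_subset_of_nonneg
    · intro x hx
      rw [Finset.mem_filter] at hx
      rw [← hx.2]; exact hsub z x hx.1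
    · intros; exact abs_nonneg _

/-- multiplicative convolution of a two variable function -/
noncomputable def cv (b : ℕ → ℕ → ℝ) (m : ℕ) : ℝ := ∑ d ∈ m.divisors, b d (m / d)

lemma cv_mul {b : ℕ → ℕ → ℝ} (hb : ∀ q q' r r' : ℕ, 0 < q * q' → 0 < r * r' → (q * q').Coprime (r * r') →
    b (q * r) (q' * r') = b q q' * b r r') {m n : ℕ} (h : m.Coprime n) : cv b (m * n) = cv b m * cv b n := by
  unfold cv
  rw [sum_divisors_coprime h (fun d => b d (m * n / d)), Finset.sum_mul_sum]
  apply Finset.sum_congr rfl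
  intro a ha
  apply Finset.sum_congr rfl
  intro c hc
  obtain ⟨⟨a', rfl⟩, ha0⟩ := Nat.mem_divisors.1 ha
  obtain ⟨⟨c', rfl⟩, hc0⟩ := Nat.mem_divisors.1 hc
  have h1 : 0 < a := Nat.pos_of_ne_zero (by rintro rfl; simp at ha0)
  have h2 : 0 < c := Nat.pos_of_ne_zero (by rintro rfl; simp at hc0)
  rw [Nat.mul_div_cancel_left _ h1, Nat.mul_div_cancel_left _ h2, show a * a' * (c * c') = a * c * (a' * c') by ring,
    Nat.mul_div_cancel_left _ (by positivity)]
  exact hb _ _ _ _ (Nat.pos_of_ne_zero ha0) (Nat.pos_of_ne_zero hc0) h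

lemma cv_pp (b : ℕ → ℕ → ℝ) {p : ℕ} (hp : p.Prime) (e : ℕ) : cv b (p ^ e) = ∑ x ∈ Finset.HasAntidiagonal.antidiagonal e, b (p ^ x.1) (p ^ x.2) := by
  unfold cv
  rw [Nat.sum_divisors_prime_pow hp, Finset.Nat.sum_antidiagonal_eq_sum_range_succ (fun i j => b (p ^ i) (p ^ j))]
  apply Finset.sum_congr rfl
  intro k hk
  rw [Nat.pow_div (by rw [Finset.mem_range] at hk; omega) hp.pos]

/-- normalised correlations -/
noncomputable def bm (q r : ℕ) : ℝ := Bm q r / (q * r)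

lemma bm_mul (q q' r r' : ℕ) (hq : 0 < q * q') (hr : 0 < r * r') (h : (q * q').Coprime (r * r')) :
    bm (q * r) (q' * r') = bm q q' * bm r r' := by
  unfold bm
  rw [Bm_mul h hq hr]
  push_cast
  rw [div_mul_div_comm]
  congr 1; ring

lemma bm_abs_mul (q q' r r' : ℕ) (hq : 0 < q * q') (hr : 0 < r * r') (h : (q * q').Coprime (r * r')) :
    |bm (q * r) (q' * r')| = |bm q q'| * |bm r r'| := by
  rw [bm_mul q q' r r' hq hr h, abs_mul]

lemma bm_pp {p : ℕ} (i j : ℕ) : bm (p ^ i) (p ^ j) = Bm (p ^ i) (p ^ j) / (p : ℝ) ^ (i + j) := by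
  unfold bm; push_cast; rw [pow_add]

lemma bm_pp_abs {p : ℕ} (i j : ℕ) : |bm (p ^ i) (p ^ j)| = |Bm (p ^ i) (p ^ j)| / (p : ℝ) ^ (i + j) := by
  rw [bm_pp, abs_div, abs_of_nonneg (by positivity : (0 : ℝ) ≤ (p : ℝ) ^ (i + j))]

lemma bm_two {i j : ℕ} (h : i + j ≠ 0) : bm (2 ^ i) (2 ^ j) = 0 := by
  rw [bm_pp]
  by_cases hi : i = 0
  · rw [Bm_even_right]; · simp
    rw [Nat.not_odd_iff_even]; exact even_two.pow_of_ne_zero (by omega)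
  · rw [Bm_even_left]; · simp
    rw [Nat.not_odd_iff_even]; exact even_two.pow_of_ne_zero (by omega)

lemma cv_two {b : ℕ → ℕ → ℝ} (hb : ∀ i j, i + j ≠ 0 → b (2 ^ i) (2 ^ j) = 0) {e : ℕ} (he : e ≠ 0) : cv b (2 ^ e) = 0 := by
  rw [cv_pp b Nat.prime_two]
  apply Finset.sum_eq_zero
  intro x hx
  rw [Finset.HasAntidiagonal.mem_antidiagonal] at hx
  exact hb _ _ (by omega)

lemma cvF_nonneg (m : ℕ) : 0 ≤ cv (fun q r => |bm q r|) m := Finset.sum_nonneg fun _ _ => abs_nonneg _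

lemma cv_one (b : ℕ → ℕ → ℝ) : cv b 1 = b 1 1 := by simp [cv]

lemma cv_zero (b : ℕ → ℕ → ℝ) : cv b 0 = 0 := by simp [cv]

lemma bm_one : bm 1 1 = 1 := by simp [bm, Bm_one]

lemma cvF_partial {p : ℕ} (hp : p.Prime) (K : ℕ) : ∑ e ∈ Finset.range K, cv (fun q r => |bm q r|) (p ^ e) ≤ 1 + 18 / (p : ℝ) ^ 2 := by
  by_cases h2 : p = 2
  · subst h2
    have : ∑ e ∈ Finset.range K, cv (fun q r => |bm q r|) (2 ^ e) ≤ 1 := by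
      rcases K with _ | K
      · simp
      · rw [Finset.sum_range_succ', Finset.sum_eq_zero]
        · rw [pow_zero, cv_one, bm_one]; simp
        · intro e _
          exact cv_two (fun i j h => by simp only [bm_two h, abs_zero]) (by omega)
    refine this.trans ?_
    have : (0 : ℝ) ≤ 18 / ((2 : ℕ) : ℝ) ^ 2 := by positivity
    linarith
  · have e1 : ∀ e, cv (fun q r => |bm q r|) (p ^ e) = ∑ k ∈ Finset.range (e + 1), |bm (p ^ k) (p ^ (e - k))| := by
      intro e
      rw [cv_pp _ hp, Finset.Nat.sum_antidiagonal_eq_sum_range_succ (fun i j => |bm (p ^ i) (p ^ j)|)]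
    simp_rw [e1]
    rw [Finset.sum_range_diag_flip K (fun i j => |bm (p ^ i) (p ^ j)|)]
    refine le_trans ?_ (local_box_bound hp h2 K)
    simp_rw [bm_pp_abs]
    calc _ ≤ ∑ i ∈ Finset.range K, ∑ j ∈ Finset.range (K + 2), |Bm (p ^ i) (p ^ j)| / (p : ℝ) ^ (i + j) := by
          apply Finset.sum_le_sum
          intro i _
          apply Finset.sum_le_sum_of_subset_of_nonneg
          · apply Finset.range_mono; show K - i ≤ K + 2; omega
          · intros; positivity
      _ ≤ _ := by
          apply Finset.sum_le_sum_of_subset_of_nonneg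
          · apply Finset.range_mono; show K ≤ K + 2; omega
          · intros; apply Finset.sum_nonneg; intros; positivity

lemma cvF_summable_pp {p : ℕ} (hp : p.Prime) : Summable fun e => cv (fun q r => |bm q r|) (p ^ e) :=
  summable_of_sum_range_le (fun _ => cvF_nonneg _) (cvF_partial hp)

lemma mult_summable {f : ℕ → ℝ} (h0 : ∀ m, 0 ≤ f m) (hz : f 0 = 0) (h1 : f 1 = 1)
    (hm : ∀ {m n : ℕ}, m.Coprime n → f (m * n) = f m * f n)
    (hp : ∀ {p : ℕ}, p.Prime → ∀ K : ℕ, ∑ e ∈ Finset.range K, f (p ^ e) ≤ 1 + 18 / (p : ℝ) ^ 2) : Summable f := by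
  have hs : Summable fun n : ℕ => 1 / (n : ℝ) ^ 2 := Real.summable_one_div_nat_pow.2 (by norm_num)
  apply summable_of_sum_range_le h0 (c := Real.exp (18 * ∑' n : ℕ, 1 / (n : ℝ) ^ 2))
  intro N
  have h := (EulerProduct.summable_and_hasSum_smoothNumbers_prod_primesBelow_tsum (f := f)
    h1 hm (fun hp' => (summable_of_sum_range_le (fun _ => h0 _) (hp hp')).norm) N).2
  have h' := hasSum_subtype_iff_indicator.1 h
  have h3 := sum_le_hasSum (Finset.range N) (fun i _ => Set.indicator_nonneg (fun m _ => h0 m) i) h'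
  have h4 : ∑ m ∈ Finset.range N, f m = ∑ m ∈ Finset.range N, (Nat.smoothNumbers N).indicator f m := by
    apply Finset.sum_congr rfl
    intro m hm
    rw [Finset.mem_range] at hm
    rcases Nat.eq_zero_or_pos m with rfl | hm0
    · simp only [Set.indicator_apply, hz, ite_self]
    · rw [Set.indicator_of_mem (Nat.mem_smoothNumbers_of_lt hm0 hm)]
  rw [h4]
  refine h3.trans ?_
  calc _ ≤ ∏ p ∈ N.primesBelow, Real.exp (18 * (1 / (p : ℝ) ^ 2)) := by
        apply Finset.prod_le_prod
        · intro p _; exact tsum_nonneg fun _ => h0 _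
        · intro p hp1
          have hp' := Nat.prime_of_mem_primesBelow hp1
          refine (Real.tsum_le_of_sum_range_le (fun _ => h0 _) (hp hp')).trans ?_
          have := Real.add_one_le_exp (18 * (1 / (p : ℝ) ^ 2))
          calc _ = 18 * (1 / (p : ℝ) ^ 2) + 1 := by ring
            _ ≤ _ := this
    _ = Real.exp (18 * ∑ p ∈ N.primesBelow, 1 / (p : ℝ) ^ 2) := by
        rw [← Real.exp_sum, Finset.mul_sum]
    _ ≤ _ := by
        apply Real.exp_le_exp.2
        gcongr
        exact hs.sum_le_tsum _ (fun _ _ => by positivity)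

lemma cvF_summable : Summable (cv (fun q r => |bm q r|)) :=
  mult_summable cvF_nonneg (cv_zero _) (by rw [cv_one, bm_one]; simp) (fun h => cv_mul bm_abs_mul h) cvF_partial

lemma cv_abs_le (m : ℕ) : |cv bm m| ≤ cv (fun q r => |bm q r|) m := Finset.abs_sum_le_sum_abs _ _

lemma cv_summable : Summable (cv bm) := Summable.of_norm_bounded cvF_summable cv_abs_le

lemma cv_hasProd : HasProd (fun p : Nat.Primes => ∑' e : ℕ, cv bm ((p : ℕ) ^ e)) (∑' n, cv bm n) :=
  EulerProduct.eulerProduct_hasProd (by rw [cv_one, bm_one]) (fun h => cv_mul bm_mul h) cv_summable.norm (cv_zero _)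

lemma cv_divAnti (b : ℕ → ℕ → ℝ) (m : ℕ) : ∑ x ∈ m.divisorsAntidiagonal, b x.1 x.2 = cv b m := by
  rw [Nat.sum_divisorsAntidiagonal b]; rfl

lemma global_limit : Tendsto (fun z => ∑ q ∈ Finset.range (z + 1), ∑ r ∈ Finset.range (z + 1), bm q r) atTop (nhds (∑' m, cv bm m)) := by
  have h := pair_limit (b := fun x => bm x.1 x.2) (wt := fun x => x.1 * x.2) (S := fun z => Finset.Ioc 0 z ×ˢ Finset.Ioc 0 z)
    (Fib := Nat.divisorsAntidiagonal) ?_ ?_ ?_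
  · simp_rw [cv_divAnti] at h
    refine h.congr ?_
    intro z
    rw [Finset.sum_product]
    have e : Finset.range (z + 1) = insert 0 (Finset.Ioc 0 z) := by ext x; rw [Finset.mem_insert, Finset.mem_range, Finset.mem_Ioc]; omega
    have h0 : ∀ r, bm 0 r = 0 := by intro r; simp [bm]
    have h0' : ∀ r, bm r 0 = 0 := by intro r; simp [bm]
    rw [e, Finset.sum_insert (by simp), Finset.sum_eq_zero (fun r _ => h0 r), zero_add]
    apply Finset.sum_congr rfl
    intro q _
    rw [Finset.sum_insert (by simp), h0', zero_add]
  · intro z x hx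
    simp only [Finset.mem_product, Finset.mem_Ioc] at hx
    rw [Nat.mem_divisorsAntidiagonal]
    exact ⟨rfl, (mul_pos hx.1.1 hx.2.1).ne'⟩
  · intro m z hmz x hx
    have hx' := Nat.mem_divisorsAntidiagonal.1 hx
    refine ⟨?_, hx'.1⟩
    have h1 : x.1 ≠ 0 := by intro h; rw [h] at hx'; simp at hx'; omega
    have h2 : x.2 ≠ 0 := by intro h; rw [h] at hx'; simp at hx'; omega
    simp only [Finset.mem_product, Finset.mem_Ioc]
    have h3 := Nat.le_mul_of_pos_right x.1 (Nat.pos_of_ne_zero h2)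
    have h4 := Nat.le_mul_of_pos_left x.2 (Nat.pos_of_ne_zero h1)
    omega
  · simp_rw [cv_divAnti (fun q r => |bm q r|)]
    exact cvF_summable

lemma box_GK {p : ℕ} (hp : p.Prime) (K : ℕ) : ∑ x ∈ Finset.range (K + 1) ×ˢ Finset.range (K + 1), bm (p ^ x.1) (p ^ x.2) =
    Em (p ^ K) (fun n => GK p K (n ^ 2 - 4) ^ 2) := by
  have hW : 0 < p ^ K := pow_pos hp.pos _
  rw [Finset.sum_product]
  have e : ∀ i ∈ Finset.range (K + 1), ∀ j ∈ Finset.range (K + 1), bm (p ^ i) (p ^ j) = Em (p ^ K) (fun n =>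
      (lam (p ^ i) (n ^ 2 - 4) / (p : ℝ) ^ i) * (lam (p ^ j) (n ^ 2 - 4) / (p : ℝ) ^ j)) := by
    intro i hi j hj
    rw [Finset.mem_range] at hi hj
    rw [bm_pp, ← Bm_eq (pow_dvd_pow p (by omega : i ≤ K)) (pow_dvd_pow p (by omega : j ≤ K)) hW, div_eq_inv_mul, ← Em_mul_left]
    apply Em_congr
    intro n
    have hp0 : (p : ℝ) ≠ 0 := by exact_mod_cast hp.ne_zero
    rw [pow_add]; field_simp
  rw [Finset.sum_congr rfl fun i hi => Finset.sum_congr rfl fun j hj => e i hi j hj]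
  simp_rw [← Em_sum]
  apply Em_congr
  intro x
  rw [GK, ← Finset.sum_mul_sum]; exact (sq _).symm

lemma local_factor {p : ℕ} (hp : p.Prime) (h2 : p ≠ 2) :
    ∑' e : ℕ, cv bm (p ^ e) = 1 + ((p : ℝ) ^ 4 - 2 * (p : ℝ) ^ 3 + 1) / ((p : ℝ) ^ 2 - 1) ^ 3 := by
  have h := pair_limit (b := fun x => bm (p ^ x.1) (p ^ x.2)) (wt := fun x => x.1 + x.2)
    (S := fun z => Finset.range (z + 1) ×ˢ Finset.range (z + 1))
    (Fib := Finset.HasAntidiagonal.antidiagonal) ?_ ?_ ?_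
  · simp_rw [← cv_pp bm hp, box_GK hp] at h
    have h3 := h.comp (tendsto_id.const_mul_atTop' (by norm_num : 0 < 2) : Tendsto (fun j : ℕ => 2 * j) atTop atTop)
    exact tendsto_nhds_unique h3 (local_limit hp h2)
  · intro z x hx
    rw [Finset.HasAntidiagonal.mem_antidiagonal]
  · intro m z hmz x hx
    rw [Finset.HasAntidiagonal.mem_antidiagonal] at hx
    simp only [Finset.mem_product, Finset.mem_range]
    omega
  · simp_rw [← cv_pp (fun q r => |bm q r|) hp]
    exact cvF_summable_pp hp

lemma factor_two : ∑' e : ℕ, cv bm (2 ^ e) = 1 := by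
  rw [tsum_eq_single 0]
  · rw [pow_zero, cv_one, bm_one]
  · intro e he
    exact cv_two (fun i j h => bm_two h) he

theorem odd_hasProd : HasProd (fun p : {p : ℕ // p.Prime ∧ p ≠ 2} =>
    (1 + ((p.1 : ℝ) ^ 4 - 2 * (p.1 : ℝ) ^ 3 + 1) / ((p.1 : ℝ) ^ 2 - 1) ^ 3)) (∑' m, cv bm m) := by
  let i : {p : ℕ // p.Prime ∧ p ≠ 2} → Nat.Primes := fun p => ⟨p.1, p.2.1⟩
  have hi : Function.Injective i := by
    intro a b h
    exact Subtype.ext (congrArg (fun x : Nat.Primes => (x : ℕ)) h)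
  have h := (hi.hasProd_iff (f := fun p : Nat.Primes => ∑' e : ℕ, cv bm ((p : ℕ) ^ e)) (a := ∑' m, cv bm m) ?_).2 cv_hasProd
  · have e : (fun p : {p : ℕ // p.Prime ∧ p ≠ 2} => (1 + ((p.1 : ℝ) ^ 4 - 2 * (p.1 : ℝ) ^ 3 + 1) / ((p.1 : ℝ) ^ 2 - 1) ^ 3)) =
        (fun p : Nat.Primes => ∑' e : ℕ, cv bm ((p : ℕ) ^ e)) ∘ i := by
      funext p
      exact (local_factor p.2.1 p.2.2).symm
    rw [e]; exact h
  · intro x hx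
    have : (x : ℕ) = 2 := by
      by_contra hne
      exact hx ⟨⟨x.1, x.2, hne⟩, rfl⟩
    rw [this]; exact factor_two

theorem odd_limit : ∃ P : ℝ, 1 ≤ P ∧ kappa = 1015 / 864 * P ∧
    Tendsto (fun z => ∑ q ∈ Finset.range (z + 1), ∑ r ∈ Finset.range (z + 1), bm q r) atTop (nhds P) := by
  refine ⟨_, ?_, ?_, global_limit⟩
  · refine ge_of_tendsto' odd_hasProd ?_
    intro s
    apply Finset.prod_induction _ (fun x : ℝ => 1 ≤ x) (fun a b ha hb => one_le_mul_of_one_le_of_one_le ha hb) le_rfl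
    rintro ⟨p, hp, h2⟩ _
    have h3 : 3 ≤ p := by have := hp.two_le; omega
    have h3 : (3 : ℝ) ≤ p := by exact_mod_cast h3
    have : 0 ≤ ((p : ℝ) ^ 4 - 2 * (p : ℝ) ^ 3 + 1) / ((p : ℝ) ^ 2 - 1) ^ 3 := by
      apply div_nonneg
      · have : (p : ℝ) ^ 4 - 2 * (p : ℝ) ^ 3 = (p : ℝ) ^ 3 * (p - 2) := by ring
        rw [this]
        have : 0 ≤ (p : ℝ) ^ 3 * (p - 2) := mul_nonneg (by positivity) (by linarith)
        linarith
      · apply pow_nonneg; nlinarith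
    show 1 ≤ 1 + _
    linarith
  · rw [kappa, odd_hasProd.tprod_eq]

end P5g

section P5h

/-- the 2-adic factor on integers -/
noncomputable def Yz : ℕ → ℤ → ℝ
  | 0, _ => 0
  | J + 1, D => if D % 4 = 0 then 1 + Yz J (D / 4) / 2 else if D % 8 = 1 then 2 else if D % 8 = 5 then 2 / 3 else 0

lemma Yz_cast (J D : ℕ) : Yz J (D : ℤ) = Ytr J D := by
  induction J generalizing D with
  | zero => rfl
  | succ J ih =>
    have h4 : (D : ℤ) % 4 = 0 ↔ D % 4 = 0 := by omega
    have h1 : (D : ℤ) % 8 = 1 ↔ D % 8 = 1 := by omega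
    have h5 : (D : ℤ) % 8 = 5 ↔ D % 8 = 5 := by omega
    have hd : (D : ℤ) / 4 = ((D / 4 : ℕ) : ℤ) := by omega
    simp only [Yz, Ytr, h4, h1, h5, hd, ih]

lemma Yz_per (J : ℕ) : PerZ (Yz J) (2 ^ (2 * J + 1)) := by
  induction J with
  | zero => intro a b _; rfl
  | succ J ih =>
    intro a b hab
    have hk : ((2 ^ (2 * (J + 1) + 1) : ℕ) : ℤ) = 4 * ((2 ^ (2 * J + 1) : ℕ) : ℤ) := by push_cast; ring
    have hk8 : ((2 ^ (2 * (J + 1) + 1) : ℕ) : ℤ) = 8 * 2 ^ (2 * J) := by push_cast; ring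
    have h8 : (8 : ℤ) ∣ a - b := by
      refine dvd_trans ?_ hab; rw [hk8]; exact Dvd.intro _ rfl
    have hm8 : a % 8 = b % 8 := by omega
    have hm4 : a % 4 = b % 4 := by omega
    simp only [Yz, hm8, hm4]
    split_ifs with h4
    · rw [ih (a / 4) (b / 4)]
      rw [hk] at hab
      obtain ⟨c, hc⟩ := hab
      refine ⟨c, ?_⟩
      have : 4 * (a / 4 - b / 4) = 4 * (((2 ^ (2 * J + 1) : ℕ) : ℤ) * c) := by
        rw [← mul_assoc, ← hc]; omega
      linarith
    all_goals rfl

lemma Yz_bd (J : ℕ) (D : ℤ) : 0 ≤ Yz J D ∧ Yz J D ≤ 2 := by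
  induction J generalizing D with
  | zero => simp [Yz]
  | succ J ih =>
    have := ih (D / 4)
    simp only [Yz]
    split_ifs <;> constructor <;> first | linarith [this.1, this.2] | norm_num

lemma Yz_diff (J : ℕ) (D : ℤ) : |Yz (J + 1) D - Yz J D| ≤ 2 / 2 ^ J := by
  induction J generalizing D with
  | zero =>
    have := Yz_bd 1 D
    rw [show Yz 0 D = 0 from rfl, abs_le]
    constructor <;> norm_num <;> linarith
  | succ J ih =>
    have h := ih (D / 4)
    rw [Yz, Yz.eq_2 D J]
    split_ifs
    · rw [show 1 + Yz (J + 1) (D / 4) / 2 - (1 + Yz J (D / 4) / 2) = (Yz (J + 1) (D / 4) - Yz J (D / 4)) / 2 by ring, abs_div,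
        abs_of_pos (by norm_num : (0 : ℝ) < 2), pow_succ, div_mul_eq_div_div]
      linarith
    all_goals (rw [sub_self, abs_zero]; positivity)

lemma Yz_four (J : ℕ) (k : ℤ) : Yz (J + 1) (4 * k) = 1 + Yz J k / 2 := by
  rw [Yz, if_pos (by omega), Int.mul_ediv_cancel_left _ (by norm_num)]

lemma Em_two (m : ℕ) (x y : ℝ) : Em (2 ^ (m + 1)) (fun k => if k % 2 = 0 then x else y) = (x + y) / 2 := by
  have h : PerZ (fun k : ℤ => if k % 2 = 0 then x else y) 2 := by
    intro a b hab
    have : a % 2 = b % 2 := by have : (2 : ℤ) ∣ a - b := hab; omega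
    simp only [this]
  rw [Em_dvd h (Dvd.intro_left (2 ^ m) (pow_succ 2 m).symm) (by positivity)]
  unfold Em
  rw [Finset.sum_range_succ, Finset.sum_range_one]
  norm_num

lemma N_rec (J : ℕ) (φ : ℝ → ℝ) : Em (2 ^ (2 * (J + 1) + 1)) (fun D => φ (Yz (J + 1) D)) =
    (Em (2 ^ (2 * J + 1)) (fun D => φ (1 + Yz J D / 2)) + (φ 2 + φ (2 / 3)) / 2 + 2 * φ 0) / 4 := by
  have hpos : 0 < 2 ^ (2 * J + 1) := by positivity
  rw [show 2 ^ (2 * (J + 1) + 1) = 4 * 2 ^ (2 * J + 1) by ring, Em_split]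
  simp only [Finset.sum_range_succ, Finset.sum_range_zero, zero_add]
  have h0 : Em (2 ^ (2 * J + 1)) (fun k => φ (Yz (J + 1) (((0 : ℕ) : ℤ) + ((4 : ℕ) : ℤ) * k))) = Em (2 ^ (2 * J + 1)) (fun D => φ (1 + Yz J D / 2)) := by
    apply Em_congr; intro k
    rw [← Yz_four]; congr 2; push_cast; ring
  have h1 : Em (2 ^ (2 * J + 1)) (fun k => φ (Yz (J + 1) (((1 : ℕ) : ℤ) + ((4 : ℕ) : ℤ) * k))) = (φ 2 + φ (2 / 3)) / 2 := by
    rw [← Em_two (2 * J)]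
    apply Em_congr; intro k
    push_cast
    rw [Yz, if_neg (by omega)]
    split_ifs <;> first | rfl | omega
  have h2 : Em (2 ^ (2 * J + 1)) (fun k => φ (Yz (J + 1) (((2 : ℕ) : ℤ) + ((4 : ℕ) : ℤ) * k))) = φ 0 := by
    rw [← Em_const hpos (φ 0)]
    apply Em_congr; intro k
    push_cast
    rw [Yz, if_neg (by omega), if_neg (by omega), if_neg (by omega)]
  have h3 : Em (2 ^ (2 * J + 1)) (fun k => φ (Yz (J + 1) (((3 : ℕ) : ℤ) + ((4 : ℕ) : ℤ) * k))) = φ 0 := by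
    rw [← Em_const hpos (φ 0)]
    apply Em_congr; intro k
    push_cast
    rw [Yz, if_neg (by omega), if_neg (by omega), if_neg (by omega)]
  rw [h0, h1, h2, h3]
  push_cast; ring

lemma M_rec (J : ℕ) (φ : ℝ → ℝ) : Em (2 ^ (2 * (J + 1))) (fun k => φ (Yz (J + 1) (2 * k))) =
    (Em (2 ^ (2 * J + 1)) (fun D => φ (1 + Yz J D / 2)) + φ 0) / 2 := by
  have hpos : 0 < 2 ^ (2 * J + 1) := by positivity
  rw [show 2 ^ (2 * (J + 1)) = 2 * 2 ^ (2 * J + 1) by ring, Em_split]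
  simp only [Finset.sum_range_succ, Finset.sum_range_zero, zero_add]
  have h0 : Em (2 ^ (2 * J + 1)) (fun k => φ (Yz (J + 1) (2 * (((0 : ℕ) : ℤ) + ((2 : ℕ) : ℤ) * k)))) = Em (2 ^ (2 * J + 1)) (fun D => φ (1 + Yz J D / 2)) := by
    apply Em_congr; intro k
    rw [← Yz_four]; congr 2; push_cast; ring
  have h1 : Em (2 ^ (2 * J + 1)) (fun k => φ (Yz (J + 1) (2 * (((1 : ℕ) : ℤ) + ((2 : ℕ) : ℤ) * k)))) = φ 0 := by
    rw [← Em_const hpos (φ 0)]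
    apply Em_congr; intro k
    push_cast
    rw [Yz, if_neg (by omega), if_neg (by omega), if_neg (by omega)]
  rw [h0, h1]; push_cast; ring

lemma Y_quad (J : ℕ) (ψ : ℝ → ℝ) : Em (2 ^ (2 * J + 3)) (fun k => ψ (Yz J (k * (k + 1)))) = Em (2 ^ (2 * J)) (fun k => ψ (Yz J (2 * k))) := by
  have hF0 : PerZ (fun k => ψ (Yz J (2 * k))) (2 ^ (2 * J)) := by
    have h := (Yz_per J).comp ψ
    rw [pow_succ'] at h
    exact h.scale (p := 2)
  have hF : PerZ (fun k => ψ (Yz J (2 * k))) (2 ^ (2 * J + 2)) := hF0.mono (pow_dvd_pow 2 (by omega))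
  rw [show 2 ^ (2 * J + 3) = 2 * 2 ^ (2 * J + 2) by ring, Em_split]
  simp only [Finset.sum_range_succ, Finset.sum_range_zero, zero_add]
  rw [← Em_dvd hF0 (pow_dvd_pow 2 (by omega : 2 * J ≤ 2 * J + 2)) (by positivity)]
  have h0 := Em_quad Nat.prime_two (m := 2 * J + 2) (c := 1) (by norm_num) hF
  have h1 := Em_quad Nat.prime_two (m := 2 * J + 2) (c := -1) (by norm_num) hF
  have e0 : Em (2 ^ (2 * J + 2)) (fun k => ψ (Yz J ((((0 : ℕ) : ℤ) + ((2 : ℕ) : ℤ) * k) * (((0 : ℕ) : ℤ) + ((2 : ℕ) : ℤ) * k + 1)))) =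
      Em (2 ^ (2 * J + 2)) (fun k => ψ (Yz J (2 * k))) := by
    rw [← h0]
    apply Em_congr; intro k
    congr 2; push_cast; ring
  have e1 : Em (2 ^ (2 * J + 2)) (fun k => ψ (Yz J ((((1 : ℕ) : ℤ) + ((2 : ℕ) : ℤ) * k) * (((1 : ℕ) : ℤ) + ((2 : ℕ) : ℤ) * k + 1)))) =
      Em (2 ^ (2 * J + 2)) (fun k => ψ (Yz J (2 * k))) := by
    rw [← h1]
    rw [← Em_shift (W := 2 ^ (2 * J + 2)) (by positivity) (F := fun k => ψ (Yz J (2 * (k * (((2 : ℕ) : ℤ) * k + -1))))) ?_ 1]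
    · apply Em_congr; intro k
      congr 2; push_cast; ring
    · intro a b hab
      apply hF
      have : a * (((2 : ℕ) : ℤ) * a + -1) - b * (((2 : ℕ) : ℤ) * b + -1) = (a - b) * (2 * (a + b) - 1) := by push_cast; ring
      rw [this]
      exact Dvd.dvd.mul_right hab _
  rw [e0, e1]; push_cast; ring

lemma T_rec (J : ℕ) (φ : ℝ → ℝ) : Em (2 ^ (2 * (J + 2) + 1)) (fun n => φ (Yz (J + 2) (n ^ 2 - 4))) =
    (φ 1 + 2 * φ (2 / 3) + Em (2 ^ (2 * J)) (fun k => φ (3 / 2 + Yz J (2 * k) / 4))) / 4 := by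
  have hpos : 0 < 2 ^ (2 * J + 3) := by positivity
  rw [show 2 ^ (2 * (J + 2) + 1) = 4 * 2 ^ (2 * J + 3) by ring, Em_split]
  simp only [Finset.sum_range_succ, Finset.sum_range_zero, zero_add]
  have h0 : Em (2 ^ (2 * J + 3)) (fun k => φ (Yz (J + 2) ((((0 : ℕ) : ℤ) + ((4 : ℕ) : ℤ) * k) ^ 2 - 4))) = φ 1 := by
    rw [← Em_const hpos (φ 1)]
    apply Em_congr; intro k
    have : (((0 : ℕ) : ℤ) + ((4 : ℕ) : ℤ) * k) ^ 2 - 4 = 4 * (4 * (k ^ 2) - 1) := by push_cast; ring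
    rw [this, Yz_four, Yz, if_neg (by omega), if_neg (by omega), if_neg (by omega)]
    norm_num
  have h2 : Em (2 ^ (2 * J + 3)) (fun k => φ (Yz (J + 2) ((((2 : ℕ) : ℤ) + ((4 : ℕ) : ℤ) * k) ^ 2 - 4))) =
      Em (2 ^ (2 * J)) (fun k => φ (3 / 2 + Yz J (2 * k) / 4)) := by
    rw [← Y_quad J (fun y => φ (3 / 2 + y / 4))]
    apply Em_congr; intro k
    have : (((2 : ℕ) : ℤ) + ((4 : ℕ) : ℤ) * k) ^ 2 - 4 = 4 * (4 * (k * (k + 1))) := by push_cast; ring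
    rw [this, Yz_four, Yz_four]
    congr 1; ring
  have h1 : Em (2 ^ (2 * J + 3)) (fun k => φ (Yz (J + 2) ((((1 : ℕ) : ℤ) + ((4 : ℕ) : ℤ) * k) ^ 2 - 4))) = φ (2 / 3) := by
    rw [← Em_const hpos (φ (2 / 3))]
    apply Em_congr; intro k
    have : (((1 : ℕ) : ℤ) + ((4 : ℕ) : ℤ) * k) ^ 2 - 4 = 8 * (2 * k ^ 2 + k - 1) + 5 := by push_cast; ring
    rw [this, Yz, if_neg (by omega), if_neg (by omega), if_pos (by omega)]
  have h3 : Em (2 ^ (2 * J + 3)) (fun k => φ (Yz (J + 2) ((((3 : ℕ) : ℤ) + ((4 : ℕ) : ℤ) * k) ^ 2 - 4))) = φ (2 / 3) := by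
    rw [← Em_const hpos (φ (2 / 3))]
    apply Em_congr; intro k
    have : (((3 : ℕ) : ℤ) + ((4 : ℕ) : ℤ) * k) ^ 2 - 4 = 8 * (2 * k ^ 2 + 3 * k) + 5 := by push_cast; ring
    rw [this, Yz, if_neg (by omega), if_neg (by omega), if_pos (by omega)]
  rw [h0, h1, h2, h3]
  push_cast; ring

lemma two_pow_tend (c : ℝ) : Tendsto (fun J : ℕ => c / 2 ^ J) atTop (nhds 0) := by
  have := (tendsto_pow_atTop_nhds_zero_of_lt_one (by norm_num : (0 : ℝ) ≤ 1 / 2) (by norm_num)).const_mul c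
  rw [mul_zero] at this
  refine this.congr fun J => ?_
  rw [one_div, inv_pow]; rfl

lemma N_diff {φ : ℝ → ℝ} {c : ℝ} (hφ : ∀ x y, 0 ≤ x → x ≤ 2 → 0 ≤ y → y ≤ 2 → |φ x - φ y| ≤ c * |x - y|) (hc : 0 ≤ c) :
    Tendsto (fun J => Em (2 ^ (2 * (J + 1) + 1)) (fun D => φ (Yz (J + 1) D)) - Em (2 ^ (2 * J + 1)) (fun D => φ (Yz J D))) atTop (nhds 0) := by
  apply squeeze_zero_norm _ (two_pow_tend (c * 2))
  intro J
  rw [Real.norm_eq_abs, ← Em_dvd ((Yz_per J).comp φ) (pow_dvd_pow 2 (by omega : 2 * J + 1 ≤ 2 * (J + 1) + 1)) (by positivity)]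
  apply Em_diff_bound (by positivity)
  intro x
  refine (hφ _ _ (Yz_bd _ _).1 (Yz_bd _ _).2 (Yz_bd _ _).1 (Yz_bd _ _).2).trans ?_
  rw [mul_div_assoc]
  exact mul_le_mul_of_nonneg_left (Yz_diff J x) hc

lemma N1_lim : Tendsto (fun J => Em (2 ^ (2 * J + 1)) (fun D => Yz J D)) atTop (nhds (2 / 3)) := by
  have h := rec_limit (m := fun J => Em (2 ^ (2 * J + 1)) (fun D => Yz J D)) (c := fun _ => 7 / 12) (c' := 7 / 12) (r := 1 / 8)
    (by norm_num) ?_ tendsto_const_nhds ?_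
  · norm_num at h; exact h
  · intro J
    have := N_rec J (fun x => x)
    rw [Em_add, Em_const (by positivity)] at this
    simp_rw [div_eq_inv_mul] at this
    rw [Em_mul_left] at this
    simp only [this]
    ring
  · exact N_diff (φ := fun x => x) (c := 1) (fun x y _ _ _ _ => (one_mul _).ge) zero_le_one

lemma N_sq (J : ℕ) : Em (2 ^ (2 * J + 1)) (fun D => (1 + Yz J D / 2) ^ 2) =
    1 + Em (2 ^ (2 * J + 1)) (fun D => Yz J D) + Em (2 ^ (2 * J + 1)) (fun D => Yz J D ^ 2) / 4 := by
  rw [Em_congr (H := fun D => (1 + Yz J D) + (1 / 4) * Yz J D ^ 2) (fun x => by ring), Em_add, Em_add, Em_const (by positivity), Em_mul_left]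
  ring

lemma N2_lim : Tendsto (fun J => Em (2 ^ (2 * J + 1)) (fun D => Yz J D ^ 2)) atTop (nhds (28 / 27)) := by
  have hd := N_diff (φ := fun x => x ^ 2) (c := 4) (by
    intro x y hx hx2 hy hy2
    show |x ^ 2 - y ^ 2| ≤ 4 * |x - y|
    rw [show x ^ 2 - y ^ 2 = (x + y) * (x - y) by ring, abs_mul, abs_of_nonneg (by linarith : 0 ≤ x + y)]
    gcongr; linarith) (by norm_num)
  have hc : Tendsto (fun J => 29 / 36 + 1 / 4 * Em (2 ^ (2 * J + 1)) (fun D => Yz J D)) atTop (nhds (29 / 36 + 1 / 4 * (2 / 3))) :=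
    tendsto_const_nhds.add (N1_lim.const_mul (1 / 4))
  have h := rec_limit (m := fun J => Em (2 ^ (2 * J + 1)) (fun D => Yz J D ^ 2))
    (c := fun J => 29 / 36 + 1 / 4 * Em (2 ^ (2 * J + 1)) (fun D => Yz J D)) (c' := 29 / 36 + 1 / 4 * (2 / 3)) (r := 1 / 16)
    (by norm_num) ?_ hc hd
  · norm_num at h; exact h
  · intro J
    have := N_rec J (fun x => x ^ 2)
    rw [N_sq] at this
    simp only [this]
    ring

theorem two_limit : Tendsto (fun J => Em (2 ^ (2 * J + 1)) (fun n => Yz J (n ^ 2 - 4) ^ 2)) atTop (nhds (1015 / 864)) := by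
  rw [← tendsto_add_atTop_iff_nat 3]
  have h1 : Tendsto (fun J => Em (2 ^ (2 * (J + 1))) (fun k => Yz (J + 1) (2 * k))) atTop (nhds (2 / 3)) := by
    have e : ∀ J, Em (2 ^ (2 * (J + 1))) (fun k => Yz (J + 1) (2 * k)) = 1 / 2 + 1 / 4 * Em (2 ^ (2 * J + 1)) (fun D => Yz J D) := by
      intro J
      have := M_rec J (fun x => x)
      rw [Em_add, Em_const (by positivity)] at this
      simp_rw [div_eq_inv_mul] at this
      rw [Em_mul_left] at this
      rw [this]; ring
    simp_rw [e]
    have := (tendsto_const_nhds (x := (1 / 2 : ℝ))).add (N1_lim.const_mul (1 / 4))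
    norm_num at this ⊢; exact this
  have h2 : Tendsto (fun J => Em (2 ^ (2 * (J + 1))) (fun k => Yz (J + 1) (2 * k) ^ 2)) atTop (nhds (26 / 27)) := by
    have e : ∀ J, Em (2 ^ (2 * (J + 1))) (fun k => Yz (J + 1) (2 * k) ^ 2) = 1 / 2 + 1 / 2 * Em (2 ^ (2 * J + 1)) (fun D => Yz J D)
        + 1 / 8 * Em (2 ^ (2 * J + 1)) (fun D => Yz J D ^ 2) := by
      intro J
      have := M_rec J (fun x => x ^ 2)
      rw [N_sq] at this
      rw [this]; ring
    simp_rw [e]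
    have := ((tendsto_const_nhds (x := (1 / 2 : ℝ))).add (N1_lim.const_mul (1 / 2))).add (N2_lim.const_mul (1 / 8))
    norm_num at this ⊢; exact this
  have e : ∀ J, Em (2 ^ (2 * (J + 3) + 1)) (fun n => Yz (J + 3) (n ^ 2 - 4) ^ 2) = 149 / 144
      + 3 / 16 * Em (2 ^ (2 * (J + 1))) (fun k => Yz (J + 1) (2 * k)) + 1 / 64 * Em (2 ^ (2 * (J + 1))) (fun k => Yz (J + 1) (2 * k) ^ 2) := by
    intro J
    have := T_rec (J + 1) (fun x => x ^ 2)
    rw [Em_congr (F := fun k => (3 / 2 + Yz (J + 1) (2 * k) / 4) ^ 2) (H := fun k => (9 / 4 + (3 / 4) * Yz (J + 1) (2 * k)) + (1 / 16) * Yz (J + 1) (2 * k) ^ 2) (fun x => by ring), Em_add, Em_add,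
      Em_const (by positivity), Em_mul_left, Em_mul_left] at this
    rw [show J + 3 = J + 1 + 2 by ring, this]
    ring
  simp_rw [e]
  have := ((tendsto_const_nhds (x := (149 / 144 : ℝ))).add (h1.const_mul (3 / 16))).add (h2.const_mul (1 / 64))
  norm_num at this ⊢; exact this

end P5h

section P6

/-- admissible weights -/
structure WtOK (G : ℕ → ℝ) (X : ℕ) (V : ℝ) : Prop where
  low : ∀ n < 3, G n = 0
  high : ∀ n, X ≤ n → G n = 0
  nonneg : ∀ n, 0 ≤ G n
  le : ∀ n, G n ≤ V
  tv : ∑ n ∈ Finset.range X, |G (n + 1) - G n| ≤ V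

variable {G : ℕ → ℝ} {X : ℕ} {V : ℝ}

lemma abel_wt (F : ℕ → ℝ) (G : ℕ → ℝ) (X : ℕ) : ∑ n ∈ Finset.range X, F n * G n =
    (∑ n ∈ Finset.range X, F n) * G X - ∑ n ∈ Finset.range X, (∑ i ∈ Finset.range (n + 1), F i) * (G (n + 1) - G n) := by
  induction X with
  | zero => simp
  | succ X ih =>
    rw [Finset.sum_range_succ, ih, Finset.sum_range_succ _ X]
    rw [Finset.sum_range_succ (fun n => (∑ i ∈ Finset.range (n + 1), F i) * (G (n + 1) - G n)) X, Finset.sum_range_succ F X]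
    ring

lemma WtOK.V_nonneg (h : WtOK G X V) : 0 ≤ V := (h.nonneg 0).trans (h.le 0)

lemma per_weight (h : WtOK G X V) {F : ℤ → ℝ} {W : ℕ} {B : ℝ} (hW : 0 < W) (hF : PerZ F W) (hB : ∀ n, |F n| ≤ B) :
    |∑ n ∈ Finset.range X, F n * G n - Em W F * ∑ n ∈ Finset.range X, G n| ≤ 2 * W * B * V := by
  have hp : Function.Periodic (fun n : ℕ => F n) W := by
    intro n
    apply hF
    push_cast; simp
  have happ : ∀ x : ℕ, |∑ n ∈ Finset.range x, (F n - Em W F)| ≤ 2 * W * B := by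
    intro x
    have := periodic_sum_approx hW hp (fun n => hB n) x
    rw [Finset.sum_sub_distrib, Finset.sum_const, Finset.card_range, nsmul_eq_mul]
    refine le_of_eq_of_le ?_ this
    congr 2
    unfold Em; ring
  have hB0 : 0 ≤ 2 * W * B := (abs_nonneg _).trans (happ 0)
  have e : ∑ n ∈ Finset.range X, F n * G n - Em W F * ∑ n ∈ Finset.range X, G n = ∑ n ∈ Finset.range X, (F n - Em W F) * G n := by
    rw [Finset.mul_sum, ← Finset.sum_sub_distrib]
    exact Finset.sum_congr rfl fun n _ => by ring
  rw [e, abel_wt, h.high X le_rfl, mul_zero, zero_sub, abs_neg]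
  refine (Finset.abs_sum_le_sum_abs _ _).trans ?_
  calc _ ≤ ∑ n ∈ Finset.range X, 2 * W * B * |G (n + 1) - G n| := by
        apply Finset.sum_le_sum
        intro n _
        rw [abs_mul]
        exact mul_le_mul_of_nonneg_right (happ _) (abs_nonneg _)
    _ = 2 * W * B * ∑ n ∈ Finset.range X, |G (n + 1) - G n| := by rw [Finset.mul_sum]
    _ ≤ _ := mul_le_mul_of_nonneg_left h.tv hB0

/-- the box sum of normalised correlations -/
noncomputable def Sz (z : ℕ) : ℝ := ∑ q ∈ Finset.range (z + 1), ∑ r ∈ Finset.range (z + 1), bm q r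

lemma pair_weight (h : WtOK G X V) {U : ℤ → ℝ} {m : ℕ} (hU : PerZ U (2 ^ m)) (hU4 : ∀ n, |U n| ≤ 4) {z q r : ℕ} (hq : q ≤ z) (hr : r ≤ z) :
    |∑ n ∈ Finset.range X, (U n * (lam q ((n : ℤ) ^ 2 - 4) / q * (lam r ((n : ℤ) ^ 2 - 4) / r))) * G n - Em (2 ^ m) U * bm q r * ∑ n ∈ Finset.range X, G n|
      ≤ 8 * 2 ^ m * (z + 1) ^ 2 * V := by
  have hV := h.V_nonneg
  by_cases ho : Odd q ∧ Odd r
  · have hq0 : 0 < q := ho.1.pos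
    have hr0 : 0 < r := ho.2.pos
    have hco : (2 ^ m).Coprime (q * r) := by
      apply Nat.Coprime.pow_left
      rw [Nat.coprime_two_left]
      exact ho.1.mul ho.2
    have h1 := lam2_per (q := q) (r := r) (W := q * r) (Dvd.intro _ rfl) (Dvd.intro_left _ rfl)
    have hper : PerZ (fun n => U n * (lam q (n ^ 2 - 4) * lam r (n ^ 2 - 4))) (2 ^ m * (q * r)) :=
      (hU.mono (Dvd.intro _ rfl)).mul (h1.mono (Dvd.intro_left _ rfl))
    have hb : ∀ n : ℤ, |U n * (lam q (n ^ 2 - 4) * lam r (n ^ 2 - 4))| ≤ 4 * (q * r) := by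
      intro n
      rw [abs_mul, abs_mul]
      have := lam_bound q (n ^ 2 - 4)
      have := lam_bound r (n ^ 2 - 4)
      have := hU4 n
      gcongr
    have key := per_weight h (by positivity) hper hb
    rw [Em_crt (by positivity) (by positivity) hco hU h1] at key
    have hq1 : (0 : ℝ) < q := by exact_mod_cast hq0
    have hr1 : (0 : ℝ) < r := by exact_mod_cast hr0
    have e : ∑ n ∈ Finset.range X, (U n * (lam q ((n : ℤ) ^ 2 - 4) / q * (lam r ((n : ℤ) ^ 2 - 4) / r))) * G n - Em (2 ^ m) U * bm q r * ∑ n ∈ Finset.range X, G n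
        = (1 / (q * r)) * (∑ n ∈ Finset.range X, (U n * (lam q ((n : ℤ) ^ 2 - 4) * lam r ((n : ℤ) ^ 2 - 4))) * G n - Em (2 ^ m) U * Bm q r * ∑ n ∈ Finset.range X, G n) := by
      rw [mul_sub]
      congr 1
      · rw [Finset.mul_sum]; apply Finset.sum_congr rfl; intro n _; field_simp
      · unfold bm; field_simp
    rw [e, abs_mul, abs_of_pos (by positivity)]
    have hqz : (q : ℝ) ≤ z + 1 := by exact_mod_cast hq.trans (Nat.le_succ z)
    have hrz : (r : ℝ) ≤ z + 1 := by exact_mod_cast hr.trans (Nat.le_succ z)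
    calc _ ≤ (1 / ((q : ℝ) * r)) * (2 * ((2 ^ m * (q * r) : ℕ) : ℝ) * (4 * (q * r)) * V) :=
          mul_le_mul_of_nonneg_left key (by positivity)
      _ = 8 * 2 ^ m * (q * r) * V := by push_cast; field_simp; ring
      _ ≤ 8 * 2 ^ m * ((z + 1) * (z + 1)) * V := by gcongr
      _ = _ := by ring
  · have h0 : ∀ D, lam q D * lam r D = 0 := by
      intro D
      by_cases hq1 : Odd q
      · rw [lam_even (q := r) (by tauto), mul_zero]
      · rw [lam_even hq1, zero_mul]
    have hb0 : bm q r = 0 := by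
      unfold bm
      by_cases hq1 : Odd q
      · rw [Bm_even_right _ (by tauto), zero_div]
      · rw [Bm_even_left _ hq1, zero_div]
    rw [hb0, Finset.sum_eq_zero]
    · simp; positivity
    · intro n _
      rw [div_mul_div_comm, h0]; simp

lemma Pz_weight (h : WtOK G X V) {U : ℤ → ℝ} {m : ℕ} (hU : PerZ U (2 ^ m)) (hU4 : ∀ n, |U n| ≤ 4) (z : ℕ) :
    |∑ n ∈ Finset.range X, U n * Pz z n ^ 2 * G n - Em (2 ^ m) U * Sz z * ∑ n ∈ Finset.range X, G n| ≤ 8 * 2 ^ m * (z + 1) ^ 4 * V := by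
  have e1 : ∑ n ∈ Finset.range X, U n * Pz z n ^ 2 * G n = ∑ q ∈ Finset.range (z + 1), ∑ r ∈ Finset.range (z + 1),
      ∑ n ∈ Finset.range X, (U n * (lam q ((n : ℤ) ^ 2 - 4) / q * (lam r ((n : ℤ) ^ 2 - 4) / r))) * G n := by
    simp_rw [Finset.sum_comm (s := Finset.range (z + 1)) (t := Finset.range X)]
    apply Finset.sum_congr rfl
    intro n _
    by_cases hn : n < 3
    · rw [h.low n hn]; simp
    · rw [Pz_eq (by omega), sq, Finset.sum_mul_sum, Finset.mul_sum, Finset.sum_mul]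
      apply Finset.sum_congr rfl; intro q _
      rw [Finset.mul_sum, Finset.sum_mul]
  have e2 : Em (2 ^ m) U * Sz z * ∑ n ∈ Finset.range X, G n = ∑ q ∈ Finset.range (z + 1), ∑ r ∈ Finset.range (z + 1),
      Em (2 ^ m) U * bm q r * ∑ n ∈ Finset.range X, G n := by
    generalize ∑ n ∈ Finset.range X, G n = S
    rw [Sz, Finset.mul_sum, Finset.sum_mul]
    apply Finset.sum_congr rfl; intro q _
    rw [Finset.mul_sum, Finset.sum_mul]
  rw [e1, e2]
  simp_rw [← Finset.sum_sub_distrib]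
  refine (Finset.abs_sum_le_sum_abs _ _).trans ?_
  calc _ ≤ ∑ q ∈ Finset.range (z + 1), ∑ r ∈ Finset.range (z + 1), 8 * 2 ^ m * ((z : ℝ) + 1) ^ 2 * V := by
        apply Finset.sum_le_sum; intro q hq
        refine (Finset.abs_sum_le_sum_abs _ _).trans ?_
        apply Finset.sum_le_sum; intro r hr
        rw [Finset.mem_range] at hq hr
        exact pair_weight h hU hU4 (by omega) (by omega)
    _ = _ := by
        simp only [Finset.sum_const, Finset.card_range, nsmul_eq_mul]
        push_cast; ring

lemma fin_bound (h : WtOK G X V) {C : ℝ} {t : ℕ} (ht : 1 ≤ t) (hX : X = t ^ 2000)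
    (hL : ∑ n ∈ Finset.Icc 3 (t ^ 2000), |Aodd n ^ 2 - Pz (t ^ 440) n ^ 2| ≤ C * t ^ 1994) (J : ℕ) :
    |∑ n ∈ Finset.range X, ampA n ^ 2 * G n - Em (2 ^ (2 * J + 1)) (fun n => Yz J (n ^ 2 - 4) ^ 2) * Sz (t ^ 440) * ∑ n ∈ Finset.range X, G n|
      ≤ 8 / 2 ^ J * (Sz (t ^ 440) * ∑ n ∈ Finset.range X, G n)
        + (64 * ((t : ℝ) ^ 440 + 1) ^ 4 + 12 * C * t ^ 1994 + 8 * 2 ^ (2 * J + 1) * ((t : ℝ) ^ 440 + 1) ^ 4) * V := by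
  have hV := h.V_nonneg
  have hC : 0 ≤ C * t ^ 1994 := (Finset.sum_nonneg fun _ _ => abs_nonneg _).trans hL
  set z := t ^ 440 with hz
  have hzc : ((z : ℕ) : ℝ) = (t : ℝ) ^ 440 := by rw [hz]; push_cast; rfl
  -- L1 step
  have hL1 : ∀ U : ℕ → ℝ, ∀ M : ℝ, (∀ n, |U n| ≤ M) →
      |∑ n ∈ Finset.range X, U n * Aodd n ^ 2 * G n - ∑ n ∈ Finset.range X, U n * Pz z n ^ 2 * G n| ≤ M * (C * t ^ 1994) * V := by
    intro U M hU
    have hM : 0 ≤ M := (abs_nonneg _).trans (hU 0)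
    rw [← Finset.sum_sub_distrib]
    refine (Finset.abs_sum_le_sum_abs _ _).trans ?_
    calc _ ≤ ∑ n ∈ Finset.range X with 3 ≤ n, M * |Aodd n ^ 2 - Pz z n ^ 2| * V := by
          rw [Finset.sum_filter]
          apply Finset.sum_le_sum; intro n _
          split_ifs with hn
          · rw [show U n * Aodd n ^ 2 * G n - U n * Pz z n ^ 2 * G n = U n * (Aodd n ^ 2 - Pz z n ^ 2) * G n by ring, abs_mul, abs_mul,
              abs_of_nonneg (h.nonneg n)]
            have := hU n
            have := h.le n
            have := h.nonneg n
            gcongr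
          · rw [h.low n (by omega)]; simp
      _ ≤ ∑ n ∈ Finset.Icc 3 (t ^ 2000), M * |Aodd n ^ 2 - Pz z n ^ 2| * V := by
          apply Finset.sum_le_sum_of_subset_of_nonneg
          · intro n hn
            rw [Finset.mem_filter, Finset.mem_range] at hn
            rw [Finset.mem_Icc, ← hX]; omega
          · intros; positivity
      _ = M * (∑ n ∈ Finset.Icc 3 (t ^ 2000), |Aodd n ^ 2 - Pz z n ^ 2|) * V := by
          rw [Finset.mul_sum, Finset.sum_mul]
      _ ≤ _ := by gcongr
  -- second moment of Aodd
  have h2 : ∑ n ∈ Finset.range X, Aodd n ^ 2 * G n ≤ Sz z * ∑ n ∈ Finset.range X, G n + 8 * (z + 1) ^ 4 * V + C * t ^ 1994 * V := by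
    have a := hL1 (fun _ => 1) 1 (by simp)
    have b := Pz_weight h (U := fun _ => 1) (m := 0) (fun _ _ _ => rfl) (by intro; norm_num) z
    rw [Em_const (by norm_num)] at b
    have a' := (abs_le.1 a).2
    have b' := (abs_le.1 b).2
    simp only [one_mul, pow_zero, mul_one] at a' b'
    linarith
  -- Y truncation
  set Y : ℕ → ℝ := fun n => Yz J ((n : ℤ) ^ 2 - 4) with hY
  have hYb : ∀ n, 0 ≤ Y n ∧ Y n ≤ 2 := fun n => Yz_bd _ _
  have h3 : |∑ n ∈ Finset.range X, ampA n ^ 2 * G n - ∑ n ∈ Finset.range X, Y n ^ 2 * Aodd n ^ 2 * G n| ≤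
      8 / 2 ^ J * ∑ n ∈ Finset.range X, Aodd n ^ 2 * G n := by
    rw [← Finset.sum_sub_distrib, Finset.mul_sum]
    refine (Finset.abs_sum_le_sum_abs _ _).trans ?_
    apply Finset.sum_le_sum; intro n _
    by_cases hn : n < 3
    · rw [h.low n hn]; simp
    · have hn9 : 9 ≤ n ^ 2 := by nlinarith
      have hYe : Y n = Ytr J (n ^ 2 - 4) := by
        rw [hY, ← Yz_cast]
        show Yz J _ = Yz J _
        congr 1
        rw [Nat.cast_sub (by omega)]; push_cast; ring
      rw [ampA_eq (J := J + n) (by omega) (by omega), hYe]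
      have d := Ytr_diff J n (n ^ 2 - 4)
      have y1 := Ytr_nonneg (J + n) (n ^ 2 - 4)
      have y2 := Ytr_nonneg J (n ^ 2 - 4)
      rw [show ∀ a b c d : ℝ, (a * c) ^ 2 * d - b ^ 2 * c ^ 2 * d = (a - b) * (a + b) * (c ^ 2 * d) by intros; ring, abs_mul, abs_mul,
        abs_of_nonneg (mul_nonneg (sq_nonneg (Aodd n)) (h.nonneg n))]
      apply mul_le_mul_of_nonneg_right _ (mul_nonneg (sq_nonneg (Aodd n)) (h.nonneg n))
      calc _ ≤ 2 / 2 ^ J * (4 : ℝ) := by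
            gcongr
            rw [abs_le]; constructor <;> linarith [y1.1, y1.2, y2.1, y2.2]
        _ = _ := by ring
  have h4 := hL1 (fun n => Y n ^ 2) 4 (by
    intro n
    rw [abs_of_nonneg (sq_nonneg _)]
    nlinarith [(hYb n).1, (hYb n).2])
  have h5 := Pz_weight h (U := fun n => Yz J (n ^ 2 - 4) ^ 2) (m := 2 * J + 1) (((Yz_per J).comp (fun x => x ^ 2)).sq4) (by
    intro n
    rw [abs_of_nonneg (sq_nonneg _)]
    have := Yz_bd J (n ^ 2 - 4)
    nlinarith [this.1, this.2]) z
  have h6 : 8 / 2 ^ J * ∑ n ∈ Finset.range X, Aodd n ^ 2 * G n ≤ 8 / 2 ^ J * (Sz z * ∑ n ∈ Finset.range X, G n) + 8 * (8 * (z + 1) ^ 4 * V + C * t ^ 1994 * V) := by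
    calc _ ≤ 8 / 2 ^ J * (Sz z * ∑ n ∈ Finset.range X, G n + 8 * (z + 1) ^ 4 * V + C * t ^ 1994 * V) :=
          mul_le_mul_of_nonneg_left h2 (by positivity)
      _ = 8 / 2 ^ J * (Sz z * ∑ n ∈ Finset.range X, G n) + 8 / 2 ^ J * (8 * (z + 1) ^ 4 * V + C * t ^ 1994 * V) := by ring
      _ ≤ _ := by
          gcongr
          exact div_le_self (by norm_num) (one_le_pow₀ (by norm_num))
  rw [hzc] at *
  rw [abs_le] at *
  constructor
  · linarith [h3.1, h4.1, h5.1]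
  · linarith [h3.2, h4.2, h5.2]

theorem weighted_main : 0 < kappa ∧ ∀ ε > 0, ∃ C' : ℝ, 0 < C' ∧ ∃ t0 : ℕ, ∀ t ≥ t0, ∀ (G : ℕ → ℝ) (V : ℝ), WtOK G (t ^ 2000) V →
    |∑ n ∈ Finset.range (t ^ 2000), ampA n ^ 2 * G n - kappa * ∑ n ∈ Finset.range (t ^ 2000), G n| ≤
      ε * ∑ n ∈ Finset.range (t ^ 2000), G n + C' * t ^ 1994 * V := by
  obtain ⟨P, hP1, hk, hlim⟩ := odd_limit
  obtain ⟨C, hC, hL⟩ := L1_approx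
  refine ⟨by rw [hk]; linarith, ?_⟩
  intro ε hε
  set E : ℕ → ℝ := fun J => Em (2 ^ (2 * J + 1)) (fun n => Yz J (n ^ 2 - 4) ^ 2) with hE
  have e1 : ∀ᶠ J in atTop, |E J * P - kappa| < ε / 3 := by
    have : Tendsto (fun J => E J * P) atTop (nhds kappa) := by
      rw [hk]; exact two_limit.mul_const P
    exact (Metric.tendsto_nhds.1 this) (ε / 3) (by positivity)
  have e2 : ∀ᶠ J : ℕ in atTop, (8 / 2 ^ J) * (P + 1) < ε / 3 := by
    have := (two_pow_tend 8).mul_const (P + 1)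
    rw [zero_mul] at this
    exact this.eventually (gt_mem_nhds (by positivity))
  obtain ⟨J, hJ1, hJ2⟩ := (e1.and e2).exists
  have e3 : Tendsto (fun t : ℕ => Sz (t ^ 440)) atTop (nhds P) := hlim.comp (tendsto_pow_atTop (by norm_num))
  have hδ : 0 < min 1 (ε / (3 * (|E J| + 1))) := by positivity
  obtain ⟨t0, ht0⟩ := eventually_atTop.1 ((Metric.tendsto_nhds.1 e3) _ hδ)
  refine ⟨1024 + 12 * C + 128 * 2 ^ (2 * J + 1), by positivity, max t0 1, ?_⟩
  intro t ht G V h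
  have ht1 : 1 ≤ t := (le_max_right _ _).trans ht
  have ht1' : (1 : ℝ) ≤ t := by exact_mod_cast ht1
  have hV := h.V_nonneg
  have hS := ht0 t ((le_max_left _ _).trans ht)
  rw [Real.dist_eq] at hS
  have hS1 := hS.trans_le (min_le_left _ _)
  have hS2 := hS.trans_le (min_le_right _ _)
  have main := fin_bound h ht1 rfl (hL t ht1) J
  have hG : 0 ≤ ∑ n ∈ Finset.range (t ^ 2000), G n := Finset.sum_nonneg fun n _ => h.nonneg n
  generalize (∑ n ∈ Finset.range (t ^ 2000), G n) = SG at *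
  generalize (∑ n ∈ Finset.range (t ^ 2000), ampA n ^ 2 * G n) = SA at *
  have hpow : ((t : ℝ) ^ 440 + 1) ^ 4 ≤ 16 * t ^ 1994 := by
    have h1 : (1 : ℝ) ≤ t ^ 440 := one_le_pow₀ ht1'
    calc ((t : ℝ) ^ 440 + 1) ^ 4 ≤ ((t : ℝ) ^ 440 + (t : ℝ) ^ 440) ^ 4 := by gcongr
      _ = 16 * (t : ℝ) ^ 1760 := by rw [← two_mul, mul_pow, ← pow_mul]; norm_num
      _ ≤ _ := by gcongr <;> norm_num [ht1']
  generalize Sz (t ^ 440) = Z at *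
  have a1 : |E J * Z * SG - kappa * SG| ≤ (2 * ε / 3) * SG := by
    rw [← sub_mul, abs_mul, abs_of_nonneg hG]
    apply mul_le_mul_of_nonneg_right _ hG
    have : |E J * (Z - P)| ≤ ε / 3 := by
      rw [abs_mul]
      calc _ ≤ (|E J| + 1) * (ε / (3 * (|E J| + 1))) := by gcongr; linarith
        _ = _ := by field_simp
    calc _ = |E J * (Z - P) + (E J * P - kappa)| := by congr 1; ring
      _ ≤ _ := abs_add_le _ _
      _ ≤ _ := by linarith
  have a2 : 8 / 2 ^ J * (Z * SG) ≤ ε / 3 * SG := by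
    rw [← mul_assoc]
    apply mul_le_mul_of_nonneg_right _ hG
    refine le_trans ?_ hJ2.le
    gcongr
    linarith [(abs_lt.1 hS1).2]
  have a3 : (64 * ((t : ℝ) ^ 440 + 1) ^ 4 + 12 * C * t ^ 1994 + 8 * 2 ^ (2 * J + 1) * ((t : ℝ) ^ 440 + 1) ^ 4) * V ≤
      (1024 + 12 * C + 128 * 2 ^ (2 * J + 1)) * t ^ 1994 * V := by
    apply mul_le_mul_of_nonneg_right _ hV
    calc _ ≤ 64 * (16 * (t : ℝ) ^ 1994) + 12 * C * t ^ 1994 + 8 * 2 ^ (2 * J + 1) * (16 * (t : ℝ) ^ 1994) := by gcongr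
      _ = _ := by ring
  calc _ = |(SA - E J * Z * SG) + (E J * Z * SG - kappa * SG)| := by
        congr 1; ring
    _ ≤ _ := abs_add_le _ _
    _ ≤ _ := by linarith

end P6

section P7a

/-- properties of the squared window -/
structure HOK (h : ℝ → ℝ) (M K : ℝ) : Prop where
  cont : Continuous h
  nonneg : ∀ u, 0 ≤ h u
  le : ∀ u, h u ≤ M
  lip : ∀ u v, |h u - h v| ≤ K * |u - v|
  zero : ∀ u, 1 ≤ u → h u = 0

/-- the normalised lengths -/
noncomputable def Un (a : ℝ) (n : ℕ) : ℝ := Real.arcosh ((n : ℝ) / 2) / a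

lemma half_ge {n : ℕ} (hn : 2 ≤ n) : (1 : ℝ) ≤ (n : ℝ) / 2 := by
  have : (2 : ℝ) ≤ n := by exact_mod_cast hn
  linarith

lemma Un_two (a : ℝ) : Un a 2 = 0 := by simp [Un]

lemma Un_mono {a : ℝ} (ha : 0 < a) {m n : ℕ} (hm : 2 ≤ m) (hmn : m ≤ n) : Un a m ≤ Un a n := by
  unfold Un
  have h1 := half_ge hm
  have h2 := half_ge (hm.trans hmn)
  have h3 : (m : ℝ) ≤ n := by exact_mod_cast hmn
  rw [div_le_div_iff_of_pos_right ha, Real.arcosh_le_arcosh (by linarith) (by linarith)]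
  linarith

lemma Un_nonneg {a : ℝ} (ha : 0 < a) {n : ℕ} (hn : 2 ≤ n) : 0 ≤ Un a n := by
  have := Un_mono ha le_rfl hn
  rwa [Un_two] at this

lemma cosh_Un {a : ℝ} (ha : 0 < a) {n : ℕ} (hn : 2 ≤ n) : 2 * Real.cosh (a * Un a n) = n := by
  unfold Un
  rw [mul_div_cancel₀ _ ha.ne', Real.cosh_arcosh (half_ge hn)]
  ring

lemma Un_ge_one {a : ℝ} (ha : 0 < a) {n : ℕ} (hn : 2 * Real.cosh a ≤ n) : 1 ≤ Un a n := by
  unfold Un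
  rw [le_div_iff₀ ha, one_mul, ← Real.arcosh_cosh ha.le]
  have := Real.one_le_cosh a
  rw [Real.arcosh_le_arcosh (by linarith) (by linarith)]
  linarith

variable {h : ℝ → ℝ} {M K a : ℝ} {X : ℕ}

lemma HOK.K_nonneg (H : HOK h M K) : 0 ≤ K := by
  have := H.lip 1 0
  simp at this
  exact (abs_nonneg _).trans this

lemma HOK.min_eq (H : HOK h M K) (u : ℝ) : h (min u 1) = h u := by
  rcases le_total u 1 with h1 | h1
  · rw [min_eq_left h1]
  · rw [min_eq_right h1, H.zero u h1, H.zero 1 le_rfl]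

lemma HOK.lip' (H : HOK h M K) {u v w : ℝ} (huv : u ≤ v) (hvw : v ≤ w) : |h v - h u| ≤ K * (min w 1 - min u 1) := by
  rw [← H.min_eq u, ← H.min_eq v]
  refine (H.lip _ _).trans ?_
  have h1 : min u 1 ≤ min v 1 := min_le_min_right _ huv
  have h2 : min v 1 ≤ min w 1 := min_le_min_right _ hvw
  rw [abs_of_nonneg (by linarith)]
  exact mul_le_mul_of_nonneg_left (by linarith) H.K_nonneg

/-- the weight -/
noncomputable def Gw (h : ℝ → ℝ) (a : ℝ) (n : ℕ) : ℝ := if 2 < n then h (Un a n) else 0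

lemma tele_min (ha : 0 < a) (hX : 2 ≤ X) : ∑ n ∈ Finset.Ico 2 X, (min (Un a (n + 1)) 1 - min (Un a n) 1) ≤ 1 := by
  rw [Finset.sum_Ico_sub (fun n => min (Un a n) 1) hX, Un_two]
  simp

lemma wt_ok (H : HOK h M K) (ha : 0 < a) (hX : 2 * Real.cosh a ≤ X) : WtOK (Gw h a) X (M + K) := by
  have hK := H.K_nonneg
  have hM : 0 ≤ M := (H.nonneg 0).trans (H.le 0)
  have hX2 : 2 ≤ X := by
    have := Real.one_le_cosh a
    have : (2 : ℝ) ≤ X := by linarith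
    exact_mod_cast this
  refine ⟨?_, ?_, ?_, ?_, ?_⟩
  · intro n hn
    rw [Gw, if_neg (by omega)]
  · intro n hn
    rw [Gw]
    split_ifs
    · apply H.zero
      apply Un_ge_one ha
      have : (X : ℝ) ≤ n := by exact_mod_cast hn
      linarith
    · rfl
  · intro n
    rw [Gw]; split_ifs
    · exact H.nonneg _
    · exact le_rfl
  · intro n
    rw [Gw]; split_ifs
    · linarith [H.le (Un a n)]
    · linarith
  · have e : ∀ n ∈ Finset.range X, |Gw h a (n + 1) - Gw h a n| ≤ (if n = 2 then M else 0) +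
        (if 2 ≤ n then K * (min (Un a (n + 1)) 1 - min (Un a n) 1) else 0) := by
      intro n _
      rcases lt_trichotomy n 2 with h2 | h2 | h2
      · rw [Gw, Gw, if_neg (by omega), if_neg (by omega), if_neg (by omega), if_neg (by omega)]; simp
      · rw [Gw, Gw, if_pos (by omega), if_neg (by omega), if_pos h2, if_pos (by omega), sub_zero, abs_of_nonneg (H.nonneg _)]
        have := Un_mono ha (m := n) (n := n + 1) (by omega) (by omega)
        have : min (Un a n) 1 ≤ min (Un a (n + 1)) 1 := min_le_min_right _ this
        have := mul_nonneg hK (sub_nonneg.2 this)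
        linarith [H.le (Un a (n + 1))]
      · rw [Gw, Gw, if_pos (by omega), if_pos (by omega), if_neg (by omega), if_pos (by omega), zero_add]
        exact H.lip' (Un_mono ha (by omega) (by omega)) le_rfl
    refine (Finset.sum_le_sum e).trans ?_
    rw [Finset.sum_add_distrib]
    apply add_le_add
    · rw [Finset.sum_ite_eq']; split_ifs <;> linarith
    · rw [← Finset.sum_filter]
      have : (Finset.range X).filter (fun n => 2 ≤ n) = Finset.Ico 2 X := by
        ext n; simp; omega
      rw [this, ← Finset.mul_sum]
      calc _ ≤ K * 1 := mul_le_mul_of_nonneg_left (tele_min ha hX2) hK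
        _ = K := mul_one K

lemma W_int (a u v : ℝ) : ∫ x in u..v, 2 * a * Real.sinh (a * x) = 2 * Real.cosh (a * v) - 2 * Real.cosh (a * u) := by
  rw [intervalIntegral.integral_eq_sub_of_hasDerivAt (f := fun x => 2 * Real.cosh (a * x))]
  · intro x _
    have h1 : HasDerivAt (fun x => a * x) a x := by simpa using (hasDerivAt_id x).const_mul a
    have := (h1.cosh).const_mul 2
    rw [show 2 * a * Real.sinh (a * x) = 2 * (Real.sinh (a * x) * a) by ring]
    exact this
  · apply Continuous.intervalIntegrable
    fun_prop

lemma cell (H : HOK h M K) (ha : 0 < a) {n : ℕ} (hn : 2 ≤ n) :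
    |h (Un a n) - ∫ x in Un a n..Un a (n + 1), h x * (2 * a * Real.sinh (a * x))| ≤ K * (min (Un a (n + 1)) 1 - min (Un a n) 1) := by
  have hc := H.cont
  have hm := Un_mono ha hn (Nat.le_succ n)
  have h1 : ∫ x in Un a n..Un a (n + 1), 2 * a * Real.sinh (a * x) = 1 := by
    rw [W_int, cosh_Un ha hn, cosh_Un ha (by omega)]; push_cast; ring
  have e : h (Un a n) - ∫ x in Un a n..Un a (n + 1), h x * (2 * a * Real.sinh (a * x)) =
      - ∫ x in Un a n..Un a (n + 1), (h x - h (Un a n)) * (2 * a * Real.sinh (a * x)) := by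
    simp_rw [sub_mul]
    rw [intervalIntegral.integral_sub, intervalIntegral.integral_const_mul, h1]
    · ring
    · apply Continuous.intervalIntegrable; fun_prop
    · apply Continuous.intervalIntegrable; fun_prop
  rw [e, abs_neg, ← Real.norm_eq_abs]
  refine (intervalIntegral.norm_integral_le_of_norm_le (g := fun x => K * (min (Un a (n + 1)) 1 - min (Un a n) 1) * (2 * a * Real.sinh (a * x))) hm ?_ ?_).trans ?_
  · refine Eventually.of_forall fun x hx => ?_
    have h0 : 0 ≤ Real.sinh (a * x) := Real.sinh_nonneg_iff.2 (mul_nonneg ha.le ((Un_nonneg ha hn).trans hx.1.le))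
    rw [Real.norm_eq_abs, abs_mul, abs_of_nonneg (a := 2 * a * _) (by positivity)]
    exact mul_le_mul_of_nonneg_right (H.lip' hx.1.le hx.2) (by positivity)
  · apply Continuous.intervalIntegrable; fun_prop
  · rw [intervalIntegral.integral_const_mul, h1, mul_one]

lemma wt_sum (H : HOK h M K) (ha : 0 < a) (hX : 2 * Real.cosh a ≤ X) :
    |∑ n ∈ Finset.range X, Gw h a n - a * ∫ x in (0 : ℝ)..1, h x * Real.exp (a * x)| ≤ K + M + a * M := by
  have hc := H.cont
  have hK := H.K_nonneg
  have hM : 0 ≤ M := (H.nonneg 0).trans (H.le 0)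
  have hX2 : 2 ≤ X := by
    have := Real.one_le_cosh a
    have : (2 : ℝ) ≤ X := by linarith
    exact_mod_cast this
  have hintg : ∀ u v, IntervalIntegrable (fun x => h x * (2 * a * Real.sinh (a * x))) volume u v := fun u v => by
    apply Continuous.intervalIntegrable; fun_prop
  have e1 : |∑ n ∈ Finset.Ico 2 X, h (Un a n) - ∫ x in (0 : ℝ)..Un a X, h x * (2 * a * Real.sinh (a * x))| ≤ K := by
    rw [← Un_two a, ← intervalIntegral.sum_integral_adjacent_intervals_Ico hX2 (fun k _ => hintg _ _), ← Finset.sum_sub_distrib]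
    refine (Finset.abs_sum_le_sum_abs _ _).trans ?_
    calc _ ≤ ∑ n ∈ Finset.Ico 2 X, K * (min (Un a (n + 1)) 1 - min (Un a n) 1) :=
          Finset.sum_le_sum fun n hn => cell H ha (Finset.mem_Ico.1 hn).1
      _ ≤ K * 1 := by rw [← Finset.mul_sum]; exact mul_le_mul_of_nonneg_left (tele_min ha hX2) hK
      _ = K := mul_one K
  have e2 : ∫ x in (0 : ℝ)..Un a X, h x * (2 * a * Real.sinh (a * x)) = ∫ x in (0 : ℝ)..1, h x * (2 * a * Real.sinh (a * x)) := by
    rw [← intervalIntegral.integral_add_adjacent_intervals (hintg 0 1) (hintg 1 _)]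
    have : ∫ x in (1 : ℝ)..Un a X, h x * (2 * a * Real.sinh (a * x)) = 0 := by
      apply intervalIntegral.integral_zero_ae
      refine Eventually.of_forall fun x hx => ?_
      rw [Set.uIoc_of_le (Un_ge_one ha hX)] at hx
      rw [H.zero x hx.1.le, zero_mul]
    rw [this, add_zero]
  have e3 : ∫ x in (0 : ℝ)..1, h x * (2 * a * Real.sinh (a * x)) = a * (∫ x in (0 : ℝ)..1, h x * Real.exp (a * x)) -
      a * ∫ x in (0 : ℝ)..1, h x * Real.exp (-(a * x)) := by
    rw [← intervalIntegral.integral_const_mul, ← intervalIntegral.integral_const_mul, ← intervalIntegral.integral_sub]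
    · congr 1; ext x; rw [Real.sinh_eq]; ring
    · apply Continuous.intervalIntegrable; fun_prop
    · apply Continuous.intervalIntegrable; fun_prop
  have e4 : 0 ≤ ∫ x in (0 : ℝ)..1, h x * Real.exp (-(a * x)) := by
    apply intervalIntegral.integral_nonneg (by norm_num)
    intro x _
    exact mul_nonneg (H.nonneg x) (Real.exp_pos _).le
  have e5 : ∫ x in (0 : ℝ)..1, h x * Real.exp (-(a * x)) ≤ M := by
    calc _ ≤ ∫ x in (0 : ℝ)..1, M := by
          apply intervalIntegral.integral_mono_on (by norm_num)
          · apply Continuous.intervalIntegrable; fun_prop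
          · simp
          · intro x hx
            calc h x * Real.exp (-(a * x)) ≤ M * 1 := by
                  apply mul_le_mul (H.le x) _ (Real.exp_pos _).le hM
                  rw [Real.exp_le_one_iff]
                  have := mul_nonneg ha.le hx.1
                  linarith
              _ = M := mul_one M
      _ = M := by simp
  have hX3 : 3 ≤ X := by
    have := Real.one_lt_cosh.2 ha.ne'
    have : (2 : ℝ) < X := by linarith
    exact_mod_cast this
  have e6 : ∑ n ∈ Finset.Ico 2 X, h (Un a n) = h 0 + ∑ n ∈ Finset.range X, Gw h a n := by
    rw [Finset.sum_eq_sum_Ico_succ_bot (by omega), Un_two, Finset.range_eq_Ico, ← Finset.sum_Ico_consecutive _ (Nat.zero_le 3) hX3]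
    have : ∑ n ∈ Finset.Ico 0 3, Gw h a n = 0 := by
      apply Finset.sum_eq_zero
      intro n hn
      rw [Finset.mem_Ico] at hn
      rw [Gw, if_neg (by omega)]
    rw [this, zero_add]
    congr 1
    apply Finset.sum_congr rfl
    intro n hn
    rw [Finset.mem_Ico] at hn
    rw [Gw, if_pos (by omega)]
  rw [e6, e2, e3] at e1
  have h0 := H.nonneg 0
  have h0' := H.le 0
  have e7 := mul_nonneg ha.le e4
  have e8 := mul_le_mul_of_nonneg_left e5 ha.le
  rw [abs_le] at e1 ⊢
  constructor <;> linarith [e1.1, e1.2]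

end P7a

section P7b

lemma window_bdd {g : ℝ → ℝ} (hg_supp : HasCompactSupport g) : BddAbove {r : ℝ | ∃ ξ : ℝ, g ξ ≠ 0 ∧ |ξ| = r} := by
  obtain ⟨R, hR⟩ := (hg_supp.isCompact.isBounded).exists_norm_le
  refine ⟨R, ?_⟩
  rintro r ⟨ξ, hξ, rfl⟩
  exact hR ξ (subset_tsupport g hξ)

lemma window_zero {g : ℝ → ℝ} (hc : Continuous g) (hg_supp : HasCompactSupport g)
    (hg_sup : sSup {r : ℝ | ∃ ξ : ℝ, g ξ ≠ 0 ∧ |ξ| = r} = 1) (u : ℝ) (hu : 1 ≤ u) : g u = 0 := by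
  have h1 : ∀ u, 1 < u → g u = 0 := by
    intro u hu
    by_contra hne
    have := le_csSup (window_bdd hg_supp) ⟨u, hne, rfl⟩
    rw [hg_sup, abs_of_pos (by linarith)] at this
    linarith
  rcases hu.lt_or_eq with h | h
  · exact h1 u h
  · subst h
    by_contra hne
    have h2 : ∀ᶠ x in nhds (1 : ℝ), g x ≠ 0 := hc.continuousAt.eventually_ne hne
    obtain ⟨δ, hδ, h3⟩ := Metric.eventually_nhds_iff.1 h2
    have := h3 (y := 1 + δ / 2) (by rw [Real.dist_eq]; rw [add_sub_cancel_left, abs_of_pos (by linarith)]; linarith)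
    exact this (h1 _ (by linarith))

lemma window_ok {g : ℝ → ℝ} (hg_smooth : ContDiff ℝ (⊤ : ℕ∞) g) (hg_supp : HasCompactSupport g)
    (hg_sup : sSup {r : ℝ | ∃ ξ : ℝ, g ξ ≠ 0 ∧ |ξ| = r} = 1) : ∃ M K, HOK (fun u => g u ^ 2) M K := by
  have hc := hg_smooth.continuous
  have hs : HasCompactSupport (fun u => g u ^ 2) := hg_supp.comp_left (g := fun x : ℝ => x ^ 2) (by simp)
  have hcd : ContDiff ℝ (⊤ : ℕ∞) (fun u => g u ^ 2) := hg_smooth.pow 2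
  obtain ⟨K, hK⟩ := ContDiff.lipschitzWith_of_hasCompactSupport hs hcd (by simp)
  obtain ⟨M, hM⟩ := hs.exists_bound_of_continuous hcd.continuous
  refine ⟨M, K, hcd.continuous, fun u => sq_nonneg _, fun u => (le_abs_self _).trans (hM u), ?_, ?_⟩
  · intro u v
    have := hK.dist_le_mul u v
    rwa [Real.dist_eq, Real.dist_eq] at this
  · intro u hu
    show g u ^ 2 = 0
    rw [window_zero hc hg_supp hg_sup u hu]; norm_num

lemma window_lower {g : ℝ → ℝ} (hc : Continuous g) (hg_even : ∀ ξ, g (-ξ) = g ξ) (hg_supp : HasCompactSupport g) (hg_zero : g 0 = 1)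
    (hg_sup : sSup {r : ℝ | ∃ ξ : ℝ, g ξ ≠ 0 ∧ |ξ| = r} = 1) :
    ∃ c > 0, ∀ a > 0, c * Real.exp (0.999 * a) ≤ ∫ x in (0 : ℝ)..1, g x ^ 2 * Real.exp (a * x) := by
  obtain ⟨r, ⟨ξ, hξ, rfl⟩, hr⟩ := exists_lt_of_lt_csSup (s := {r : ℝ | ∃ ξ : ℝ, g ξ ≠ 0 ∧ |ξ| = r}) (b := 0.999)
    ⟨_, 0, by rw [hg_zero]; norm_num, rfl⟩ (by rw [hg_sup]; norm_num)
  have hne : g |ξ| ≠ 0 := by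
    rcases abs_choice ξ with h | h
    · rwa [h]
    · rwa [h, hg_even]
  have hlt : |ξ| < 1 := by
    by_contra h
    exact hne (window_zero hc hg_supp hg_sup _ (not_lt.1 h))
  generalize |ξ| = s at *
  have hs2 : 0 < g s ^ 2 := by positivity
  have hev : ∀ᶠ x in nhds s, g s ^ 2 / 2 < g x ^ 2 :=
    (hc.pow 2).continuousAt.eventually (lt_mem_nhds (by simp only [Pi.pow_apply]; linarith))
  obtain ⟨δ, hδ, h3⟩ := Metric.eventually_nhds_iff.1 hev
  set e := min (δ / 2) (1 - s) with he
  have he0 : 0 < e := lt_min (by linarith) (by linarith)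
  have he1 : e ≤ δ / 2 := min_le_left _ _
  have he2 : e ≤ 1 - s := min_le_right _ _
  have hs0 : 0 < s := by norm_num at hr; linarith
  refine ⟨e * (g s ^ 2 / 2), by positivity, ?_⟩
  intro a ha
  have hI : ∀ u v, IntervalIntegrable (fun x => g x ^ 2 * Real.exp (a * x)) volume u v := fun u v => by
    apply Continuous.intervalIntegrable; fun_prop
  have hnn : ∀ x, 0 ≤ g x ^ 2 * Real.exp (a * x) := fun x => by positivity
  calc _ = ∫ x in s..(s + e), g s ^ 2 / 2 * Real.exp (0.999 * a) := by
        rw [intervalIntegral.integral_const, smul_eq_mul]; ring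
    _ ≤ ∫ x in s..(s + e), g x ^ 2 * Real.exp (a * x) := by
        apply intervalIntegral.integral_mono_on (by linarith) (by simp) (hI _ _)
        intro x hx
        have := h3 (y := x) (by rw [Real.dist_eq, abs_of_nonneg (by linarith [hx.1])]; linarith [hx.2])
        have h5 : 0.999 * a ≤ a * x := by
          rw [mul_comm]; exact mul_le_mul_of_nonneg_left (by linarith [hx.1]) ha.le
        gcongr
    _ ≤ ∫ x in (0 : ℝ)..1, g x ^ 2 * Real.exp (a * x) := by
        apply intervalIntegral.integral_mono_interval hs0.le (by linarith) (by linarith)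
        · exact Eventually.of_forall hnn
        · exact hI _ _

lemma window_Ioi {g : ℝ → ℝ} (hc : Continuous g) (hg_supp : HasCompactSupport g)
    (hg_sup : sSup {r : ℝ | ∃ ξ : ℝ, g ξ ≠ 0 ∧ |ξ| = r} = 1) (a : ℝ) :
    ∫ u in Set.Ioi (0 : ℝ), g u ^ 2 * Real.exp (a * u) = ∫ x in (0 : ℝ)..1, g x ^ 2 * Real.exp (a * x) := by
  rw [intervalIntegral.integral_of_le zero_le_one]
  apply setIntegral_eq_of_subset_of_forall_sdiff_eq_zero measurableSet_Ioi Set.Ioc_subset_Ioi_self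
  intro x hx
  have : 1 ≤ x := by
    by_contra h
    exact hx.2 ⟨hx.1, (not_le.1 h).le⟩
  rw [window_zero hc hg_supp hg_sup x this]; simp

lemma log_Nnorm {n : ℕ} (a : ℝ) : Real.log (Nnorm n) / (2 * a) = Un a n := by
  have e : Real.sqrt (((n : ℝ) / 2) ^ 2 - 1) = Real.sqrt ((n : ℝ) ^ 2 - 4) / 2 := by
    rw [show ((n : ℝ) / 2) ^ 2 - 1 = ((n : ℝ) ^ 2 - 4) / 2 ^ 2 by ring, Real.sqrt_div' _ (by norm_num), Real.sqrt_sq (by norm_num)]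
  rw [Nnorm, Real.log_pow, Un, Real.arcosh, e, ← add_div]
  push_cast
  rw [mul_div_mul_left _ _ (by norm_num)]

/-- choice of the scale -/
lemma choose_t : ∃ D : ℝ, 0 < D ∧ ∀ a > 0, ∃ t : ℕ, Real.exp (a / 2000) ≤ t ∧ 2 * Real.cosh a ≤ ((t ^ 2000 : ℕ) : ℝ) ∧
    (t : ℝ) ^ 1994 ≤ D * Real.exp (0.997 * a) := by
  refine ⟨4 ^ 1994, by positivity, ?_⟩
  intro a ha
  have h1 : 1 ≤ Real.exp (a / 2000) := Real.one_le_exp (by positivity)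
  refine ⟨⌈2 * Real.exp (a / 2000)⌉₊, ?_, ?_, ?_⟩
  · have := Nat.le_ceil (2 * Real.exp (a / 2000))
    linarith
  · have h2 := Nat.le_ceil (2 * Real.exp (a / 2000))
    have h3 : (2 * Real.exp (a / 2000)) ^ 2000 ≤ (⌈2 * Real.exp (a / 2000)⌉₊ : ℝ) ^ 2000 :=
      pow_le_pow_left₀ (by positivity) h2 _
    rw [mul_pow, ← Real.exp_nat_mul] at h3
    have h4 : Real.exp ((2000 : ℕ) * (a / 2000)) = Real.exp a := by
      congr 1; push_cast; ring
    rw [h4] at h3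
    have h5 : Real.cosh a ≤ Real.exp a := by
      rw [Real.cosh_eq]
      have : Real.exp (-a) ≤ Real.exp a := Real.exp_le_exp.2 (by linarith)
      linarith
    have h6 : (2 : ℝ) ≤ 2 ^ 2000 := by
      calc (2 : ℝ) = 2 ^ 1 := by norm_num
        _ ≤ 2 ^ 2000 := pow_le_pow_right₀ (by norm_num) (by norm_num)
    rw [Nat.cast_pow]
    refine le_trans ?_ h3
    exact mul_le_mul h6 h5 (Real.cosh_pos a).le (by positivity)
  · have h2 := (Nat.ceil_lt_add_one (show 0 ≤ 2 * Real.exp (a / 2000) by positivity)).le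
    have h3 : (⌈2 * Real.exp (a / 2000)⌉₊ : ℝ) ≤ 4 * Real.exp (a / 2000) := by linarith
    have h4 : (⌈2 * Real.exp (a / 2000)⌉₊ : ℝ) ^ 1994 ≤ (4 * Real.exp (a / 2000)) ^ 1994 :=
      pow_le_pow_left₀ (by positivity) h3 _
    rw [mul_pow, ← Real.exp_nat_mul] at h4
    have h5 : Real.exp ((1994 : ℕ) * (a / 2000)) = Real.exp (0.997 * a) := by
      congr 1; push_cast; ring
    rwa [h5] at h4

lemma err_tend (c p q r : ℝ) (hc : 0 < c) : Tendsto (fun a : ℝ => (p * Real.exp (0.997 * a) + q + a * r) / (a * (c * Real.exp (0.999 * a)))) atTop (nhds 0) := by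
  have h1 : Tendsto (fun a : ℝ => Real.exp (-(0.002 * a))) atTop (nhds 0) := by
    apply Real.tendsto_exp_neg_atTop_nhds_zero.comp
    exact tendsto_id.const_mul_atTop (by norm_num)
  have h2 : Tendsto (fun a : ℝ => Real.exp (-(0.999 * a))) atTop (nhds 0) := by
    apply Real.tendsto_exp_neg_atTop_nhds_zero.comp
    exact tendsto_id.const_mul_atTop (by norm_num)
  have h3 : Tendsto (fun a : ℝ => a⁻¹) atTop (nhds 0) := tendsto_inv_atTop_zero
  have h4 := (((h1.mul h3).const_mul (p / c)).add ((h2.mul h3).const_mul (q / c))).add (h2.const_mul (r / c))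
  simp only [mul_zero, add_zero] at h4
  refine h4.congr' ?_
  filter_upwards [eventually_gt_atTop 0] with a ha
  have e1 : Real.exp (0.997 * a) = Real.exp (0.999 * a) * Real.exp (-(0.002 * a)) := by
    rw [← Real.exp_add]; congr 1; ring
  rw [e1, Real.exp_neg (0.999 * a)]
  have := (Real.exp_pos (0.999 * a)).ne'
  have := hc.ne'
  generalize Real.exp (0.999 * a) = E at *
  generalize Real.exp (-(0.002 * a)) = F at *
  field_simp

end P7b

/-- **Asymptotics of the diagonal sum**: as `L → ∞`,
`(2/(πL)²)·Σ_{n>2} A(n)²·g(log N(n)/(2πL))² ∼ σ_L² = (2κ/(πL))·∫₀^∞ g(u)²·e^{πLu} du`. -/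
theorem diagonal_sum_asymptotics
    (g : ℝ → ℝ) (hg_smooth : ContDiff ℝ (⊤ : ℕ∞) g) (hg_even : ∀ ξ, g (-ξ) = g ξ)
    (hg_supp : HasCompactSupport g) (hg_zero : g 0 = 1)
    (hg_sup : sSup {r : ℝ | ∃ ξ : ℝ, g ξ ≠ 0 ∧ |ξ| = r} = 1) :
    Tendsto (fun L : ℝ =>
        ((2 / (Real.pi * L) ^ 2) * ∑' n : ℕ, if 2 < n then
            ampA n ^ 2 * g (Real.log (Nnorm n) / (2 * Real.pi * L)) ^ 2 else 0)
          / sigmaSq g L)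
      atTop (nhds 1) := by
  have hc := hg_smooth.continuous
  obtain ⟨M, K, H⟩ := window_ok hg_smooth hg_supp hg_sup
  obtain ⟨c, hc0, hlow⟩ := window_lower hc hg_even hg_supp hg_zero hg_sup
  obtain ⟨hk, hw⟩ := weighted_main
  obtain ⟨D, hD, hch⟩ := choose_t
  have hpi : Tendsto (fun L : ℝ => Real.pi * L) atTop atTop := tendsto_id.const_mul_atTop Real.pi_pos
  rw [Metric.tendsto_nhds]
  intro η hη
  obtain ⟨C', hC', t0, ht0⟩ := hw (kappa * η / 2) (by positivity)
  have ev1 : ∀ᶠ a : ℝ in atTop, (C' * D * (M + K) * Real.exp (0.997 * a) + (kappa * η / 2 + kappa) * (K + M) + a * ((kappa * η / 2 + kappa) * M)) /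
      (a * (c * Real.exp (0.999 * a))) < kappa * η / 2 :=
    (err_tend c _ _ _ hc0).eventually (gt_mem_nhds (by positivity))
  have ev2 : ∀ᶠ a : ℝ in atTop, (t0 : ℝ) ≤ Real.exp (a / 2000) :=
    (Real.tendsto_exp_atTop.comp (tendsto_id.atTop_div_const (by norm_num))).eventually (eventually_ge_atTop _)
  filter_upwards [hpi.eventually ev1, hpi.eventually ev2, eventually_gt_atTop 0] with L h1 h2 hL
  rw [sigmaSq, window_Ioi hc hg_supp hg_sup]
  simp_rw [mul_assoc 2 Real.pi L, log_Nnorm]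
  have ha : 0 < Real.pi * L := mul_pos Real.pi_pos hL
  generalize Real.pi * L = a at *
  obtain ⟨t, ht1, ht2, ht3⟩ := hch a ha
  have htt : t0 ≤ t := by exact_mod_cast h2.trans ht1
  have wok := wt_ok H ha ht2
  have hsum := wt_sum H ha ht2
  have hmain := ht0 t htt _ _ wok
  have hV := wok.V_nonneg
  have hlow' := hlow a ha
  have hts : (∑' n : ℕ, if 2 < n then ampA n ^ 2 * g (Un a n) ^ 2 else 0) =
      ∑ n ∈ Finset.range (t ^ 2000), ampA n ^ 2 * Gw (fun u => g u ^ 2) a n := by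
    have e : ∀ n, (if 2 < n then ampA n ^ 2 * g (Un a n) ^ 2 else 0) = ampA n ^ 2 * Gw (fun u => g u ^ 2) a n := by
      intro n
      rw [Gw]; split_ifs <;> simp
    simp_rw [e]
    apply tsum_eq_sum
    intro n hn
    rw [Finset.mem_range, not_lt] at hn
    rw [wok.high n hn, mul_zero]
  rw [hts]
  generalize (∑ n ∈ Finset.range (t ^ 2000), ampA n ^ 2 * Gw (fun u => g u ^ 2) a n) = S at *
  generalize (∑ n ∈ Finset.range (t ^ 2000), Gw (fun u => g u ^ 2) a n) = SG at *
  have hE := Real.exp_pos (0.999 * a)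
  have hI : 0 < ∫ x in (0 : ℝ)..1, g x ^ 2 * Real.exp (a * x) := lt_of_lt_of_le (by positivity) hlow'
  generalize (∫ x in (0 : ℝ)..1, g x ^ 2 * Real.exp (a * x)) = I at *
  generalize (t : ℝ) ^ 1994 = T at *
  generalize Real.exp (0.997 * a) = F at *
  generalize Real.exp (0.999 * a) = E at *
  rw [div_lt_iff₀ (by positivity)] at h1
  have h3 : kappa * η / 2 * (a * (c * E)) ≤ kappa * η / 2 * (a * I) := by gcongr
  have h4 : C' * T * (M + K) ≤ C' * (D * F) * (M + K) := by gcongr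
  have e1 : 2 / a ^ 2 * S / (2 * kappa / a * I) - 1 = (S - kappa * (a * I)) / (kappa * (a * I)) := by
    field_simp
  rw [Real.dist_eq, e1, abs_div, abs_of_pos (a := kappa * (a * I)) (by positivity), div_lt_iff₀ (by positivity)]
  have h5 : |S - kappa * (a * I)| ≤ |S - kappa * SG| + kappa * |SG - a * I| := by
    calc _ = |(S - kappa * SG) + kappa * (SG - a * I)| := by congr 1; ring
      _ ≤ _ := abs_add_le _ _
      _ = _ := by rw [abs_mul, abs_of_pos hk]
  have h6 : kappa * |SG - a * I| ≤ kappa * (K + M + a * M) := mul_le_mul_of_nonneg_left hsum hk.le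
  have h7 : kappa * η / 2 * SG ≤ kappa * η / 2 * (a * I + (K + M + a * M)) := by
    apply mul_le_mul_of_nonneg_left _ (by positivity)
    linarith [(abs_le.1 hsum).2]
  linarith
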